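/- Let K be a totally real number field of degree d. For every totally real number field K, there exist constants C > 0 and N such that for all integers n ≥ N, log U_K(n) ≤ (d/4)·n²·log n + n²·(2·log Δ_K − 2d·log(2π) − 3d)/8 + C·n·log n. -/

import Mathlib

open scoped TensorProduct

noncomputable section

open NumberField

structure OKLattice (K : Type) [Field K] : Type 1 where
  carrier : Type
  [addCommGroup : AddCommGroup carrier]
  [module : Module (𝓞 K) carrier]
  [finite : Module.Finite (𝓞 K) carrier]
  [torsionFree : NoZeroSMulDivisors (𝓞 K) carrier]
  form : carrier →ₗ[𝓞 K] carrier →ₗ[𝓞 K] 𝓞 K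
  symm : ∀ x y, form x y = form y x
  posDef : ∀ v : carrier, v ≠ 0 → ∀ σ : K →+* ℝ, 0 < σ (algebraMap (𝓞 K) K (form v v))

attribute [instance] OKLattice.addCommGroup OKLattice.module OKLattice.finite
  OKLattice.torsionFree

namespace OKLattice

variable {K : Type} [Field K]

/-- The rank of an `O_K`-lattice: the `K`-dimension of `L ⊗ K`. -/
def rank (L : OKLattice K) : ℕ :=
  Module.finrank K (K ⊗[𝓞 K] L.carrier)

/-- `L.Represents L'` : `L'` is represented by `L`. -/
def Represents (L L' : OKLattice K) : Prop :=
  ∃ σ : L'.carrier →ₗ[𝓞 K] L.carrier, ∀ x, L.form (σ x) (σ x) = L'.form x x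

/-- `L` is `n`-universal. -/
def IsUniversal (L : OKLattice K) (n : ℕ) : Prop :=
  ∀ L' : OKLattice K, L'.rank = n → L.Represents L'

end OKLattice

/-- `U_K(n)`: the minimal rank of an `n`-universal `O_K`-lattice. -/
def minUnivRank (K : Type) [Field K] (n : ℕ) : ℕ :=
  sInf {m | ∃ L : OKLattice K, L.IsUniversal n ∧ L.rank = m}

/-- `K` is totally real: every embedding into `ℂ` has image contained in `ℝ`. -/
def TotallyReal (K : Type) [Field K] : Prop :=
  ∀ φ : K →+* ℂ, ∀ x : K, (φ x).im = 0

namespace ThetaBound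

open scoped ENNReal
open MeasureTheory

set_option linter.unusedSectionVars false

section Pairing

variable {E : Type*} [AddCommGroup E] (Λ : AddSubgroup E)

/-- The subgroup `2Λ` of `Λ`. -/
def dbl : AddSubgroup Λ := (nsmulAddMonoidHom (α := Λ) 2).range

/-- The sum of `h` over a translate of a coset of `2Λ`. -/
noncomputable def cosetSum (h : E → ℝ≥0∞) (c : Λ ⧸ dbl Λ) (y : E) : ℝ≥0∞ :=
  ∑' u : dbl Λ, h (((Quotient.out c + (u : Λ) : Λ) : E) + y)

theorem tsum_coset (f : Λ → ℝ≥0∞) :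
    ∑' s : Λ, f s = ∑' c : Λ ⧸ dbl Λ, ∑' u : dbl Λ, f (Quotient.out c + (u : Λ)) := by
  have hbij : Function.Bijective
      (fun p : (Λ ⧸ dbl Λ) × dbl Λ => Quotient.out p.1 + (p.2 : Λ)) := by
    constructor
    · rintro ⟨c, u⟩ ⟨c', u'⟩ h
      have hc : c = c' := by
        have := congrArg (QuotientAddGroup.mk (s := dbl Λ)) h
        simpa using this
      subst hc
      simpa using h
    · intro s
      refine ⟨⟨QuotientAddGroup.mk s, ⟨-Quotient.out (QuotientAddGroup.mk s : Λ ⧸ dbl Λ) + s,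
          ?_⟩⟩, ?_⟩
      · rw [← QuotientAddGroup.eq]; simp
      · simp
  rw [← ENNReal.tsum_prod (f := fun (c : Λ ⧸ dbl Λ) (u : dbl Λ) => f (Quotient.out c + (u : Λ)))]
  exact ((Equiv.ofBijective _ hbij).tsum_eq f).symm

theorem tsum_mul_tsum_eq_cosetSum (h g : E → ℝ≥0∞)
    (hg : ∀ a b : E, g a * g b = h (a + b) * h (a - b))
    (h2 : ∀ x : Λ, 2 • x = 0 → x = 0) (y z : E) :
    (∑' v : Λ, g (v + y)) * (∑' v : Λ, g (v + z)) =
      ∑' c : Λ ⧸ dbl Λ, cosetSum Λ h c (y + z) * cosetSum Λ h c (y - z) := by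
  have hinj : Function.Injective (nsmulAddMonoidHom (α := Λ) 2) := by
    rw [injective_iff_map_eq_zero]
    intro x hx
    exact h2 x hx
  let e : Λ ≃ dbl Λ := (AddMonoidHom.ofInjective hinj).toEquiv
  have he : ∀ w : Λ, ((e w : Λ) : E) = w + w := fun w => by
    have : (e w : Λ) = 2 • w := rfl
    rw [this, two_nsmul]; rfl
  have key : ∀ c : Λ ⧸ dbl Λ, cosetSum Λ h c (y + z) * cosetSum Λ h c (y - z) =
      ∑' u : dbl Λ, ∑' w : Λ, h (((Quotient.out c + (u : Λ) : Λ) : E) + (y + z)) *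
        h (((Quotient.out c + (u : Λ) : Λ) : E) - (w + w) + (y - z)) := by
    intro c
    rw [cosetSum, ← ENNReal.tsum_mul_right]
    refine tsum_congr fun u => ?_
    rw [ENNReal.tsum_mul_left]
    congr 1
    rw [cosetSum, ← (e.trans (Equiv.subLeft u)).tsum_eq]
    refine tsum_congr fun w => ?_
    congr 1
    simp only [Equiv.trans_apply, Equiv.subLeft_apply, AddSubgroup.coe_add, AddSubgroup.coe_sub, he]
    abel
  simp_rw [key]
  rw [← tsum_coset Λ (fun s => ∑' w : Λ, h ((s : E) + (y + z)) * h ((s : E) - (w + w) + (y - z))),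
    ENNReal.tsum_comm, ← ENNReal.tsum_mul_left]
  refine tsum_congr fun w => ?_
  rw [← ENNReal.tsum_mul_right]
  refine Eq.trans (tsum_congr fun v => ?_) ((Equiv.addRight w).tsum_eq _)
  rw [hg]
  congr 2
  · simp only [Equiv.coe_addRight, AddSubgroup.coe_add]; abel
  · simp only [Equiv.coe_addRight, AddSubgroup.coe_add]; abel

theorem two_mul_le_sq_add_sq (a b : ℝ≥0∞) : 2 * (a * b) ≤ a * a + b * b := by
  rcases eq_or_ne a ∞ with rfl | ha
  · simp
  rcases eq_or_ne b ∞ with rfl | hb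
  · simp
  lift a to NNReal using ha
  lift b to NNReal using hb
  norm_cast
  rw [← NNReal.coe_le_coe]
  push_cast
  nlinarith [sq_nonneg ((a : ℝ) - b)]

theorem two_mul_sq_le (h g : E → ℝ≥0∞)
    (hg : ∀ a b : E, g a * g b = h (a + b) * h (a - b))
    (h2 : ∀ x : Λ, 2 • x = 0 → x = 0) (x : E) :
    2 * ((∑' v : Λ, g (v + x)) * (∑' v : Λ, g (v + x))) ≤
      (∑' v : Λ, g (v + (x + x))) * (∑' v : Λ, g (v + 0)) +
        (∑' v : Λ, g (v + 0)) * (∑' v : Λ, g (v + 0)) := by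
  simp only [tsum_mul_tsum_eq_cosetSum Λ h g hg h2]
  rw [← ENNReal.tsum_mul_left, ← ENNReal.tsum_add]
  refine ENNReal.tsum_le_tsum fun c => ?_
  simpa using two_mul_le_sq_add_sq (cosetSum Λ h c (x + x)) (cosetSum Λ h c 0)

theorem tsum_translate_le (h g : E → ℝ≥0∞)
    (hg : ∀ a b : E, g a * g b = h (a + b) * h (a - b))
    (h2 : ∀ x : Λ, 2 • x = 0 → x = 0)
    (C : ℝ≥0∞) (hC : C ≠ ∞) (hbd : ∀ x, ∑' v : Λ, g (v + x) ≤ C) (x : E) :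
    ∑' v : Λ, g (v + x) ≤ ∑' v : Λ, g (v + 0) := by
  set F : E → ℝ≥0∞ := fun x => ∑' v : Λ, g (v + x) with hF
  have hfin : ∀ x, F x ≠ ∞ := fun x => ne_top_of_le_ne_top hC (hbd x)
  have hstep : ∀ x, 2 * ((F x).toReal * (F x).toReal) ≤
      (F (x + x)).toReal * (F 0).toReal + (F 0).toReal * (F 0).toReal := by
    intro x
    have := two_mul_sq_le Λ h g hg h2 x
    have h3 := (ENNReal.toReal_le_toReal (by finiteness [hfin x]) (by
      finiteness [hfin x, hfin 0, hfin (x+x)])).2 this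
    rwa [ENNReal.toReal_add (by finiteness [hfin (x+x), hfin 0]) (by finiteness [hfin 0]),
      ENNReal.toReal_mul, ENNReal.toReal_mul, ENNReal.toReal_mul, ENNReal.toReal_mul] at h3
  have hb : BddAbove (Set.range fun x => (F x).toReal) := by
    refine ⟨C.toReal, ?_⟩
    rintro _ ⟨x, rfl⟩
    exact ENNReal.toReal_mono hC (hbd x)
  set M := ⨆ x, (F x).toReal with hM
  have hle : ∀ x, (F x).toReal ≤ M := fun x => le_ciSup hb x
  have h0 : 0 ≤ (F 0).toReal := ENNReal.toReal_nonneg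
  have hM0 : 0 ≤ M := h0.trans (hle 0)
  have hsq : ∀ x, (F x).toReal ≤
      Real.sqrt ((M * (F 0).toReal + (F 0).toReal * (F 0).toReal) / 2) := by
    intro x
    apply Real.le_sqrt_of_sq_le
    nlinarith [hstep x, mul_le_mul_of_nonneg_right (hle (x + x)) h0]
  have hM2 : M ≤ Real.sqrt ((M * (F 0).toReal + (F 0).toReal * (F 0).toReal) / 2) := ciSup_le hsq
  have hM3 : M ^ 2 ≤ (M * (F 0).toReal + (F 0).toReal * (F 0).toReal) / 2 := by
    have := pow_le_pow_left₀ hM0 hM2 2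
    rwa [Real.sq_sqrt (by positivity)] at this
  have hM4 : M ≤ (F 0).toReal := by
    by_contra! hlt
    nlinarith
  exact (ENNReal.toReal_le_toReal (hfin x) (hfin 0)).1 ((hle x).trans hM4)

end Pairing

section Gaussian

variable {E : Type*} [NormedAddCommGroup E] [InnerProductSpace ℝ E] [FiniteDimensional ℝ E]
  [MeasurableSpace E] [BorelSpace E] (Λ : Submodule ℤ E) [DiscreteTopology Λ] [IsZLattice ℝ Λ]

theorem summable_gaussian (a : ℝ) (ha : 0 < a) :
    Summable fun v : Λ => Real.exp (-a * ‖(v : E)‖ ^ 2) := by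
  set n := Module.finrank ℤ Λ + 1
  have h1 := ZLattice.summable_norm_rpow Λ (-(2 * n : ℝ)) (by simp [n]; linarith)
  have hnn : Summable fun v : Λ => (n.factorial / a ^ n : ℝ) * ‖v‖ ^ (-(2 * n : ℝ)) :=
    h1.mul_left _
  rw [← (Set.finite_singleton (0 : Λ)).summable_compl_iff] at hnn ⊢
  refine hnn.of_nonneg_of_le (fun v => (Real.exp_pos _).le) ?_
  rintro ⟨v, hv⟩
  have hv0 : v ≠ 0 := by simpa using hv
  have hpos : 0 < ‖(v : E)‖ := by simpa using hv0
  have hx : (0 : ℝ) < a * ‖(v : E)‖ ^ 2 := by positivity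
  have h2 := Real.pow_div_factorial_le_exp (a * ‖(v : E)‖ ^ 2) hx.le n
  simp only [Function.comp]
  rw [neg_mul, Real.exp_neg]
  have h4 : ‖v‖ ^ (-(2 * n : ℝ)) = ((‖(v : E)‖ ^ 2) ^ n)⁻¹ := by
    rw [Real.rpow_neg (norm_nonneg _), ← pow_mul]
    norm_cast
  rw [h4]
  rw [inv_le_comm₀ (Real.exp_pos _) (by positivity)]
  refine le_trans (le_of_eq ?_) h2
  rw [mul_pow]
  field_simp

theorem exists_bound_gaussian (a : ℝ) (ha : 0 < a) :
    ∃ C : ℝ≥0∞, C ≠ ∞ ∧ ∀ x : E,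
      ∑' v : Λ, ENNReal.ofReal (Real.exp (-a * ‖(v : E) + x‖ ^ 2)) ≤ C := by
  let b := (Module.Free.chooseBasis ℤ Λ).ofZLatticeBasis ℝ Λ
  obtain ⟨R, hR⟩ := (ZSpan.fundamentalDomain_isBounded b).exists_norm_le
  have hs := summable_gaussian Λ (a / 2) (by positivity)
  refine ⟨ENNReal.ofReal (Real.exp (a * R ^ 2)) *
    ∑' v : Λ, ENNReal.ofReal (Real.exp (-(a / 2) * ‖(v : E)‖ ^ 2)), ?_, ?_⟩
  · rw [← ENNReal.ofReal_tsum_of_nonneg (fun _ => (Real.exp_pos _).le) hs]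
    finiteness
  intro x
  have hxm := ZSpan.fract_mem_fundamentalDomain b x
  set r := ZSpan.fract b x with hr
  have hfl : (ZSpan.floor b x : E) ∈ Λ := by
    have := (ZSpan.floor b x).2
    exact ((Module.Free.chooseBasis ℤ Λ).ofZLatticeBasis_span ℝ (L := Λ)).le this
  rw [← ENNReal.tsum_mul_left, ← (Equiv.subRight (⟨_, hfl⟩ : Λ)).tsum_eq]
  refine ENNReal.tsum_le_tsum fun v => ?_
  rw [← ENNReal.ofReal_mul (Real.exp_pos _).le, ← Real.exp_add]
  refine ENNReal.ofReal_le_ofReal (Real.exp_le_exp.2 ?_)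
  have hvx : (((Equiv.subRight (⟨_, hfl⟩ : Λ)) v : Λ) : E) + x = v + r := by
    have h0 : (((Equiv.subRight (⟨_, hfl⟩ : Λ)) v : Λ) : E) = v - (ZSpan.floor b x : E) := rfl
    rw [h0, hr, ZSpan.fract_apply]
    abel
  rw [hvx]
  have h1 : ‖r‖ ≤ R := hR _ hxm
  have h2 : ‖(v : E)‖ ≤ ‖(v : E) + r‖ + ‖r‖ := by
    simpa using norm_sub_le ((v : E) + r) r
  have h3 : ‖(v : E)‖ ^ 2 ≤ 2 * ‖(v : E) + r‖ ^ 2 + 2 * R ^ 2 := by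
    have : ‖(v : E)‖ ^ 2 ≤ (‖(v : E) + r‖ + R) ^ 2 := by
      gcongr; linarith
    nlinarith [sq_nonneg (‖(v : E) + r‖ - R)]
  nlinarith

theorem gaussian_tsum_translate_le (a : ℝ) (ha : 0 < a) (x : E) :
    ∑' v : Λ, ENNReal.ofReal (Real.exp (-a * ‖(v : E) + x‖ ^ 2)) ≤
      ∑' v : Λ, ENNReal.ofReal (Real.exp (-a * ‖(v : E)‖ ^ 2)) := by
  obtain ⟨C, hC, hb⟩ := exists_bound_gaussian Λ a ha
  have := tsum_translate_le Λ.toAddSubgroup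
    (fun x => ENNReal.ofReal (Real.exp (-(a / 2) * ‖x‖ ^ 2)))
    (fun x => ENNReal.ofReal (Real.exp (-a * ‖x‖ ^ 2))) ?_ ?_ C hC hb x
  · simp only [add_zero] at this
    exact this
  · intro v w
    rw [← ENNReal.ofReal_mul (Real.exp_pos _).le, ← Real.exp_add,
      ← ENNReal.ofReal_mul (Real.exp_pos _).le, ← Real.exp_add]
    congr 2
    have := parallelogram_law_with_norm ℝ v w
    nlinarith
  · intro y hy
    have h1 : (2 : ℝ) • (y : E) = 0 := by
      rw [two_smul, ← two_nsmul]; exact congrArg Subtype.val hy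
    have : (y : E) = 0 := by simpa using h1
    exact Subtype.ext this

/-- Lower bound for the theta series of a lattice by its covolume. -/
theorem theta_lower_bound (t : ℝ) (ht : 0 < t) :
    ENNReal.ofReal (t ^ (-(Module.finrank ℝ E : ℝ) / 2) / ZLattice.covolume Λ) ≤
      ∑' v : Λ, ENNReal.ofReal (Real.exp (-(Real.pi * t) * ‖(v : E)‖ ^ 2)) := by
  have hpt : 0 < Real.pi * t := by positivity
  let b := Module.Free.chooseBasis ℤ Λ
  have hfd := ZLattice.isAddFundamentalDomain b (volume : Measure E)
  set D := ZSpan.fundamentalDomain (b.ofZLatticeBasis ℝ Λ) with hD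
  have hcov := ZLattice.covolume_eq_measure_fundamentalDomain Λ volume hfd
  have hDfin : volume D < ∞ :=
    Bornology.IsBounded.measure_lt_top (ZSpan.fundamentalDomain_isBounded _)
  have hint := GaussianFourier.integral_rexp_neg_mul_sq_norm (V := E) hpt
  have hl : ∫⁻ x : E, ENNReal.ofReal (Real.exp (-(Real.pi * t) * ‖x‖ ^ 2)) =
      ENNReal.ofReal (t ^ (-(Module.finrank ℝ E : ℝ) / 2)) := by
    rw [← ofReal_integral_eq_lintegral_ofReal]
    · rw [hint]
      congr 1
      rw [neg_div, Real.rpow_neg ht.le, ← Real.inv_rpow ht.le]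
      congr 1
      field_simp
    · by_contra hni
      rw [integral_undef hni] at hint
      have : 0 < (Real.pi / (Real.pi * t)) ^ ((Module.finrank ℝ E : ℝ) / 2) := by positivity
      linarith
    · exact Filter.Eventually.of_forall fun _ => (Real.exp_pos _).le
  have : VAddInvariantMeasure Λ E volume :=
    (inferInstance : VAddInvariantMeasure Λ.toAddSubgroup E volume)
  have : MeasurableVAdd Λ E := (inferInstance : MeasurableVAdd Λ.toAddSubgroup E)
  have hun := hfd.lintegral_eq_tsum'
    (fun x : E => ENNReal.ofReal (Real.exp (-(Real.pi * t) * ‖x‖ ^ 2)))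
  rw [hl] at hun
  set S := ∑' v : Λ, ENNReal.ofReal (Real.exp (-(Real.pi * t) * ‖(v : E)‖ ^ 2))
  have hle : ENNReal.ofReal (t ^ (-(Module.finrank ℝ E : ℝ) / 2)) ≤ S * volume D := by
    rw [hun, ← lintegral_tsum]
    · calc _ ≤ ∫⁻ _ in D, S := by
            refine lintegral_mono fun x => ?_
            refine le_trans (le_of_eq ?_) (gaussian_tsum_translate_le Λ (Real.pi * t) hpt x)
            rw [← (Equiv.neg Λ).tsum_eq]
            refine tsum_congr fun v => ?_
            simp [Submodule.vadd_def]
        _ = S * volume D := by simp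
    · intro v
      fun_prop
  have hDr : volume D = ENNReal.ofReal (ZLattice.covolume Λ) := by
    rw [hcov, ofReal_measureReal hDfin.ne]
  rw [ENNReal.ofReal_div_of_pos (ZLattice.covolume_pos Λ _)]
  refine ENNReal.div_le_of_le_mul ?_
  rw [← hDr]
  exact hle

end Gaussian

end ThetaBound

namespace AutBound

open scoped Matrix

/-- The sum of the `j`-th powers of a character is divisible by the group order. -/
theorem exists_sum_char_pow {G : Type} [Group G] [Fintype G] {V : Type} [AddCommGroup V]
    [Module ℚ V] [FiniteDimensional ℚ V] (ρ : Representation ℚ G V) (j : ℕ) :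
    ∃ m : ℕ, ∑ g : G, ρ.character g ^ j = (Nat.card G : ℚ) * m := by
  have key : ∀ j : ℕ, ∃ (W : Type) (_ : AddCommGroup W) (_ : Module ℚ W)
      (_ : FiniteDimensional ℚ W) (τ : Representation ℚ G W), τ.character = ρ.character ^ j := by
    intro j
    induction j with
    | zero =>
      refine ⟨ℚ, inferInstance, inferInstance, inferInstance, 1, ?_⟩
      ext g
      simp [Representation.character]
    | succ j ih =>
      obtain ⟨W, _, _, _, τ, hτ⟩ := ih
      exact ⟨_, _, _, inferInstance, τ.tprod ρ, by rw [Representation.char_tensor, hτ, pow_succ]⟩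
  obtain ⟨W, _, _, _, τ, hτ⟩ := key j
  have hG : (Nat.card G : ℚ) ≠ 0 := by simp
  have : Invertible (Nat.card G : ℚ) := invertibleOfNonzero hG
  have h := τ.card_inv_mul_sum_char_eq_finrank
  rw [inv_mul_eq_iff_eq_mul₀ hG] at h
  exact ⟨_, by rw [← h, hτ]; simp⟩

variable {ι : Type} [Fintype ι] [DecidableEq ι]

theorem card_le_of_trace {G : Type} [Group G] [Finite G] (φ : G →* Matrix ι ι ℤ)
    (hb : ∀ g, |(φ g).trace| ≤ Fintype.card ι)
    (he : ∀ g, (φ g).trace = Fintype.card ι → g = 1) :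
    Nat.card G ≤ (2 * Fintype.card ι).factorial := by
  have := Fintype.ofFinite G
  set N := Fintype.card ι with hN
  let ρ : Representation ℚ G (ι → ℚ) :=
    ((Matrix.toLinAlgEquiv' (R := ℚ) (n := ι)).toRingEquiv.toMonoidHom.comp
      ((Int.castRingHom ℚ).mapMatrix (m := ι)).toMonoidHom).comp φ
  have hχ : ∀ g, ρ.character g = ((φ g).trace : ℚ) := by
    intro g
    change LinearMap.trace ℚ _ (Matrix.toLin' ((φ g).map (Int.castRingHom ℚ))) = _
    rw [Matrix.trace_toLin'_eq]
    simp [Matrix.trace]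
  have hdiv : ∀ j : ℕ, (Nat.card G : ℤ) ∣ ∑ g, (φ g).trace ^ j := by
    intro j
    obtain ⟨m, hm⟩ := exists_sum_char_pow ρ j
    refine ⟨m, ?_⟩
    simp only [hχ] at hm
    exact_mod_cast hm
  have hpoly : ∀ p : Polynomial ℤ, (Nat.card G : ℤ) ∣ ∑ g, p.eval (φ g).trace := by
    intro p
    simp only [Polynomial.eval_eq_sum_range]
    rw [Finset.sum_comm]
    refine Finset.dvd_sum fun i _ => ?_
    rw [← Finset.mul_sum]
    exact Dvd.dvd.mul_left (hdiv i) _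
  let p : Polynomial ℤ := ∏ j ∈ Finset.range (2 * N), (Polynomial.X - Polynomial.C ((j : ℤ) - N))
  have hp := hpoly p
  have hev : ∀ x : ℤ, p.eval x = ∏ j ∈ Finset.range (2 * N), (x - ((j : ℤ) - N)) := by
    intro x; simp [p, Polynomial.eval_prod]
  rw [Finset.sum_eq_single 1] at hp
  · have h1 : p.eval (φ 1).trace = ((2 * N).factorial : ℤ) := by
      rw [hev, map_one, Matrix.trace_one, ← hN, ← Finset.prod_range_reflect,
        ← Finset.prod_range_add_one_eq_factorial]
      push_cast
      refine Finset.prod_congr rfl fun j hj => ?_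
      have : j < 2 * N := Finset.mem_range.1 hj
      have : ((2 * N - 1 - j : ℕ) : ℤ) = 2 * N - 1 - j := by omega
      rw [this]
      ring
    rw [h1] at hp
    exact Nat.le_of_dvd (Nat.factorial_pos _) (by exact_mod_cast hp)
  · intro g _ hg
    rw [hev]
    have h1 := abs_le.1 (hb g)
    have h2 : (φ g).trace ≠ N := fun h => hg (he g h)
    have h3 : (φ g).trace < N := lt_of_le_of_ne h1.2 h2
    refine Finset.prod_eq_zero (i := ((φ g).trace + N).toNat) (Finset.mem_range.2 ?_) ?_
    · omega
    · have : (((φ g).trace + N).toNat : ℤ) = (φ g).trace + N := Int.toNat_of_nonneg (by omega)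
      rw [this]; ring
  · simp

theorem orthogonal_entry_sq_le {O : Matrix ι ι ℝ} (hO : Oᵀ * O = 1) (i j : ι) : O i j ^ 2 ≤ 1 := by
  have h := congrFun (congrFun hO j) j
  simp only [Matrix.mul_apply, Matrix.transpose_apply, Matrix.one_apply_eq] at h
  rw [← h, sq]
  exact Finset.single_le_sum (f := fun k => O k j * O k j) (fun k _ => mul_self_nonneg _)
    (Finset.mem_univ i)

theorem orthogonal_trace_le {O : Matrix ι ι ℝ} (hO : Oᵀ * O = 1) : |O.trace| ≤ Fintype.card ι := by
  calc |O.trace| ≤ ∑ i, |O i i| := Finset.abs_sum_le_sum_abs _ _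
    _ ≤ ∑ _i : ι, (1 : ℝ) := Finset.sum_le_sum fun i _ => by
        have := orthogonal_entry_sq_le hO i i
        exact (sq_le_one_iff_abs_le_one _).1 this
    _ = Fintype.card ι := by simp

theorem orthogonal_eq_one {O : Matrix ι ι ℝ} (hO : Oᵀ * O = 1) (ht : O.trace = Fintype.card ι) :
    O = 1 := by
  have hle : ∀ i, O i i ≤ 1 := fun i => by
    have := (sq_le_one_iff_abs_le_one _).1 (orthogonal_entry_sq_le hO i i)
    exact (abs_le.1 this).2
  have hd : ∀ i, O i i = 1 := by
    have hs : ∑ i, (1 - O i i) = 0 := by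
      simp only [Finset.sum_sub_distrib, Finset.sum_const, Finset.card_univ, nsmul_eq_mul, mul_one]
      rw [Matrix.trace] at ht
      simp only [Matrix.diag_apply] at ht
      linarith
    intro i
    have := (Finset.sum_eq_zero_iff_of_nonneg (fun i _ => sub_nonneg.2 (hle i))).1 hs i
      (Finset.mem_univ i)
    linarith
  ext i j
  rcases eq_or_ne i j with rfl | hij
  · simp [hd]
  · have h := congrFun (congrFun hO j) j
    simp only [Matrix.mul_apply, Matrix.transpose_apply, Matrix.one_apply_eq] at h
    rw [← Finset.add_sum_erase _ _ (Finset.mem_univ j), hd j] at h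
    have h0 : ∑ k ∈ Finset.univ.erase j, O k j * O k j = 0 := by linarith
    have := (Finset.sum_eq_zero_iff_of_nonneg (fun k _ => mul_self_nonneg (O k j))).1 h0 i
      (by simp [hij])
    rw [Matrix.one_apply_ne hij]
    simpa using this

/-- A group of integral matrices preserving a definite form is finite of explicitly bounded
order. -/
theorem finite_and_card_le {G : Type} [Group G] (φ : G →* Matrix ι ι ℤ)
    (hinj : Function.Injective φ) (R R' : Matrix ι ι ℝ) (hR : R' * R = 1)
    (hO : ∀ g, (R * (φ g).map (Int.cast : ℤ → ℝ) * R')ᵀ *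
      (R * (φ g).map (Int.cast : ℤ → ℝ) * R') = 1) :
    Finite G ∧ Nat.card G ≤ (2 * Fintype.card ι).factorial := by
  have htr : ∀ g, (R * (φ g).map (Int.cast : ℤ → ℝ) * R').trace = ((φ g).trace : ℝ) := by
    intro g
    rw [Matrix.trace_mul_comm, ← mul_assoc, hR, one_mul]
    simp [Matrix.trace]
  have hfin : Finite G := by
    have hB : ∃ C : ℤ, ∀ g i j, |φ g i j| ≤ C := by
      let C : ι → ι → ℝ := fun i j => ∑ k, ∑ l, |R' i k| * |R l j|
      refine ⟨⌈∑ i, ∑ j, C i j⌉, fun g i j => ?_⟩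
      set O := R * (φ g).map (Int.cast : ℤ → ℝ) * R' with hOd
      have hφ : (φ g).map (Int.cast : ℤ → ℝ) = R' * (O * R) := by
        have h1 : R * R' = 1 := mul_eq_one_comm.1 hR
        rw [hOd, mul_assoc, hR, mul_one, ← mul_assoc, hR, one_mul]
      have h2 : ((φ g i j : ℤ) : ℝ) = ∑ k, R' i k * ∑ l, O k l * R l j := by
        have := congrFun (congrFun hφ i) j
        simpa [Matrix.mul_apply] using this
      have h3 : |((φ g i j : ℤ) : ℝ)| ≤ C i j := by
        rw [h2]
        refine (Finset.abs_sum_le_sum_abs _ _).trans (Finset.sum_le_sum fun k _ => ?_)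
        rw [abs_mul, ← Finset.mul_sum]
        refine mul_le_mul_of_nonneg_left ?_ (abs_nonneg _)
        refine (Finset.abs_sum_le_sum_abs _ _).trans (Finset.sum_le_sum fun l _ => ?_)
        rw [abs_mul]
        have := (sq_le_one_iff_abs_le_one _).1 (orthogonal_entry_sq_le (hO g) k l)
        exact mul_le_of_le_one_left (abs_nonneg _) this
      have hC0 : ∀ i j, 0 ≤ C i j := fun i j =>
        Finset.sum_nonneg fun k _ => Finset.sum_nonneg fun l _ => by positivity
      have h4 : C i j ≤ ∑ i, ∑ j, C i j :=
        (Finset.single_le_sum (f := fun j => C i j) (fun j _ => hC0 i j) (Finset.mem_univ j)).trans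
          (Finset.single_le_sum (f := fun i => ∑ j, C i j)
            (fun i _ => Finset.sum_nonneg fun j _ => hC0 i j) (Finset.mem_univ i))
      have h5 := (h3.trans h4).trans (Int.le_ceil _)
      exact_mod_cast h5
    obtain ⟨C, hC⟩ := hB
    have hs : Set.Finite {A : ι → ι → ℤ | ∀ i j, A i j ∈ Set.Icc (-C) C} := by
      have := Set.Finite.pi (fun i : ι => Set.Finite.pi (fun j : ι => Set.finite_Icc (-C) C))
      refine this.subset fun A hA => ?_
      exact fun i _ j _ => hA i j
    have := hs.to_subtype
    refine Finite.of_injective (fun g => (⟨φ g, fun i j => abs_le.1 (hC g i j)⟩ :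
      {A : ι → ι → ℤ | ∀ i j, A i j ∈ Set.Icc (-C) C})) fun a b h => ?_
    exact hinj (Subtype.mk.inj h)
  refine ⟨hfin, card_le_of_trace φ (fun g => ?_) fun g hg => ?_⟩
  · have := orthogonal_trace_le (hO g)
    rw [htr] at this
    exact_mod_cast this
  · have h1 := orthogonal_eq_one (hO g) (by rw [htr, hg]; simp)
    have h2 : (φ g).map (Int.cast : ℤ → ℝ) = 1 := by
      have h0 : R * R' = 1 := mul_eq_one_comm.1 hR
      calc (φ g).map (Int.cast : ℤ → ℝ)
          = R' * (R * (φ g).map (Int.cast : ℤ → ℝ) * R') * R := by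
            rw [mul_assoc R, ← mul_assoc, hR, one_mul, mul_assoc, hR, mul_one]
        _ = 1 := by rw [h1, mul_one, hR]
    apply hinj
    rw [map_one]
    ext i j
    have := congrFun (congrFun h2 i) j
    rw [Matrix.map_apply] at this
    rcases eq_or_ne i j with rfl | hij
    · rw [Matrix.one_apply_eq] at *; exact_mod_cast this
    · rw [Matrix.one_apply_ne hij] at *; exact_mod_cast this

end AutBound

namespace TotReal

open NumberField Module
open scoped nonZeroDivisors

variable (K : Type) [Field K] [NumberField K] [IsTotallyReal K]

/-- Real embeddings of a totally real field are the same as its rational algebra maps to `ℂ`. -/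
noncomputable def embEquiv : (K →+* ℝ) ≃ (K →ₐ[ℚ] ℂ) :=
  Equiv.ofBijective (fun σ => (RingHom.equivRatAlgHom K ℂ) (Complex.ofRealHom.comp σ)) <| by
    constructor
    · intro σ τ h
      ext x
      have := DFunLike.congr_fun h x
      simpa using this
    · intro φ
      have hr : ComplexEmbedding.IsReal (φ : K →+* ℂ) :=
        InfinitePlace.isReal_mk_iff.1 (IsTotallyReal.isReal (InfinitePlace.mk (φ : K →+* ℂ)))
      refine ⟨hr.embedding, ?_⟩
      ext x
      exact hr.coe_embedding_apply x

theorem embEquiv_apply (σ : K →+* ℝ) (x : K) : embEquiv K σ x = (σ x : ℂ) := rfl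

noncomputable instance : Fintype (K →+* ℝ) := Fintype.ofEquiv _ (embEquiv K).symm

theorem card_emb : Fintype.card (K →+* ℝ) = finrank ℚ K := by
  rw [← AlgHom.card ℚ K ℂ]
  exact Fintype.card_congr (embEquiv K)

instance : Nonempty (K →+* ℝ) := by
  rw [← Fintype.card_pos_iff, card_emb]
  exact finrank_pos

theorem prod_emb (x : K) : ∏ σ : K →+* ℝ, σ x = (Algebra.norm ℚ x : ℝ) := by
  have h := Algebra.norm_eq_prod_embeddings ℚ ℂ x
  rw [← (embEquiv K).prod_comp] at h
  simp only [embEquiv_apply] at h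
  have : (((Algebra.norm ℚ x : ℚ) : ℝ) : ℂ) = ((∏ σ : K →+* ℝ, σ x : ℝ) : ℂ) := by
    push_cast
    simpa using h
  exact_mod_cast this.symm

open Classical in
theorem abs_det_int (b : Basis (K →+* ℝ) ℤ (𝓞 K)) :
    |(Matrix.of fun i σ : K →+* ℝ => σ (b i : K)).det| = √|(discr K : ℝ)| := by
  have h := Algebra.discr_eq_det_embeddingsMatrixReindex_pow_two ℚ ℂ
    (fun i => (b i : K)) (embEquiv K)
  have hd : Algebra.discr ℚ (fun i => (b i : K)) = (discr K : ℚ) := by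
    rw [← discr_eq_discr K b]
    have := Algebra.discr_localizationLocalization (R := ℤ) (S := 𝓞 K) (Rₘ := ℚ) (Sₘ := K) ℤ⁰ b
    rw [eq_intCast] at this
    rw [← this]
    congr 1
    ext i
    simp [Basis.localizationLocalization_apply]
  have hm : (Algebra.embeddingsMatrixReindex ℚ ℂ (fun i => (b i : K)) (embEquiv K)) =
      (Matrix.of fun i σ : K →+* ℝ => σ (b i : K)).map Complex.ofRealHom := by
    ext i σ
    simp [Algebra.embeddingsMatrixReindex, Algebra.embeddingsMatrix, embEquiv_apply]
  rw [hd, hm, ← RingHom.mapMatrix_apply, ← RingHom.map_det] at h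
  have h2 : (discr K : ℝ) = (Matrix.of fun i σ : K →+* ℝ => σ (b i : K)).det ^ 2 := by
    have h3 : ((discr K : ℝ) : ℂ) =
        (((Matrix.of fun i σ : K →+* ℝ => σ (b i : K)).det ^ 2 : ℝ) : ℂ) := by
      push_cast
      simpa using h
    exact_mod_cast h3
  rw [h2, abs_sq, Real.sqrt_sq_eq_abs]

theorem exists_basis_int : Nonempty (Basis (K →+* ℝ) ℤ (𝓞 K)) := by
  have e : Free.ChooseBasisIndex ℤ (𝓞 K) ≃ (K →+* ℝ) := Fintype.equivOfCardEq (by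
    rw [card_emb, ← RingOfIntegers.rank K, finrank_eq_card_chooseBasisIndex])
  exact ⟨(RingOfIntegers.basis K).reindex e⟩

open Classical in
theorem abs_det_ideal (I : FractionalIdeal (𝓞 K)⁰ K) (bI : Basis (K →+* ℝ) ℤ I) :
    |(Matrix.of fun i σ : K →+* ℝ => σ (bI i : K)).det| =
      (FractionalIdeal.absNorm I : ℝ) * √|(discr K : ℝ)| := by
  obtain ⟨b⟩ := exists_basis_int K
  rw [← FractionalIdeal.abs_det_basis_change b I bI, ← abs_det_int K b]
  set b₀ := b.localizationLocalization ℚ ℤ⁰ K with hb₀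
  have hmul : (Matrix.of fun i σ : K →+* ℝ => σ (bI i : K)) =
      ((b₀.toMatrix ((↑) ∘ bI)).map (Rat.castHom ℝ)).transpose *
        (Matrix.of fun i σ : K →+* ℝ => σ (b i : K)) := by
    ext i σ
    rw [Matrix.mul_apply]
    have h1 := b₀.sum_repr (bI i : K)
    conv_lhs => rw [Matrix.of_apply, ← h1, map_sum]
    refine Finset.sum_congr rfl fun j _ => ?_
    rw [Algebra.smul_def, map_mul, hb₀, Basis.localizationLocalization_apply]
    simp [Basis.toMatrix_apply]
  rw [hmul, Matrix.det_mul, Matrix.det_transpose, abs_mul, ← RingHom.mapMatrix_apply,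
    ← RingHom.map_det, Basis.det_apply]
  simp

theorem exists_basis_ideal (I : FractionalIdeal (𝓞 K)⁰ K) (hI : I ≠ 0) :
    Nonempty (Basis (K →+* ℝ) ℤ I) := by
  have e : Free.ChooseBasisIndex ℤ I ≃ (K →+* ℝ) := Fintype.equivOfCardEq (by
    have h := fractionalIdeal_rank K (Units.mk0 I hI)
    rw [RingOfIntegers.rank, finrank_eq_card_chooseBasisIndex] at h
    rw [card_emb, ← h]
    rfl)
  exact ⟨(fractionalIdealBasis K I).reindex e⟩

end TotReal

namespace TotReal

open NumberField Module MeasureTheory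
open scoped nonZeroDivisors

set_option linter.unusedSectionVars false

section General

variable {ι : Type} [Fintype ι]

theorem theta_pi (Λ : Submodule ℤ (ι → ℝ)) [DiscreteTopology Λ] [IsZLattice ℝ Λ] (t : ℝ)
    (ht : 0 < t) :
    ENNReal.ofReal (t ^ (-(Fintype.card ι : ℝ) / 2) / ZLattice.covolume Λ) ≤
      ∑' v : Λ, ENNReal.ofReal (Real.exp (-(Real.pi * t) * ∑ i, (v : ι → ℝ) i ^ 2)) := by
  let e : EuclideanSpace ℝ ι ≃L[ℝ] (ι → ℝ) := EuclideanSpace.equiv ι ℝ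
  have hcov := ZLattice.covolume_comap Λ volume (ν := (volume : Measure (EuclideanSpace ℝ ι)))
    (e := e) (PiLp.volume_preserving_ofLp ι)
  have h := ThetaBound.theta_lower_bound (ZLattice.comap ℝ Λ e.toLinearMap) t ht
  rw [hcov, finrank_euclideanSpace] at h
  refine h.trans (le_of_eq ?_)
  let f : (ZLattice.comap ℝ Λ e.toLinearMap) ≃ Λ :=
    { toFun := fun v => ⟨e v, v.2⟩
      invFun := fun v => ⟨e.symm v, by
        change e (e.symm v) ∈ Λ
        simp⟩
      left_inv := fun v => by simp
      right_inv := fun v => by simp }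
  rw [← f.tsum_eq]
  refine tsum_congr fun v => ?_
  rw [EuclideanSpace.norm_sq_eq]
  simp [f, e]

end General

variable {K : Type} [Field K] [NumberField K] [IsTotallyReal K]

/-- The real coordinates of a vector, scaled so that the standard Euclidean form is the trace of
the diagonal form with coefficients `w`. -/
noncomputable def realCoord {k : ℕ} (w : Fin k → K) :
    (Fin k → K) →+ ((K →+* ℝ) × Fin k → ℝ) where
  toFun x p := √(p.1 (w p.2)) * p.1 (x p.2)
  map_zero' := by ext; simp
  map_add' x y := by ext; simp [mul_add]

theorem realCoord_apply {k : ℕ} (w x : Fin k → K) (p : (K →+* ℝ) × Fin k) :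
    realCoord w x p = √(p.1 (w p.2)) * p.1 (x p.2) := rfl

open Classical in
/-- `L` has covolume `c` with respect to the diagonal form with coefficients `w`. -/
def HasCov {k : ℕ} (w : Fin k → K) (L : Submodule (𝓞 K) (Fin k → K)) (c : ℝ) : Prop :=
  0 < c ∧ ∃ b : Basis ((K →+* ℝ) × Fin k) ℤ L,
    |(Matrix.of fun p q => realCoord w (b p : Fin k → K) q).det| = c

theorem realCoord_injective {k : ℕ} {w : Fin k → K} (hw : ∀ i (σ : K →+* ℝ), 0 < σ (w i)) :
    Function.Injective (realCoord w) := by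
  rw [injective_iff_map_eq_zero]
  intro x hx
  ext i
  obtain ⟨σ⟩ := (inferInstance : Nonempty (K →+* ℝ))
  have := congrFun hx (σ, i)
  simp only [realCoord_apply, Pi.zero_apply, mul_eq_zero] at this
  rcases this with h | h
  · exact absurd h (Real.sqrt_ne_zero'.2 (hw i σ))
  · simpa using h

/-- A lattice with a covolume becomes a genuine lattice in the real coordinate space. -/
theorem HasCov.exists_zlattice {k : ℕ} {w : Fin k → K} {L : Submodule (𝓞 K) (Fin k → K)} {c : ℝ}
    (h : HasCov w L c) :
    ∃ (Λ : Submodule ℤ ((K →+* ℝ) × Fin k → ℝ)) (_ : DiscreteTopology Λ) (_ : IsZLattice ℝ Λ),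
      ZLattice.covolume Λ = c ∧ Λ.toAddSubgroup = L.toAddSubgroup.map (realCoord w) := by
  classical
  obtain ⟨hc, b, hb⟩ := h
  set A : Matrix ((K →+* ℝ) × Fin k) ((K →+* ℝ) × Fin k) ℝ :=
    Matrix.of fun p q => realCoord w (b p : Fin k → K) q with hA
  have hdet : IsUnit A := by
    rw [Matrix.isUnit_iff_isUnit_det, isUnit_iff_ne_zero]
    intro h0
    simp only [hA] at h0
    rw [show (Matrix.of fun p q => realCoord w (b p : Fin k → K) q).det = 0 by convert h0] at hb
    simp at hb
    linarith
  have hli := Matrix.linearIndependent_rows_iff_isUnit.2 hdet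
  let b' : Basis ((K →+* ℝ) × Fin k) ℝ ((K →+* ℝ) × Fin k → ℝ) :=
    basisOfLinearIndependentOfCardEqFinrank' A.row hli (by simp)
  have hb' : ∀ p, b' p = realCoord w (b p : Fin k → K) := fun p => by
    simp only [b', coe_basisOfLinearIndependentOfCardEqFinrank']
    rfl
  refine ⟨Submodule.span ℤ (Set.range b'), inferInstance, inferInstance, ?_, ?_⟩
  · rw [ZLattice.covolume_eq_det _ (b'.restrictScalars ℤ), ← hb]
    congr 2
    ext p q
    simp [hb']
    rfl
  · ext y
    rw [Submodule.mem_toAddSubgroup, AddSubgroup.mem_map]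
    constructor
    · intro hy
      induction hy using Submodule.span_induction with
      | mem y hy =>
        obtain ⟨p, rfl⟩ := hy
        exact ⟨b p, (b p).2, (hb' p).symm⟩
      | zero => exact ⟨0, zero_mem _, map_zero _⟩
      | add y z _ _ hy hz =>
        obtain ⟨y', hy', rfl⟩ := hy
        obtain ⟨z', hz', rfl⟩ := hz
        exact ⟨y' + z', add_mem hy' hz', map_add _ _ _⟩
      | smul n y _ hy =>
        obtain ⟨y', hy', rfl⟩ := hy
        exact ⟨n • y', zsmul_mem hy' n, map_zsmul _ _ _⟩
    · rintro ⟨x, hx, rfl⟩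
      have h1 := b.sum_repr ⟨x, hx⟩
      have h2 : x = ∑ p, b.repr ⟨x, hx⟩ p • (b p : Fin k → K) := by
        have := congrArg Subtype.val h1
        simp only [AddSubmonoidClass.coe_finsetSum] at this
        exact this.symm
      rw [h2, map_sum]
      refine Submodule.sum_mem _ fun p _ => ?_
      rw [map_zsmul, ← hb']
      exact Submodule.smul_mem _ _ (Submodule.subset_span ⟨p, rfl⟩)

theorem HasCov.div_eq_relIndex {k : ℕ} {w : Fin k → K} (hw : ∀ i (σ : K →+* ℝ), 0 < σ (w i))
    {L₁ L₂ : Submodule (𝓞 K) (Fin k → K)} {c₁ c₂ : ℝ} (h₁ : HasCov w L₁ c₁) (h₂ : HasCov w L₂ c₂)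
    (hle : L₁ ≤ L₂) : c₁ / c₂ = L₁.toAddSubgroup.relIndex L₂.toAddSubgroup := by
  obtain ⟨Λ₁, _, _, hc₁, hΛ₁⟩ := h₁.exists_zlattice
  obtain ⟨Λ₂, _, _, hc₂, hΛ₂⟩ := h₂.exists_zlattice
  have hl : Λ₁ ≤ Λ₂ := by
    rw [← Submodule.toAddSubgroup_le, hΛ₁, hΛ₂]
    exact AddSubgroup.map_mono hle
  have := ZLattice.covolume_div_covolume_eq_relIndex Λ₁ Λ₂ hl
  rw [hc₁, hc₂, hΛ₁, hΛ₂,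
    AddSubgroup.relIndex_map_map_of_injective _ _ (realCoord_injective hw)] at this
  exact this

theorem HasCov.unique {k : ℕ} {w : Fin k → K} (hw : ∀ i (σ : K →+* ℝ), 0 < σ (w i))
    {L : Submodule (𝓞 K) (Fin k → K)} {c₁ c₂ : ℝ} (h₁ : HasCov w L c₁) (h₂ : HasCov w L c₂) :
    c₁ = c₂ := by
  have := h₁.div_eq_relIndex hw h₂ le_rfl
  rw [AddSubgroup.relIndex_self, Nat.cast_one, div_eq_one_iff_eq h₂.1.ne'] at this
  exact this

theorem sum_realCoord_sq {k : ℕ} {w : Fin k → K} (hw : ∀ i (σ : K →+* ℝ), 0 < σ (w i))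
    (x : Fin k → K) :
    ∑ p, realCoord w x p ^ 2 = ∑ σ : K →+* ℝ, σ (∑ i, w i * x i * x i) := by
  rw [Fintype.sum_prod_type]
  refine Finset.sum_congr rfl fun σ _ => ?_
  rw [map_sum]
  refine Finset.sum_congr rfl fun i _ => ?_
  rw [realCoord_apply, mul_pow, Real.sq_sqrt (hw i σ).le, map_mul, map_mul]
  ring

theorem HasCov.theta {k : ℕ} {w : Fin k → K} (hw : ∀ i (σ : K →+* ℝ), 0 < σ (w i))
    {L : Submodule (𝓞 K) (Fin k → K)} {c : ℝ} (h : HasCov w L c) (t : ℝ) (ht : 0 < t) :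
    ENNReal.ofReal (t ^ (-((finrank ℚ K : ℝ) * k) / 2) / c) ≤
      ∑' x : L, ENNReal.ofReal (Real.exp (-(Real.pi * t) *
        ∑ σ : K →+* ℝ, σ (∑ i, w i * (x : Fin k → K) i * (x : Fin k → K) i))) := by
  obtain ⟨Λ, _, _, hc, hΛ⟩ := h.exists_zlattice
  have := theta_pi Λ t ht
  rw [hc, Fintype.card_prod, card_emb, Fintype.card_fin, Nat.cast_mul] at this
  refine this.trans (le_of_eq ?_)
  have hbij : Function.Bijective (fun x : L => (⟨realCoord w x, by
      rw [← Submodule.mem_toAddSubgroup, hΛ]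
      exact ⟨x, x.2, rfl⟩⟩ : Λ)) := by
    constructor
    · intro x y hxy
      exact Subtype.ext (realCoord_injective hw (Subtype.mk.inj hxy))
    · rintro ⟨y, hy⟩
      rw [← Submodule.mem_toAddSubgroup, hΛ] at hy
      obtain ⟨x, hx, rfl⟩ := hy
      exact ⟨⟨x, hx⟩, rfl⟩
  rw [← (Equiv.ofBijective _ hbij).tsum_eq]
  refine tsum_congr fun x => ?_
  rw [← sum_realCoord_sq hw]
  rfl

/-- Separate the first coordinate. -/
def splitIndex (S : Type) (k : ℕ) : S ⊕ S × Fin k ≃ S × Fin (k + 1) where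
  toFun := Sum.elim (fun s => (s, 0)) (fun p => (p.1, p.2.succ))
  invFun p := Fin.cases (Sum.inl p.1) (fun i => Sum.inr (p.1, i)) p.2
  left_inv := by rintro (s | p) <;> simp
  right_inv := by
    rintro ⟨s, i⟩
    refine Fin.cases ?_ (fun i => ?_) i <;> simp

/-- The covolume of a lattice with a block triangular structure. -/
theorem HasCov.block {k : ℕ} {w : Fin (k + 1) → K} (hw : ∀ i (σ : K →+* ℝ), 0 < σ (w i))
    {L : Submodule (𝓞 K) (Fin (k + 1) → K)} {I : FractionalIdeal (𝓞 K)⁰ K} (hI : I ≠ 0)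
    {M : Submodule (𝓞 K) (Fin k → K)} {c : ℝ} (hM : HasCov (Fin.tail w) M c)
    (Φ : (I × M) ≃ₗ[ℤ] L)
    (h₁ : ∀ a : I, (Φ (a, 0) : Fin (k + 1) → K) 0 = a)
    (h₂ : ∀ m : M, Fin.tail (Φ (0, m) : Fin (k + 1) → K) = m)
    (h₃ : (∀ m : M, (Φ (0, m) : Fin (k + 1) → K) 0 = 0) ∨
      (∀ a : I, Fin.tail (Φ (a, 0) : Fin (k + 1) → K) = 0)) :
    HasCov w L (√(Algebra.norm ℚ (w 0) : ℝ) * (FractionalIdeal.absNorm I : ℝ) *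
      √|(discr K : ℝ)| * c) := by
  classical
  obtain ⟨hc, bM, hbM⟩ := hM
  obtain ⟨bI⟩ := exists_basis_ideal K I hI
  have hN : 0 < (Algebra.norm ℚ (w 0) : ℝ) := by
    rw [← prod_emb]; exact Finset.prod_pos fun σ _ => hw 0 σ
  have hIpos : (0 : ℝ) < FractionalIdeal.absNorm I := by
    have h0 : FractionalIdeal.absNorm I ≠ 0 := by rwa [ne_eq, FractionalIdeal.absNorm_eq_zero_iff]
    have := FractionalIdeal.absNorm_nonneg I
    exact_mod_cast lt_of_le_of_ne this h0.symm
  have hD : 0 < √|(discr K : ℝ)| := by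
    have := discr_ne_zero K
    positivity
  refine ⟨by positivity, ((bI.prod bM).map Φ).reindex (splitIndex _ k), ?_⟩
  set b := ((bI.prod bM).map Φ).reindex (splitIndex (K →+* ℝ) k) with hb
  have hbl : ∀ s, b (s, 0) = Φ (bI s, 0) := by
    intro s
    have : (s, (0 : Fin (k + 1))) = splitIndex (K →+* ℝ) k (Sum.inl s) := rfl
    rw [hb, this, Basis.reindex_apply, Equiv.symm_apply_apply]
    simp
  have hbr : ∀ p : (K →+* ℝ) × Fin k, b (p.1, p.2.succ) = Φ (0, bM p) := by
    intro p
    have : (p.1, p.2.succ) = splitIndex (K →+* ℝ) k (Sum.inr p) := rfl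
    rw [hb, this, Basis.reindex_apply, Equiv.symm_apply_apply]
    simp
  set A : Matrix ((K →+* ℝ) × Fin (k + 1)) ((K →+* ℝ) × Fin (k + 1)) ℝ :=
    Matrix.of fun p q => realCoord w (b p : Fin (k + 1) → K) q with hA
  rw [← Matrix.det_submatrix_equiv_self (splitIndex (K →+* ℝ) k) A,
    ← Matrix.fromBlocks_toBlocks (A.submatrix (splitIndex (K →+* ℝ) k) (splitIndex (K →+* ℝ) k))]
  set A' := A.submatrix (splitIndex (K →+* ℝ) k) (splitIndex (K →+* ℝ) k)
  have hX : |A'.toBlocks₁₁.det| = √(Algebra.norm ℚ (w 0) : ℝ) *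
      (FractionalIdeal.absNorm I : ℝ) * √|(discr K : ℝ)| := by
    have : A'.toBlocks₁₁ = Matrix.of fun i σ : K →+* ℝ =>
        √(σ (w 0)) * (Matrix.of fun i σ : K →+* ℝ => σ (bI i : K)) i σ := by
      ext i σ
      change realCoord w (b (i, 0) : Fin (k + 1) → K) (σ, 0) = _
      rw [realCoord_apply, hbl, h₁]
      rfl
    rw [this, Matrix.det_mul_row, abs_mul, abs_det_ideal, ← prod_emb, ← Real.sqrt_prod]
    · rw [abs_of_nonneg (by positivity)]
      ring
    · exact fun σ _ => (hw 0 σ).le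
  have hY : |A'.toBlocks₂₂.det| = c := by
    rw [← hbM]
    congr 2
    ext p q
    change realCoord w (b (p.1, p.2.succ) : Fin (k + 1) → K) (q.1, q.2.succ) = _
    rw [Matrix.of_apply, realCoord_apply, realCoord_apply, hbr, ← h₂ (bM p)]
    rfl
  rcases h₃ with h₃ | h₃
  · have : A'.toBlocks₂₁ = 0 := by
      ext p σ
      change realCoord w (b (p.1, p.2.succ) : Fin (k + 1) → K) (σ, 0) = _
      rw [realCoord_apply, hbr, h₃]
      simp
    rw [this, Matrix.det_fromBlocks_zero₂₁, abs_mul, hX, hY]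
  · have : A'.toBlocks₁₂ = 0 := by
      ext σ q
      change realCoord w (b (σ, 0) : Fin (k + 1) → K) (q.1, q.2.succ) = _
      have h0 := congrFun (h₃ (bI σ)) q.2
      rw [Fin.tail] at h0
      rw [realCoord_apply, hbl, h0]
      simp
    rw [this, Matrix.det_fromBlocks_zero₁₂, abs_mul, hX, hY]

end TotReal

namespace TotReal

open NumberField Module MeasureTheory
open scoped nonZeroDivisors

set_option linter.unusedSectionVars false

section Abstract

variable {K : Type} [Field K] [NumberField K]
variable {V' : Type} [AddCommGroup V'] [Module K V'] [Module (𝓞 K) V'] [IsScalarTower (𝓞 K) K V']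
variable {V : Type} [AddCommGroup V] [Module K V] [Module (𝓞 K) V] [IsScalarTower (𝓞 K) K V]

/-- A bilinear form is symmetric and totally positive definite. -/
def TotPos (B : V →ₗ[K] V →ₗ[K] K) : Prop :=
  (∀ x y, B x y = B y x) ∧ ∀ x, x ≠ 0 → ∀ σ : K →+* ℝ, 0 < σ (B x x)

/-- Finitely generated submodules of full rank. -/
def IsLat (L : Submodule (𝓞 K) V) : Prop :=
  L.FG ∧ ∀ v : V, ∃ a : 𝓞 K, a ≠ 0 ∧ a • v ∈ L

/-- The dual of a lattice. -/
def dualLat (B : V →ₗ[K] V →ₗ[K] K) (L : Submodule (𝓞 K) V) : Submodule (𝓞 K) V where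
  carrier := {x | ∀ y ∈ L, IsIntegral ℤ (B x y)}
  zero_mem' y _ := by simpa using isIntegral_zero
  add_mem' hx hx' y hy := by
    rw [map_add, LinearMap.add_apply]
    exact (hx y hy).add (hx' y hy)
  smul_mem' a x hx y hy := by
    rw [← algebraMap_smul K a x, map_smul, LinearMap.smul_apply, smul_eq_mul]
    exact (RingOfIntegers.isIntegral_coe a).mul (hx y hy)

theorem mem_dualLat {B : V →ₗ[K] V →ₗ[K] K} {L : Submodule (𝓞 K) V} {x : V} :
    x ∈ dualLat B L ↔ ∀ y ∈ L, IsIntegral ℤ (B x y) := Iff.rfl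

/-- The index of a lattice in its dual. -/
noncomputable def disc (B : V →ₗ[K] V →ₗ[K] K) (L : Submodule (𝓞 K) V) : ℕ :=
  L.toAddSubgroup.relIndex (dualLat B L).toAddSubgroup

theorem dualLat_map {B : V →ₗ[K] V →ₗ[K] K} {B' : V' →ₗ[K] V' →ₗ[K] K} (f : V ≃ₗ[K] V')
    (hf : ∀ x y, B' (f x) (f y) = B x y) (L : Submodule (𝓞 K) V) :
    dualLat B' (L.map (f.toLinearMap.restrictScalars (𝓞 K))) =
      (dualLat B L).map (f.toLinearMap.restrictScalars (𝓞 K)) := by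
  ext x
  obtain ⟨x, rfl⟩ := f.surjective x
  simp only [Submodule.mem_map, mem_dualLat]
  constructor
  · intro h
    refine ⟨x, fun y hy => ?_, rfl⟩
    rw [← hf]
    exact h _ ⟨y, hy, rfl⟩
  · rintro ⟨y, hy, hxy⟩ z ⟨z, hz, rfl⟩
    have : y = x := f.injective hxy
    subst this
    have := hy z hz
    rw [← hf] at this
    exact this

theorem disc_map {B : V →ₗ[K] V →ₗ[K] K} {B' : V' →ₗ[K] V' →ₗ[K] K} (f : V ≃ₗ[K] V')
    (hf : ∀ x y, B' (f x) (f y) = B x y) (L : Submodule (𝓞 K) V) :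
    disc B' (L.map (f.toLinearMap.restrictScalars (𝓞 K))) = disc B L := by
  have h : ∀ M : Submodule (𝓞 K) V, (M.map (f.toLinearMap.restrictScalars (𝓞 K))).toAddSubgroup =
      M.toAddSubgroup.map f.toAddEquiv.toAddMonoidHom := fun M => rfl
  rw [disc, dualLat_map f hf, disc, h, h]
  exact AddSubgroup.relIndex_map_map_of_injective _ _ f.injective

theorem IsLat.map {L : Submodule (𝓞 K) V} (h : IsLat L) (f : V ≃ₗ[K] V') :
    IsLat (L.map (f.toLinearMap.restrictScalars (𝓞 K))) := by
  refine ⟨h.1.map _, fun v => ?_⟩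
  obtain ⟨a, ha, hv⟩ := h.2 (f.symm v)
  refine ⟨a, ha, a • f.symm v, hv, ?_⟩
  rw [map_smul]
  simp

theorem integral_iff {x : K} : IsIntegral ℤ x ↔ ∃ a : 𝓞 K, (a : K) = x :=
  ⟨fun h => ⟨⟨x, h⟩, rfl⟩, fun ⟨a, ha⟩ => ha ▸ RingOfIntegers.isIntegral_coe a⟩

end Abstract

section Diag

variable {K : Type} [Field K]

/-- The diagonal form with coefficients `w`. -/
def diagB {k : ℕ} (w : Fin k → K) : (Fin k → K) →ₗ[K] (Fin k → K) →ₗ[K] K :=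
  LinearMap.mk₂ K (fun x y => ∑ i, w i * x i * y i)
    (fun x x' y => by simp [mul_add, add_mul, Finset.sum_add_distrib])
    (fun a x y => by simp [Finset.mul_sum]; exact Finset.sum_congr rfl fun _ _ => by ring)
    (fun x y y' => by simp [mul_add, Finset.sum_add_distrib])
    (fun a x y => by simp [Finset.mul_sum]; exact Finset.sum_congr rfl fun _ _ => by ring)

theorem diagB_apply {k : ℕ} (w x y : Fin k → K) : diagB w x y = ∑ i, w i * x i * y i := rfl

theorem diagB_succ {k : ℕ} (w x y : Fin (k + 1) → K) :
    diagB w x y = w 0 * x 0 * y 0 + diagB (Fin.tail w) (Fin.tail x) (Fin.tail y) := by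
  rw [diagB_apply, Fin.sum_univ_succ, diagB_apply]; rfl

theorem diagB_symm {k : ℕ} (w x y : Fin k → K) : diagB w x y = diagB w y x := by
  simp only [diagB_apply]
  exact Finset.sum_congr rfl fun _ _ => by ring

variable [NumberField K]

/-- The first coordinates of a lattice. -/
def headIdeal {k : ℕ} (L : Submodule (𝓞 K) (Fin (k + 1) → K)) : Submodule (𝓞 K) K :=
  L.map (LinearMap.proj 0)

/-- The sublattice on which the first coordinate vanishes. -/
def tailLat {k : ℕ} (L : Submodule (𝓞 K) (Fin (k + 1) → K)) : Submodule (𝓞 K) (Fin k → K) where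
  carrier := {y | (Fin.cons 0 y : Fin (k + 1) → K) ∈ L}
  zero_mem' := by
    change (Fin.cons 0 (0 : Fin k → K) : Fin (k + 1) → K) ∈ L
    convert L.zero_mem
    ext i; refine Fin.cases ?_ (fun i => ?_) i <;> simp
  add_mem' {x y} hx hy := by
    change (Fin.cons 0 (x + y) : Fin (k + 1) → K) ∈ L
    convert L.add_mem hx hy
    ext i; refine Fin.cases ?_ (fun i => ?_) i <;> simp
  smul_mem' a x hx := by
    change (Fin.cons 0 (a • x) : Fin (k + 1) → K) ∈ L
    convert L.smul_mem a hx
    ext i; refine Fin.cases ?_ (fun i => ?_) i <;> simp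

theorem mem_tailLat {k : ℕ} {L : Submodule (𝓞 K) (Fin (k + 1) → K)} {y : Fin k → K} :
    y ∈ tailLat L ↔ (Fin.cons 0 y : Fin (k + 1) → K) ∈ L := Iff.rfl

theorem IsLat.tail {k : ℕ} {L : Submodule (𝓞 K) (Fin (k + 1) → K)} (h : IsLat L) :
    IsLat (tailLat L) := by
  constructor
  · have : IsNoetherian (𝓞 K) L := isNoetherian_of_fg_of_noetherian L h.1
    let f : tailLat L →ₗ[𝓞 K] L :=
      { toFun := fun y => ⟨Fin.cons 0 y, y.2⟩
        map_add' := fun x y => by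
          ext i; refine Fin.cases ?_ (fun i => ?_) i <;> simp
        map_smul' := fun a y => by
          ext i; refine Fin.cases ?_ (fun i => ?_) i <;> simp }
    have hf : Function.Injective f := fun x y hxy => by
      ext i
      simpa using congrFun (Subtype.mk.inj hxy) i.succ
    have := isNoetherian_of_injective f hf
    exact (Submodule.fg_top _).1 (IsNoetherian.noetherian _)
  · intro v
    obtain ⟨a, ha, hv⟩ := h.2 (Fin.cons 0 v)
    refine ⟨a, ha, ?_⟩
    rw [mem_tailLat]
    convert hv using 1
    ext i; refine Fin.cases ?_ (fun i => ?_) i <;> simp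

/-- The fractional ideal of first coordinates of a lattice. -/
noncomputable def headFrac {k : ℕ} (L : Submodule (𝓞 K) (Fin (k + 1) → K)) (h : IsLat L) :
    FractionalIdeal (𝓞 K)⁰ K :=
  ⟨headIdeal L, FractionalIdeal.isFractional_of_fg (h.1.map _)⟩

theorem mem_headFrac {k : ℕ} {L : Submodule (𝓞 K) (Fin (k + 1) → K)} {h : IsLat L} {a : K} :
    a ∈ headFrac L h ↔ ∃ x ∈ L, x 0 = a := Iff.rfl

theorem headFrac_ne_zero {k : ℕ} {L : Submodule (𝓞 K) (Fin (k + 1) → K)} (h : IsLat L) :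
    headFrac L h ≠ 0 := by
  intro h0
  obtain ⟨a, ha, hv⟩ := h.2 (Fin.cons 1 0)
  have : (a : K) ∈ headFrac L h := mem_headFrac.2 ⟨_, hv, by
    rw [Pi.smul_apply, Fin.cons_zero, Algebra.smul_def, mul_one]⟩
  rw [h0, FractionalIdeal.mem_zero_iff] at this
  exact ha (by simpa using this)

theorem smul_mem' {k : ℕ} {L : Submodule (𝓞 K) (Fin k → K)} {a : K} (ha : IsIntegral ℤ a)
    {x : Fin k → K} (hx : x ∈ L) : a • x ∈ L := by
  obtain ⟨a, rfl⟩ := integral_iff.1 ha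
  exact L.smul_mem a hx

theorem mem_inv_iff' {I : FractionalIdeal (𝓞 K)⁰ K} (hI : I ≠ 0) {x : K} :
    x ∈ I⁻¹ ↔ ∀ y ∈ I, IsIntegral ℤ (x * y) := by
  rw [FractionalIdeal.mem_inv_iff hI]
  refine forall₂_congr fun y _ => ?_
  rw [FractionalIdeal.mem_one_iff, integral_iff]

/-- A lattice splits over the ideal of first coordinates. -/
theorem exists_split {k : ℕ} {L : Submodule (𝓞 K) (Fin (k + 1) → K)} (h : IsLat L) :
    ∃ z : Fin k → K, ∀ x, x ∈ L ↔ x 0 ∈ headFrac L h ∧ Fin.tail x - x 0 • z ∈ tailLat L := by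
  have key : ∀ s ∈ headFrac L h * (headFrac L h)⁻¹,
      ∃ z : Fin k → K, ∀ b ∈ headFrac L h, (Fin.cons (s * b) (b • z) : Fin (k + 1) → K) ∈ L := by
    intro s hs
    refine FractionalIdeal.mul_induction_on hs (fun i hi j hj => ?_) (fun x y hx hy => ?_)
    · obtain ⟨x, hx, rfl⟩ := mem_headFrac.1 hi
      refine ⟨j • Fin.tail x, fun b hb => ?_⟩
      have := smul_mem' ((mem_inv_iff' (headFrac_ne_zero h)).1 hj b hb) hx
      convert this using 1
      ext i; refine Fin.cases ?_ (fun i => ?_) i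
      · simp; ring
      · simp [Fin.tail]; ring
    · obtain ⟨z, hz⟩ := hx
      obtain ⟨z', hz'⟩ := hy
      refine ⟨z + z', fun b hb => ?_⟩
      convert L.add_mem (hz b hb) (hz' b hb) using 1
      ext i; refine Fin.cases ?_ (fun i => ?_) i
      · simp; ring
      · simp
  obtain ⟨z, hz⟩ := key 1 (by
    rw [mul_inv_cancel₀ (headFrac_ne_zero h)]
    exact FractionalIdeal.one_mem_one _)
  refine ⟨z, fun x => ?_⟩
  simp only [one_mul] at hz
  have hx : ∀ x : Fin (k + 1) → K,
      x = Fin.cons (x 0) (x 0 • z) + Fin.cons 0 (Fin.tail x - x 0 • z) := by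
    intro x
    ext i; refine Fin.cases ?_ (fun i => ?_) i
    · simp
    · simp [Fin.tail]
  constructor
  · intro hxL
    have h0 : x 0 ∈ headFrac L h := mem_headFrac.2 ⟨x, hxL, rfl⟩
    refine ⟨h0, ?_⟩
    rw [mem_tailLat]
    have := L.sub_mem hxL (hz _ h0)
    rwa [sub_eq_iff_eq_add'.2 (hx x)] at this
  · rintro ⟨h0, h1⟩
    rw [hx x]
    exact L.add_mem (hz _ h0) h1

theorem mem_dualLat_diag {k : ℕ} {w : Fin (k + 1) → K}
    {L : Submodule (𝓞 K) (Fin (k + 1) → K)} (h : IsLat L) {z : Fin k → K}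
    (hz : ∀ x, x ∈ L ↔ x 0 ∈ headFrac L h ∧ Fin.tail x - x 0 • z ∈ tailLat L)
    {x : Fin (k + 1) → K} :
    x ∈ dualLat (diagB w) L ↔ w 0 * x 0 + diagB (Fin.tail w) z (Fin.tail x) ∈ (headFrac L h)⁻¹ ∧
      Fin.tail x ∈ dualLat (diagB (Fin.tail w)) (tailLat L) := by
  rw [mem_inv_iff' (headFrac_ne_zero h), mem_dualLat, mem_dualLat]
  constructor
  · intro hx
    constructor
    · intro b hb
      have := hx (Fin.cons b (b • z)) ((hz _).2 (by
        rw [Fin.cons_zero, Fin.tail_cons, sub_self]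
        exact ⟨hb, zero_mem _⟩))
      rw [diagB_succ, Fin.cons_zero, Fin.tail_cons, map_smul, smul_eq_mul, diagB_symm] at this
      convert this using 1
      ring
    · intro y hy
      have := hx (Fin.cons 0 y) hy
      rwa [diagB_succ, Fin.cons_zero, Fin.tail_cons, mul_zero, zero_add] at this
  · rintro ⟨h1, h2⟩ y hy
    obtain ⟨h3, h4⟩ := (hz y).1 hy
    have := (h1 _ h3).add (h2 _ h4)
    rw [diagB_succ]
    rw [map_sub, map_smul, smul_eq_mul, diagB_symm _ z] at this
    refine (congrArg (IsIntegral ℤ) (?_ : _ = _)).mpr this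
    ring

theorem exists_split_equiv {k : ℕ} {L : Submodule (𝓞 K) (Fin (k + 1) → K)} (h : IsLat L)
    {z : Fin k → K}
    (hz : ∀ x, x ∈ L ↔ x 0 ∈ headFrac L h ∧ Fin.tail x - x 0 • z ∈ tailLat L) :
    ∃ Φ : (headFrac L h × tailLat L) ≃ₗ[ℤ] L,
      ∀ p, (Φ p : Fin (k + 1) → K) = Fin.cons (p.1 : K) ((p.1 : K) • z + (p.2 : Fin k → K)) := by
  let f : headFrac L h × tailLat L →+ L := AddMonoidHom.mk'
    (fun p => ⟨Fin.cons (p.1 : K) ((p.1 : K) • z + (p.2 : Fin k → K)), (hz _).2 (by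
      rw [Fin.cons_zero, Fin.tail_cons, add_sub_cancel_left]
      exact ⟨p.1.2, p.2.2⟩)⟩) (by
    intro p q
    ext i; refine Fin.cases ?_ (fun i => ?_) i
    · simp
    · simp; ring)
  have hf : ∀ p, (f p : Fin (k + 1) → K) =
      Fin.cons (p.1 : K) ((p.1 : K) • z + (p.2 : Fin k → K)) := fun p => rfl
  have hbij : Function.Bijective f := by
    constructor
    · rw [injective_iff_map_eq_zero]
      intro p hp
      have h1 := congrArg Subtype.val hp
      rw [hf, ZeroMemClass.coe_zero] at h1
      have h2 : (p.1 : K) = 0 := by simpa using congrFun h1 0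
      ext i
      · exact h2
      · simpa [h2] using congrFun h1 i.succ
    · intro x
      refine ⟨(⟨x.1 0, ((hz _).1 x.2).1⟩, ⟨_, ((hz _).1 x.2).2⟩), ?_⟩
      ext i
      rw [hf]
      refine Fin.cases ?_ (fun i => ?_) i
      · simp
      · simp [Fin.tail]
  exact ⟨(AddEquiv.ofBijective f hbij).toIntLinearEquiv, hf⟩

theorem exists_split_dual_equiv {k : ℕ} {w : Fin (k + 1) → K} (hw : w 0 ≠ 0)
    {L : Submodule (𝓞 K) (Fin (k + 1) → K)} (h : IsLat L) {z : Fin k → K}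
    (hz : ∀ x, x ∈ L ↔ x 0 ∈ headFrac L h ∧ Fin.tail x - x 0 • z ∈ tailLat L) :
    ∃ Φ : ((FractionalIdeal.spanSingleton (𝓞 K)⁰ (w 0)⁻¹ * (headFrac L h)⁻¹ :
        FractionalIdeal (𝓞 K)⁰ K) × dualLat (diagB (Fin.tail w)) (tailLat L)) ≃ₗ[ℤ]
        dualLat (diagB w) L,
      ∀ p, (Φ p : Fin (k + 1) → K) =
        Fin.cons ((p.1 : K) - (w 0)⁻¹ * diagB (Fin.tail w) z (p.2 : Fin k → K))
            (p.2 : Fin k → K) := by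
  have hmem : ∀ s : K, s ∈ (FractionalIdeal.spanSingleton (𝓞 K)⁰ (w 0)⁻¹ * (headFrac L h)⁻¹ :
        FractionalIdeal (𝓞 K)⁰ K) ↔ w 0 * s ∈ (headFrac L h)⁻¹ := by
    intro s
    rw [FractionalIdeal.mem_singleton_mul]
    constructor
    · rintro ⟨y, hy, rfl⟩
      rwa [mul_inv_cancel_left₀ hw]
    · intro hs
      exact ⟨_, hs, by rw [inv_mul_cancel_left₀ hw]⟩
  let f : (FractionalIdeal.spanSingleton (𝓞 K)⁰ (w 0)⁻¹ * (headFrac L h)⁻¹ :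
        FractionalIdeal (𝓞 K)⁰ K) × dualLat (diagB (Fin.tail w)) (tailLat L) →+
        dualLat (diagB w) L := AddMonoidHom.mk'
    (fun p => ⟨Fin.cons ((p.1 : K) - (w 0)⁻¹ * diagB (Fin.tail w) z (p.2 : Fin k → K))
      (p.2 : Fin k → K), (mem_dualLat_diag h hz).2 (by
      rw [Fin.cons_zero, Fin.tail_cons, mul_sub, mul_inv_cancel_left₀ hw, sub_add_cancel]
      exact ⟨(hmem _).1 p.1.2, p.2.2⟩)⟩) (by
    intro p q
    ext i; refine Fin.cases ?_ (fun i => ?_) i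
    · simp; ring
    · simp)
  have hf : ∀ p, (f p : Fin (k + 1) → K) = Fin.cons
      ((p.1 : K) - (w 0)⁻¹ * diagB (Fin.tail w) z (p.2 : Fin k → K)) (p.2 : Fin k → K) :=
    fun p => rfl
  have hbij : Function.Bijective f := by
    constructor
    · rw [injective_iff_map_eq_zero]
      intro p hp
      have h1 := congrArg Subtype.val hp
      rw [hf, ZeroMemClass.coe_zero] at h1
      have h2 : (p.2 : Fin k → K) = 0 := by
        ext i
        simpa using congrFun h1 i.succ
      ext i
      · simpa [h2] using congrFun h1 0
      · exact congrFun h2 i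
    · intro x
      refine ⟨(⟨x.1 0 + (w 0)⁻¹ * diagB (Fin.tail w) z (Fin.tail x.1), (hmem _).2 (by
        have := ((mem_dualLat_diag h hz).1 x.2).1
        rwa [mul_add, mul_inv_cancel_left₀ hw])⟩, ⟨_, ((mem_dualLat_diag h hz).1 x.2).2⟩), ?_⟩
      ext i
      rw [hf]
      refine Fin.cases ?_ (fun i => ?_) i
      · simp
      · simp [Fin.tail]
  exact ⟨(AddEquiv.ofBijective f hbij).toIntLinearEquiv, hf⟩

variable [IsTotallyReal K]

theorem exists_hasCov {k : ℕ} {w : Fin k → K} (hw : ∀ i (σ : K →+* ℝ), 0 < σ (w i))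
    {L : Submodule (𝓞 K) (Fin k → K)} (h : IsLat L) :
    ∃ c c', HasCov w L c ∧ HasCov w (dualLat (diagB w) L) c' ∧ c * c' = |(discr K : ℝ)| ^ k := by
  induction k with
  | zero =>
    have : ∀ L : Submodule (𝓞 K) (Fin 0 → K), HasCov w L 1 := by
      intro L
      refine ⟨one_pos, Basis.empty _, ?_⟩
      exact (congrArg abs (by convert Matrix.det_isEmpty; infer_instance)).trans abs_one
    exact ⟨1, 1, this _, this _, by simp⟩
  | succ k ih =>
    obtain ⟨c, c', hc, hc', hcc⟩ := ih (w := Fin.tail w) (fun i => hw i.succ) h.tail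
    have hw0 : w 0 ≠ 0 := fun h0 => by
      obtain ⟨σ⟩ := (inferInstance : Nonempty (K →+* ℝ))
      have := hw 0 σ
      simp [h0] at this
    obtain ⟨z, hz⟩ := exists_split h
    obtain ⟨Φ, hΦ⟩ := exists_split_equiv h hz
    obtain ⟨Ψ, hΨ⟩ := exists_split_dual_equiv hw0 h hz
    have hI := headFrac_ne_zero h
    have hJ : (FractionalIdeal.spanSingleton (𝓞 K)⁰ (w 0)⁻¹ * (headFrac L h)⁻¹ :
        FractionalIdeal (𝓞 K)⁰ K) ≠ 0 := by
      refine mul_ne_zero ?_ (inv_ne_zero hI)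
      rw [FractionalIdeal.spanSingleton_ne_zero_iff]
      exact inv_ne_zero hw0
    refine ⟨_, _, HasCov.block hw hI hc Φ (fun a => by rw [hΦ]; rfl)
      (fun m => by rw [hΦ, Fin.tail_cons]; simp) (Or.inl fun m => by rw [hΦ]; simp),
      HasCov.block hw hJ hc' Ψ (fun a => by rw [hΨ]; simp)
      (fun m => by rw [hΨ, Fin.tail_cons]) (Or.inr fun a => by rw [hΨ, Fin.tail_cons]; simp), ?_⟩
    have hN : 0 < (Algebra.norm ℚ (w 0) : ℝ) := by
      rw [← prod_emb]; exact Finset.prod_pos fun σ _ => hw 0 σ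
    have hA : (FractionalIdeal.absNorm (headFrac L h) : ℝ) ≠ 0 := by
      have := (FractionalIdeal.absNorm_eq_zero_iff (I := headFrac L h)).not.2 hI
      exact_mod_cast this
    rw [map_mul, map_inv₀, FractionalIdeal.absNorm_span_singleton, Algebra.norm_inv, pow_succ, ←
        hcc]
    have habs : (((|(Algebra.norm ℚ (w 0))⁻¹| : ℚ)) : ℝ) = (Algebra.norm ℚ (w 0) : ℝ)⁻¹ := by
      push_cast
      rw [abs_of_pos (by positivity)]
    push_cast at habs ⊢
    rw [habs]
    have h1 := Real.mul_self_sqrt hN.le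
    have h2 := Real.mul_self_sqrt (abs_nonneg (discr K : ℝ))
    calc _ = (√(Algebra.norm ℚ (w 0) : ℝ) * √(Algebra.norm ℚ (w 0) : ℝ)) *
          (Algebra.norm ℚ (w 0) : ℝ)⁻¹ * (√|(discr K : ℝ)| * √|(discr K : ℝ)|) *
          ((FractionalIdeal.absNorm (headFrac L h) : ℝ) *
            (FractionalIdeal.absNorm (headFrac L h) : ℝ)⁻¹) * (c * c') := by ring
      _ = _ := by
        rw [h1, h2, mul_inv_cancel₀ hA, mul_inv_cancel₀ hN.ne']
        ring

end Diag

end TotReal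

namespace TotReal

open NumberField Module MeasureTheory
open scoped nonZeroDivisors

set_option linter.unusedSectionVars false

section Disc

variable {K : Type} [Field K] [NumberField K] [IsTotallyReal K]

theorem hasCov_sq {k : ℕ} {w : Fin k → K} (hw : ∀ i (σ : K →+* ℝ), 0 < σ (w i))
    {L : Submodule (𝓞 K) (Fin k → K)} (hL : IsLat L) (hi : L ≤ dualLat (diagB w) L) {c : ℝ}
    (h : HasCov w L c) : c ^ 2 = disc (diagB w) L * |(discr K : ℝ)| ^ k := by
  obtain ⟨c₁, c', h₁, h', hcc⟩ := exists_hasCov hw hL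
  obtain rfl := h.unique hw h₁
  have := h₁.div_eq_relIndex hw h' hi
  rw [disc, ← this, ← hcc]
  have := h'.1.ne'
  field_simp

theorem disc_pos_diag {k : ℕ} {w : Fin k → K} (hw : ∀ i (σ : K →+* ℝ), 0 < σ (w i))
    {L : Submodule (𝓞 K) (Fin k → K)} (hL : IsLat L) (hi : L ≤ dualLat (diagB w) L) :
    0 < disc (diagB w) L := by
  obtain ⟨c, -, h, -⟩ := exists_hasCov hw hL
  have h1 := hasCov_sq hw hL hi h
  refine Nat.pos_of_ne_zero fun h0 => ?_
  rw [h0, Nat.cast_zero, zero_mul] at h1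
  exact h.1.ne' (pow_eq_zero_iff two_ne_zero |>.1 h1)

theorem tail_integral {k : ℕ} {w : Fin (k + 1) → K} {L : Submodule (𝓞 K) (Fin (k + 1) → K)}
    (hi : L ≤ dualLat (diagB w) L) :
    tailLat L ≤ dualLat (diagB (Fin.tail w)) (tailLat L) := by
  intro x hx y hy
  have := hi hx _ hy
  rwa [diagB_succ, Fin.cons_zero, Fin.tail_cons, Fin.tail_cons, mul_zero, zero_mul,
    zero_add] at this

theorem disc_succ {k : ℕ} {w : Fin (k + 1) → K} (hw : ∀ i (σ : K →+* ℝ), 0 < σ (w i))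
    {L : Submodule (𝓞 K) (Fin (k + 1) → K)} (hL : IsLat L) (hi : L ≤ dualLat (diagB w) L) :
    (disc (diagB w) L : ℝ) = disc (diagB (Fin.tail w)) (tailLat L) *
      ((Algebra.norm ℚ (w 0) : ℝ) * (FractionalIdeal.absNorm (headFrac L hL) : ℝ) ^ 2) := by
  obtain ⟨c, -, h, -⟩ := exists_hasCov (w := Fin.tail w) (fun i => hw i.succ) hL.tail
  obtain ⟨z, hz⟩ := exists_split hL
  obtain ⟨Φ, hΦ⟩ := exists_split_equiv hL hz
  have h' := HasCov.block hw (headFrac_ne_zero hL) h Φ (fun a => by rw [hΦ]; rfl)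
      (fun m => by rw [hΦ, Fin.tail_cons]; simp) (Or.inl fun m => by rw [hΦ]; simp)
  have h1 := hasCov_sq (fun i => hw i.succ) hL.tail (tail_integral hi) h
  have h2 := hasCov_sq hw hL hi h'
  have hN : 0 < (Algebra.norm ℚ (w 0) : ℝ) := by
    rw [← prod_emb]; exact Finset.prod_pos fun σ _ => hw 0 σ
  have hΔ : 0 < |(discr K : ℝ)| := by
    have := discr_ne_zero K
    positivity
  rw [mul_pow, mul_pow, mul_pow, Real.sq_sqrt hN.le, Real.sq_sqrt hΔ.le] at h2
  have h3 : c ^ 2 = disc (diagB (Fin.tail w)) (tailLat L) * |(discr K : ℝ)| ^ k := h1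
  rw [h3] at h2
  have := pow_pos hΔ k
  have hne : |(discr K : ℝ)| ^ k * |(discr K : ℝ)| ≠ 0 := by positivity
  refine mul_right_cancel₀ hne ?_
  linear_combination -h2

variable (K) in
/-- The scaling parameter used for lattices of rank `k` and discriminant `D`. -/
noncomputable def tpar (k D : ℕ) : ℝ :=
  ((4 : ℝ) ^ (-(1 : ℝ) / k) * (D : ℝ) ^ ((1 : ℝ) / (k + 1)) / |(discr K : ℝ)|) ^
    ((1 : ℝ) / finrank ℚ K)

theorem abs_discr_pos : 0 < |(discr K : ℝ)| := by
  have := discr_ne_zero K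
  positivity

theorem tpar_pos {k D : ℕ} (hD : 0 < D) : 0 < tpar K k D := by
  have := abs_discr_pos (K := K)
  unfold tpar
  positivity

theorem tpar_rpow {k D : ℕ} (hk : 0 < k) (hD : 0 < D) :
    tpar K k D ^ (-((finrank ℚ K : ℝ) * k) / 2) =
      2 * (D : ℝ) ^ (-(k : ℝ) / (2 * (k + 1))) * √(|(discr K : ℝ)| ^ k) := by
  have h1 := abs_discr_pos (K := K)
  have hd : (0 : ℝ) < finrank ℚ K := by exact_mod_cast finrank_pos
  have hk' : (0 : ℝ) < k := by exact_mod_cast hk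
  have hD' : (0 : ℝ) < D := by exact_mod_cast hD
  rw [tpar, ← Real.rpow_mul (by positivity), Real.div_rpow (by positivity) h1.le,
    Real.mul_rpow (by positivity) (by positivity), ← Real.rpow_mul (by positivity),
    ← Real.rpow_mul (by positivity)]
  have e1 : -1 / (k : ℝ) * (1 / (finrank ℚ K : ℝ) * (-((finrank ℚ K : ℝ) * k) / 2)) = 1 / 2 := by
    field_simp
  have e2 : 1 / ((k : ℝ) + 1) * (1 / (finrank ℚ K : ℝ) * (-((finrank ℚ K : ℝ) * k) / 2)) =
      -(k : ℝ) / (2 * (k + 1)) := by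
    field_simp
  have e3 : 1 / (finrank ℚ K : ℝ) * (-((finrank ℚ K : ℝ) * k) / 2) = -((k : ℝ) / 2) := by
    field_simp
  have e4 : (4 : ℝ) ^ ((1 : ℝ) / 2) = 2 := by
    rw [← Real.sqrt_eq_rpow, show (4 : ℝ) = 2 ^ 2 by norm_num, Real.sqrt_sq (by norm_num)]
  rw [e1, e2, e3, e4, Real.rpow_neg h1.le, div_inv_eq_mul, Real.sqrt_eq_rpow,
    ← Real.rpow_natCast, ← Real.rpow_mul h1.le]
  ring_nf

/-- Recursively, the lattice has integral first coordinates. -/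
def Rigid : ∀ {k : ℕ}, (Fin k → K) → Submodule (𝓞 K) (Fin k → K) → Prop
  | 0, _, _ => True
  | _ + 1, w, L => (∀ σ : K →+* ℝ, 0 < σ (w 0)) ∧ (∀ x ∈ L, IsIntegral ℤ (x 0)) ∧
      Rigid (Fin.tail w) (tailLat L)

/-- The weight of a rigid lattice. -/
noncomputable def wt : ∀ {k : ℕ}, (Fin k → K) → Submodule (𝓞 K) (Fin k → K) → ℝ
  | 0, _, _ => 1
  | k + 1, w, L => Real.exp (-(Real.pi * tpar K (k + 1) (disc (diagB w) L)) *
      ∑ σ : K →+* ℝ, (σ (w 0))⁻¹) * wt (Fin.tail w) (tailLat L)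

theorem Rigid.pos {k : ℕ} {w : Fin k → K} {L : Submodule (𝓞 K) (Fin k → K)} (h : Rigid w L) :
    ∀ i (σ : K →+* ℝ), 0 < σ (w i) := by
  induction k with
  | zero => exact fun i => i.elim0
  | succ k ih => exact fun i => Fin.cases h.1 (fun i => ih h.2.2 i) i

theorem wt_pos {k : ℕ} (w : Fin k → K) (L : Submodule (𝓞 K) (Fin k → K)) : 0 < wt w L := by
  induction k with
  | zero => exact one_pos
  | succ k ih => exact mul_pos (Real.exp_pos _) (ih _ _)

end Disc

section Frame

variable {K : Type} [Field K] [NumberField K] [IsTotallyReal K]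
variable {V : Type} [AddCommGroup V] [Module K V] [Module (𝓞 K) V] [IsScalarTower (𝓞 K) K V]

/-- Families of pairwise orthogonal nonzero vectors. -/
def OrthFrame (B : V →ₗ[K] V →ₗ[K] K) {k : ℕ} (g : Fin k → V) : Prop :=
  (∀ i j, i ≠ j → B (g i) (g j) = 0) ∧ ∀ i, g i ≠ 0

/-- The pullback of a lattice to the coordinates of a frame. -/
noncomputable def frameLat (L : Submodule (𝓞 K) V) {k : ℕ} (g : Fin k → V) :
    Submodule (𝓞 K) (Fin k → K) :=
  L.comap ((Fintype.linearCombination K g).restrictScalars (𝓞 K))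

/-- The norms of the vectors in a frame. -/
def frameWt (B : V →ₗ[K] V →ₗ[K] K) {k : ℕ} (g : Fin k → V) : Fin k → K :=
  fun i => B (g i) (g i)

theorem mem_frameLat {L : Submodule (𝓞 K) V} {k : ℕ} {g : Fin k → V} {x : Fin k → K} :
    x ∈ frameLat L g ↔ ∑ i, x i • g i ∈ L := Iff.rfl

theorem frame_form {B : V →ₗ[K] V →ₗ[K] K} {k : ℕ} {g : Fin k → V} (hg : OrthFrame B g)
    (x y : Fin k → K) :
    B (Fintype.linearCombination K g x) (Fintype.linearCombination K g y) =
      diagB (frameWt B g) x y := by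
  classical
  simp only [Fintype.linearCombination_apply, map_sum, LinearMap.sum_apply, map_smul,
    LinearMap.smul_apply, smul_eq_mul, diagB_apply, frameWt]
  refine Finset.sum_congr rfl fun i _ => ?_
  rw [Finset.sum_eq_single i]
  · ring
  · intro j _ hj
    rw [hg.1 _ _ hj]
    ring
  · simp

theorem frame_injective {B : V →ₗ[K] V →ₗ[K] K} (hB : TotPos B) {k : ℕ} {g : Fin k → V}
    (hg : OrthFrame B g) : Function.Injective (Fintype.linearCombination K g) := by
  classical
  rw [injective_iff_map_eq_zero]
  intro x hx
  ext i
  have := frame_form hg x (Pi.single i 1)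
  rw [hx, map_zero, LinearMap.zero_apply, diagB_apply, Finset.sum_eq_single i] at this
  · rw [Pi.single_eq_same, mul_one] at this
    obtain ⟨σ⟩ := (inferInstance : Nonempty (K →+* ℝ))
    have h2 := hB.2 _ (hg.2 i) σ
    rcases mul_eq_zero.1 this.symm with h | h
    · rw [frameWt] at h
      rw [h, map_zero] at h2
      exact absurd h2 (lt_irrefl _)
    · exact h
  · intro j _ hj
    rw [Pi.single_eq_of_ne hj, mul_zero]
  · simp

/-- A full frame identifies the space with a diagonal space. -/
noncomputable def frameEquiv {B : V →ₗ[K] V →ₗ[K] K} (hB : TotPos B) {k : ℕ} {g : Fin k → V}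
    (hg : OrthFrame B g) [FiniteDimensional K V] (hk : finrank K V = k) : (Fin k → K) ≃ₗ[K] V :=
  LinearEquiv.ofBijective (Fintype.linearCombination K g) ⟨frame_injective hB hg,
    (LinearMap.injective_iff_surjective_of_finrank_eq_finrank (by simp [hk])).1
      (frame_injective hB hg)⟩

theorem frameEquiv_apply {B : V →ₗ[K] V →ₗ[K] K} (hB : TotPos B) {k : ℕ} {g : Fin k → V}
    (hg : OrthFrame B g) [FiniteDimensional K V] (hk : finrank K V = k) (x : Fin k → K) :
    frameEquiv hB hg hk x = ∑ i, x i • g i := rfl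

theorem frameEquiv_form {B : V →ₗ[K] V →ₗ[K] K} (hB : TotPos B) {k : ℕ} {g : Fin k → V}
    (hg : OrthFrame B g) [FiniteDimensional K V] (hk : finrank K V = k) (x y : Fin k → K) :
    B (frameEquiv hB hg hk x) (frameEquiv hB hg hk y) = diagB (frameWt B g) x y :=
  frame_form hg x y

theorem map_frameLat {B : V →ₗ[K] V →ₗ[K] K} (hB : TotPos B) {k : ℕ} {g : Fin k → V}
    (hg : OrthFrame B g) [FiniteDimensional K V] (hk : finrank K V = k) (L : Submodule (𝓞 K) V) :
    (frameLat L g).map ((frameEquiv hB hg hk).toLinearMap.restrictScalars (𝓞 K)) = L :=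
  Submodule.map_comap_eq_of_surjective (f := (frameEquiv hB hg hk).toLinearMap.restrictScalars
      (𝓞 K))
    (frameEquiv hB hg hk).surjective L

theorem frameLat_eq_map {B : V →ₗ[K] V →ₗ[K] K} (hB : TotPos B) {k : ℕ} {g : Fin k → V}
    (hg : OrthFrame B g) [FiniteDimensional K V] (hk : finrank K V = k) (L : Submodule (𝓞 K) V) :
    frameLat L g = L.map ((frameEquiv hB hg hk).symm.toLinearMap.restrictScalars (𝓞 K)) := by
  ext x
  rw [Submodule.mem_map]
  constructor
  · intro hx
    exact ⟨_, hx, (frameEquiv hB hg hk).symm_apply_apply x⟩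
  · rintro ⟨y, hy, rfl⟩
    have : frameEquiv hB hg hk ((frameEquiv hB hg hk).symm y) = y :=
      (frameEquiv hB hg hk).apply_symm_apply y
    rw [mem_frameLat]
    change frameEquiv hB hg hk ((frameEquiv hB hg hk).symm y) ∈ L
    rwa [this]

theorem IsLat.frame {B : V →ₗ[K] V →ₗ[K] K} (hB : TotPos B) {k : ℕ} {g : Fin k → V}
    (hg : OrthFrame B g) [FiniteDimensional K V] (hk : finrank K V = k) {L : Submodule (𝓞 K) V}
    (h : IsLat L) : IsLat (frameLat L g) := by
  rw [frameLat_eq_map hB hg hk]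
  exact h.map _

theorem disc_frame {B : V →ₗ[K] V →ₗ[K] K} (hB : TotPos B) {k : ℕ} {g : Fin k → V}
    (hg : OrthFrame B g) [FiniteDimensional K V] (hk : finrank K V = k) (L : Submodule (𝓞 K) V) :
    disc (diagB (frameWt B g)) (frameLat L g) = disc B L := by
  rw [← disc_map (frameEquiv hB hg hk) (frameEquiv_form hB hg hk), map_frameLat]

theorem dual_frame {B : V →ₗ[K] V →ₗ[K] K} (hB : TotPos B) {k : ℕ} {g : Fin k → V}
    (hg : OrthFrame B g) [FiniteDimensional K V] (hk : finrank K V = k) (L : Submodule (𝓞 K) V) :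
    dualLat (diagB (frameWt B g)) (frameLat L g) = frameLat (dualLat B L) g := by
  have h := dualLat_map (frameEquiv hB hg hk) (frameEquiv_form hB hg hk) (frameLat L g)
  rw [map_frameLat] at h
  rw [h]
  exact (Submodule.comap_map_eq_of_injective
    (f := (frameEquiv hB hg hk).toLinearMap.restrictScalars (𝓞 K))
    (frameEquiv hB hg hk).injective _).symm

theorem exists_frame {B : V →ₗ[K] V →ₗ[K] K} (hB : TotPos B) [FiniteDimensional K V] :
    ∃ g : Fin (finrank K V) → V, OrthFrame B g := by
  have : Invertible (2 : K) := invertibleOfNonzero two_ne_zero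
  obtain ⟨v, hv⟩ := LinearMap.BilinForm.exists_orthogonal_basis (B := B)
    ⟨fun x y => hB.1 x y⟩
  exact ⟨v, fun i j hij => hv hij, fun i => v.ne_zero i⟩

theorem frameWt_pos {B : V →ₗ[K] V →ₗ[K] K} (hB : TotPos B) {k : ℕ} {g : Fin k → V}
    (hg : OrthFrame B g) : ∀ i (σ : K →+* ℝ), 0 < σ (frameWt B g i) :=
  fun i σ => hB.2 _ (hg.2 i) σ

theorem integral_frame {B : V →ₗ[K] V →ₗ[K] K} (hB : TotPos B) {k : ℕ} {g : Fin k → V}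
    (hg : OrthFrame B g) [FiniteDimensional K V] (hk : finrank K V = k) {L : Submodule (𝓞 K) V}
    (h : L ≤ dualLat B L) : frameLat L g ≤ dualLat (diagB (frameWt B g)) (frameLat L g) := by
  rw [dual_frame hB hg hk]
  exact Submodule.comap_mono h

theorem disc_pos {B : V →ₗ[K] V →ₗ[K] K} (hB : TotPos B) [FiniteDimensional K V]
    {L : Submodule (𝓞 K) V} (hL : IsLat L) (h : L ≤ dualLat B L) : 0 < disc B L := by
  obtain ⟨g, hg⟩ := exists_frame hB
  rw [← disc_frame hB hg rfl]
  exact disc_pos_diag (frameWt_pos hB hg) (hL.frame hB hg rfl) (integral_frame hB hg rfl h)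

end Frame

end TotReal

namespace TotReal

open NumberField Module MeasureTheory
open scoped nonZeroDivisors

set_option linter.unusedSectionVars false

variable {K : Type} [Field K] [NumberField K] [IsTotallyReal K]

theorem theta_dual {V : Type} [AddCommGroup V] [Module K V] [Module (𝓞 K) V]
    [IsScalarTower (𝓞 K) K V] {B : V →ₗ[K] V →ₗ[K] K} (hB : TotPos B) [FiniteDimensional K V]
    {L : Submodule (𝓞 K) V} (hL : IsLat L) (hi : L ≤ dualLat B L) (t : ℝ) (ht : 0 < t) :
    ENNReal.ofReal (t ^ (-((finrank ℚ K : ℝ) * finrank K V) / 2) *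
      √(disc B L / |(discr K : ℝ)| ^ (finrank K V))) ≤
    ∑' x : dualLat B L, ENNReal.ofReal (Real.exp (-(Real.pi * t) *
        ∑ σ : K →+* ℝ, σ (B x x))) := by
  obtain ⟨g, hg⟩ := exists_frame hB
  have hw := frameWt_pos hB hg
  have hLg := hL.frame hB hg rfl
  have hig := integral_frame hB hg rfl hi
  obtain ⟨c, c', h, h', hcc⟩ := exists_hasCov hw hLg
  have hsq := hasCov_sq hw hLg hig h
  have hΔ := pow_pos (abs_discr_pos (K := K)) (finrank K V)
  have hc' : (√(disc B L / |(discr K : ℝ)| ^ (finrank K V))) = c'⁻¹ := by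
    rw [disc_frame hB hg rfl] at hsq
    rw [Real.sqrt_eq_iff_mul_self_eq (by positivity) (inv_pos.2 h'.1).le]
    rw [← hcc] at hsq ⊢
    have h1 := h.1.ne'
    have h2 := h'.1.ne'
    field_simp
    have : c * c = c * (disc B L * c') := by linear_combination hsq
    exact (mul_left_cancel₀ h1 this).symm
  have := h'.theta hw t ht
  rw [hc', ← div_eq_mul_inv]
  refine this.trans (le_of_eq ?_)
  let e : dualLat (diagB (frameWt B g)) (frameLat L g) ≃ dualLat B L :=
    { toFun := fun x => ⟨frameEquiv hB hg rfl x, by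
        have h1 := (SetLike.ext_iff.1 (dual_frame hB hg rfl L) _).1 x.2
        exact h1⟩
      invFun := fun x => ⟨(frameEquiv hB hg rfl).symm x, by
        rw [dual_frame hB hg rfl]
        change frameEquiv hB hg rfl ((frameEquiv hB hg rfl).symm x) ∈ dualLat B L
        rw [LinearEquiv.apply_symm_apply]
        exact x.2⟩
      left_inv := fun x => by simp
      right_inv := fun x => by simp }
  rw [← e.tsum_eq]
  refine tsum_congr fun x => ?_
  have : B (e x) (e x) = diagB (frameWt B g) x x := frameEquiv_form hB hg rfl _ _
  rw [this, diagB_apply]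

theorem one_le_theta_dual {V : Type} [AddCommGroup V] [Module K V] [Module (𝓞 K) V]
    [IsScalarTower (𝓞 K) K V] {B : V →ₗ[K] V →ₗ[K] K} (hB : TotPos B) [FiniteDimensional K V]
    {L : Submodule (𝓞 K) V} (hL : IsLat L) (hi : L ≤ dualLat B L) (hV : 0 < finrank K V) :
    1 ≤ ∑' x : {x : V // x ∈ dualLat B L ∧ x ≠ 0}, ENNReal.ofReal (Real.exp
      (-(Real.pi * tpar K (finrank K V) (disc B L)) * ∑ σ : K →+* ℝ, σ (B x x))) := by
  have hD := disc_pos hB hL hi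
  have h := theta_dual hB hL hi _ (tpar_pos (K := K) (k := finrank K V) hD)
  set t := tpar K (finrank K V) (disc B L)
  have h2 : 2 ≤ t ^ (-((finrank ℚ K : ℝ) * finrank K V) / 2) *
      √(disc B L / |(discr K : ℝ)| ^ (finrank K V)) := by
    rw [tpar_rpow hV hD]
    have hD' : (1 : ℝ) ≤ disc B L := by exact_mod_cast hD
    have hΔ := pow_pos (abs_discr_pos (K := K)) (finrank K V)
    rw [Real.sqrt_div (by positivity), mul_assoc, mul_div_cancel₀ _ (by positivity), mul_assoc,
      Real.sqrt_eq_rpow, ← Real.rpow_add (by positivity)]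
    have : (1 : ℝ) ≤ (disc B L : ℝ) ^ (-(finrank K V : ℝ) / (2 * (finrank K V + 1)) + 1 / 2) := by
      refine Real.one_le_rpow hD' ?_
      have : (0 : ℝ) ≤ finrank K V := by positivity
      have h3 : -(finrank K V : ℝ) / (2 * (finrank K V + 1)) + 1 / 2 =
        1 / (2 * (finrank K V + 1)) := by field_simp; ring
      rw [h3]
      positivity
    linarith
  have h3 := (ENNReal.ofReal_le_ofReal h2).trans h
  classical
  rw [ENNReal.tsum_eq_add_tsum_ite 0] at h3
  set f : dualLat B L → ENNReal := fun x =>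
    ENNReal.ofReal (Real.exp (-(Real.pi * t) * ∑ σ : K →+* ℝ, σ (B x x)))
  have h4 : f 0 = 1 := by simp [f]
  have h5 : (∑' x, if x = 0 then 0 else f x) = ∑' x : {x : V // x ∈ dualLat B L ∧ x ≠ 0},
      ENNReal.ofReal (Real.exp (-(Real.pi * t) * ∑ σ : K →+* ℝ, σ (B x x))) := by
    have : (∑' x, if x = 0 then 0 else f x) = ∑' x, ({0}ᶜ : Set (dualLat B L)).indicator f x := by
      refine tsum_congr fun x => ?_
      by_cases hx : x = 0 <;> simp [hx]
    rw [this, ← tsum_subtype]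
    let e : ({0}ᶜ : Set (dualLat B L)) ≃ {x : V // x ∈ dualLat B L ∧ x ≠ 0} :=
      { toFun := fun x => ⟨x.1.1, x.1.2, fun h0 => x.2 (Subtype.ext h0)⟩
        invFun := fun x => ⟨⟨x.1, x.2.1⟩, fun h0 => x.2.2 (congrArg Subtype.val h0)⟩
        left_inv := fun x => rfl
        right_inv := fun x => rfl }
    rw [← e.tsum_eq]
    rfl
  replace h3 : ENNReal.ofReal 2 ≤ f 0 + ∑' x, (if x = 0 then 0 else f x) :=
    h3.trans (le_of_eq (by congr!))
  rw [h4, h5, show ENNReal.ofReal 2 = 1 + 1 by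
    rw [← ENNReal.ofReal_one, ← ENNReal.ofReal_add] <;> norm_num] at h3
  exact (ENNReal.add_le_add_iff_left ENNReal.one_ne_top).1 h3

section Ortho

variable {V : Type} [AddCommGroup V] [Module K V] [Module (𝓞 K) V] [IsScalarTower (𝓞 K) K V]

/-- The restriction of a form to a subspace. -/
def restr (B : V →ₗ[K] V →ₗ[K] K) (U : Submodule K V) : U →ₗ[K] U →ₗ[K] K :=
  B.domRestrict₁₂ U U

theorem restr_apply (B : V →ₗ[K] V →ₗ[K] K) (U : Submodule K V) (x y : U) :
    restr B U x y = B x y := rfl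

theorem TotPos.restr {B : V →ₗ[K] V →ₗ[K] K} (hB : TotPos B) (U : Submodule K V) :
    TotPos (restr B U) :=
  ⟨fun x y => hB.1 x y, fun x hx σ => hB.2 x (by simpa using hx) σ⟩

/-- The intersection of a lattice with a subspace. -/
def interLat (L : Submodule (𝓞 K) V) (U : Submodule K V) : Submodule (𝓞 K) U :=
  L.comap (U.subtype.restrictScalars (𝓞 K))

theorem mem_interLat {L : Submodule (𝓞 K) V} {U : Submodule K V} {x : U} :
    x ∈ interLat L U ↔ (x : V) ∈ L := Iff.rfl

theorem IsLat.inter {L : Submodule (𝓞 K) V} (hL : IsLat L) (U : Submodule K V) :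
    IsLat (interLat L U) := by
  constructor
  · have : IsNoetherian (𝓞 K) L := isNoetherian_of_fg_of_noetherian L hL.1
    let f : interLat L U →ₗ[𝓞 K] L :=
      { toFun := fun y => ⟨y.1.1, y.2⟩
        map_add' := fun x y => rfl
        map_smul' := fun a y => rfl }
    have hf : Function.Injective f := fun x y hxy =>
      Subtype.ext (Subtype.ext (congrArg (fun z : L => (z : V)) hxy))
    have := isNoetherian_of_injective f hf
    exact (Submodule.fg_top _).1 (IsNoetherian.noetherian _)
  · intro v
    obtain ⟨a, ha, hv⟩ := hL.2 v
    exact ⟨a, ha, hv⟩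

theorem integral_inter {B : V →ₗ[K] V →ₗ[K] K} {L : Submodule (𝓞 K) V} (hi : L ≤ dualLat B L)
    (U : Submodule K V) : interLat L U ≤ dualLat (restr B U) (interLat L U) :=
  fun _ hx _ hy => hi hx _ hy

theorem TotPos.ne_zero {B : V →ₗ[K] V →ₗ[K] K} (hB : TotPos B) {v : V} (hv : v ≠ 0) :
    B v v ≠ 0 := by
  obtain ⟨σ⟩ := (inferInstance : Nonempty (K →+* ℝ))
  intro h0
  have := hB.2 v hv σ
  rw [h0, map_zero] at this
  exact lt_irrefl _ this

theorem finrank_orth {B : V →ₗ[K] V →ₗ[K] K} (hB : TotPos B) [FiniteDimensional K V] {v : V}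
    (hv : v ≠ 0) {k : ℕ} (hk : finrank K V = k + 1) : finrank K (LinearMap.ker (B v)) = k := by
  have h := LinearMap.finrank_range_add_finrank_ker (B v)
  rw [LinearMap.range_eq_top.2 ((B v).surjective (fun h0 => hB.ne_zero hv (by rw [h0]; rfl))),
    finrank_top, finrank_self] at h
  omega

/-- The frames of a lattice with rigid coordinates. -/
def rigidFrames (B : V →ₗ[K] V →ₗ[K] K) (L : Submodule (𝓞 K) V) (k : ℕ) : Set (Fin k → V) :=
  {g | OrthFrame B g ∧ Rigid (frameWt B g) (frameLat L g)}

/-- Extend a frame of the orthogonal complement of `v`. -/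
noncomputable def extFrame (B : V →ₗ[K] V →ₗ[K] K) (v : V) {k : ℕ}
    (g : Fin k → LinearMap.ker (B v)) : Fin (k + 1) → V :=
  Fin.cons ((B v v)⁻¹ • v) (fun i => (g i : V))

theorem frameWt_ext_zero {B : V →ₗ[K] V →ₗ[K] K} {v : V} (hv : B v v ≠ 0) {k : ℕ}
    (g : Fin k → LinearMap.ker (B v)) : frameWt B (extFrame B v g) 0 = (B v v)⁻¹ := by
  simp only [frameWt, extFrame, Fin.cons_zero, map_smul, LinearMap.smul_apply, smul_eq_mul]
  field_simp

theorem tail_frameWt_ext {B : V →ₗ[K] V →ₗ[K] K} {v : V} {k : ℕ}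
    (g : Fin k → LinearMap.ker (B v)) :
    Fin.tail (frameWt B (extFrame B v g)) = frameWt (restr B _) g := by
  ext i
  simp [Fin.tail, frameWt, extFrame, restr_apply]

theorem tailLat_ext {B : V →ₗ[K] V →ₗ[K] K} {L : Submodule (𝓞 K) V} {v : V} {k : ℕ}
    (g : Fin k → LinearMap.ker (B v)) :
    tailLat (frameLat L (extFrame B v g)) = frameLat (interLat L (LinearMap.ker (B v))) g := by
  ext x
  rw [mem_tailLat, mem_frameLat, mem_frameLat, mem_interLat, Fin.sum_univ_succ]
  simp [extFrame]

theorem extFrame_mem {B : V →ₗ[K] V →ₗ[K] K} (hB : TotPos B) {L : Submodule (𝓞 K) V} {v : V}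
    (hv : v ≠ 0) (hvL : v ∈ dualLat B L) {k : ℕ} {g : Fin k → LinearMap.ker (B v)}
    (hg : g ∈ rigidFrames (restr B _) (interLat L (LinearMap.ker (B v))) k) :
    extFrame B v g ∈ rigidFrames B L (k + 1) := by
  have hQ := hB.ne_zero hv
  have horth : ∀ i, B v (g i) = 0 := fun i => (g i).2
  refine ⟨⟨?_, ?_⟩, ?_, ?_, ?_⟩
  · intro i j
    refine Fin.cases ?_ (fun i => ?_) i <;> refine Fin.cases ?_ (fun j => ?_) j
    · simp
    · simp [extFrame, horth]
    · simp [extFrame, hB.1 (g i) v, horth]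
    · intro hij
      exact hg.1.1 i j (fun h => hij (by rw [h]))
  · intro i
    refine Fin.cases ?_ (fun i => ?_) i
    · simp [extFrame, hQ, hv]
    · simpa [extFrame] using hg.1.2 i
  · intro σ
    rw [frameWt_ext_zero hQ, map_inv₀]
    exact inv_pos.2 (hB.2 v hv σ)
  · intro x hx
    have h := hvL _ (mem_frameLat.1 hx)
    rw [Fin.sum_univ_succ] at h
    simp only [extFrame, Fin.cons_zero, Fin.cons_succ, map_add, map_sum, map_smul, horth,
      smul_eq_mul, mul_zero, Finset.sum_const_zero, add_zero, inv_mul_cancel₀ hQ, mul_one] at h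
    exact h
  · rw [tail_frameWt_ext, tailLat_ext]
    exact hg.2

end Ortho

theorem one_le_tsum_rigidFrames (k : ℕ) : ∀ {V : Type} [AddCommGroup V] [Module K V]
    [Module (𝓞 K) V] [IsScalarTower (𝓞 K) K V] {B : V →ₗ[K] V →ₗ[K] K} (_ : TotPos B)
    [FiniteDimensional K V] {L : Submodule (𝓞 K) V} (_ : IsLat L) (_ : L ≤ dualLat B L)
    (_ : finrank K V = k),
    1 ≤ ∑' g : rigidFrames B L k, ENNReal.ofReal (wt (frameWt B g.1) (frameLat L g.1)) := by
  induction k with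
  | zero =>
    intro V _ _ _ _ B hB _ L hL hi hk
    have hmem : (Fin.elim0 : Fin 0 → V) ∈ rigidFrames B L 0 :=
      ⟨⟨fun i => i.elim0, fun i => i.elim0⟩, trivial⟩
    refine le_trans ?_ (ENNReal.le_tsum ⟨_, hmem⟩)
    simp [wt]
  | succ k ih =>
    intro V _ _ _ _ B hB _ L hL hi hk
    have h1 := one_le_theta_dual hB hL hi (by omega)
    refine h1.trans ?_
    let F := Σ v : {x : V // x ∈ dualLat B L ∧ x ≠ 0},
      rigidFrames (restr B _) (interLat L (LinearMap.ker (B v.1))) k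
    let ι : F → rigidFrames B L (k + 1) := fun p =>
      ⟨extFrame B p.1.1 p.2.1, extFrame_mem hB p.1.2.2 p.1.2.1 p.2.2⟩
    have hι : Function.Injective ι := by
      rintro ⟨⟨v, hv⟩, ⟨g, hg⟩⟩ ⟨⟨v', hv'⟩, ⟨g', hg'⟩⟩ h
      have h := congrArg Subtype.val h
      simp only [ι] at h
      have h0 : frameWt B (extFrame B v g) 0 = frameWt B (extFrame B v' g') 0 := by rw [h]
      rw [frameWt_ext_zero (hB.ne_zero hv.2), frameWt_ext_zero (hB.ne_zero hv'.2), inv_inj] at h0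
      have h2 := congrFun h 0
      simp only [extFrame, Fin.cons_zero] at h2
      rw [h0] at h2
      have h3 : v = v' := smul_right_injective V (inv_ne_zero (hB.ne_zero hv'.2)) h2
      subst h3
      have h4 : g = g' := by
        ext i
        have := congrFun h i.succ
        simpa [extFrame] using this
      subst h4
      rfl
    refine le_trans ?_ (ENNReal.tsum_comp_le_tsum_of_injective hι _)
    rw [ENNReal.tsum_sigma']
    refine ENNReal.tsum_le_tsum fun v => ?_
    have hv := hB.ne_zero v.2.2
    have h2 := ih (hB.restr _) (hL.inter _) (integral_inter hi (LinearMap.ker (B v.1)))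
      (finrank_orth hB v.2.2 hk)
    calc _ = ENNReal.ofReal (Real.exp
      (-(Real.pi * tpar K (finrank K V) (disc B L)) * ∑ σ : K →+* ℝ, σ (B v.1 v.1))) * 1 := by
          rw [mul_one]
      _ ≤ _ := mul_le_mul_right h2 _
      _ = _ := by
        rw [← ENNReal.tsum_mul_left]
        refine tsum_congr fun g => ?_
        rw [← ENNReal.ofReal_mul (Real.exp_pos _).le]
        congr 1
        simp only [ι, wt]
        rw [disc_frame hB (extFrame_mem hB v.2.2 v.2.1 g.2).1 hk, hk, frameWt_ext_zero hv,
          tail_frameWt_ext, tailLat_ext]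
        simp only [map_inv₀, inv_inv]

end TotReal

namespace TotReal

theorem exp_neg_le_rpow {c z a : ℝ} (hc : 0 < c) (hz : 0 < z) (ha : 0 < a) :
    Real.exp (-(c * z)) ≤ (a / (Real.exp 1 * c)) ^ a * z ^ (-a) := by
  have h1 : Real.exp (-(c * z)) = Real.exp (-(c * z / a)) ^ a := by
    rw [← Real.exp_mul]
    congr 1
    field_simp
  have h2 : (a / (Real.exp 1 * c)) ^ a * z ^ (-a) = (a / (Real.exp 1 * c * z)) ^ a := by
    rw [Real.rpow_neg hz.le, ← Real.inv_rpow hz.le, ← Real.mul_rpow (by positivity)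
      (by positivity)]
    congr 1
    field_simp
  rw [h1, h2]
  refine Real.rpow_le_rpow (Real.exp_pos _).le ?_ ha.le
  have h3 := Real.add_one_le_exp (c * z / a - 1)
  rw [sub_add_cancel, Real.exp_sub, div_le_div_iff₀ ha (Real.exp_pos 1)] at h3
  rw [Real.exp_neg, ← one_div, div_le_div_iff₀ (Real.exp_pos _) (by positivity)]
  nlinarith

theorem exp_neg_mul_prod_le {ι : Type*} [Fintype ι] [Nonempty ι] {z : ι → ℝ} (hz : ∀ i, 0 < z i)
    {τ : ℝ} (hτ : 0 < τ) :
    Real.exp (-(τ * ∑ i, (z i)⁻¹)) * ∏ i, (1 + z i) ^ 2 ≤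
      (1 + ∏ i, z i) ^ (2 * Fintype.card ι) *
        ((2 * Fintype.card ι ^ 2).factorial * (τ ^ (2 * Fintype.card ι ^ 2))⁻¹ * Real.exp τ) := by
  obtain ⟨j, hj⟩ := Finite.exists_min z
  set d := Fintype.card ι
  set y := ∏ i, z i
  have hy : 0 < y := Finset.prod_pos fun i _ => hz i
  set u := max 1 (z j)⁻¹
  have hu : 1 ≤ u := le_max_left _ _
  have hju : (z j)⁻¹ ≤ u := le_max_right _ _
  have hzu : ∀ i, 1 ≤ u * z i := fun i => by
    have : 1 ≤ u * z j := by
      rw [← inv_mul_cancel₀ (hz j).ne']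
      exact mul_le_mul_of_nonneg_right hju (hz j).le
    exact this.trans (mul_le_mul_of_nonneg_left (hj i) (by linarith))
  have hone : ∀ i, 1 + z i ≤ (1 + y) * u ^ d := fun i => by
    have h1 : z i ≤ y * u ^ d := by
      have : y * u ^ d = ∏ i, (u * z i) := by
        rw [Finset.prod_mul_distrib, Finset.prod_const, Finset.card_univ, mul_comm]
      rw [this]
      classical
      rw [← Finset.mul_prod_erase _ _ (Finset.mem_univ i)]
      have h2 : 1 ≤ ∏ x ∈ Finset.univ.erase i, u * z x := Finset.one_le_prod fun x _ => hzu x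
      have h3 := hz i
      nlinarith [mul_nonneg (sub_nonneg.2 hu) h3.le, mul_nonneg
          (mul_nonneg (by linarith : 0 ≤ u) h3.le) (sub_nonneg.2 h2)]
    have h2 : 1 ≤ u ^ d := one_le_pow₀ hu
    linarith
  have hprod : ∏ i, (1 + z i) ^ 2 ≤ (1 + y) ^ (2 * d) * u ^ (2 * d ^ 2) := by
    calc ∏ i, (1 + z i) ^ 2 ≤ ∏ _i : ι, ((1 + y) * u ^ d) ^ 2 :=
          Finset.prod_le_prod (fun i _ => by positivity) fun i _ =>
            pow_le_pow_left₀ (by have := hz i; positivity) (hone i) 2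
      _ = _ := by
          rw [Finset.prod_const, Finset.card_univ]
          change (((1 + y) * u ^ d) ^ 2) ^ d = _
          rw [← pow_mul, mul_pow, ← pow_mul, show d * (2 * d) = 2 * d ^ 2 by ring]
  have hexp : Real.exp (-(τ * ∑ i, (z i)⁻¹)) ≤ Real.exp τ * Real.exp (-(τ * u)) := by
    rw [← Real.exp_add, Real.exp_le_exp]
    have h1 : (z j)⁻¹ ≤ ∑ i, (z i)⁻¹ :=
      Finset.single_le_sum (f := fun i => (z i)⁻¹) (fun i _ => (inv_pos.2 (hz i)).le)
        (Finset.mem_univ j)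
    have h2 : u ≤ 1 + (z j)⁻¹ := max_le (by have := inv_pos.2 (hz j); linarith) (by linarith)
    nlinarith
  have hfact : Real.exp (-(τ * u)) * u ^ (2 * d ^ 2) ≤
      (2 * d ^ 2).factorial * (τ ^ (2 * d ^ 2))⁻¹ := by
    have h1 := Real.pow_div_factorial_le_exp (τ * u) (by positivity) (2 * d ^ 2)
    rw [div_le_iff₀ (by positivity), mul_pow] at h1
    rw [Real.exp_neg, ← div_eq_mul_inv, le_div_iff₀ (by positivity), inv_mul_eq_div,
      div_mul_eq_mul_div, div_le_iff₀ (by positivity)]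
    linarith
  calc _ ≤ (Real.exp τ * Real.exp (-(τ * u))) * ((1 + y) ^ (2 * d) * u ^ (2 * d ^ 2)) := by
        gcongr
    _ = (1 + y) ^ (2 * d) * ((Real.exp (-(τ * u)) * u ^ (2 * d ^ 2)) * Real.exp τ) := by ring
    _ ≤ _ := by gcongr

theorem card_mul_prod_rpow_le {ι : Type*} [Fintype ι] [Nonempty ι] {x : ι → ℝ}
    (hx : ∀ i, 0 < x i) :
    (Fintype.card ι : ℝ) * (∏ i, x i) ^ (-(1 / (Fintype.card ι : ℝ))) ≤ ∑ i, (x i)⁻¹ := by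
  have hc : (0 : ℝ) < Fintype.card ι := by exact_mod_cast Fintype.card_pos
  have := Real.geom_mean_le_arith_mean_weighted Finset.univ (fun _ : ι => 1 / (Fintype.card ι : ℝ))
    (fun i => (x i)⁻¹) (fun _ _ => by positivity)
    (by rw [Finset.sum_const, Finset.card_univ, nsmul_eq_mul]; field_simp)
    (fun i _ => (inv_pos.2 (hx i)).le)
  rw [← Finset.mul_sum, Real.finsetProd_rpow _ _ (fun i _ => (inv_pos.2 (hx i)).le),
    Finset.prod_inv_distrib, Real.inv_rpow (Finset.prod_nonneg fun i _ => (hx i).le),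
    ← Real.rpow_neg (Finset.prod_nonneg fun i _ => (hx i).le)] at this
  calc _ ≤ (Fintype.card ι : ℝ) * (1 / (Fintype.card ι : ℝ) * ∑ i, (x i)⁻¹) :=
        mul_le_mul_of_nonneg_left this hc.le
    _ = _ := by field_simp

/-- The constant bounding the bulk part of the rank `k` weights. -/
noncomputable def bulkConst (d : ℕ) (Δ : ℝ) (k : ℕ) : ℝ :=
  let c := Real.pi * (k / (k + 1)) * d * ((4 : ℝ) ^ (-(1 / (k : ℝ))) / Δ) ^ (1 / (d : ℝ))
  let a₁ : ℝ := (k / 2 + 2 * d) * d * (k + 1) / k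
  let a₂ := (d : ℝ) * (k + 1) / 2
  (a₁ / (Real.exp 1 * c)) ^ a₁ + (a₂ / (Real.exp 1 * c)) ^ a₂

theorem bulk_bound {d k : ℕ} (hd : 0 < d) (hk : 0 < k) {Δ D D₀ b y H : ℝ} (hΔ : 0 < Δ)
    (hD : 1 ≤ D) (hD₀ : 1 ≤ D₀) (hb : 1 ≤ b) (hy : D = D₀ * y) (hH : H = D₀ * b ^ 2) :
    Real.exp (-(Real.pi * (k / (k + 1)) * d * ((4 : ℝ) ^ (-(1 / (k : ℝ))) / Δ) ^ (1 / (d : ℝ)) *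
        (H * D ^ (-(k / (k + 1) : ℝ))) ^ (1 / (d : ℝ)))) * D ^ (-(k / 2 + 2 * d : ℝ)) *
        (1 + y) ^ (2 * d) ≤
      2 ^ (2 * d) * bulkConst d Δ k * D₀ ^ (-((k - 1) / 2 + 2 * d + 1 : ℝ)) * (b ^ 2)⁻¹ := by
  have hd' : (0 : ℝ) < d := by exact_mod_cast hd
  have hk' : (1 : ℝ) ≤ k := by exact_mod_cast hk
  have hH1 : 1 ≤ H := hH ▸ one_le_mul_of_one_le_of_one_le hD₀ (one_le_pow₀ hb)
  have hDp : 0 < D := by linarith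
  have hHp : 0 < H := by linarith
  have hD₀p : 0 < D₀ := by linarith
  have hbp : 0 < b := by linarith
  have hyp : 0 < y := by
    rw [hy] at hDp
    exact pos_of_mul_pos_right hDp hD₀p.le
  set c := Real.pi * (k / (k + 1)) * d * ((4 : ℝ) ^ (-(1 / (k : ℝ))) / Δ) ^ (1 / (d : ℝ))
  have hc : 0 < c := by positivity
  set a₁ : ℝ := (k / 2 + 2 * d) * d * (k + 1) / k with ha₁
  set a₂ : ℝ := (d : ℝ) * (k + 1) / 2 with ha₂
  have ha₁p : 0 < a₁ := by positivity
  have ha₂p : 0 < a₂ := by positivity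
  set z := (H * D ^ (-(k / (k + 1) : ℝ))) ^ (1 / (d : ℝ)) with hz
  have hzp : 0 < z := by positivity
  have hza : ∀ a : ℝ, z ^ (-a) = H ^ (-(a / d)) * D ^ (k / (k + 1) * (a / d) : ℝ) := by
    intro a
    rw [hz, ← Real.rpow_mul (by positivity), Real.mul_rpow hHp.le (by positivity),
      ← Real.rpow_mul hDp.le]
    congr 2
    · ring
    · ring
  set e : ℝ := (k - 1) / 2 + 2 * d + 1 with he
  have hHe : H ^ (-e) ≤ D₀ ^ (-e) * (b ^ 2)⁻¹ := by
    rw [hH, Real.mul_rpow hD₀p.le (by positivity)]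
    refine mul_le_mul_of_nonneg_left ?_ (by positivity)
    rw [← Real.rpow_neg_one (b ^ 2)]
    exact Real.rpow_le_rpow_of_exponent_le (one_le_pow₀ hb) (by rw [he]; linarith)
  have h1 : Real.exp (-(c * z)) * D ^ (-(k / 2 + 2 * d : ℝ)) ≤
      (a₁ / (Real.exp 1 * c)) ^ a₁ * (D₀ ^ (-e) * (b ^ 2)⁻¹) := by
    calc _ ≤ ((a₁ / (Real.exp 1 * c)) ^ a₁ * z ^ (-a₁)) * D ^ (-(k / 2 + 2 * d : ℝ)) :=
          mul_le_mul_of_nonneg_right (exp_neg_le_rpow hc hzp ha₁p) (by positivity)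
      _ = (a₁ / (Real.exp 1 * c)) ^ a₁ * H ^ (-(a₁ / d)) := by
          rw [hza, mul_assoc, mul_assoc, ← Real.rpow_add hDp,
            show (k / (k + 1) * (a₁ / d) + -(k / 2 + 2 * d) : ℝ) = 0 by
              rw [ha₁]; field_simp; ring, Real.rpow_zero, mul_one]
      _ ≤ (a₁ / (Real.exp 1 * c)) ^ a₁ * H ^ (-e) := by
          refine mul_le_mul_of_nonneg_left ?_ (by positivity)
          refine Real.rpow_le_rpow_of_exponent_le hH1 (neg_le_neg ?_)
          rw [he, ha₁, show (k / 2 + 2 * d) * d * (k + 1) / k / (d : ℝ) =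
            k / 2 + 1 / 2 + 2 * d + 2 * d / k by field_simp; ring]
          have : 0 ≤ 2 * (d : ℝ) / k := by positivity
          linarith
      _ ≤ _ := mul_le_mul_of_nonneg_left hHe (by positivity)
  have h2 : Real.exp (-(c * z)) * D ^ (-(k / 2 + 2 * d : ℝ)) * y ^ (2 * d) ≤
      (a₂ / (Real.exp 1 * c)) ^ a₂ * (D₀ ^ (-e) * (b ^ 2)⁻¹) := by
    have hyD : y ^ (2 * d) = D ^ (2 * d : ℝ) * D₀ ^ (-(2 * d : ℝ)) := by
      have : y = D * D₀⁻¹ := by rw [hy]; field_simp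
      rw [this, mul_pow, Real.rpow_neg hD₀p.le, ← Real.inv_rpow hD₀p.le]
      norm_cast
    calc _ ≤ ((a₂ / (Real.exp 1 * c)) ^ a₂ * z ^ (-a₂)) * D ^ (-(k / 2 + 2 * d : ℝ)) *
            y ^ (2 * d) := by
          gcongr
          exact exp_neg_le_rpow hc hzp ha₂p
      _ = (a₂ / (Real.exp 1 * c)) ^ a₂ * (H ^ (-(a₂ / d)) * D₀ ^ (-(2 * d : ℝ))) := by
          rw [hza, hyD]
          have : D ^ (k / (k + 1) * (a₂ / d) : ℝ) * D ^ (-(k / 2 + 2 * d : ℝ)) *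
              D ^ (2 * d : ℝ) = 1 := by
            rw [← Real.rpow_add hDp, ← Real.rpow_add hDp,
              show (k / (k + 1) * (a₂ / d) + -(k / 2 + 2 * d) + 2 * d : ℝ) = 0 by
              rw [ha₂]; field_simp; ring, Real.rpow_zero]
          linear_combination ((a₂ / (Real.exp 1 * c)) ^ a₂ * H ^ (-(a₂ / d)) *
            D₀ ^ (-(2 * d : ℝ))) * this
      _ = (a₂ / (Real.exp 1 * c)) ^ a₂ * (D₀ ^ (-e) * (b ^ 2) ^ (-((k + 1) / 2 : ℝ))) := by
          rw [hH, Real.mul_rpow hD₀p.le (by positivity),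
            show (a₂ / d : ℝ) = (k + 1) / 2 by rw [ha₂]; field_simp,
            mul_right_comm, ← Real.rpow_add hD₀p,
            show (-((k + 1) / 2) + -(2 * d) : ℝ) = -e by rw [he]; ring]
      _ ≤ _ := by
          refine mul_le_mul_of_nonneg_left ?_ (by positivity)
          refine mul_le_mul_of_nonneg_left ?_ (by positivity)
          rw [← Real.rpow_neg_one (b ^ 2)]
          exact Real.rpow_le_rpow_of_exponent_le (one_le_pow₀ hb) (by linarith)
  have h3 : (1 + y) ^ (2 * d) ≤ 2 ^ (2 * d) * (1 + y ^ (2 * d)) := by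
    rcases le_total y 1 with h | h
    · calc (1 + y) ^ (2 * d) ≤ 2 ^ (2 * d) := by gcongr; linarith
        _ ≤ _ := le_mul_of_one_le_right (by positivity) (by linarith [pow_pos hyp (2 * d)])
    · calc (1 + y) ^ (2 * d) ≤ (2 * y) ^ (2 * d) := by gcongr; linarith
        _ = 2 ^ (2 * d) * y ^ (2 * d) := mul_pow _ _ _
        _ ≤ _ := by gcongr; linarith
  calc _ ≤ Real.exp (-(c * z)) * D ^ (-(k / 2 + 2 * d : ℝ)) * (2 ^ (2 * d) * (1 + y ^ (2 * d))) :=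
        by gcongr
    _ = 2 ^ (2 * d) * (Real.exp (-(c * z)) * D ^ (-(k / 2 + 2 * d : ℝ)) +
        Real.exp (-(c * z)) * D ^ (-(k / 2 + 2 * d : ℝ)) * y ^ (2 * d)) := by ring
    _ ≤ 2 ^ (2 * d) * ((a₁ / (Real.exp 1 * c)) ^ a₁ * (D₀ ^ (-e) * (b ^ 2)⁻¹) +
        (a₂ / (Real.exp 1 * c)) ^ a₂ * (D₀ ^ (-e) * (b ^ 2)⁻¹)) := by gcongr
    _ = _ := by
        change _ = 2 ^ (2 * d) * ((a₁ / (Real.exp 1 * c)) ^ a₁ +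
          (a₂ / (Real.exp 1 * c)) ^ a₂) * D₀ ^ (-e) * (b ^ 2)⁻¹
        ring

/-- The constant in the recursive bound for the sum over rigid lattices. -/
noncomputable def stepConst (d : ℕ) (Δ : ℝ) (k : ℕ) : ℝ :=
  let τ := Real.pi * (4 * Δ) ^ (-(1 / (d : ℝ))) / (k + 1)
  ((2 * d ^ 2).factorial * (τ ^ (2 * d ^ 2))⁻¹ * Real.exp τ) * (2 ^ (2 * d) * bulkConst d Δ k)

theorem bulkConst_nonneg (d k : ℕ) {Δ : ℝ} (hΔ : 0 ≤ Δ) : 0 ≤ bulkConst d Δ k := by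
  have := Real.pi_pos
  unfold bulkConst
  positivity

theorem stepConst_nonneg (d k : ℕ) {Δ : ℝ} (hΔ : 0 ≤ Δ) : 0 ≤ stepConst d Δ k := by
  have := Real.pi_pos
  have := bulkConst_nonneg d k hΔ
  unfold stepConst
  positivity

theorem step_bound {ι : Type*} [Fintype ι] [Nonempty ι] {d k : ℕ} (hd : Fintype.card ι = d)
    (hk : 0 < k) {Δ D D₀ b : ℝ} {x : ι → ℝ} (hx : ∀ i, 0 < x i) (hΔ : 0 < Δ)
    (hD : 1 ≤ D) (hD₀ : 1 ≤ D₀) (hb : 1 ≤ b) (hy : D = D₀ * ((∏ i, x i) * b ^ 2)) :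
    Real.exp (-(Real.pi * ((4 : ℝ) ^ (-(1 / (k : ℝ))) * D ^ (1 / (k + 1 : ℝ)) / Δ) ^
        (1 / (d : ℝ))) * ∑ i, (x i)⁻¹) * D ^ (-(k / 2 + 2 * d : ℝ)) *
        ∏ i, (1 + x i * (b ^ 2) ^ (1 / (d : ℝ))) ^ 2 ≤
      stepConst d Δ k * D₀ ^ (-((k - 1) / 2 + 2 * d + 1 : ℝ)) * (b ^ 2)⁻¹ := by
  have hd0 : 0 < d := hd ▸ Fintype.card_pos
  have hd' : (0 : ℝ) < d := by exact_mod_cast hd0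
  have hk' : (1 : ℝ) ≤ k := by exact_mod_cast hk
  have hDp : 0 < D := by linarith
  have hD₀p : 0 < D₀ := by linarith
  have hbp : 0 < b := by linarith
  set q := (b ^ 2) ^ (1 / (d : ℝ)) with hq
  have hqp : 0 < q := by positivity
  have hqd : q ^ d = b ^ 2 := by
    rw [hq, one_div, Real.rpow_inv_natCast_pow (by positivity) hd0.ne']
  set P := ∏ i, x i with hP
  have hPp : 0 < P := Finset.prod_pos fun i _ => hx i
  set T := (4 : ℝ) ^ (-(1 / (k : ℝ))) * D ^ (1 / (k + 1 : ℝ)) / Δ with hT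
  have hTp : 0 < T := by positivity
  set t := T ^ (1 / (d : ℝ)) with ht
  have htp : 0 < t := by positivity
  set S := ∑ i, (x i)⁻¹ with hS
  set τ := Real.pi * (4 * Δ) ^ (-(1 / (d : ℝ))) / (k + 1) with hτ
  have hτp : 0 < τ := by positivity
  have hprod : ∏ i, (x i * q) = P * b ^ 2 := by
    rw [Finset.prod_mul_distrib, Finset.prod_const, Finset.card_univ, hd, hqd]
  have hsum : ∑ i, (x i * q)⁻¹ = S * q⁻¹ := by
    rw [hS, Finset.sum_mul]
    exact Finset.sum_congr rfl fun i _ => mul_inv _ _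
  have hSp : 0 ≤ S := Finset.sum_nonneg fun i _ => (inv_pos.2 (hx i)).le
  have hA := exp_neg_mul_prod_le (z := fun i => x i * q) (fun i => mul_pos (hx i) hqp) hτp
  rw [hsum, hprod, hd] at hA
  have hB := bulk_bound hd0 hk hΔ hD hD₀ hb (y := P * b ^ 2) (H := D₀ * b ^ 2) hy rfl
  set c := Real.pi * (k / (k + 1)) * d * ((4 : ℝ) ^ (-(1 / (k : ℝ))) / Δ) ^ (1 / (d : ℝ)) with hc
  set z := (D₀ * b ^ 2 * D ^ (-(k / (k + 1) : ℝ))) ^ (1 / (d : ℝ)) with hz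
  have h1 : τ * (S * q⁻¹) ≤ Real.pi * t * S / (k + 1) := by
    have : (4 * Δ) ^ (-(1 / (d : ℝ))) * q⁻¹ ≤ t := by
      rw [Real.rpow_neg (by positivity), ht]
      have h4 : (4 * Δ)⁻¹ ≤ T := by
        rw [hT, mul_inv, div_eq_mul_inv]
        refine mul_le_mul_of_nonneg_right ?_ (by positivity)
        have h5 : (4 : ℝ)⁻¹ ≤ (4 : ℝ) ^ (-(1 / (k : ℝ))) := by
          rw [← Real.rpow_neg_one]
          refine Real.rpow_le_rpow_of_exponent_le (by norm_num) (neg_le_neg ?_)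
          rw [div_le_one (by linarith)]
          exact hk'
        have h6 : 1 ≤ D ^ (1 / (k + 1 : ℝ)) := Real.one_le_rpow hD (by positivity)
        nlinarith [mul_le_mul h5 h6 zero_le_one (by positivity)]
      rw [← Real.inv_rpow (by positivity)]
      have h7 : ((4 * Δ)⁻¹) ^ (1 / (d : ℝ)) ≤ T ^ (1 / (d : ℝ)) :=
        Real.rpow_le_rpow (by positivity) h4 (by positivity)
      have h8 : q⁻¹ ≤ 1 := inv_le_one_of_one_le₀
        (Real.one_le_rpow (one_le_pow₀ hb) (by positivity))
      calc _ ≤ T ^ (1 / (d : ℝ)) * 1 := mul_le_mul h7 h8 (by positivity) (by positivity)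
        _ = _ := mul_one _
    calc τ * (S * q⁻¹) = Real.pi * ((4 * Δ) ^ (-(1 / (d : ℝ))) * q⁻¹) * S / (k + 1) := by
          rw [hτ]; ring
      _ ≤ _ := by gcongr
  have h2 : c * z ≤ Real.pi * t * S * (k / (k + 1)) := by
    have hcard := card_mul_prod_rpow_le hx
    rw [hd] at hcard
    have : ((4 : ℝ) ^ (-(1 / (k : ℝ))) / Δ) ^ (1 / (d : ℝ)) * z = t * P ^ (-(1 / (d : ℝ))) := by
      rw [hz, ht, Real.rpow_neg hPp.le, ← Real.inv_rpow hPp.le, ← Real.mul_rpow (by positivity)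
        (by positivity), ← Real.mul_rpow (by positivity) (by positivity)]
      congr 1
      have h3 : D₀ * b ^ 2 = D * P⁻¹ := by rw [hy]; field_simp
      have h4 : D * D ^ (-(k / (k + 1) : ℝ)) = D ^ (1 / (k + 1 : ℝ)) := by
        nth_rewrite 1 [← Real.rpow_one D]
        rw [← Real.rpow_add hDp]
        congr 1
        field_simp
        ring
      rw [h3, hT, ← h4]
      ring
    calc c * z = Real.pi * (k / (k + 1)) * d *
          (((4 : ℝ) ^ (-(1 / (k : ℝ))) / Δ) ^ (1 / (d : ℝ)) * z) := by rw [hc]; ring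
      _ = Real.pi * t * (k / (k + 1)) * (d * P ^ (-(1 / (d : ℝ)))) := by rw [this]; ring
      _ ≤ Real.pi * t * (k / (k + 1)) * S := by gcongr
      _ = _ := by ring
  have h3 : Real.exp (-(Real.pi * t) * S) ≤ Real.exp (-(τ * (S * q⁻¹))) * Real.exp (-(c * z)) := by
    rw [← Real.exp_add, Real.exp_le_exp]
    have : Real.pi * t * S = Real.pi * t * S / (k + 1) + Real.pi * t * S * (k / (k + 1)) := by
      field_simp
      ring
    linarith
  calc _ ≤ (Real.exp (-(τ * (S * q⁻¹))) * Real.exp (-(c * z))) * D ^ (-(k / 2 + 2 * d : ℝ)) *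
        ∏ i, (1 + x i * q) ^ 2 := by
        have : 0 ≤ ∏ i, (1 + x i * q) ^ 2 := Finset.prod_nonneg fun i _ => by positivity
        gcongr
    _ = (Real.exp (-(τ * (S * q⁻¹))) * ∏ i, (1 + x i * q) ^ 2) *
        (Real.exp (-(c * z)) * D ^ (-(k / 2 + 2 * d : ℝ))) := by ring
    _ ≤ ((1 + P * b ^ 2) ^ (2 * d) *
        ((2 * d ^ 2).factorial * (τ ^ (2 * d ^ 2))⁻¹ * Real.exp τ)) *
        (Real.exp (-(c * z)) * D ^ (-(k / 2 + 2 * d : ℝ))) := by gcongr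
    _ = ((2 * d ^ 2).factorial * (τ ^ (2 * d ^ 2))⁻¹ * Real.exp τ) *
        (Real.exp (-(c * z)) * D ^ (-(k / 2 + 2 * d : ℝ)) * (1 + P * b ^ 2) ^ (2 * d)) := by ring
    _ ≤ ((2 * d ^ 2).factorial * (τ ^ (2 * d ^ 2))⁻¹ * Real.exp τ) *
        (2 ^ (2 * d) * bulkConst d Δ k * D₀ ^ (-((k - 1) / 2 + 2 * d + 1 : ℝ)) * (b ^ 2)⁻¹) := by
        gcongr
    _ = _ := by
        change _ = ((2 * d ^ 2).factorial * (τ ^ (2 * d ^ 2))⁻¹ * Real.exp τ) *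
          (2 ^ (2 * d) * bulkConst d Δ k) * D₀ ^ (-((k - 1) / 2 + 2 * d + 1 : ℝ)) * (b ^ 2)⁻¹
        ring

end TotReal

namespace TotReal

open NumberField Module Filter Asymptotics
open scoped nonZeroDivisors

variable (K : Type) [Field K] [NumberField K]

theorem summable_card_ideal :
    Summable fun n : ℕ => (Nat.card {I : Ideal (𝓞 K) // Ideal.absNorm I = n} : ℝ) *
      ((n : ℝ) ^ 2)⁻¹ := by
  set f : ℕ → ℝ := fun n => Nat.card {I : Ideal (𝓞 K) // Ideal.absNorm I = n}
  have hO : (fun n ↦ ∑ k ∈ Finset.Icc 1 n, f k) =O[atTop] fun n ↦ (n : ℝ) ^ (1 : ℝ) := by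
    have h := ((Ideal.tendsto_norm_le_div_atTop₀ K).comp tendsto_natCast_atTop_atTop).isBigO_one ℝ
    have h2 : (fun n : ℕ => (n : ℝ)) =O[atTop] fun n : ℕ => (n : ℝ) := isBigO_refl _ _
    have h3 := h.mul h2
    refine (h3.congr' ?_ ?_)
    · filter_upwards [eventually_gt_atTop 0] with n hn
      have hn' : (n : ℝ) ≠ 0 := by positivity
      simp only [Function.comp_apply, Nat.cast_le, f]
      rw [div_mul_cancel₀ _ hn', ← Nat.cast_sum]
      congr
      rw [← add_left_inj 1, ← Ideal.card_norm_le_eq_card_norm_le_add_one,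
        show Finset.Icc 1 n = Finset.Ioc 0 n from Finset.Icc_succ_left_eq_Ioc _ _,
        show 1 = Nat.card {I : Ideal (𝓞 K) // Ideal.absNorm I = 0} by
          simp [Ideal.absNorm_eq_zero_iff],
        Finset.sum_Ioc_add_eq_sum_Icc (n.zero_le),
        ← Finset.card_preimage_eq_sum_card_image_eq
          (fun k _ ↦ Ideal.finite_setOfPred_absNorm_eq k)]
      simp [Set.coe_eq_subtype]
    · filter_upwards with n
      simp
  have h := LSeriesSummable_of_sum_norm_bigO_and_nonneg (s := 2) hO (fun n => by positivity)
    zero_le_one (by norm_num)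
  have h := h.norm
  refine h.congr fun n => ?_
  rw [LSeries.norm_term_eq]
  rcases eq_or_ne n 0 with rfl | hn
  · simp
  · rw [if_neg hn]
    simp [f, div_eq_mul_inv]

theorem tsum_absNorm_ne_top :
    (∑' I : Ideal (𝓞 K), ENNReal.ofReal (((Ideal.absNorm I : ℝ) ^ 2)⁻¹)) ≠ ⊤ := by
  rw [← (Equiv.sigmaFiberEquiv (fun I : Ideal (𝓞 K) => Ideal.absNorm I)).tsum_eq,
    ENNReal.tsum_sigma']
  have : ∀ n : ℕ, (∑' I : {I : Ideal (𝓞 K) // Ideal.absNorm I = n}, ENNReal.ofReal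
      (((Ideal.absNorm (Equiv.sigmaFiberEquiv (fun I : Ideal (𝓞 K) => Ideal.absNorm I)
        ⟨n, I⟩) : ℝ) ^ 2)⁻¹)) =
      ENNReal.ofReal ((Nat.card {I : Ideal (𝓞 K) // Ideal.absNorm I = n} : ℝ) *
        ((n : ℝ) ^ 2)⁻¹) := by
    intro n
    have hfin : Finite {I : Ideal (𝓞 K) // Ideal.absNorm I = n} :=
      Ideal.finite_setOfPred_absNorm_eq n
    have := Fintype.ofFinite {I : Ideal (𝓞 K) // Ideal.absNorm I = n}
    rw [tsum_fintype, Finset.sum_congr rfl (g := fun _ => ENNReal.ofReal (((n : ℝ) ^ 2)⁻¹))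
      (fun I _ => by simp only [Equiv.sigmaFiberEquiv_apply]; rw [I.2]), Finset.sum_const,
      Finset.card_univ, nsmul_eq_mul, ENNReal.ofReal_mul (by positivity),
      ENNReal.ofReal_natCast, Nat.card_eq_fintype_card]
  rw [tsum_congr this]
  exact (summable_card_ideal K).tsum_ofReal_ne_top

theorem tsum_prod_eq_pow (f : ℕ → ENNReal) (n : ℕ) :
    ∑' i : Fin n → ℕ, ∏ s, f (i s) = (∑' m, f m) ^ n := by
  induction n with
  | zero => simp
  | succ n ih =>
    rw [← (Fin.consEquiv (fun _ => ℕ)).tsum_eq, ENNReal.tsum_prod', pow_succ', ← ih,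
      ← ENNReal.tsum_mul_right]
    refine tsum_congr fun m => ?_
    rw [← ENNReal.tsum_mul_left]
    refine tsum_congr fun i => ?_
    rw [Fin.prod_univ_succ]
    rfl

theorem tsum_prod_inv_sq_ne_top (ι : Type) [Fintype ι] :
    (∑' i : ι → ℕ, ENNReal.ofReal (∏ s, ((1 + (i s : ℝ)) ^ 2)⁻¹)) ≠ ⊤ := by
  have h : ∀ i : ι → ℕ, ENNReal.ofReal (∏ s, ((1 + (i s : ℝ)) ^ 2)⁻¹) =
      ∏ s, ENNReal.ofReal (((1 + (i s : ℝ)) ^ 2)⁻¹) := fun i =>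
    ENNReal.ofReal_prod_of_nonneg fun _ _ => by positivity
  rw [tsum_congr h, ← ((Fintype.equivFin ι).arrowCongr (Equiv.refl ℕ)).symm.tsum_eq]
  have h2 : ∀ i : Fin (Fintype.card ι) → ℕ,
      (∏ s, ENNReal.ofReal (((1 + ((((Fintype.equivFin ι).arrowCongr
        (Equiv.refl ℕ)).symm i s : ℕ) : ℝ)) ^ 2)⁻¹)) =
      ∏ s, ENNReal.ofReal (((1 + (i s : ℝ)) ^ 2)⁻¹) := fun i =>
    (Fintype.equivFin ι).prod_comp (fun s => ENNReal.ofReal (((1 + (i s : ℝ)) ^ 2)⁻¹))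
  rw [tsum_congr h2, tsum_prod_eq_pow (fun m => ENNReal.ofReal (((1 + (m : ℝ)) ^ 2)⁻¹))]
  refine ENNReal.pow_ne_top (Summable.tsum_ofReal_ne_top ?_)
  have := (summable_nat_add_iff 1).2 (Real.summable_nat_pow_inv (p := 2).2 one_lt_two)
  refine this.congr fun n => ?_
  push_cast
  rw [add_comm]

end TotReal

namespace TotReal

open NumberField Module
open scoped nonZeroDivisors

set_option linter.unusedSectionVars false

variable {K : Type} [Field K] [NumberField K] [IsTotallyReal K]

variable (K) in
/-- Pairs of weights and integral lattices in rigid position. -/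
def rigidPairs (k : ℕ) : Set ((Fin k → K) × Submodule (𝓞 K) (Fin k → K)) :=
  {p | Rigid p.1 p.2 ∧ IsLat p.2 ∧ p.2 ≤ dualLat (diagB p.1) p.2}

theorem tail_mem_rigidPairs {k : ℕ} {p : (Fin (k + 1) → K) × Submodule (𝓞 K) (Fin (k + 1) → K)}
    (hp : p ∈ rigidPairs K (k + 1)) : (Fin.tail p.1, tailLat p.2) ∈ rigidPairs K k :=
  ⟨hp.1.2.2, hp.2.1.tail, tail_integral hp.2.2⟩

/-- The ideal of integral first coordinates of a lattice. -/
def headInt {k : ℕ} (L : Submodule (𝓞 K) (Fin (k + 1) → K)) : Ideal (𝓞 K) :=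
  (headIdeal L).comap (Algebra.linearMap (𝓞 K) K)

theorem mem_headInt {k : ℕ} {L : Submodule (𝓞 K) (Fin (k + 1) → K)} {a : 𝓞 K} :
    a ∈ headInt L ↔ ∃ x ∈ L, x 0 = (a : K) := Iff.rfl

theorem coe_headInt {k : ℕ} {L : Submodule (𝓞 K) (Fin (k + 1) → K)} (h : IsLat L)
    (hi : ∀ x ∈ L, IsIntegral ℤ (x 0)) :
    (headInt L : FractionalIdeal (𝓞 K)⁰ K) = headFrac L h := by
  ext a
  rw [FractionalIdeal.mem_coeIdeal, mem_headFrac]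
  constructor
  · rintro ⟨b, hb, rfl⟩
    exact hb
  · rintro ⟨x, hx, rfl⟩
    obtain ⟨b, hb⟩ := integral_iff.1 (hi x hx)
    exact ⟨b, ⟨x, hx, hb.symm⟩, hb⟩

theorem headInt_ne_bot {k : ℕ} {L : Submodule (𝓞 K) (Fin (k + 1) → K)} (h : IsLat L)
    (hi : ∀ x ∈ L, IsIntegral ℤ (x 0)) : headInt L ≠ ⊥ := by
  intro h0
  have := coe_headInt h hi
  rw [h0, FractionalIdeal.coeIdeal_bot] at this
  exact headFrac_ne_zero h this.symm

/-- An element generating `J` modulo `D J`. -/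
noncomputable def modGen (J : Ideal (𝓞 K)) (D : ℕ) : 𝓞 K :=
  Classical.epsilon fun c => Ideal.span {(D : 𝓞 K)} * J ⊔ Ideal.span {c} = J

theorem modGen_spec {J : Ideal (𝓞 K)} (hJ : J ≠ ⊥) {D : ℕ} (hD : 0 < D) :
    Ideal.span {(D : 𝓞 K)} * J ⊔ Ideal.span {modGen J D} = J := by
  refine Classical.epsilon_spec (p := fun c => Ideal.span {(D : 𝓞 K)} * J ⊔ Ideal.span {c} = J)
    (IsDedekindDomain.exists_sup_span_eq Ideal.mul_le_right ?_)
  refine mul_ne_zero ?_ hJ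
  rw [Ne, Ideal.zero_eq_bot, Ideal.span_singleton_eq_bot]
  exact_mod_cast hD.ne'

theorem modGen_mem {J : Ideal (𝓞 K)} (hJ : J ≠ ⊥) {D : ℕ} (hD : 0 < D) : modGen J D ∈ J := by
  have h := modGen_spec hJ hD
  rw [← Ideal.span_singleton_le_iff_mem]
  exact le_sup_right.trans h.le

theorem exists_modGen {J : Ideal (𝓞 K)} (hJ : J ≠ ⊥) {D : ℕ} (hD : 0 < D) {x : 𝓞 K}
    (hx : x ∈ J) : ∃ a : 𝓞 K, ∃ b ∈ J, x = D * b + a * modGen J D := by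
  rw [← modGen_spec hJ hD, Submodule.mem_sup] at hx
  obtain ⟨y, hy, z, hz, rfl⟩ := hx
  obtain ⟨b, hb, rfl⟩ := Ideal.mem_span_singleton_mul.1 hy
  obtain ⟨a, rfl⟩ := Ideal.mem_span_singleton'.1 hz
  exact ⟨a, b, hb, rfl⟩

/-- A vector extending the coordinate `c` to an element of `L`. -/
noncomputable def headLift {k : ℕ} (L : Submodule (𝓞 K) (Fin (k + 1) → K)) (c : 𝓞 K) :
    Fin k → K :=
  Classical.epsilon fun z => (Fin.cons (c : K) z : Fin (k + 1) → K) ∈ L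

theorem headLift_spec {k : ℕ} {L : Submodule (𝓞 K) (Fin (k + 1) → K)} {c : 𝓞 K}
    (hc : c ∈ headInt L) : (Fin.cons (c : K) (headLift L c) : Fin (k + 1) → K) ∈ L := by
  obtain ⟨x, hx, h0⟩ := mem_headInt.1 hc
  refine Classical.epsilon_spec (p := fun z => (Fin.cons (c : K) z : Fin (k + 1) → K) ∈ L)
    ⟨Fin.tail x, ?_⟩
  rwa [← h0, Fin.cons_self_tail]

theorem tail_mem_dual {k : ℕ} {w : Fin (k + 1) → K} {L : Submodule (𝓞 K) (Fin (k + 1) → K)}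
    (hi : L ≤ dualLat (diagB w) L) {x : Fin (k + 1) → K} (hx : x ∈ L) :
    Fin.tail x ∈ dualLat (diagB (Fin.tail w)) (tailLat L) := by
  intro y hy
  have h := hi hx _ (mem_tailLat.1 hy)
  rwa [diagB_succ, Fin.cons_zero, mul_zero, zero_add, Fin.tail_cons] at h

theorem disc_smul_mem {k : ℕ} {w : Fin k → K} {L : Submodule (𝓞 K) (Fin k → K)}
    {x : Fin k → K} (hx : x ∈ dualLat (diagB w) L) : (disc (diagB w) L : ℕ) • x ∈ L :=
  AddSubgroup.nsmul_relIndex_mem L.toAddSubgroup (K := (dualLat (diagB w) L).toAddSubgroup) hx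

/-- The lattice is determined by its tail, its head ideal and one lifted vector. -/
theorem le_of_headLift {k : ℕ} {w w' : Fin (k + 1) → K}
    {L L' : Submodule (𝓞 K) (Fin (k + 1) → K)} (hL : IsLat L)
    (h0 : ∀ x ∈ L, IsIntegral ℤ (x 0))
    (hi : L ≤ dualLat (diagB w) L) (hi' : L' ≤ dualLat (diagB w') L')
    (hw : Fin.tail w = Fin.tail w') (ht : tailLat L = tailLat L') (hJ : headInt L = headInt L')
    (hD : 0 < disc (diagB (Fin.tail w)) (tailLat L)) {z : Fin k → K}
    (hz : (Fin.cons (modGen (headInt L) (disc (diagB (Fin.tail w)) (tailLat L)) : K) z :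
      Fin (k + 1) → K) ∈ L)
    (hz' : (Fin.cons (modGen (headInt L) (disc (diagB (Fin.tail w)) (tailLat L)) : K) z :
      Fin (k + 1) → K) ∈ L') : L ≤ L' := by
  intro x hx
  obtain ⟨x0, hx0⟩ := integral_iff.1 (h0 x hx)
  have hxJ : x0 ∈ headInt L := ⟨x, hx, hx0.symm⟩
  obtain ⟨a, b, hb, hab⟩ := exists_modGen (headInt_ne_bot hL h0) hD hxJ
  obtain ⟨y, hy, hyb⟩ := mem_headInt.1 hb
  obtain ⟨y', hy', hyb'⟩ := mem_headInt.1 (hJ ▸ hb)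
  set D := disc (diagB (Fin.tail w)) (tailLat L)
  set c : Fin (k + 1) → K := Fin.cons (modGen (headInt L) D : K) z
  have hyD : D • y ∈ L' := by
    have h1 : D • (Fin.tail y - Fin.tail y') ∈ tailLat L := by
      refine disc_smul_mem (Submodule.sub_mem _ (tail_mem_dual hi hy) ?_)
      rw [hw, ht]
      exact tail_mem_dual hi' hy'
    rw [ht, mem_tailLat] at h1
    have h2 : D • y = D • y' + Fin.cons 0 (D • (Fin.tail y - Fin.tail y')) := by
      ext i
      refine Fin.cases ?_ (fun i => ?_) i
      · simp [hyb, hyb']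
      · simp [Fin.tail, mul_sub]
    rw [h2]
    exact L'.add_mem (nsmul_mem hy' D) h1
  have h3 : x - D • y - a • c ∈ L :=
    L.sub_mem (L.sub_mem hx (nsmul_mem hy D)) (L.smul_mem a hz)
  have h4 : x - D • y - a • c = Fin.cons 0 (Fin.tail (x - D • y - a • c)) := by
    ext i
    refine Fin.cases ?_ (fun i => ?_) i
    · have h5 : (x0 : K) = D * b + a * (modGen (headInt L) D : K) := by
        rw [hab]; push_cast; ring
      simp [c, ← hx0, h5, hyb, Algebra.smul_def]
    · rfl
  have h5 : x - D • y - a • c ∈ L' := by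
    rw [h4] at h3 ⊢
    rw [← mem_tailLat, ← ht]
    exact h3
  have h6 : x = (x - D • y - a • c) + D • y + a • c := by abel
  rw [h6]
  exact L'.add_mem (L'.add_mem h5 hyD) (L'.smul_mem a hz')

/-- Two rigid weights of the same lattice whose heads are close coincide. -/
theorem head_eq_of_close {k : ℕ} {w w' : Fin (k + 1) → K}
    {L : Submodule (𝓞 K) (Fin (k + 1) → K)} (hL : IsLat L)
    (h0 : ∀ x ∈ L, IsIntegral ℤ (x 0))
    (hi : L ≤ dualLat (diagB w) L) (hi' : L ≤ dualLat (diagB w') L)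
    (hw : Fin.tail w = Fin.tail w')
    (hc : ∀ σ : K →+* ℝ, |σ (w 0) - σ (w' 0)| *
      ((Ideal.absNorm (headInt L) : ℝ) ^ 2) ^ (1 / (finrank ℚ K : ℝ)) < 1) : w 0 = w' 0 := by
  by_contra hne
  set δ := w 0 - w' 0 with hδ
  have hδ0 : δ ≠ 0 := sub_ne_zero.2 hne
  set J := headFrac L hL
  have hle : FractionalIdeal.spanSingleton (𝓞 K)⁰ δ * (J * J) ≤ 1 := by
    rw [FractionalIdeal.spanSingleton_mul_le_iff]
    intro z hz
    have : J * J ≤ FractionalIdeal.spanSingleton (𝓞 K)⁰ δ⁻¹ := by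
      rw [FractionalIdeal.mul_le]
      intro a ha b hb
      obtain ⟨x, hx, rfl⟩ := mem_headFrac.1 ha
      obtain ⟨y, hy, rfl⟩ := mem_headFrac.1 hb
      have h1 := (hi hx _ hy).sub (hi' hx _ hy)
      rw [diagB_succ, diagB_succ, hw, add_sub_add_right_eq_sub] at h1
      obtain ⟨e, he⟩ := integral_iff.1 h1
      rw [FractionalIdeal.mem_spanSingleton]
      refine ⟨e, ?_⟩
      rw [Algebra.smul_def]
      change (e : K) * δ⁻¹ = _
      rw [he, hδ]
      field_simp
    have h2 := this hz
    rw [FractionalIdeal.mem_spanSingleton] at h2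
    obtain ⟨e, rfl⟩ := h2
    rw [FractionalIdeal.mem_one_iff]
    refine ⟨e, ?_⟩
    rw [Algebra.smul_def]
    field_simp
  obtain ⟨I, hI⟩ := FractionalIdeal.le_one_iff_exists_coeIdeal.1 hle
  have hI0 : I ≠ ⊥ := by
    rintro rfl
    rw [FractionalIdeal.coeIdeal_bot] at hI
    have hJ := headFrac_ne_zero hL
    exact mul_ne_zero (FractionalIdeal.spanSingleton_ne_zero_iff.2 hδ0) (mul_ne_zero hJ hJ) hI.symm
  have hN := congrArg FractionalIdeal.absNorm hI
  rw [FractionalIdeal.coeIdeal_absNorm, map_mul, map_mul, FractionalIdeal.absNorm_span_singleton,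
    show J = headFrac L hL from rfl, ← coe_headInt hL h0, FractionalIdeal.coeIdeal_absNorm] at hN
  have h1 : (1 : ℝ) ≤ Ideal.absNorm I := by
    exact_mod_cast Nat.pos_of_ne_zero (fun h => hI0 (Ideal.absNorm_eq_zero_iff.1 h))
  have hN' : (Ideal.absNorm I : ℝ) = |(Algebra.norm ℚ δ : ℝ)| *
      ((Ideal.absNorm (headInt L) : ℝ) * (Ideal.absNorm (headInt L) : ℝ)) := by
    exact_mod_cast congrArg (fun q : ℚ => (q : ℝ)) hN
  set b : ℝ := (Ideal.absNorm (headInt L) : ℝ)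
  have hb0 : 0 ≤ b := Nat.cast_nonneg _
  set q := (b ^ 2) ^ (1 / (finrank ℚ K : ℝ)) with hq
  have hqd : q ^ Fintype.card (K →+* ℝ) = b ^ 2 := by
    rw [hq, card_emb, one_div, Real.rpow_inv_natCast_pow (by positivity) finrank_pos.ne']
  have h2 : ∏ σ : K →+* ℝ, (|σ δ| * q) < 1 := by
    have h3 : ∏ σ : K →+* ℝ, (|σ δ| * q) ≤ ∏ σ : K →+* ℝ, (1 : ℝ) :=
      Finset.prod_le_prod (fun σ _ => by positivity) fun σ _ => by
        rw [hδ, map_sub]; exact (hc σ).le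
    by_cases hq0 : q = 0
    · rw [hq0]
      simp
    · refine (Finset.prod_lt_prod_of_nonempty (g := fun _ => (1 : ℝ)) (fun σ _ => ?_)
        (fun σ _ => ?_) Finset.univ_nonempty).trans_eq (by simp)
      · have := (map_ne_zero σ).2 hδ0
        positivity
      · rw [hδ, map_sub]; exact hc σ
  rw [Finset.prod_mul_distrib, Finset.prod_const, Finset.card_univ, hqd, ← Finset.abs_prod,
    prod_emb] at h2
  rw [hN'] at h1
  nlinarith

theorem disc_pos_of_mem {k : ℕ} {p : (Fin k → K) × Submodule (𝓞 K) (Fin k → K)}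
    (hp : p ∈ rigidPairs K k) : 0 < disc (diagB p.1) p.2 :=
  disc_pos_diag hp.1.pos hp.2.1 hp.2.2

variable (K) in
/-- The sum of the weights of rigid pairs of rank `k`, damped by the discriminant. -/
noncomputable def rigidSum (k : ℕ) : ENNReal :=
  ∑' p : rigidPairs K k, ENNReal.ofReal (wt p.1.1 p.1.2 *
    (disc (diagB p.1.1) p.1.2 : ℝ) ^ (-(k / 2 + 2 * finrank ℚ K : ℝ)))

/-- The discriminant group of a lattice. -/
abbrev DiscGroup {k : ℕ} (p : (Fin k → K) × Submodule (𝓞 K) (Fin k → K)) : Type :=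
  (dualLat (diagB p.1) p.2).toAddSubgroup ⧸
    p.2.toAddSubgroup.addSubgroupOf (dualLat (diagB p.1) p.2).toAddSubgroup

variable (K) in
/-- The data determining a rigid pair. -/
abbrev RigidCode (k : ℕ) : Type :=
  Σ p : rigidPairs K k, Ideal (𝓞 K) × DiscGroup p.1 × ((K →+* ℝ) → ℕ)

/-- The scaled size of the head of a rigid pair at an embedding. -/
noncomputable def headSize {k : ℕ} (p : (Fin (k + 1) → K) × Submodule (𝓞 K) (Fin (k + 1) → K))
    (σ : K →+* ℝ) : ℝ :=
  σ (p.1 0) * ((Ideal.absNorm (headInt p.2) : ℝ) ^ 2) ^ (1 / (finrank ℚ K : ℝ))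

theorem cons_headLift_mem {k : ℕ} {L : Submodule (𝓞 K) (Fin (k + 1) → K)} (h : IsLat L)
    (hi : ∀ x ∈ L, IsIntegral ℤ (x 0)) {D : ℕ} (hD : 0 < D) :
    (Fin.cons (modGen (headInt L) D : K) (headLift L (modGen (headInt L) D)) :
      Fin (k + 1) → K) ∈ L :=
  headLift_spec (modGen_mem (headInt_ne_bot h hi) hD)

theorem headLift_mem {k : ℕ} {p : (Fin (k + 1) → K) × Submodule (𝓞 K) (Fin (k + 1) → K)}
    (hp : p ∈ rigidPairs K (k + 1)) :
    (Fin.cons (modGen (headInt p.2) (disc (diagB (Fin.tail p.1)) (tailLat p.2)) : K)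
      (headLift p.2 (modGen (headInt p.2) (disc (diagB (Fin.tail p.1)) (tailLat p.2)))) :
      Fin (k + 1) → K) ∈ p.2 := by
  obtain ⟨w, L⟩ := p
  obtain ⟨⟨hp, h0, hr⟩, hL, hi⟩ := hp
  generalize hw : disc (diagB (Fin.tail (w, L).1)) (tailLat (w, L).2) = D
  have hD : 0 < D := hw ▸ disc_pos_diag hr.pos hL.tail (tail_integral hi)
  exact cons_headLift_mem hL h0 hD

theorem headLift_mem_dual {k : ℕ} {p : (Fin (k + 1) → K) × Submodule (𝓞 K) (Fin (k + 1) → K)}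
    (hp : p ∈ rigidPairs K (k + 1)) :
    headLift p.2 (modGen (headInt p.2) (disc (diagB (Fin.tail p.1)) (tailLat p.2))) ∈
      dualLat (diagB (Fin.tail p.1)) (tailLat p.2) := by
  have := tail_mem_dual hp.2.2 (headLift_mem hp)
  rwa [Fin.tail_cons] at this

/-- The code of a rigid pair. -/
noncomputable def rigidCode {k : ℕ} (p : rigidPairs K (k + 1)) : RigidCode K k :=
  ⟨⟨_, tail_mem_rigidPairs p.2⟩, headInt p.1.2,
    QuotientAddGroup.mk ⟨_, headLift_mem_dual p.2⟩, fun σ => ⌊headSize p.1 σ⌋₊⟩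

theorem rigidCode_injective {k : ℕ} :
    Function.Injective (rigidCode : rigidPairs K (k + 1) → RigidCode K k) := by
  rintro ⟨⟨w, L⟩, hp⟩ ⟨⟨w', L'⟩, hp'⟩ h
  have hD := disc_pos_of_mem (tail_mem_rigidPairs hp)
  have hz := headLift_mem hp
  have hz' := headLift_mem hp'
  have hzd := headLift_mem_dual hp
  have hzd' := headLift_mem_dual hp'
  simp only at hz hz' hzd hzd' hD
  rw [rigidCode, rigidCode, Sigma.mk.injEq] at h
  obtain ⟨h1, h2⟩ := h
  rw [Subtype.mk.injEq, Prod.mk.injEq] at h1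
  obtain ⟨hw, ht⟩ := h1
  simp only at hw ht
  have key : ∀ (w₁ : Fin k → K) (M : Submodule (𝓞 K) (Fin k → K)) (hM : (w₁, M) ∈ rigidPairs K k),
      Fin.tail w' = w₁ → tailLat L' = M → ∀ (J J' : Ideal (𝓞 K)) (z z' : Fin k → K)
      (hz : z ∈ dualLat (diagB (Fin.tail w)) (tailLat L)) (hz' : z' ∈ dualLat (diagB w₁) M)
      (i i' : (K →+* ℝ) → ℕ),
      HEq ((J, QuotientAddGroup.mk ⟨z, hz⟩, i) : Ideal (𝓞 K) ×
        DiscGroup (Fin.tail w, tailLat L) × ((K →+* ℝ) → ℕ))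
        ((J', QuotientAddGroup.mk ⟨z', hz'⟩, i') : Ideal (𝓞 K) × DiscGroup (w₁, M) ×
          ((K →+* ℝ) → ℕ)) → Fin.tail w = w₁ → tailLat L = M →
      J = J' ∧ z' - z ∈ tailLat L ∧ i = i' := by
    rintro _ _ hM - - J J' z z' hz hz' i i' h rfl rfl
    have h := eq_of_heq h
    rw [Prod.mk.injEq, Prod.mk.injEq] at h
    refine ⟨h.1, ?_, h.2.2⟩
    have h3 := QuotientAddGroup.eq.1 h.2.1
    rw [AddSubgroup.mem_addSubgroupOf] at h3
    have h4 : -z + z' ∈ tailLat L := h3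
    rwa [neg_add_eq_sub] at h4
  obtain ⟨hJ, hzz, hf⟩ := key _ _ (tail_mem_rigidPairs hp') rfl rfl _ _ _ _ hzd hzd' _ _ h2 hw ht
  simp only at hJ hzz
  rw [← hJ, ← hw, ← ht] at hz' hzz
  have hz2 : (Fin.cons (modGen (headInt L) (disc (diagB (Fin.tail w)) (tailLat L)) : K)
      (headLift L (modGen (headInt L) (disc (diagB (Fin.tail w)) (tailLat L)))) :
      Fin (k + 1) → K) ∈ L' := by
    rw [ht, mem_tailLat] at hzz
    have := L'.sub_mem hz' hzz
    rw [← ht] at this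
    convert this using 1
    ext i
    refine Fin.cases ?_ (fun i => ?_) i <;> simp
  have hLL : L = L' := by
    refine le_antisymm (le_of_headLift hp.2.1 hp.1.2.1 hp.2.2 hp'.2.2 hw ht hJ hD hz hz2) ?_
    refine le_of_headLift hp'.2.1 hp'.1.2.1 hp'.2.2 hp.2.2 hw.symm ht.symm hJ.symm ?_ (z :=
      headLift L (modGen (headInt L) (disc (diagB (Fin.tail w)) (tailLat L)))) ?_ ?_
    · simp only
      rw [← hw, ← ht]
      exact hD
    · simp only
      rw [← hw, ← ht, ← hJ]
      exact hz2
    · simp only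
      rw [← hw, ← ht, ← hJ]
      exact hz
  subst hLL
  have h0 : w 0 = w' 0 := by
    refine head_eq_of_close hp.2.1 hp.1.2.1 hp.2.2 hp'.2.2 hw fun σ => ?_
    have h1 := congrFun hf σ
    simp only [headSize] at h1
    set q := ((Ideal.absNorm (headInt L) : ℝ) ^ 2) ^ (1 / (finrank ℚ K : ℝ))
    have hq : 0 ≤ q := by positivity
    have h3 := Nat.floor_le (mul_nonneg (hp.1.1 σ).le hq)
    have h4 := Nat.lt_floor_add_one (σ (w 0) * q)
    have h5 := Nat.floor_le (mul_nonneg (hp'.1.1 σ).le hq)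
    have h6 := Nat.lt_floor_add_one (σ (w' 0) * q)
    simp only at h3 h5
    rw [h1] at h3 h4
    rw [← abs_of_nonneg hq, ← abs_mul, sub_mul, abs_lt]
    constructor <;> linarith
  have hww : w = w' := by
    rw [← Fin.cons_self_tail w, ← Fin.cons_self_tail w', h0, hw]
  subst hww
  rfl

theorem headInt_pos {k : ℕ} {p : (Fin (k + 1) → K) × Submodule (𝓞 K) (Fin (k + 1) → K)}
    (hp : p ∈ rigidPairs K (k + 1)) : 1 ≤ Ideal.absNorm (headInt p.2) := by
  obtain ⟨w, L⟩ := p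
  obtain ⟨⟨hp, h0, hr⟩, hL, hi⟩ := hp
  exact Nat.pos_of_ne_zero fun h => headInt_ne_bot hL h0 (Ideal.absNorm_eq_zero_iff.1 h)

theorem disc_eq_of_mem {k : ℕ} {p : (Fin (k + 1) → K) × Submodule (𝓞 K) (Fin (k + 1) → K)}
    (hp : p ∈ rigidPairs K (k + 1)) : (disc (diagB p.1) p.2 : ℝ) =
      disc (diagB (Fin.tail p.1)) (tailLat p.2) *
        ((∏ σ : K →+* ℝ, σ (p.1 0)) * (Ideal.absNorm (headInt p.2) : ℝ) ^ 2) := by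
  obtain ⟨w, L⟩ := p
  obtain ⟨⟨hw, h0, hr⟩, hL, hi⟩ := hp
  have hpos : ∀ i (σ : K →+* ℝ), 0 < σ (w i) := fun i => Fin.cases hw (fun i => hr.pos i) i
  have h := disc_succ hpos hL hi
  rw [← coe_headInt hL h0, FractionalIdeal.coeIdeal_absNorm] at h
  simp only
  rw [h, prod_emb]
  push_cast
  rfl

/-- The weight of a rigid pair is bounded by a product over its code. -/
theorem wt_le_code {k : ℕ} (p : rigidPairs K (k + 1)) :
    wt p.1.1 p.1.2 * (disc (diagB p.1.1) p.1.2 : ℝ) ^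
        (-(((k + 1 : ℕ) : ℝ) / 2 + 2 * finrank ℚ K : ℝ)) ≤
      stepConst (finrank ℚ K) |(discr K : ℝ)| (k + 1) *
        (wt (Fin.tail p.1.1) (tailLat p.1.2) *
          (disc (diagB (Fin.tail p.1.1)) (tailLat p.1.2) : ℝ) ^
            (-(k / 2 + 2 * finrank ℚ K + 1 : ℝ))) *
        ((Ideal.absNorm (headInt p.1.2) : ℝ) ^ 2)⁻¹ *
        ∏ σ : K →+* ℝ, ((1 + (⌊headSize p.1 σ⌋₊ : ℝ)) ^ 2)⁻¹ := by
  have h1 : (1 : ℝ) ≤ disc (diagB p.1.1) p.1.2 := by exact_mod_cast disc_pos_of_mem p.2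
  have h2 : (1 : ℝ) ≤ disc (diagB (Fin.tail p.1.1)) (tailLat p.1.2) := by
    exact_mod_cast disc_pos_of_mem (tail_mem_rigidPairs p.2)
  have h3 : (1 : ℝ) ≤ Ideal.absNorm (headInt p.1.2) := by exact_mod_cast headInt_pos p.2
  have hw : ∀ σ : K →+* ℝ, 0 < σ (p.1.1 0) := fun σ => p.2.1.pos 0 σ
  have h := step_bound (k := k + 1) (card_emb (K := K)) k.succ_pos hw (abs_discr_pos (K :=
      K)) h1 h2 h3
    (disc_eq_of_mem p.2)
  have hwt : wt p.1.1 p.1.2 = Real.exp (-(Real.pi * tpar K (k + 1) (disc (diagB p.1.1) p.1.2)) *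
      ∑ σ : K →+* ℝ, (σ (p.1.1 0))⁻¹) * wt (Fin.tail p.1.1) (tailLat p.1.2) := rfl
  have htp : tpar K (k + 1) (disc (diagB p.1.1) p.1.2) =
      ((4 : ℝ) ^ (-(1 / ((k + 1 : ℕ) : ℝ))) * (disc (diagB p.1.1) p.1.2 : ℝ) ^
        (1 / (((k + 1 : ℕ) : ℝ) + 1)) / |(discr K : ℝ)|) ^ (1 / (finrank ℚ K : ℝ)) := by
    rw [tpar, neg_div]
  rw [← htp] at h
  have hfl : ∏ σ : K →+* ℝ, (1 + (⌊headSize p.1 σ⌋₊ : ℝ)) ^ 2 ≤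
      ∏ σ : K →+* ℝ, (1 + σ (p.1.1 0) * ((Ideal.absNorm (headInt p.1.2) : ℝ) ^ 2) ^
        (1 / (finrank ℚ K : ℝ))) ^ 2 := by
    refine Finset.prod_le_prod (fun _ _ => by positivity) fun σ _ => ?_
    have : (⌊headSize p.1 σ⌋₊ : ℝ) ≤ headSize p.1 σ :=
      Nat.floor_le (mul_nonneg (hw σ).le (by positivity))
    have h4 : headSize p.1 σ = σ (p.1.1 0) * ((Ideal.absNorm (headInt p.1.2) : ℝ) ^ 2) ^
        (1 / (finrank ℚ K : ℝ)) := rfl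
    rw [← h4]
    gcongr
  rw [hwt, Finset.prod_inv_distrib, ← div_eq_mul_inv, le_div_iff₀
    (Finset.prod_pos fun _ _ => by positivity)]
  have h5 := wt_pos (Fin.tail p.1.1) (tailLat p.1.2)
  have h6 : (-(((((k + 1 : ℕ) : ℝ) - 1) / 2 + 2 * finrank ℚ K + 1 : ℝ))) =
      (-(k / 2 + 2 * finrank ℚ K + 1 : ℝ)) := by push_cast; ring
  rw [h6] at h
  have h7 := mul_le_mul_of_nonneg_left ((mul_le_mul_of_nonneg_left hfl
    (by positivity)).trans h) h5.le
  refine (le_of_eq ?_).trans (h7.trans (le_of_eq ?_)) <;> ring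

variable (K) in
/-- The sum over ideals of the inverse square norms. -/
noncomputable def idealSum : ENNReal :=
  ∑' I : Ideal (𝓞 K), ENNReal.ofReal (((Ideal.absNorm I : ℝ) ^ 2)⁻¹)

variable (K) in
/-- The sum over integral vectors indexed by the embeddings. -/
noncomputable def floorSum : ENNReal :=
  ∑' i : (K →+* ℝ) → ℕ, ENNReal.ofReal (∏ s, ((1 + (i s : ℝ)) ^ 2)⁻¹)

theorem card_discGroup {k : ℕ} {p : (Fin k → K) × Submodule (𝓞 K) (Fin k → K)}
    (hp : p ∈ rigidPairs K k) (c : ENNReal) :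
    ∑' _ : DiscGroup p, c = (disc (diagB p.1) p.2 : ENNReal) * c := by
  have h : Nat.card (DiscGroup p) = disc (diagB p.1) p.2 := rfl
  have h0 := disc_pos_of_mem hp
  have : Finite (DiscGroup p) := Nat.finite_of_card_ne_zero (by omega)
  have := Fintype.ofFinite (DiscGroup p)
  rw [tsum_fintype, Finset.sum_const, Finset.card_univ, ← Nat.card_eq_fintype_card, h,
    nsmul_eq_mul]

theorem rigidSum_succ (k : ℕ) : rigidSum K (k + 1) ≤
    ENNReal.ofReal (stepConst (finrank ℚ K) |(discr K : ℝ)| (k + 1)) * idealSum K *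
      floorSum K * rigidSum K k := by
  set S := stepConst (finrank ℚ K) |(discr K : ℝ)| (k + 1) with hS
  have hS0 : 0 ≤ S := stepConst_nonneg _ _ (abs_nonneg _)
  let F : RigidCode K k → ENNReal := fun c =>
    ENNReal.ofReal (wt c.1.1.1 c.1.1.2 * (disc (diagB c.1.1.1) c.1.1.2 : ℝ) ^
      (-(k / 2 + 2 * finrank ℚ K + 1 : ℝ))) *
      (ENNReal.ofReal (((Ideal.absNorm c.2.1 : ℝ) ^ 2)⁻¹) *
        ENNReal.ofReal (∏ σ : K →+* ℝ, ((1 + (c.2.2.2 σ : ℝ)) ^ 2)⁻¹))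
  have h1 : rigidSum K (k + 1) ≤ ENNReal.ofReal S * ∑' p : rigidPairs K (k + 1),
      F (rigidCode p) := by
    rw [← ENNReal.tsum_mul_left]
    refine ENNReal.tsum_le_tsum fun p => ?_
    refine (ENNReal.ofReal_le_ofReal (wt_le_code p)).trans_eq ?_
    have h5 := (wt_pos (Fin.tail p.1.1) (tailLat p.1.2)).le
    rw [ENNReal.ofReal_mul (by positivity), ENNReal.ofReal_mul (by positivity),
      ENNReal.ofReal_mul hS0, mul_assoc, mul_assoc]
    rfl
  have h2 : ∑' c : RigidCode K k, F c = rigidSum K k * (idealSum K * floorSum K) := by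
    rw [ENNReal.tsum_sigma', rigidSum, ← ENNReal.tsum_mul_right]
    refine tsum_congr fun p => ?_
    have h0 : (0 : ℝ) < disc (diagB p.1.1) p.1.2 := by exact_mod_cast disc_pos_of_mem p.2
    simp only [F]
    rw [ENNReal.tsum_mul_left]
    have h3 : ∑' b : Ideal (𝓞 K) × DiscGroup p.1 × ((K →+* ℝ) → ℕ),
        (ENNReal.ofReal (((Ideal.absNorm b.1 : ℝ) ^ 2)⁻¹) *
          ENNReal.ofReal (∏ σ : K →+* ℝ, ((1 + (b.2.2 σ : ℝ)) ^ 2)⁻¹)) =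
        idealSum K * ((disc (diagB p.1.1) p.1.2 : ENNReal) * floorSum K) := by
      rw [ENNReal.tsum_prod', idealSum, ← ENNReal.tsum_mul_right]
      refine tsum_congr fun J => ?_
      simp only
      rw [ENNReal.tsum_mul_left, ENNReal.tsum_prod']
      exact congrArg _ (card_discGroup p.2 (floorSum K))
    rw [h3, neg_add, Real.rpow_add h0, Real.rpow_neg_one, ← mul_assoc (wt _ _),
      ENNReal.ofReal_mul (by have := wt_pos p.1.1 p.1.2; positivity),
      ENNReal.ofReal_inv_of_pos h0, ENNReal.ofReal_natCast]
    have h6 : (disc (diagB p.1.1) p.1.2 : ENNReal)⁻¹ * (disc (diagB p.1.1) p.1.2 : ENNReal) = 1 :=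
      ENNReal.inv_mul_cancel (by exact_mod_cast h0.ne') (ENNReal.natCast_ne_top _)
    calc _ = _ * ((disc (diagB p.1.1) p.1.2 : ENNReal)⁻¹ *
        (disc (diagB p.1.1) p.1.2 : ENNReal)) * (idealSum K * floorSum K) := by ring
      _ = _ := by rw [h6, mul_one]
  refine h1.trans ?_
  rw [mul_assoc, mul_assoc, ← mul_assoc (idealSum K), mul_comm _ (rigidSum K k), ← h2]
  exact mul_le_mul_right (ENNReal.tsum_comp_le_tsum_of_injective rigidCode_injective F) _

theorem rigidSum_zero : rigidSum K 0 ≤ 1 := by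
  have hsub : Subsingleton (rigidPairs K 0) := by
    refine ⟨fun p q => Subtype.ext (Prod.ext (Subsingleton.elim _ _) ?_)⟩
    ext x
    rw [Subsingleton.elim x 0]
    exact ⟨fun _ => zero_mem _, fun _ => zero_mem _⟩
  rw [rigidSum]
  have h : ∀ p : rigidPairs K 0, ENNReal.ofReal (wt p.1.1 p.1.2 *
    (disc (diagB p.1.1) p.1.2 : ℝ) ^ (-((0 : ℕ) / 2 + 2 * finrank ℚ K : ℝ))) ≤ 1 := by
    intro p
    have h1 : (1 : ℝ) ≤ disc (diagB p.1.1) p.1.2 := by exact_mod_cast disc_pos_of_mem p.2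
    rw [ENNReal.ofReal_le_one]
    change 1 * _ ≤ _
    rw [one_mul]
    refine Real.rpow_le_one_of_one_le_of_nonpos h1 ?_
    have : (0 : ℝ) ≤ finrank ℚ K := Nat.cast_nonneg _
    simp
  rcases isEmpty_or_nonempty (rigidPairs K 0) with h0 | ⟨⟨p⟩⟩
  · simp
  · rw [tsum_eq_single p (fun q hq => absurd (Subsingleton.elim q p) hq)]
    exact h p

theorem rigidSum_le (k : ℕ) : rigidSum K k ≤ ∏ j ∈ Finset.range k,
    (ENNReal.ofReal (stepConst (finrank ℚ K) |(discr K : ℝ)| (j + 1)) * idealSum K *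
      floorSum K) := by
  induction k with
  | zero => simpa using rigidSum_zero
  | succ k ih =>
    rw [Finset.prod_range_succ, mul_comm]
    exact (rigidSum_succ k).trans (mul_le_mul_right ih _)

variable (K) in
/-- The lattice independent constant in the class number bound. -/
noncomputable def sumConst : ℝ := 1 + (idealSum K * floorSum K).toReal

theorem one_le_sumConst : 1 ≤ sumConst K := le_add_of_nonneg_right ENNReal.toReal_nonneg

theorem rigidSum_le_ofReal (k : ℕ) : rigidSum K k ≤ ENNReal.ofReal (∏ j ∈ Finset.range k,
    (stepConst (finrank ℚ K) |(discr K : ℝ)| (j + 1) * sumConst K)) := by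
  refine (rigidSum_le k).trans ?_
  have h0 : ∀ j, 0 ≤ stepConst (finrank ℚ K) |(discr K : ℝ)| (j + 1) := fun j =>
    stepConst_nonneg _ _ (abs_nonneg _)
  have hs := one_le_sumConst (K := K)
  rw [ENNReal.ofReal_prod_of_nonneg fun j _ => mul_nonneg (h0 j) (by linarith)]
  refine Finset.prod_le_prod' fun j _ => ?_
  rw [mul_assoc, ENNReal.ofReal_mul (h0 j)]
  refine mul_le_mul_right ?_ _
  have hne : idealSum K * floorSum K ≠ ⊤ :=
    ENNReal.mul_ne_top (tsum_absNorm_ne_top K) (tsum_prod_inv_sq_ne_top _)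
  rw [← ENNReal.ofReal_toReal hne]
  refine ENNReal.ofReal_le_ofReal ?_
  rw [sumConst]
  linarith

end TotReal

namespace TotReal

open NumberField Module
open scoped nonZeroDivisors Matrix

set_option linter.unusedSectionVars false

variable {K : Type} [Field K] [NumberField K] [IsTotallyReal K]

theorem sum_realCoord_mul {k : ℕ} {w : Fin k → K} (hw : ∀ i (σ : K →+* ℝ), 0 < σ (w i))
    (x y : Fin k → K) :
    ∑ p, realCoord w x p * realCoord w y p = ∑ σ : K →+* ℝ, σ (diagB w x y) := by
  rw [Fintype.sum_prod_type]
  refine Finset.sum_congr rfl fun σ _ => ?_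
  rw [diagB_apply, map_sum]
  refine Finset.sum_congr rfl fun i _ => ?_
  rw [realCoord_apply, realCoord_apply, map_mul, map_mul]
  simp only
  nth_rewrite 3 [← Real.mul_self_sqrt (hw i σ).le]
  ring

/-- The isometries of a diagonal space preserving a lattice. -/
def isomGroup {k : ℕ} (w : Fin k → K) (L : Submodule (𝓞 K) (Fin k → K)) :
    Subgroup ((Fin k → K) ≃ₗ[K] (Fin k → K)) where
  carrier := {f | (∀ x y, diagB w (f x) (f y) = diagB w x y) ∧ ∀ x, f x ∈ L ↔ x ∈ L}
  one_mem' := ⟨fun _ _ => rfl, fun _ => Iff.rfl⟩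
  mul_mem' {f g} hf hg := ⟨fun x y => (hf.1 _ _).trans (hg.1 x y),
    fun x => (hf.2 _).trans (hg.2 x)⟩
  inv_mem' {f} hf := by
    refine ⟨fun x y => ?_, fun x => ?_⟩
    · rw [← hf.1]
      exact congrArg₂ (fun a b => diagB w a b) (f.apply_symm_apply x) (f.apply_symm_apply y)
    · rw [← hf.2]
      exact iff_of_eq (congrArg (· ∈ L) (f.apply_symm_apply x))

/-- The action of an isometry on the lattice. -/
def isomAct {k : ℕ} (w : Fin k → K) (L : Submodule (𝓞 K) (Fin k → K)) :
    isomGroup w L →* (L →ₗ[ℤ] L) where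
  toFun f := (f.1.toLinearMap.toAddMonoidHom.toIntLinearMap).restrict
    (p := L.restrictScalars ℤ) (q := L.restrictScalars ℤ) fun x hx => (f.2.2 x).2 hx
  map_one' := rfl
  map_mul' _ _ := rfl

theorem card_isomGroup_le {k : ℕ} {w : Fin k → K} (hw : ∀ i (σ : K →+* ℝ), 0 < σ (w i))
    {L : Submodule (𝓞 K) (Fin k → K)} (hL : IsLat L) :
    Finite (isomGroup w L) ∧
      Nat.card (isomGroup w L) ≤ (2 * (finrank ℚ K * k)).factorial := by
  classical
  obtain ⟨c, -, ⟨hc, b, hb⟩, -⟩ := exists_hasCov hw hL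
  set P : Matrix ((K →+* ℝ) × Fin k) ((K →+* ℝ) × Fin k) ℝ :=
    Matrix.of fun p q => realCoord w (b p : Fin k → K) q with hP
  have hdet : IsUnit Pᵀ.det := by
    rw [Matrix.det_transpose, isUnit_iff_ne_zero]
    rintro h
    rw [h, abs_zero] at hb
    exact hc.ne hb
  have hcard : Fintype.card ((K →+* ℝ) × Fin k) = finrank ℚ K * k := by
    rw [Fintype.card_prod, card_emb, Fintype.card_fin]
  let φ : isomGroup w L →* Matrix ((K →+* ℝ) × Fin k) ((K →+* ℝ) × Fin k) ℤ :=
    (LinearMap.toMatrixAlgEquiv b : (L →ₗ[ℤ] L) →* _).comp (isomAct w L)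
  have hφ : ∀ (g : isomGroup w L) i, (g.1 (b i : Fin k → K)) = ∑ j, φ g j i • (b j : Fin k → K) :=
      by
    intro g i
    have h1 : isomAct w L g (b i) = ∑ j, φ g j i • b j := by
      rw [← b.sum_repr (isomAct w L g (b i))]
      refine Finset.sum_congr rfl fun j _ => ?_
      congr 1
      exact (LinearMap.toMatrixAlgEquiv_apply b _ _ _).symm
    have h2 := congrArg (fun x : L => (x : Fin k → K)) h1
    refine h2.trans ?_
    simp
  have hRA : ∀ g : isomGroup w L, Pᵀ * (φ g).map (Int.cast : ℤ → ℝ) =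
      Matrix.of fun q p => realCoord w (g.1 (b p : Fin k → K)) q := by
    intro g
    ext q p
    rw [Matrix.mul_apply, Matrix.of_apply, hφ, map_sum, Finset.sum_apply]
    refine Finset.sum_congr rfl fun j _ => ?_
    rw [map_zsmul]
    simp [hP, mul_comm]
  rw [← hcard]
  refine AutBound.finite_and_card_le φ ?_ Pᵀ (Pᵀ)⁻¹ (Matrix.nonsing_inv_mul _ hdet) ?_
  · intro f g h
    have h1 : ∀ x ∈ L, f.1 x = g.1 x := by
      have h3 : isomAct w L f = isomAct w L g := (LinearMap.toMatrixAlgEquiv b).injective h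
      intro x hx
      exact congrArg Subtype.val (LinearMap.congr_fun h3 ⟨x, hx⟩)
    refine Subtype.ext (LinearEquiv.ext fun x => ?_)
    obtain ⟨a, ha, hx⟩ := hL.2 x
    have h2 := h1 _ hx
    rw [algebra_compatible_smul K, map_smul, map_smul] at h2
    refine smul_right_injective _ ?_ h2
    simpa using ha
  · intro g
    rw [hRA]
    set Q : Matrix ((K →+* ℝ) × Fin k) ((K →+* ℝ) × Fin k) ℝ :=
      Matrix.of fun q p => realCoord w (g.1 (b p : Fin k → K)) q
    have hQ : Qᵀ * Q = P * Pᵀ := by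
      ext i j
      simp only [Matrix.mul_apply, Matrix.transpose_apply, Q, hP, Matrix.of_apply]
      rw [sum_realCoord_mul hw, sum_realCoord_mul hw, g.2.1]
    rw [Matrix.transpose_mul, mul_assoc, ← mul_assoc Qᵀ, hQ, mul_assoc P,
      Matrix.mul_nonsing_inv _ hdet, mul_one, ← Matrix.transpose_transpose P,
      ← Matrix.transpose_mul, Matrix.transpose_transpose, Matrix.mul_nonsing_inv _ hdet,
      Matrix.transpose_one]

/-- Summation along a map with bounded fibres. -/
theorem tsum_comp_le_mul {α β : Type*} (f : α → β) (h : β → ENNReal) {N : ℕ}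
    (hN : ∀ b, Finite {a // f a = b} ∧ Nat.card {a // f a = b} ≤ N) :
    ∑' a, h (f a) ≤ N * ∑' b, h b := by
  rw [← (Equiv.sigmaFiberEquiv f).tsum_eq, ENNReal.tsum_sigma', ← ENNReal.tsum_mul_left]
  refine ENNReal.tsum_le_tsum fun b => ?_
  have h1 : ∀ a : {a // f a = b}, h (f (Equiv.sigmaFiberEquiv f ⟨b, a⟩)) = h b := fun a => by
    rw [Equiv.sigmaFiberEquiv_apply, a.2]
  rw [tsum_congr h1]
  obtain ⟨hf, hc⟩ := hN b
  have := Fintype.ofFinite {a // f a = b}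
  rw [tsum_fintype, Finset.sum_const, nsmul_eq_mul, Finset.card_univ, ← Nat.card_eq_fintype_card]
  gcongr

variable (K) in
/-- Positive diagonal spaces with an integral lattice of discriminant at most `X`. -/
def latPairs (m X : ℕ) : Set ((Fin m → K) × Submodule (𝓞 K) (Fin m → K)) :=
  {p | (∀ i (σ : K →+* ℝ), 0 < σ (p.1 i)) ∧ IsLat p.2 ∧ p.2 ≤ dualLat (diagB p.1) p.2 ∧
    disc (diagB p.1) p.2 ≤ X}

/-- Isometry of lattices in diagonal spaces. -/
def Isom {m : ℕ} (p q : (Fin m → K) × Submodule (𝓞 K) (Fin m → K)) : Prop :=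
  ∃ f : (Fin m → K) ≃ₗ[K] (Fin m → K),
    (∀ x y, diagB q.1 (f x) (f y) = diagB p.1 x y) ∧ ∀ x, f x ∈ q.2 ↔ x ∈ p.2

theorem Isom.refl {m : ℕ} (p : (Fin m → K) × Submodule (𝓞 K) (Fin m → K)) : Isom p p :=
  ⟨LinearEquiv.refl _ _, fun _ _ => rfl, fun _ => Iff.rfl⟩

theorem Isom.symm {m : ℕ} {p q : (Fin m → K) × Submodule (𝓞 K) (Fin m → K)} (h : Isom p q) :
    Isom q p := by
  obtain ⟨f, hf, hL⟩ := h
  refine ⟨f.symm, fun x y => ?_, fun x => ?_⟩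
  · rw [← hf, f.apply_symm_apply, f.apply_symm_apply]
  · rw [← hL, f.apply_symm_apply]

theorem Isom.trans {m : ℕ} {p q r : (Fin m → K) × Submodule (𝓞 K) (Fin m → K)} (h : Isom p q)
    (h' : Isom q r) : Isom p r := by
  obtain ⟨f, hf, hL⟩ := h
  obtain ⟨f', hf', hL'⟩ := h'
  exact ⟨f.trans f', fun x y => (hf' _ _).trans (hf x y), fun x => (hL' _).trans (hL x)⟩

theorem totPos_diagB {m : ℕ} {w : Fin m → K} (hw : ∀ i (σ : K →+* ℝ), 0 < σ (w i)) :
    TotPos (diagB w) := by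
  refine ⟨diagB_symm w, fun x hx σ => ?_⟩
  obtain ⟨i, hi⟩ := Function.ne_iff.1 hx
  rw [diagB_apply, map_sum]
  refine Finset.sum_pos' (fun j _ => ?_) ⟨i, Finset.mem_univ _, ?_⟩
  · rw [mul_assoc, map_mul, map_mul]
    exact mul_nonneg (hw j σ).le (mul_self_nonneg _)
  · rw [mul_assoc, map_mul, map_mul]
    exact mul_pos (hw i σ) (mul_self_pos.2 ((map_ne_zero σ).2 hi))

theorem frame_mem_rigidPairs {m : ℕ} {B : (Fin m → K) →ₗ[K] (Fin m → K) →ₗ[K] K} (hB : TotPos B)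
    {L : Submodule (𝓞 K) (Fin m → K)} (hL : IsLat L) (hi : L ≤ dualLat B L)
    (g : rigidFrames B L m) : (frameWt B g.1, frameLat L g.1) ∈ rigidPairs K m :=
  ⟨g.2.2, hL.frame hB g.2.1 (by simp), integral_frame hB g.2.1 (by simp) hi⟩

theorem isom_frame {m : ℕ} {w : Fin m → K} (hw : ∀ i (σ : K →+* ℝ), 0 < σ (w i))
    (L : Submodule (𝓞 K) (Fin m → K)) {g : Fin m → Fin m → K} (hg : OrthFrame (diagB w) g) :
    Isom (frameWt (diagB w) g, frameLat L g) (w, L) :=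
  ⟨frameEquiv (totPos_diagB hw) hg (by simp), frameEquiv_form (totPos_diagB hw) hg (by simp),
    fun _ => Iff.rfl⟩

/-- The number of pairwise non-isometric lattices is bounded by the sum over rigid pairs. -/
theorem card_le_rigidSum {m X : ℕ} (S : Finset ((Fin m → K) × Submodule (𝓞 K) (Fin m → K)))
    (hS : ∀ p ∈ S, p ∈ latPairs K m X) (hne : ∀ p ∈ S, ∀ q ∈ S, Isom p q → p = q) :
    (S.card : ENNReal) ≤ (2 * (finrank ℚ K * m)).factorial *
      (ENNReal.ofReal ((X : ℝ) ^ (m / 2 + 2 * finrank ℚ K : ℝ)) * rigidSum K m) := by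
  classical
  let A : Type := Σ p : S, rigidFrames (diagB p.1.1) p.1.2 m
  let code : A → rigidPairs K m := fun a => ⟨_, frame_mem_rigidPairs
    (totPos_diagB (hS _ a.1.2).1) (hS _ a.1.2).2.1 (hS _ a.1.2).2.2.1 a.2⟩
  have hdisc : ∀ a : A, disc (diagB (code a).1.1) (code a).1.2 ≤ X := fun a => by
    refine le_of_eq_of_le ?_ (hS _ a.1.2).2.2.2
    exact disc_frame (totPos_diagB (hS _ a.1.2).1) a.2.2.1 (by simp) _
  have h1 : (S.card : ENNReal) ≤
      ∑' a : A, ENNReal.ofReal (wt (code a).1.1 (code a).1.2) := by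
    rw [ENNReal.tsum_sigma']
    calc (S.card : ENNReal) = ∑' _ : S, 1 := by
          rw [tsum_fintype, Finset.sum_const, Finset.card_univ, Fintype.card_coe, nsmul_one]
      _ ≤ _ := ENNReal.tsum_le_tsum fun p => one_le_tsum_rigidFrames m
          (totPos_diagB (hS _ p.2).1) (hS _ p.2).2.1 (hS _ p.2).2.2.1 (by simp)
  set s : ℝ := m / 2 + 2 * finrank ℚ K with hs
  have hs0 : 0 ≤ s := by positivity
  have h2 : ∀ a : A, ENNReal.ofReal (wt (code a).1.1 (code a).1.2) ≤
      ENNReal.ofReal ((X : ℝ) ^ s) * ENNReal.ofReal (wt (code a).1.1 (code a).1.2 *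
        (disc (diagB (code a).1.1) (code a).1.2 : ℝ) ^ (-s)) := by
    intro a
    have hw := wt_pos (code a).1.1 (code a).1.2
    have hd : (0 : ℝ) < disc (diagB (code a).1.1) (code a).1.2 := by
      exact_mod_cast disc_pos_of_mem (code a).2
    rw [← ENNReal.ofReal_mul (by positivity)]
    refine ENNReal.ofReal_le_ofReal ?_
    have h3 : (disc (diagB (code a).1.1) (code a).1.2 : ℝ) ^ s ≤ (X : ℝ) ^ s :=
      Real.rpow_le_rpow hd.le (by exact_mod_cast hdisc a) hs0
    rw [Real.rpow_neg hd.le, ← div_eq_mul_inv, ← mul_div_assoc, le_div_iff₀ (by positivity),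
      mul_comm]
    gcongr
  refine h1.trans ((ENNReal.tsum_le_tsum h2).trans ?_)
  rw [ENNReal.tsum_mul_left, mul_left_comm]
  refine mul_le_mul_right ?_ _
  refine tsum_comp_le_mul code (fun r => ENNReal.ofReal (wt r.1.1 r.1.2 *
        (disc (diagB r.1.1) r.1.2 : ℝ) ^ (-s))) fun r => ?_
  rcases isEmpty_or_nonempty {a // code a = r} with h0 | ⟨⟨⟨p₀, g₀⟩, h₀⟩⟩
  · exact ⟨inferInstance, by simp⟩
  have hw₀ := (hS _ p₀.2).1
  have e₀ := h₀
  have hfib : ∀ a : {a // code a = r}, a.1.1 = p₀ := by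
    rintro ⟨⟨p, g⟩, h⟩
    refine Subtype.ext (hne _ p.2 _ p₀.2 ?_)
    have i1 := isom_frame (hS _ p.2).1 p.1.2 g.2.1
    have i2 := isom_frame (hS _ p₀.2).1 p₀.1.2 g₀.2.1
    have h3 : (frameWt (diagB p.1.1) g.1, frameLat p.1.2 g.1) =
        (frameWt (diagB p₀.1.1) g₀.1, frameLat p₀.1.2 g₀.1) :=
      congrArg Subtype.val (h.trans h₀.symm)
    rw [h3] at i1
    exact i1.symm.trans i2
  obtain ⟨hfin, hcard⟩ := card_isomGroup_le hw₀ (hS _ p₀.2).2.1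
  have hT : ∀ a : {a // code a = r}, ∃ f : isomGroup p₀.1.1 p₀.1.2,
      HEq a.1.2.1 (fun i => f.1 (g₀.1 i)) := by
    rintro ⟨⟨p, g⟩, h⟩
    obtain rfl : p = p₀ := hfib ⟨⟨p, g⟩, h⟩
    have h3 := congrArg Subtype.val (h.trans h₀.symm)
    have h4 : frameWt (diagB p.1.1) g.1 = frameWt (diagB p.1.1) g₀.1 := congrArg Prod.fst h3
    have h5 : frameLat p.1.2 g.1 = frameLat p.1.2 g₀.1 := congrArg Prod.snd h3
    have hB := totPos_diagB hw₀
    let e := frameEquiv hB g.2.1 (by simp)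
    let e0 := frameEquiv hB g₀.2.1 (by simp)
    have he : ∀ x, e (e0.symm (e0 x)) = e x := fun x => by rw [e0.symm_apply_apply]
    refine ⟨⟨e0.symm.trans e, fun x y => ?_, fun x => ?_⟩, heq_of_eq (funext fun i => ?_)⟩
    · obtain ⟨x, rfl⟩ := e0.surjective x
      obtain ⟨y, rfl⟩ := e0.surjective y
      rw [LinearEquiv.trans_apply, LinearEquiv.trans_apply, he, he,
        frameEquiv_form hB g.2.1, frameEquiv_form hB g₀.2.1, h4]
    · obtain ⟨x, rfl⟩ := e0.surjective x
      rw [LinearEquiv.trans_apply, he]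
      change x ∈ frameLat p.1.2 g.1 ↔ x ∈ frameLat p.1.2 g₀.1
      rw [h5]
    · have h6 : g₀.1 i = e0 (Pi.single i 1) := by
        rw [frameEquiv_apply, Finset.sum_eq_single i]
        · rw [Pi.single_eq_same, one_smul]
        · intro j _ hj
          rw [Pi.single_eq_of_ne hj, zero_smul]
        · simp
      rw [h6, LinearEquiv.trans_apply, he, frameEquiv_apply, Finset.sum_eq_single i]
      · rw [Pi.single_eq_same, one_smul]
      · intro j _ hj
        rw [Pi.single_eq_of_ne hj, zero_smul]
      · simp
  choose T hT using hT
  have hinj : Function.Injective T := by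
    intro a b hab
    have h3 := (hT a).trans ((heq_of_eq (by rw [hab])).trans (hT b).symm)
    have ha := hfib a
    have hb := hfib b
    obtain ⟨⟨p, g⟩, h⟩ := a
    obtain ⟨⟨q, g'⟩, h'⟩ := b
    simp only at ha hb
    subst ha
    subst hb
    have h4 : g = g' := Subtype.ext (eq_of_heq h3)
    subst h4
    rfl
  exact ⟨Finite.of_injective T hinj, (Nat.card_le_card_of_injective T hinj).trans hcard⟩

variable (K) in
/-- The bound for the number of classes of lattices of rank `m` and discriminant at most `X`. -/
noncomputable def classBound (m X : ℕ) : ℝ :=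
  (2 * (finrank ℚ K * m)).factorial * ((X : ℝ) ^ (m / 2 + 2 * finrank ℚ K : ℝ) *
    ∏ j ∈ Finset.range m, (stepConst (finrank ℚ K) |(discr K : ℝ)| (j + 1) * sumConst K))

theorem card_le_classBound {m X : ℕ} (S : Finset ((Fin m → K) × Submodule (𝓞 K) (Fin m → K)))
    (hS : ∀ p ∈ S, p ∈ latPairs K m X) (hne : ∀ p ∈ S, ∀ q ∈ S, Isom p q → p = q) :
    (S.card : ℝ) ≤ classBound K m X := by
  have h0 : 0 ≤ ∏ j ∈ Finset.range m,
      (stepConst (finrank ℚ K) |(discr K : ℝ)| (j + 1) * sumConst K) :=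
    Finset.prod_nonneg fun j _ => mul_nonneg (stepConst_nonneg _ _ (abs_nonneg _))
      (zero_le_one.trans one_le_sumConst)
  have h := (card_le_rigidSum S hS hne).trans
    (mul_le_mul_right (mul_le_mul_right (rigidSum_le_ofReal m) _) _)
  rw [← ENNReal.ofReal_mul (by positivity), ← ENNReal.ofReal_natCast (Nat.factorial _),
    ← ENNReal.ofReal_mul (by positivity), ← ENNReal.ofReal_natCast] at h
  exact (ENNReal.ofReal_le_ofReal_iff (mul_nonneg (by positivity)
      (mul_nonneg (by positivity) h0))).1 h

/-- Finite systems of representatives of explicitly bounded size. -/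
theorem exists_reps (m X : ℕ) : ∃ S : Finset ((Fin m → K) × Submodule (𝓞 K) (Fin m → K)),
    (∀ p ∈ S, p ∈ latPairs K m X) ∧ (∀ q ∈ latPairs K m X, ∃ p ∈ S, Isom q p) ∧
      (S.card : ℝ) ≤ classBound K m X := by
  classical
  let P : ℕ → Prop := fun n => ∃ S : Finset ((Fin m → K) × Submodule (𝓞 K) (Fin m → K)),
    (∀ p ∈ S, p ∈ latPairs K m X) ∧ (∀ p ∈ S, ∀ q ∈ S, Isom p q → p = q) ∧ S.card = n
  have hb : ∀ n, P n → n ≤ ⌊classBound K m X⌋₊ := by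
    rintro n ⟨S, hS, hne, rfl⟩
    exact Nat.le_floor (card_le_classBound S hS hne)
  have h0 : P 0 := ⟨∅, by simp, by simp, rfl⟩
  obtain ⟨S, hS, hne, hc⟩ := Nat.findGreatest_spec (Nat.zero_le _) h0
  refine ⟨S, hS, fun q hq => ?_, card_le_classBound S hS hne⟩
  by_contra! hno
  have hqS : q ∉ S := fun h => hno q h (Isom.refl q)
  have h1 : P (S.card + 1) := by
    refine ⟨insert q S, ?_, ?_, Finset.card_insert_of_notMem hqS⟩
    · simpa [hq] using hS
    · intro a ha b hb hab
      rw [Finset.mem_insert] at ha hb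
      rcases ha with rfl | ha <;> rcases hb with rfl | hb
      · rfl
      · exact absurd hab (hno b hb)
      · exact absurd hab.symm (hno a ha)
      · exact hne a ha b hb hab
  have h2 := Nat.le_findGreatest (hb _ h1) h1
  rw [← hc] at h2
  omega

end TotReal

namespace TotReal

open NumberField Module IsDedekindDomain
open scoped nonZeroDivisors

set_option linter.unusedSectionVars false

section Local

variable {K : Type} [Field K] [NumberField K]
variable {M : Type} [AddCommGroup M] [Module (𝓞 K) M]

/-- The vectors lying in a submodule locally at a prime. -/
def loc (P : HeightOneSpectrum (𝓞 K)) (N : Submodule (𝓞 K) M) : Submodule (𝓞 K) M where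
  carrier := {z | ∃ s : 𝓞 K, s ∉ P.asIdeal ∧ s • z ∈ N}
  zero_mem' := ⟨1, fun h => P.isPrime.ne_top ((Ideal.eq_top_iff_one _).2 h), by simp⟩
  add_mem' := by
    rintro x y ⟨s, hs, hx⟩ ⟨t, ht, hy⟩
    refine ⟨s * t, fun h => (P.isPrime.mem_or_mem h).elim hs ht, ?_⟩
    rw [smul_add, mul_smul, mul_smul, smul_comm s t x]
    exact N.add_mem (N.smul_mem _ hx) (N.smul_mem _ hy)
  smul_mem' := by
    rintro c x ⟨s, hs, hx⟩
    exact ⟨s, hs, by rw [smul_comm]; exact N.smul_mem _ hx⟩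

theorem one_notMem (P : HeightOneSpectrum (𝓞 K)) : (1 : 𝓞 K) ∉ P.asIdeal :=
  fun h => P.isPrime.ne_top ((Ideal.eq_top_iff_one _).2 h)

theorem mul_notMem {P : HeightOneSpectrum (𝓞 K)} {s t : 𝓞 K} (hs : s ∉ P.asIdeal)
    (ht : t ∉ P.asIdeal) : s * t ∉ P.asIdeal :=
  fun h => (P.isPrime.mem_or_mem h).elim hs ht

theorem loc_mono (P : HeightOneSpectrum (𝓞 K)) {N N' : Submodule (𝓞 K) M} (h : N ≤ N') :
    loc P N ≤ loc P N' :=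
  fun _ ⟨s, hs, hz⟩ => ⟨s, hs, h hz⟩

theorem mem_of_forall_loc {N : Submodule (𝓞 K) M} {z : M} (h : ∀ P, z ∈ loc P N) : z ∈ N := by
  let J : Ideal (𝓞 K) := N.comap (LinearMap.toSpanSingleton (𝓞 K) M z)
  have hJ : ∀ s, s ∈ J ↔ s • z ∈ N := fun s => Iff.rfl
  by_contra hz
  have hJt : J ≠ ⊤ := fun ht => hz (by
    have := (Ideal.eq_top_iff_one _).1 ht
    rwa [hJ, one_smul] at this)
  obtain ⟨m, hm, hJm⟩ := Ideal.exists_le_maximal J hJt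
  have hb := Ring.ne_bot_of_isMaximal_of_not_isField hm (RingOfIntegers.not_isField K)
  obtain ⟨s, hs, h⟩ := h ⟨m, hm.isPrime, hb⟩
  exact hs (hJm ((hJ s).2 h))

theorem loc_of_killed {P : HeightOneSpectrum (𝓞 K)} {N : Submodule (𝓞 K) M} {z : M}
    (h : ∀ s ∈ P.asIdeal, s • z ∈ N) {Q : HeightOneSpectrum (𝓞 K)} (hQ : Q ≠ P) :
    z ∈ loc Q N := by
  have : ¬ P.asIdeal ≤ Q.asIdeal := fun hle => hQ (by
    ext1
    exact ((P.isPrime.isMaximal P.ne_bot).eq_of_le Q.isPrime.ne_top hle).symm)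
  obtain ⟨s, hs, hsQ⟩ := SetLike.not_le_iff_exists.1 this
  exact ⟨s, hsQ, h s hs⟩

theorem mem_of_killed {P : HeightOneSpectrum (𝓞 K)} {N : Submodule (𝓞 K) M} {z : M}
    (h : ∀ s ∈ P.asIdeal, s • z ∈ N) (hz : z ∈ loc P N) : z ∈ N :=
  mem_of_forall_loc fun Q => by
    by_cases hQ : Q = P
    · rwa [hQ]
    · exact loc_of_killed h hQ

variable (K) in
/-- The integral elements of `K` as a submodule. -/
def intSub : Submodule (𝓞 K) K where
  carrier := {x | IsIntegral ℤ x}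
  zero_mem' := isIntegral_zero
  add_mem' := IsIntegral.add
  smul_mem' a x hx := by
    rw [Algebra.smul_def]
    exact (RingOfIntegers.isIntegral_coe a).mul hx

theorem mem_intSub {x : K} : x ∈ intSub K ↔ IsIntegral ℤ x := Iff.rfl

theorem exists_unif (P : HeightOneSpectrum (𝓞 K)) :
    ∃ t ∈ P.asIdeal, t ∉ P.asIdeal ^ 2 := by
  have : ¬ P.asIdeal ≤ P.asIdeal ^ 2 := fun h => by
    have h2 := Ideal.pow_right_strictAnti P.asIdeal P.ne_bot P.isPrime.ne_top
      (show 1 < 2 by norm_num)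
    simp only [pow_one] at h2
    exact absurd h h2.not_ge
  obtain ⟨t, ht, h⟩ := SetLike.not_le_iff_exists.1 this
  exact ⟨t, ht, h⟩

theorem valuation_unif {P : HeightOneSpectrum (𝓞 K)} {t : 𝓞 K} (ht : t ∈ P.asIdeal)
    (ht2 : t ∉ P.asIdeal ^ 2) : P.valuation K (t : K) = WithZero.exp (-1 : ℤ) := by
  have h1 : P.valuation K (t : K) ≤ WithZero.exp (-((1 : ℕ) : ℤ)) := by
    rw [HeightOneSpectrum.valuation_of_algebraMap, HeightOneSpectrum.intValuation_le_pow_iff_mem]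
    simpa using ht
  have h2 : ¬ P.valuation K (t : K) ≤ WithZero.exp (-((2 : ℕ) : ℤ)) := by
    rwa [HeightOneSpectrum.valuation_of_algebraMap, HeightOneSpectrum.intValuation_le_pow_iff_mem]
  have h0 : P.valuation K (t : K) ≠ 0 := fun h => h2 (by rw [h]; exact zero_le)
  obtain ⟨m, hm⟩ : ∃ m : ℤ, P.valuation K (t : K) = WithZero.exp m :=
    ⟨_, (WithZero.exp_log h0).symm⟩
  rw [hm] at h1 h2 ⊢
  rw [WithZero.exp_le_exp] at h1 h2
  congr 1
  push_cast at h1 h2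
  omega

theorem valuation_eq_one {P : HeightOneSpectrum (𝓞 K)} {s : 𝓞 K} (hs : s ∉ P.asIdeal) :
    P.valuation K (s : K) = 1 := by
  refine le_antisymm (HeightOneSpectrum.valuation_le_one P s) (not_lt.1 fun h => hs ?_)
  exact (HeightOneSpectrum.valuation_lt_one_iff_mem P s).1 h

/-- An element with a simple pole at `P` becomes integral when the residue vanishes. -/
theorem integral_of_residue {P : HeightOneSpectrum (𝓞 K)} {t : 𝓞 K} (ht : t ∈ P.asIdeal)
    (ht2 : t ∉ P.asIdeal ^ 2) {x : K} (hx : ∀ s ∈ P.asIdeal, IsIntegral ℤ ((s : K) * x))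
    {a : 𝓞 K} (ha : a ∈ P.asIdeal) (h : (a : K) = t * x) : IsIntegral ℤ x := by
  have : ∀ Q : HeightOneSpectrum (𝓞 K), Q.valuation K x ≤ 1 := by
    intro Q
    by_cases hQ : Q = P
    · subst hQ
      have h1 : Q.valuation K (a : K) ≤ WithZero.exp (-((1 : ℕ) : ℤ)) := by
        rw [HeightOneSpectrum.valuation_of_algebraMap,
            HeightOneSpectrum.intValuation_le_pow_iff_mem]
        simpa using ha
      rw [h, map_mul, valuation_unif ht ht2] at h1
      have h3 := mul_le_mul_right h1 (WithZero.exp (1 : ℤ))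
      rw [← mul_assoc, ← WithZero.exp_add, ← WithZero.exp_add] at h3
      simpa using h3
    · obtain ⟨s, hs, h⟩ : x ∈ loc Q (intSub K) := loc_of_killed (P := P) (fun s hs => by
        rw [Algebra.smul_def]; exact hx s hs) hQ
      obtain ⟨y, hy⟩ := integral_iff.1 h
      have hv : Q.valuation K (y : K) ≤ 1 := HeightOneSpectrum.valuation_le_one Q y
      rw [hy, Algebra.smul_def, map_mul, valuation_eq_one hs, one_mul] at hv
      exact hv
  obtain ⟨y, hy⟩ := HeightOneSpectrum.mem_integers_of_valuation_le_one K x this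
  exact hy ▸ RingOfIntegers.isIntegral_coe y

end Local

section Maximal

variable {K : Type} [Field K] [NumberField K] [IsTotallyReal K]
variable {V : Type} [AddCommGroup V] [Module K V] [Module (𝓞 K) V] [IsScalarTower (𝓞 K) K V]
variable {B : V →ₗ[K] V →ₗ[K] K} {L : Submodule (𝓞 K) V} {P : HeightOneSpectrum (𝓞 K)}

theorem form_smul_left (B : V →ₗ[K] V →ₗ[K] K) (a : 𝓞 K) (x y : V) :
    B (a • x) y = a * B x y := by
  rw [← algebraMap_smul K a x, map_smul, LinearMap.smul_apply, smul_eq_mul]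

theorem form_smul_right (B : V →ₗ[K] V →ₗ[K] K) (a : 𝓞 K) (x y : V) :
    B x (a • y) = a * B x y := by
  rw [← algebraMap_smul K a y, map_smul, smul_eq_mul]

/-- Integral lattices that are maximal among integral lattices. -/
structure MaxLat (B : V →ₗ[K] V →ₗ[K] K) (L : Submodule (𝓞 K) V) : Prop where
  lat : IsLat L
  int : L ≤ dualLat B L
  max : ∀ N, IsLat N → N ≤ dualLat B N → L ≤ N → N ≤ L

theorem dualLat_anti {N : Submodule (𝓞 K) V} (h : L ≤ N) : dualLat B N ≤ dualLat B L :=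
  fun _ hx y hy => hx y (h hy)

theorem integral_span {s : Set V} (h : ∀ x ∈ s, ∀ y ∈ s, IsIntegral ℤ (B x y)) :
    Submodule.span (𝓞 K) s ≤ dualLat B (Submodule.span (𝓞 K) s) := by
  rw [Submodule.span_le]
  intro x hx y hy
  induction hy using Submodule.span_induction with
  | mem y hy => exact h x hx y hy
  | zero => simpa using isIntegral_zero
  | add y z _ _ hy hz => rw [map_add]; exact hy.add hz
  | smul a y _ hy =>
    rw [form_smul_right]
    exact (RingOfIntegers.isIntegral_coe a).mul hy

theorem exists_maxLat (hB : TotPos B) [FiniteDimensional K V] (hL : IsLat L)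
    (hi : L ≤ dualLat B L) : ∃ N, L ≤ N ∧ MaxLat B N := by
  let S : Set ℕ := {n | ∃ N, L ≤ N ∧ IsLat N ∧ N ≤ dualLat B N ∧ disc B N = n}
  have hS : S.Nonempty := ⟨_, L, le_rfl, hL, hi, rfl⟩
  obtain ⟨N, hLN, hN, hNi, hd⟩ := Nat.sInf_mem hS
  refine ⟨N, hLN, hN, hNi, fun N' hN' hi' hle => ?_⟩
  have h1 := Nat.sInf_le (show disc B N' ∈ S from ⟨N', hLN.trans hle, hN', hi', rfl⟩)
  rw [← hd] at h1
  have hdle : dualLat B N' ≤ dualLat B N := dualLat_anti hle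
  have h2 : disc B N = N.toAddSubgroup.relIndex N'.toAddSubgroup *
      (disc B N' * (dualLat B N').toAddSubgroup.relIndex (dualLat B N).toAddSubgroup) := by
    rw [disc, disc, AddSubgroup.relIndex_mul_relIndex _ _ _ (show N'.toAddSubgroup ≤ _ from hi')
      (show (dualLat B N').toAddSubgroup ≤ _ from hdle),
      AddSubgroup.relIndex_mul_relIndex _ _ _ (show N.toAddSubgroup ≤ N'.toAddSubgroup from hle)
      (show N'.toAddSubgroup ≤ _ from hi'.trans hdle)]
  have hp := disc_pos hB hN hNi
  have hp' := disc_pos hB hN' hi'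
  have h3 : N.toAddSubgroup.relIndex N'.toAddSubgroup = 1 := by
    set a := N.toAddSubgroup.relIndex N'.toAddSubgroup
    set c := (dualLat B N').toAddSubgroup.relIndex (dualLat B N).toAddSubgroup
    have hc : 0 < c := Nat.pos_of_ne_zero fun h => by rw [h2, h] at hp; simp at hp
    have ha : 0 < a := Nat.pos_of_ne_zero fun h => by rw [h2, h] at hp; simp at hp
    by_contra hne
    have : 2 * disc B N' ≤ a * (disc B N' * c) :=
      Nat.mul_le_mul (by omega) (Nat.le_mul_of_pos_right _ hc)
    omega
  exact AddSubgroup.relIndex_eq_one.1 h3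

theorem MaxLat.mem_of_integral (hB : TotPos B) (hL : MaxLat B L) {x : V}
    (hx : x ∈ dualLat B L) (h : IsIntegral ℤ (B x x)) : x ∈ L := by
  let N := Submodule.span (𝓞 K) (insert x (L : Set V))
  have hN : L ≤ N := fun y hy => Submodule.subset_span (Set.mem_insert_of_mem _ hy)
  refine hL.max N ⟨?_, fun v => ?_⟩ (integral_span ?_) hN
    (Submodule.subset_span (Set.mem_insert _ _))
  · have : N = Submodule.span (𝓞 K) {x} ⊔ L := by
      change Submodule.span (𝓞 K) (insert x (L : Set V)) = _
      rw [Submodule.span_insert, Submodule.span_eq]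
    rw [this]
    exact (Submodule.fg_span_singleton x).sup hL.lat.1
  · obtain ⟨a, ha, hv⟩ := hL.lat.2 v
    exact ⟨a, ha, hN hv⟩
  · rintro y (rfl | hy) z (rfl | hz)
    · exact h
    · exact hx z hz
    · rw [hB.1]; exact hx y hy
    · exact hL.int hy z hz

/-- The elements of the dual lattice that are multiplied into the lattice by a prime. -/
def pDual (B : V →ₗ[K] V →ₗ[K] K) (L : Submodule (𝓞 K) V) (P : HeightOneSpectrum (𝓞 K)) :
    Submodule (𝓞 K) V where
  carrier := {x | x ∈ dualLat B L ∧ ∀ s ∈ P.asIdeal, s • x ∈ L}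
  zero_mem' := ⟨zero_mem _, fun s _ => by simp⟩
  add_mem' hx hy := ⟨add_mem hx.1 hy.1, fun s hs => by
    rw [smul_add]; exact add_mem (hx.2 s hs) (hy.2 s hs)⟩
  smul_mem' a x hx := ⟨Submodule.smul_mem _ a hx.1, fun s hs => by
    rw [smul_comm]; exact L.smul_mem a (hx.2 s hs)⟩

theorem mem_pDual {x : V} :
    x ∈ pDual B L P ↔ x ∈ dualLat B L ∧ ∀ s ∈ P.asIdeal, s • x ∈ L := Iff.rfl

/-- The primes at which a lattice differs from its dual. -/
def badPrimes (B : V →ₗ[K] V →ₗ[K] K) (L : Submodule (𝓞 K) V) :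
    Set (HeightOneSpectrum (𝓞 K)) :=
  {P | ¬ pDual B L P ≤ L}

theorem MaxLat.dual_le_loc (hB : TotPos B) (hL : MaxLat B L) :
    dualLat B L ≤ loc P (pDual B L P) := by
  intro x hx
  obtain ⟨D, hD, hDx⟩ := hL.lat.2 x
  have hD0 : Ideal.span {D} ≠ 0 := by simpa using hD
  obtain ⟨I, hI, hPI⟩ :=
      (FiniteMultiplicity.of_prime_left P.prime hD0).exists_eq_pow_mul_and_not_dvd
  obtain ⟨s, hsI, hsP⟩ := SetLike.not_le_iff_exists.1 (fun h => hPI (Ideal.dvd_iff_le.2 h))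
  refine ⟨s, hsP, ?_⟩
  have key : ∀ k : ℕ, (∀ r ∈ P.asIdeal ^ k, (s * r) • x ∈ L) → s • x ∈ pDual B L P := by
    intro k
    induction k with
    | zero =>
      intro h
      have : s • x ∈ L := by simpa using h 1 (by simp)
      exact ⟨hL.int this, fun r _ => L.smul_mem r this⟩
    | succ k ih =>
      intro h
      rcases Nat.eq_zero_or_pos k with rfl | hk
      · refine ⟨Submodule.smul_mem _ _ hx, fun r hr => ?_⟩
        rw [smul_smul, mul_comm]
        exact h r (by simpa using hr)
      · refine ih fun r hr => hL.mem_of_integral hB (Submodule.smul_mem _ _ hx) ?_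
        have h1 : r * r ∈ P.asIdeal ^ (k + 1) :=
          Ideal.pow_le_pow_right (show k + 1 ≤ k + k by omega) (by
            rw [pow_add]; exact Ideal.mul_mem_mul hr hr)
        have h2 := (RingOfIntegers.isIntegral_coe s).mul (hx _ (h _ h1))
        rw [form_smul_right] at h2
        rw [form_smul_right, form_smul_left]
        have e1 : ((s * r : 𝓞 K) : K) = s * r := map_mul (algebraMap (𝓞 K) K) _ _
        have e2 : ((s * (r * r) : 𝓞 K) : K) = s * (r * r) := by
          rw [← map_mul (algebraMap (𝓞 K) K), ← map_mul (algebraMap (𝓞 K) K)]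
        rw [e2] at h2
        rw [e1]
        exact (by ring : (s : K) * ((s * (r * r)) * B x x) = s * r * (s * r * B x x)) ▸ h2
  refine key (multiplicity P.asIdeal (Ideal.span {D})) fun r hr => ?_
  have : s * r ∈ Ideal.span {D} := by
    rw [hI, mul_comm s]; exact Ideal.mul_mem_mul hr hsI
  obtain ⟨c, hc⟩ := Ideal.mem_span_singleton'.1 this
  rw [← hc, mul_smul]
  exact L.smul_mem c hDx

theorem MaxLat.dual_le_loc_of_notMem (hB : TotPos B) (hL : MaxLat B L)
    (hP : P ∉ badPrimes B L) : dualLat B L ≤ loc P L :=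
  (hL.dual_le_loc hB).trans (loc_mono P (not_not.1 hP))

theorem pDual_form (hB : TotPos B) {x y : V} (hx : x ∈ pDual B L P) (hy : y ∈ dualLat B L) :
    ∀ s ∈ P.asIdeal, IsIntegral ℤ ((s : K) * B x y) := fun s hs => by
  rw [← form_smul_left, hB.1]
  exact hy _ (hx.2 s hs)

theorem exists_residue (hB : TotPos B) {t : 𝓞 K} (ht : t ∈ P.asIdeal) {x y : V}
    (hx : x ∈ pDual B L P) (hy : y ∈ dualLat B L) : ∃ a : 𝓞 K, (a : K) = t * B x y :=
  integral_iff.1 (pDual_form hB hx hy t ht)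

theorem integral_form_of_residue (hB : TotPos B) {t : 𝓞 K} (ht : t ∈ P.asIdeal)
    (ht2 : t ∉ P.asIdeal ^ 2) {x y : V} (hx : x ∈ pDual B L P) (hy : y ∈ dualLat B L) {a : 𝓞 K}
    (ha : a ∈ P.asIdeal) (h : (a : K) = t * B x y) : IsIntegral ℤ (B x y) :=
  integral_of_residue ht ht2 (pDual_form hB hx hy) ha h

theorem MaxLat.mem_of_residue (hB : TotPos B) (hL : MaxLat B L) {t : 𝓞 K} (ht : t ∈ P.asIdeal)
    (ht2 : t ∉ P.asIdeal ^ 2) {x : V} (hx : x ∈ pDual B L P) {a : 𝓞 K}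
    (ha : a ∈ P.asIdeal) (h : (a : K) = t * B x x) : x ∈ L :=
  hL.mem_of_integral hB hx.1 (integral_form_of_residue hB ht ht2 hx hx.1 ha h)

end Maximal

end TotReal

namespace TotReal

open NumberField Module IsDedekindDomain
open scoped nonZeroDivisors

set_option linter.unusedSectionVars false

section Residue

variable {K : Type} [Field K] [NumberField K] {P : HeightOneSpectrum (𝓞 K)}

theorem finite_quot (P : HeightOneSpectrum (𝓞 K)) : Finite (𝓞 K ⧸ P.asIdeal) :=
  Ideal.finiteQuotientOfFreeOfNeBot P.asIdeal P.ne_bot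

theorem exists_inv_mod {a : 𝓞 K} (ha : a ∉ P.asIdeal) :
    ∃ c, ∃ i ∈ P.asIdeal, c * a + i = 1 :=
  (P.isPrime.isMaximal P.ne_bot).exists_inv ha

open Polynomial in
theorem exists_quadratic_root (h2 : (2 : 𝓞 K) ∉ P.asIdeal) {a b : 𝓞 K} (ha : a ∉ P.asIdeal)
    (hb : b ∉ P.asIdeal) (c : 𝓞 K) : ∃ u v : 𝓞 K, a * (u * u) + b * (v * v) + c ∈ P.asIdeal := by
  have := finite_quot P
  have hm := P.isPrime.isMaximal P.ne_bot
  let := Ideal.Quotient.field P.asIdeal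
  let := Fintype.ofFinite (𝓞 K ⧸ P.asIdeal)
  let π := Ideal.Quotient.mk P.asIdeal
  have hne : ∀ {r : 𝓞 K}, r ∉ P.asIdeal → π r ≠ 0 :=
      fun hr h => hr (Ideal.Quotient.eq_zero_iff_mem.1 h)
  have hchar : ringChar (𝓞 K ⧸ P.asIdeal) ≠ 2 := by
    intro h
    have h3 := ringChar.Nat.cast_ringChar (R := 𝓞 K ⧸ P.asIdeal)
    rw [h] at h3
    exact hne h2 (by rw [map_ofNat]; simpa using h3)
  obtain ⟨u, v, h⟩ := FiniteField.exists_root_sum_quadratic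
    (f := C (π a) * X ^ 2 + C 0 * X + C (π c)) (g := C (π b) * X ^ 2 + C 0 * X + C 0)
    (Polynomial.degree_quadratic (hne ha)) (Polynomial.degree_quadratic (hne hb))
    (FiniteField.odd_card_of_char_ne_two hchar)
  obtain ⟨u, rfl⟩ := Ideal.Quotient.mk_surjective u
  obtain ⟨v, rfl⟩ := Ideal.Quotient.mk_surjective v
  refine ⟨u, v, Ideal.Quotient.eq_zero_iff_mem.1 ?_⟩
  rw [← h]
  simp [π]
  ring

theorem exists_sqrt_mod (h2 : (2 : 𝓞 K) ∈ P.asIdeal) (a : 𝓞 K) :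
    ∃ u : 𝓞 K, u * u - a ∈ P.asIdeal := by
  have := finite_quot P
  have hm := P.isPrime.isMaximal P.ne_bot
  let := Ideal.Quotient.field P.asIdeal
  let := Fintype.ofFinite (𝓞 K ⧸ P.asIdeal)
  have h : ((2 : ℕ) : 𝓞 K ⧸ P.asIdeal) = 0 := by
    have := Ideal.Quotient.eq_zero_iff_mem.2 h2
    rw [map_ofNat] at this
    simpa using this
  have hchar : ringChar (𝓞 K ⧸ P.asIdeal) = 2 :=
    ((Nat.prime_two.eq_one_or_self_of_dvd _ (ringChar.dvd h)).resolve_left fun h1 => by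
      have := ringChar.Nat.cast_ringChar (R := 𝓞 K ⧸ P.asIdeal)
      rw [h1] at this
      simp at this)
  obtain ⟨u, hu⟩ := FiniteField.isSquare_of_char_two hchar (Ideal.Quotient.mk P.asIdeal a)
  obtain ⟨u, rfl⟩ := Ideal.Quotient.mk_surjective u
  refine ⟨u, ?_⟩
  rw [← Ideal.Quotient.eq_zero_iff_mem, map_sub, map_mul, hu, sub_self]

/-- The product of two nonsquares modulo `P` is a square modulo `P`. -/
theorem exists_sqrt_mul {a b : 𝓞 K}
    (ha : ∀ s, s * s - a ∉ P.asIdeal) (hb : ∀ s, s * s - b ∉ P.asIdeal) :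
    ∃ s, s * s - a * b ∈ P.asIdeal := by
  classical
  have := finite_quot P
  have hm := P.isPrime.isMaximal P.ne_bot
  let := Ideal.Quotient.field P.asIdeal
  let := Fintype.ofFinite (𝓞 K ⧸ P.asIdeal)
  have hns : ∀ a : 𝓞 K, (∀ s, s * s - a ∉ P.asIdeal) →
      ¬ IsSquare (Ideal.Quotient.mk P.asIdeal a) := by
    rintro a ha ⟨s, hs⟩
    obtain ⟨s, rfl⟩ := Ideal.Quotient.mk_surjective s
    refine ha s ?_
    rw [← Ideal.Quotient.eq_zero_iff_mem, map_sub, map_mul, hs, sub_self]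
  have h1 := quadraticChar_neg_one_iff_not_isSquare.2 (hns a ha)
  have h2 := quadraticChar_neg_one_iff_not_isSquare.2 (hns b hb)
  by_contra! hcon
  have h3 := quadraticChar_neg_one_iff_not_isSquare.2 (hns _ hcon)
  rw [map_mul, map_mul, h1, h2] at h3
  norm_num at h3

end Residue

section Plane

variable {K : Type} [Field K] [NumberField K] [IsTotallyReal K]
variable {V : Type} [AddCommGroup V] [Module K V] [Module (𝓞 K) V] [IsScalarTower (𝓞 K) K V]
variable {B : V →ₗ[K] V →ₗ[K] K} {L : Submodule (𝓞 K) V} {P : HeightOneSpectrum (𝓞 K)}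

theorem exists_orth (hB : TotPos B) {t : 𝓞 K} (ht : t ∈ P.asIdeal) (ht2 : t ∉ P.asIdeal ^ 2)
    {x z : V} (hx : x ∈ pDual B L P) (hz : z ∈ pDual B L P) {a : 𝓞 K} (ha : (a : K) = t * B x x)
    (haP : a ∉ P.asIdeal) : ∃ u : 𝓞 K, IsIntegral ℤ (B (z - u • x) x) := by
  obtain ⟨c, i, hi, hc⟩ := exists_inv_mod haP
  obtain ⟨r, hr⟩ := exists_residue hB ht hz hx.1
  refine ⟨r * c, integral_form_of_residue hB ht ht2
    (sub_mem hz (Submodule.smul_mem _ _ hx)) hx.1 (Ideal.mul_mem_left _ r hi) ?_⟩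
  have hi' := congrArg (algebraMap (𝓞 K) K) hc
  simp only [map_add, map_mul, map_one] at hi'
  simp only [map_sub, LinearMap.sub_apply, form_smul_left, map_mul]
  linear_combination (r : K) * hi' + hr - (r : K) * c * ha

theorem form_add_self (hB : TotPos B) (x y : V) : B (x + y) (x + y) = B x x + 2 * B x y +
    B y y := by
  simp only [map_add, LinearMap.add_apply]
  rw [hB.1 y x]
  ring

theorem MaxLat.residue_notMem (hB : TotPos B) (hL : MaxLat B L) {t : 𝓞 K} (ht : t ∈ P.asIdeal)
    (ht2 : t ∉ P.asIdeal ^ 2) {x : V} (hx : x ∈ pDual B L P) (hxL : x ∉ L) {a : 𝓞 K}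
    (ha : (a : K) = t * B x x) : a ∉ P.asIdeal :=
  fun h => hxL (hL.mem_of_residue hB ht ht2 hx h ha)

theorem MaxLat.plane (hB : TotPos B) (hL : MaxLat B L) (h2 : (2 : 𝓞 K) ∉ P.asIdeal) {t : 𝓞 K}
    (ht : t ∈ P.asIdeal) (ht2 : t ∉ P.asIdeal ^ 2) {x z : V} (hx : x ∈ pDual B L P) (hxL : x ∉ L)
    (hz : z ∈ pDual B L P) (hzx : ∀ u : 𝓞 K, z - u • x ∉ L) :
    ∃ y ∈ pDual B L P, IsIntegral ℤ (B x y) ∧ y ∉ L ∧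
      (∀ a b s : 𝓞 K, (a : K) = t * B x x → (b : K) = t * B y y → s * s + a * b ∉ P.asIdeal) ∧
      ∀ w ∈ pDual B L P, ∃ u v : 𝓞 K, w - u • x - v • y ∈ L := by
  obtain ⟨a, ha⟩ := exists_residue hB ht hx hx.1
  have haP := hL.residue_notMem hB ht ht2 hx hxL ha
  obtain ⟨u₀, hu₀⟩ := exists_orth hB ht ht2 hx hz ha haP
  set y := z - u₀ • x with hy
  have hyx : ∀ u : 𝓞 K, y - u • x ∉ L := fun u h => hzx (u₀ + u) (by
    rwa [add_smul, ← sub_sub])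
  have hyL : y ∉ L := by simpa using hyx 0
  have hyP : y ∈ pDual B L P := sub_mem hz (Submodule.smul_mem _ _ hx)
  obtain ⟨b, hb⟩ := exists_residue hB ht hyP hyP.1
  have hbP := hL.residue_notMem hB ht ht2 hyP hyL hb
  have hxy : IsIntegral ℤ (B x y) := by rw [hB.1]; exact hu₀
  obtain ⟨m, hm⟩ := integral_iff.1 hxy
  refine ⟨y, hyP, hxy, hyL, ?_, ?_⟩
  · intro a' b' s ha' hb' hs
    obtain rfl : a' = a := RingOfIntegers.ext (by rw [ha', ha])
    obtain rfl : b' = b := RingOfIntegers.ext (by rw [hb', hb])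
    have hw : s • x + a' • y ∈ L := by
      refine hL.mem_of_residue hB ht ht2 (add_mem (Submodule.smul_mem _ _ hx)
        (Submodule.smul_mem _ _ hyP)) (a := a' * (s * s + a' * b') + t * (2 * s * a' * m)) ?_ ?_
      · exact add_mem (Ideal.mul_mem_left _ _ hs) (Ideal.mul_mem_right _ _ ht)
      · rw [form_add_self hB]
        simp only [form_smul_left, form_smul_right, map_add, map_mul, ← hm, map_ofNat]
        linear_combination (s : K) ^ 2 * ha + (a' : K) ^ 2 * hb
    obtain ⟨c, i, hi, hc⟩ := exists_inv_mod haP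
    refine hyx (-(c * s)) ?_
    have : y - (-(c * s)) • x = c • (s • x + a' • y) + i • y := by
      rw [smul_add, smul_smul, smul_smul, neg_smul, sub_neg_eq_add, add_assoc, ← add_smul, hc,
        one_smul, add_comm]
    rw [this]
    exact add_mem (L.smul_mem _ hw) (hyP.2 i hi)
  · intro w hw
    obtain ⟨u, hu⟩ := exists_orth hB ht ht2 hx hw ha haP
    obtain ⟨v, hv⟩ := exists_orth hB ht ht2 hyP
      (sub_mem hw (Submodule.smul_mem _ u hx)) hb hbP
    set w' := w - u • x - v • y with hw'
    have hw'P : w' ∈ pDual B L P :=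
      sub_mem (sub_mem hw (Submodule.smul_mem _ _ hx)) (Submodule.smul_mem _ _ hyP)
    have h1 : IsIntegral ℤ (B w' x) := by
      rw [hw', map_sub, LinearMap.sub_apply, form_smul_left]
      exact hu.sub ((RingOfIntegers.isIntegral_coe v).mul hu₀)
    obtain ⟨c, hc⟩ := exists_residue hB ht hw'P hw'P.1
    obtain ⟨p, q, hpq⟩ := exists_quadratic_root h2 haP hbP c
    obtain ⟨m₁, hm₁⟩ := integral_iff.1 h1
    obtain ⟨m₂, hm₂⟩ := integral_iff.1 hv
    have hmem : p • x + (q • y + w') ∈ L := by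
      refine hL.mem_of_residue hB ht ht2 (add_mem (Submodule.smul_mem _ _ hx)
        (add_mem (Submodule.smul_mem _ _ hyP) hw'P))
        (a := (a * (p * p) + b * (q * q) + c) + t * (2 * (p * (q * m + m₁) + q * m₂))) ?_ ?_
      · exact add_mem hpq (Ideal.mul_mem_right _ _ ht)
      · rw [form_add_self hB, form_add_self hB]
        simp only [form_smul_left, form_smul_right, map_add, map_mul, map_ofNat, hB.1 x w',
          hB.1 y w', ← hm, ← hm₁, ← hm₂]
        linear_combination (p : K) ^ 2 * ha + (q : K) ^ 2 * hb + hc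
    refine ⟨u - p, v - q, ?_⟩
    convert hmem using 1
    rw [hw', sub_smul, sub_smul]
    abel

/-- The dual modulo the lattice is generated by at most two elements at each prime. -/
theorem MaxLat.two_gen (hB : TotPos B) (hL : MaxLat B L) (P : HeightOneSpectrum (𝓞 K)) :
    ∃ x ∈ pDual B L P, ∃ y ∈ pDual B L P, ∀ w ∈ pDual B L P, ∃ u v : 𝓞 K,
      w - u • x - v • y ∈ L := by
  by_cases hP : pDual B L P ≤ L
  · exact ⟨0, zero_mem _, 0, zero_mem _, fun w hw => ⟨0, 0, by simpa using hP hw⟩⟩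
  obtain ⟨x, hx, hxL⟩ := SetLike.not_le_iff_exists.1 hP
  by_cases hx1 : ∀ z ∈ pDual B L P, ∃ u : 𝓞 K, z - u • x ∈ L
  · refine ⟨x, hx, 0, zero_mem _, fun w hw => ?_⟩
    obtain ⟨u, hu⟩ := hx1 w hw
    exact ⟨u, 0, by simpa using hu⟩
  push Not at hx1
  obtain ⟨z, hz, hzx⟩ := hx1
  obtain ⟨t, ht, ht2⟩ := exists_unif P
  by_cases h2 : (2 : 𝓞 K) ∈ P.asIdeal
  · exfalso
    obtain ⟨a, ha⟩ := exists_residue hB ht hx hx.1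
    have haP := hL.residue_notMem hB ht ht2 hx hxL ha
    obtain ⟨r, hr⟩ := exists_residue hB ht hz hz.1
    obtain ⟨m, hm⟩ := exists_residue hB ht hz hx.1
    obtain ⟨c, i, hi, hc⟩ := exists_inv_mod haP
    obtain ⟨u, hu⟩ := exists_sqrt_mod h2 (c * r)
    refine hzx (-u) (hL.mem_of_residue hB ht ht2 (sub_mem hz (Submodule.smul_mem _ _ hx))
      (a := a * (u * u - c * r) + 2 * (u * m + r) - i * r) ?_ ?_)
    · exact sub_mem (add_mem (Ideal.mul_mem_left _ _ hu) (Ideal.mul_mem_right _ _ h2))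
        (Ideal.mul_mem_right _ _ hi)
    · have hc' := congrArg (algebraMap (𝓞 K) K) hc
      simp only [map_add, map_mul, map_one] at hc'
      rw [neg_smul, sub_neg_eq_add, form_add_self hB]
      simp only [form_smul_left, form_smul_right, map_add, map_mul, map_ofNat, map_sub]
      linear_combination (u : K) ^ 2 * ha + hr + 2 * (u : K) * hm - (r : K) * hc'
  · obtain ⟨y, hy, -, -, -, h⟩ := hL.plane hB h2 ht ht2 hx hxL hz hzx
    exact ⟨x, hx, y, hy, h⟩

end Plane

end TotReal

namespace TotReal

open NumberField Module IsDedekindDomain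
open scoped nonZeroDivisors

set_option linter.unusedSectionVars false

variable {K : Type} [Field K] [NumberField K] [IsTotallyReal K]
variable {V : Type} [AddCommGroup V] [Module K V] [Module (𝓞 K) V] [IsScalarTower (𝓞 K) K V]
variable {B : V →ₗ[K] V →ₗ[K] K} {L : Submodule (𝓞 K) V}

theorem MaxLat.smul_mem_of_bad (hB : TotPos B) (hL : MaxLat B L)
    {S : Finset (HeightOneSpectrum (𝓞 K))} (hS : badPrimes B L ⊆ S) {x : V}
    (hx : x ∈ dualLat B L) {r : 𝓞 K} (hr : ∀ P ∈ S, r ∈ P.asIdeal) : r • x ∈ L := by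
  refine mem_of_forall_loc fun Q => ?_
  by_cases hQ : Q ∈ S
  · obtain ⟨s, hs, h⟩ := hL.dual_le_loc hB (P := Q) hx
    exact ⟨s, hs, by rw [smul_comm]; exact h.2 r (hr Q hQ)⟩
  · exact Submodule.smul_mem _ r (hL.dual_le_loc_of_notMem hB (fun h => hQ (hS h)) hx)

theorem exists_idem (S : Finset (HeightOneSpectrum (𝓞 K))) (P : HeightOneSpectrum (𝓞 K)) :
    ∃ e : 𝓞 K, e - 1 ∈ P.asIdeal ∧ ∀ Q ∈ S, Q ≠ P → e ∈ Q.asIdeal := by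
  classical
  obtain ⟨e, he⟩ := IsDedekindDomain.exists_forall_sub_mem_ideal (s := insert P S)
    (fun Q : HeightOneSpectrum (𝓞 K) => Q.asIdeal) (fun _ => 1) (fun Q _ => Q.prime)
    (fun Q _ R _ h h' => h (HeightOneSpectrum.ext h')) (fun Q => if Q.1 = P then 1 else 0)
  refine ⟨e, by simpa using he P (Finset.mem_insert_self _ _), fun Q hQ hne => ?_⟩
  simpa [hne] using he Q (Finset.mem_insert_of_mem hQ)

/-- A maximal lattice whose bad primes lie in a fixed finite set has bounded discriminant. -/
theorem MaxLat.disc_le (hB : TotPos B) (hL : MaxLat B L)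
    {S : Finset (HeightOneSpectrum (𝓞 K))} (hS : badPrimes B L ⊆ S) :
    disc B L ≤ ∏ P ∈ S, Ideal.absNorm P.asIdeal ^ 2 := by
  classical
  choose e he1 he0 using exists_idem (K := K) S
  choose x hx y hy hxy using hL.two_gen hB
  have heL : ∀ z ∈ dualLat B L, ∀ P ∈ S, e P • z ∈ pDual B L P := fun z hz P hP =>
    ⟨Submodule.smul_mem _ _ hz, fun s hs => by
      rw [smul_smul]
      refine hL.smul_mem_of_bad hB hS hz fun Q hQ => ?_
      by_cases h : Q = P
      · subst h; exact Ideal.mul_mem_right _ _ hs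
      · exact Ideal.mul_mem_left _ _ (he0 P Q hQ h)⟩
  have hglue : ∀ z ∈ dualLat B L, (∀ P ∈ S, e P • z ∈ L) → z ∈ L := by
    refine fun z hz h => mem_of_forall_loc fun Q => ?_
    by_cases hQ : Q ∈ S
    · refine ⟨e Q, fun h' => one_notMem Q ?_, h Q hQ⟩
      simpa using sub_mem h' (he1 Q)
    · exact hL.dual_le_loc_of_notMem hB (fun h => hQ (hS h)) hz
  have hc : ∀ z : dualLat B L, ∀ P : S, ∃ p : 𝓞 K × 𝓞 K,
      e P • (z : V) - p.1 • x P - p.2 • y P ∈ L := fun z P => by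
    obtain ⟨u, v, h⟩ := hxy P _ (heL z z.2 P P.2)
    exact ⟨(u, v), h⟩
  choose c hc using hc
  have := fun P : S => finite_quot P.1
  let Q := (dualLat B L).toAddSubgroup ⧸ L.toAddSubgroup.addSubgroupOf (dualLat B L).toAddSubgroup
  let F : Q → ∀ P : S, (𝓞 K ⧸ P.1.asIdeal) × (𝓞 K ⧸ P.1.asIdeal) := fun z P =>
    (Ideal.Quotient.mk _ (c (Quotient.out z) P).1, Ideal.Quotient.mk _ (c (Quotient.out z) P).2)
  have hF : Function.Injective F := by
    intro z w hzw
    rw [← Quotient.out_eq z, ← Quotient.out_eq w]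
    refine QuotientAddGroup.eq.2 ?_
    rw [AddSubgroup.mem_addSubgroupOf]
    refine hglue _ (SetLike.coe_mem _) fun P hP => ?_
    have h1 := congrFun hzw ⟨P, hP⟩
    simp only [F, Prod.mk.injEq] at h1
    have h2 := (hx P).2 _ (Ideal.Quotient.eq.1 h1.1)
    have h3 := (hy P).2 _ (Ideal.Quotient.eq.1 h1.2)
    have h4 := L.sub_mem (hc (Quotient.out w) ⟨P, hP⟩) (hc (Quotient.out z) ⟨P, hP⟩)
    convert L.sub_mem (L.sub_mem h4 h2) h3 using 1
    simp only [AddSubgroup.coe_add, AddSubgroup.coe_neg, smul_add, smul_neg, sub_smul]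
    abel
  calc disc B L = Nat.card Q := rfl
    _ ≤ Nat.card (∀ P : S, (𝓞 K ⧸ P.1.asIdeal) × (𝓞 K ⧸ P.1.asIdeal)) :=
      Nat.card_le_card_of_injective F hF
    _ = ∏ P ∈ S, Ideal.absNorm P.asIdeal ^ 2 := by
      rw [Nat.card_pi, ← Finset.prod_coe_sort S]
      refine Finset.prod_congr rfl fun P _ => ?_
      rw [Nat.card_prod, sq]
      rfl

theorem MaxLat.finite_bad (hB : TotPos B) [FiniteDimensional K V] (hL : MaxLat B L) :
    (badPrimes B L).Finite := by
  have hd := disc_pos hB hL.lat hL.int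
  have hne : Ideal.span {(disc B L : 𝓞 K)} ≠ 0 := by
    simpa using hd.ne'
  refine (Ideal.finite_factors hne).subset fun P hP => ?_
  rw [Set.mem_ofPred_eq, Ideal.dvd_span_singleton]
  by_contra hn
  refine hP fun x hx => mem_of_killed hx.2 ⟨_, hn, ?_⟩
  have := AddSubgroup.nsmul_index_mem
    (H := L.toAddSubgroup.addSubgroupOf (dualLat B L).toAddSubgroup) ⟨x, hx.1⟩
  rw [AddSubgroup.mem_addSubgroupOf] at this
  rw [Nat.cast_smul_eq_nsmul]
  exact this

end TotReal

namespace TotReal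

open NumberField Module IsDedekindDomain
open scoped nonZeroDivisors

set_option linter.unusedSectionVars false

section Local

variable {K : Type} [Field K] [NumberField K]
variable {M : Type} [AddCommGroup M] [Module (𝓞 K) M]

theorem exists_uniform {P : HeightOneSpectrum (𝓞 K)} {N N' : Submodule (𝓞 K) M} (hN : N.FG)
    (h : N ≤ loc P N') : ∃ s : 𝓞 K, s ∉ P.asIdeal ∧ ∀ n ∈ N, s • n ∈ N' := by
  classical
  obtain ⟨T, rfl⟩ := hN
  have h1 : ∀ z : T, ∃ s : 𝓞 K, s ∉ P.asIdeal ∧ s • (z : M) ∈ N' := fun z =>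
    h (Submodule.subset_span z.2)
  choose s hs hsz using h1
  refine ⟨∏ z, s z, fun hP => ?_, fun n hn => ?_⟩
  · obtain ⟨z, -, hz⟩ := (P.isPrime.prod_mem_iff).1 hP
    exact hs z hz
  · induction hn using Submodule.span_induction with
    | mem x hx =>
      rw [← Finset.prod_erase_mul _ _ (Finset.mem_univ (⟨x, hx⟩ : T)), mul_smul]
      exact N'.smul_mem _ (hsz ⟨x, hx⟩)
    | zero => simp
    | add x y _ _ hx hy => rw [smul_add]; exact N'.add_mem hx hy
    | smul a x _ hx => rw [smul_comm]; exact N'.smul_mem _ hx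

theorem exists_inverse_elem (P : HeightOneSpectrum (𝓞 K)) :
    ∃ w : K, ¬ IsIntegral ℤ w ∧ ∀ p ∈ P.asIdeal, IsIntegral ℤ ((p : K) * w) := by
  obtain ⟨t, ht, ht2⟩ := exists_unif P
  have h1 : P.asIdeal * ((Ideal.span {t}) : Ideal (𝓞 K)) ≠ Ideal.span {t} := by
    intro h
    have h0 : (Ideal.span {t} : Ideal (𝓞 K)) ≠ ⊥ := by
      rw [Ne, Ideal.span_singleton_eq_bot]
      rintro rfl
      exact ht2 (Submodule.zero_mem _)
    exact P.isPrime.ne_top (by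
      have := mul_right_cancel₀ h0 (h.trans (one_mul _).symm)
      rwa [Ideal.one_eq_top] at this)
  obtain ⟨J, hJ⟩ : P.asIdeal ∣ Ideal.span {t} := by
    rw [Ideal.dvd_span_singleton]; exact ht
  have h2 : ¬ J ≤ Ideal.span {t} := fun h => h1 (by
    refine le_antisymm Ideal.mul_le_right ?_
    calc Ideal.span {t} = P.asIdeal * J := hJ
      _ ≤ _ := Ideal.mul_mono_right h)
  obtain ⟨j, hj, hjt⟩ := SetLike.not_le_iff_exists.1 h2
  have ht0 : (t : K) ≠ 0 := by
    simp only [ne_eq, RingOfIntegers.coe_eq_zero_iff]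
    rintro rfl
    exact ht2 (Submodule.zero_mem _)
  refine ⟨j / t, fun h => hjt ?_, fun p hp => ?_⟩
  · obtain ⟨a, ha⟩ := integral_iff.1 h
    rw [eq_div_iff ht0] at ha
    refine Ideal.mem_span_singleton'.2 ⟨a, ?_⟩
    apply RingOfIntegers.coe_injective
    simpa only [map_mul] using ha
  · have : p * j ∈ Ideal.span {t} := hJ ▸ Ideal.mul_mem_mul hp hj
    obtain ⟨a, ha⟩ := Ideal.mem_span_singleton'.1 this
    refine integral_iff.2 ⟨a, ?_⟩
    have := congrArg (algebraMap (𝓞 K) K) ha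
    simp only [map_mul] at this
    rw [mul_div_assoc', eq_div_iff ht0]
    exact this

end Local

section Det

variable {K : Type} [Field K] [NumberField K] [IsTotallyReal K]
variable {V : Type} [AddCommGroup V] [Module K V] [Module (𝓞 K) V] [IsScalarTower (𝓞 K) K V]
variable {B : V →ₗ[K] V →ₗ[K] K} {L : Submodule (𝓞 K) V} {P : HeightOneSpectrum (𝓞 K)}

/-- The determinant of the form is a square. -/
def SqDet (B : V →ₗ[K] V →ₗ[K] K) : Prop :=
  ∃ (n : ℕ) (b : Basis (Fin n) K V), IsSquare (LinearMap.toMatrix₂ b b B).det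

theorem isSquare_det_of_basis {ι ι' : Type} [Fintype ι] [DecidableEq ι] [Fintype ι']
    [DecidableEq ι'] (b : Basis ι K V) (c : Basis ι' K V)
    (h : IsSquare (LinearMap.toMatrix₂ b b B).det) :
    IsSquare (LinearMap.toMatrix₂ c c B).det := by
  let e := b.indexEquiv c
  let c' := c.reindex e.symm
  have h1 : (LinearMap.toMatrix₂ c' c' B).det = (LinearMap.toMatrix₂ c c B).det := by
    have : LinearMap.toMatrix₂ c' c' B = (LinearMap.toMatrix₂ c c B).submatrix e e := by
      ext i j
      simp [c', LinearMap.toMatrix₂_apply]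
    rw [this, Matrix.det_submatrix_equiv_self]
  rw [← h1, ← LinearMap.toMatrix₂_mul_basis_toMatrix b b c' c' B, Matrix.det_mul, Matrix.det_mul,
    Matrix.det_transpose]
  obtain ⟨r, hr⟩ := h
  exact ⟨(b.toMatrix c').det * r, by rw [hr]; ring⟩

theorem SqDet.basis (h : SqDet B) {ι : Type} [Fintype ι] [DecidableEq ι] (c : Basis ι K V) :
    IsSquare (LinearMap.toMatrix₂ c c B).det := by
  obtain ⟨n, b, hb⟩ := h
  exact isSquare_det_of_basis b c hb

theorem SqDet.of_basis {ι : Type} [Fintype ι] [DecidableEq ι] (c : Basis ι K V)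
    (h : IsSquare (LinearMap.toMatrix₂ c c B).det) : SqDet B :=
  ⟨_, c.reindex (Fintype.equivFin ι), isSquare_det_of_basis c _ h⟩

theorem det_frame (hB : TotPos B) [FiniteDimensional K V] {k : ℕ} {g : Fin k → V}
    (hg : OrthFrame B g) (hk : finrank K V = k) :
    ∃ c : Basis (Fin k) K V, (LinearMap.toMatrix₂ c c B).det = ∏ i, B (g i) (g i) := by
  refine ⟨Basis.ofEquivFun (frameEquiv hB hg hk).symm, ?_⟩
  have hc : ∀ i, Basis.ofEquivFun (frameEquiv hB hg hk).symm i = g i := fun i => by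
    simp [frameEquiv_apply, Pi.single_apply]
  have : LinearMap.toMatrix₂ (Basis.ofEquivFun (frameEquiv hB hg hk).symm)
      (Basis.ofEquivFun (frameEquiv hB hg hk).symm) B = Matrix.diagonal fun i => B (g i) (g i) := by
    ext i j
    rw [LinearMap.toMatrix₂_apply, hc, hc, Matrix.diagonal_apply]
    split_ifs with h
    · rw [h]
    · exact hg.1 i j h
  rw [this, Matrix.det_diagonal]

theorem SqDet.frame (h : SqDet B) (hB : TotPos B) [FiniteDimensional K V] {k : ℕ} {g : Fin k → V}
    (hg : OrthFrame B g) (hk : finrank K V = k) : IsSquare (∏ i, B (g i) (g i)) := by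
  obtain ⟨c, hc⟩ := det_frame hB hg hk
  exact hc ▸ h.basis c

theorem orthFrame_cons {y : V} (hy : y ≠ 0) (hB : TotPos B) {k : ℕ}
    {g : Fin k → LinearMap.ker (B y)} (hg : OrthFrame (restr B _) g) :
    OrthFrame B (Fin.cons y fun i => (g i : V) : Fin (k + 1) → V) := by
  refine ⟨fun i j hij => ?_, fun i => ?_⟩
  · induction i using Fin.cases with
    | zero =>
      induction j using Fin.cases with
      | zero => exact absurd rfl hij
      | succ j => exact (g j).2
    | succ i =>
      induction j using Fin.cases with
      | zero => exact (hB.1 _ _).trans (g i).2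
      | succ j => exact hg.1 i j fun h => hij (by rw [h])
  · induction i using Fin.cases with
    | zero => exact hy
    | succ i => exact fun h => hg.2 i (Subtype.ext h)

/-- Unimodularity at a prime. -/
def PUni (B : V →ₗ[K] V →ₗ[K] K) (M : Submodule (𝓞 K) V) (P : HeightOneSpectrum (𝓞 K)) : Prop :=
  ∀ z, (∀ m ∈ M, ∃ s : 𝓞 K, s ∉ P.asIdeal ∧ IsIntegral ℤ ((s : K) * B z m)) → z ∈ loc P M

theorem PUni.exists_unit (hB : TotPos B) {M : Submodule (𝓞 K) V} (hM : IsLat M)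
    (hi : M ≤ dualLat B M) (h2 : (2 : 𝓞 K) ∉ P.asIdeal) (hu : PUni B M P) {v : V} (hv : v ≠ 0) :
    ∃ y ∈ M, ∃ u : 𝓞 K, u ∉ P.asIdeal ∧ (u : K) = B y y := by
  by_contra! hcon
  have hself : ∀ y ∈ M, ∃ u ∈ P.asIdeal, (u : K) = B y y := fun y hy => by
    obtain ⟨u, h⟩ := integral_iff.1 (hi hy y hy)
    exact ⟨u, by by_contra hu; exact hcon y hy u hu h, h⟩
  have hall : ∀ y ∈ M, ∀ z ∈ M, ∃ u ∈ P.asIdeal, (u : K) = B y z := fun y hy z hz => by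
    obtain ⟨u, h⟩ := integral_iff.1 (hi hy z hz)
    obtain ⟨a, ha, ha'⟩ := hself _ (M.add_mem hy hz)
    obtain ⟨b, hb, hb'⟩ := hself _ hy
    obtain ⟨c, hc, hc'⟩ := hself _ hz
    refine ⟨u, ?_, h⟩
    have : 2 * u = a - b - c := by
      apply RingOfIntegers.coe_injective
      simp only [map_mul, map_sub, map_ofNat]
      linear_combination 2 * h - ha' + hb' + hc' - form_add_self hB y z
    refine (P.isPrime.mem_or_mem (this ▸ ?_)).resolve_left h2
    exact Ideal.sub_mem _ (Ideal.sub_mem _ ha hb) hc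
  obtain ⟨w, hw, hwP⟩ := exists_inverse_elem P
  have h1 : M.map ((LinearMap.lsmul K V w).restrictScalars (𝓞 K)) ≤ loc P M := by
    rintro _ ⟨m, hm, rfl⟩
    refine hu _ fun m' hm' => ⟨1, one_notMem P, ?_⟩
    obtain ⟨u, hu, hu'⟩ := hall m hm m' hm'
    have := hwP u hu
    simpa [← hu', mul_comm] using this
  obtain ⟨s, hs, hsM⟩ := exists_uniform (hM.1.map _) h1
  obtain ⟨a, ha, hav⟩ := hM.2 v
  have hint : IsIntegral (𝓞 K) (s * w : K) := by
    refine isIntegral_of_smul_mem_submodule M ?_ hM.1 _ fun n hn => ?_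
    · rintro rfl
      rw [Submodule.mem_bot] at hav
      rw [← algebraMap_smul K a v] at hav
      exact (smul_ne_zero (by simpa using ha) hv) hav
    · have := hsM _ (Submodule.mem_map_of_mem hn)
      rw [mul_smul]
      rw [← algebraMap_smul K s] at this
      simpa using this
  have hint' : IsIntegral ℤ (s * w : K) := isIntegral_trans _ hint
  refine hw (mem_of_killed (P := P) (N := intSub K) (fun p hp => ?_) ⟨s, hs, ?_⟩)
  · rw [Algebra.smul_def]; exact hwP p hp
  · rw [Algebra.smul_def]; exact hint'

theorem PUni.frame (h2 : (2 : 𝓞 K) ∉ P.asIdeal) (k : ℕ) : ∀ {V : Type} [AddCommGroup V]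
    [Module K V] [Module (𝓞 K) V] [IsScalarTower (𝓞 K) K V] {B : V →ₗ[K] V →ₗ[K] K} (_ : TotPos B)
    [FiniteDimensional K V] {M : Submodule (𝓞 K) V} (_ : IsLat M) (_ : M ≤ dualLat B M)
    (_ : PUni B M P) (_ : finrank K V = k),
    ∃ g : Fin k → V, OrthFrame B g ∧ ∀ i, P.valuation K (B (g i) (g i)) = 1 := by
  induction k with
  | zero => exact fun _ _ _ _ _ _ _ => ⟨Fin.elim0, ⟨fun i => i.elim0, fun i => i.elim0⟩,
      fun i => i.elim0⟩
  | succ k ih =>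
    intro V _ _ _ _ B hB _ M hM hi hu hk
    have : Nontrivial V := Module.nontrivial_of_finrank_pos (R := K) (by omega)
    obtain ⟨v, hv⟩ := exists_ne (0 : V)
    obtain ⟨y, hy, c, hc, hcB⟩ := hu.exists_unit hB hM hi h2 hv
    have hc0 : (c : K) ≠ 0 := by
      simp only [ne_eq, RingOfIntegers.coe_eq_zero_iff]
      rintro rfl
      exact hc (Submodule.zero_mem _)
    have hy0 : y ≠ 0 := by
      rintro rfl
      exact hc0 (by simpa using hcB)
    have hu' : PUni (restr B (LinearMap.ker (B y))) (interLat M (LinearMap.ker (B y))) P := by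
      intro z hz
      obtain ⟨s, hs, hsz⟩ : (z : V) ∈ loc P M := by
        refine hu _ fun m hm => ?_
        obtain ⟨b, hb⟩ := integral_iff.1 (hi hy m hm)
        have hmem : c • m - b • y ∈ LinearMap.ker (B y) := by
          rw [LinearMap.mem_ker, map_sub, form_smul_right, form_smul_right, hb, ← hcB]
          ring
        obtain ⟨s, hs, h⟩ := hz ⟨_, hmem⟩ (M.sub_mem (M.smul_mem _ hm) (M.smul_mem _ hy))
        refine ⟨s * c, mul_notMem hs hc, ?_⟩
        have hzy : B z y = 0 := by rw [hB.1]; exact z.2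
        rw [restr_apply] at h
        rw [map_sub, form_smul_right, form_smul_right, hzy, mul_zero, sub_zero] at h
        simpa only [map_mul, mul_assoc] using h
      exact ⟨s, hs, hsz⟩
    obtain ⟨g, hg, hgv⟩ := ih (hB.restr _) (hM.inter _) (integral_inter hi _) hu'
      (finrank_orth hB hy0 hk)
    refine ⟨_, orthFrame_cons hy0 hB hg, fun i => ?_⟩
    induction i using Fin.cases with
    | zero => simpa [← hcB] using valuation_eq_one hc
    | succ i => exact hgv i

theorem MaxLat.even (hB : TotPos B) [FiniteDimensional K V] (hL : MaxLat B L) (hsq : SqDet B)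
    (h2 : (2 : 𝓞 K) ∉ P.asIdeal) {x : V} (hx : x ∈ pDual B L P) (hxL : x ∉ L) :
    ∃ z ∈ pDual B L P, ∀ u : 𝓞 K, z - u • x ∉ L := by
  by_contra! hcon
  obtain ⟨t, ht, ht2⟩ := exists_unif P
  obtain ⟨a, ha⟩ := exists_residue hB ht hx hx.1
  have haP := hL.residue_notMem hB ht ht2 hx hxL ha
  have hx0 : x ≠ 0 := by
    rintro rfl
    exact hxL L.zero_mem
  have hu : PUni (restr B (LinearMap.ker (B x))) (interLat L (LinearMap.ker (B x))) P := by
    intro z hz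
    have h1 : L.map ((B z).restrictScalars (𝓞 K)) ≤ loc P (intSub K) := by
      rintro _ ⟨l, hl, rfl⟩
      obtain ⟨b, hb⟩ := integral_iff.1 (hx.1 l hl)
      have hmem : a • l - b • t • x ∈ LinearMap.ker (B x) := by
        rw [LinearMap.mem_ker, map_sub, form_smul_right, form_smul_right, form_smul_right, hb, ← ha]
        ring
      obtain ⟨s, hs, h⟩ := hz ⟨_, hmem⟩ (L.sub_mem (L.smul_mem _ hl) (L.smul_mem _ (hx.2 t ht)))
      refine ⟨s * a, mul_notMem hs haP, ?_⟩
      have hzx : B z x = 0 := by rw [hB.1]; exact z.2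
      rw [restr_apply, map_sub, form_smul_right, form_smul_right, form_smul_right, hzx, mul_zero,
        mul_zero, sub_zero, ← mul_assoc] at h
      rw [mem_intSub, Algebra.smul_def]
      simp only [map_mul]
      exact h
    obtain ⟨s, hs, hsL⟩ := exists_uniform (hL.lat.1.map _) h1
    have h2 : s • (z : V) ∈ dualLat B L := fun l hl => by
      rw [form_smul_left]
      have := hsL _ (Submodule.mem_map_of_mem hl)
      rwa [Algebra.smul_def] at this
    obtain ⟨r, hr, hrz⟩ := hL.dual_le_loc (P := P) hB h2
    obtain ⟨u, hu⟩ := hcon _ hrz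
    have hrs : r • s • (z : V) ∈ L := by
      obtain ⟨b, hb⟩ := integral_iff.1 (hx.1 _ hu)
      have hzx : B x z = 0 := z.2
      rw [map_sub, form_smul_right, form_smul_right, form_smul_right, hzx] at hb
      have huP : u ∈ P.asIdeal := by
        refine (P.isPrime.mem_or_mem (y := a) ?_).resolve_right haP
        have : u * a = -b * t := by
          apply RingOfIntegers.coe_injective
          simp only [map_mul, map_neg]
          linear_combination (u : K) * ha + (t : K) * hb
        rw [this]
        exact Ideal.mul_mem_left _ _ ht
      simpa using L.add_mem hu (hx.2 u huP)
    exact ⟨r * s, mul_notMem hr hs, by rw [mem_interLat]; simpa [mul_smul] using hrs⟩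
  have hpos : 0 < finrank K V := by
    have : Nontrivial V := ⟨x, 0, hx0⟩
    exact Module.finrank_pos
  obtain ⟨k, hk⟩ : ∃ k, finrank K V = k + 1 := ⟨finrank K V - 1, by omega⟩
  obtain ⟨g, hg, hgv⟩ := PUni.frame h2 k (hB.restr _) (hL.lat.inter _)
    (integral_inter hL.int _) hu (finrank_orth hB hx0 hk)
  obtain ⟨r, hr⟩ := hsq.frame hB (orthFrame_cons hx0 hB hg) hk
  have hval := congrArg (P.valuation K) hr
  rw [Fin.prod_univ_succ, map_mul, map_mul, map_prod] at hval
  simp only [Fin.cons_zero, Fin.cons_succ] at hval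
  have hgv' : ∀ i, P.valuation K (B (g i) (g i)) = 1 := hgv
  rw [Finset.prod_congr rfl fun i _ => hgv' i, Finset.prod_const_one, mul_one] at hval
  have ht' := valuation_unif ht ht2
  have ha' := valuation_eq_one haP
  rw [ha, map_mul, ht', hval] at ha'
  have hr0 : P.valuation K r ≠ 0 := by
    intro h
    simp [h] at ha'
  obtain ⟨m, hm⟩ : ∃ m : ℤ, P.valuation K r = WithZero.exp m :=
    ⟨_, (WithZero.exp_log hr0).symm⟩
  rw [hm, ← WithZero.exp_add, ← WithZero.exp_add, ← WithZero.exp_zero] at ha'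
  have := WithZero.exp_injective ha'
  omega

end Det

end TotReal

namespace TotReal

open NumberField Module IsDedekindDomain
open scoped nonZeroDivisors

set_option linter.unusedSectionVars false

section Sum

variable {K : Type} [Field K] [NumberField K] [IsTotallyReal K]
variable {V : Type} [AddCommGroup V] [Module K V] [Module (𝓞 K) V] [IsScalarTower (𝓞 K) K V]
variable {W : Type} [AddCommGroup W] [Module K W] [Module (𝓞 K) W] [IsScalarTower (𝓞 K) K W]
variable {B : V →ₗ[K] V →ₗ[K] K} {C : W →ₗ[K] W →ₗ[K] K}
variable {L : Submodule (𝓞 K) V} {M : Submodule (𝓞 K) W} {P : HeightOneSpectrum (𝓞 K)}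

/-- The orthogonal sum of two forms. -/
def prodForm (B : V →ₗ[K] V →ₗ[K] K) (C : W →ₗ[K] W →ₗ[K] K) :
    (V × W) →ₗ[K] (V × W) →ₗ[K] K :=
  B.compl₁₂ (LinearMap.fst K V W) (LinearMap.fst K V W) +
    C.compl₁₂ (LinearMap.snd K V W) (LinearMap.snd K V W)

@[simp]
theorem prodForm_apply (x y : V × W) : prodForm B C x y = B x.1 y.1 + C x.2 y.2 := rfl

theorem TotPos.nonneg (hB : TotPos B) (x : V) (σ : K →+* ℝ) : 0 ≤ σ (B x x) := by
  by_cases h : x = 0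
  · simp [h]
  · exact (hB.2 x h σ).le

theorem TotPos.prod (hB : TotPos B) (hC : TotPos C) : TotPos (prodForm B C) := by
  refine ⟨fun x y => by simp [hB.1 x.1, hC.1 x.2], fun x hx σ => ?_⟩
  rw [prodForm_apply, map_add]
  by_cases h : x.1 = 0
  · have h2 : x.2 ≠ 0 := fun h2 => hx (Prod.ext h h2)
    exact add_pos_of_nonneg_of_pos (hB.nonneg _ σ) (hC.2 _ h2 σ)
  · exact add_pos_of_pos_of_nonneg (hB.2 _ h σ) (hC.nonneg _ σ)

theorem SqDet.prod (hB : SqDet B) (hC : SqDet C) : SqDet (prodForm B C) := by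
  obtain ⟨n, b, r, hr⟩ := hB
  obtain ⟨m, c, q, hq⟩ := hC
  refine SqDet.of_basis (b.prod c) ⟨r * q, ?_⟩
  have : LinearMap.toMatrix₂ (b.prod c) (b.prod c) (prodForm B C) =
      Matrix.fromBlocks (LinearMap.toMatrix₂ b b B) 0 0 (LinearMap.toMatrix₂ c c C) := by
    ext i j
    rcases i with i | i <;> rcases j with j | j <;> simp [LinearMap.toMatrix₂_apply]
  rw [this, Matrix.det_fromBlocks_zero₂₁, hr, hq]
  ring

theorem IsLat.prod (hL : IsLat L) (hM : IsLat M) : IsLat (L.prod M) := by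
  refine ⟨hL.1.prod hM.1, fun v => ?_⟩
  obtain ⟨a, ha, hav⟩ := hL.2 v.1
  obtain ⟨b, hb, hbv⟩ := hM.2 v.2
  refine ⟨a * b, mul_ne_zero ha hb, ?_, ?_⟩
  · rw [mul_comm, mul_smul]; exact L.smul_mem _ hav
  · rw [mul_smul]; exact M.smul_mem _ hbv

theorem isIntegral_of_two {P Q : HeightOneSpectrum (𝓞 K)} (hPQ : P ≠ Q) {x : K}
    (hP : ∀ s ∈ P.asIdeal, IsIntegral ℤ ((s : K) * x))
    (hQ : ∀ s ∈ Q.asIdeal, IsIntegral ℤ ((s : K) * x)) : IsIntegral ℤ x :=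
  mem_of_killed (P := P) (N := intSub K) (fun s hs => by rw [Algebra.smul_def]; exact hP s hs)
    (loc_of_killed (P := Q) (fun s hs => by rw [Algebra.smul_def]; exact hQ s hs) hPQ)

/-- Vectors gluing two maximal lattices at a prime. -/
structure Glue (B : V →ₗ[K] V →ₗ[K] K) (C : W →ₗ[K] W →ₗ[K] K) (L : Submodule (𝓞 K) V)
    (M : Submodule (𝓞 K) W) (P : HeightOneSpectrum (𝓞 K)) (x y : V × W) : Prop where
  x1 : x.1 ∈ pDual B L P
  x2 : x.2 ∈ pDual C M P
  y1 : y.1 ∈ pDual B L P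
  y2 : y.2 ∈ pDual C M P
  xx : IsIntegral ℤ (prodForm B C x x)
  xy : IsIntegral ℤ (prodForm B C x y)
  yy : IsIntegral ℤ (prodForm B C y y)
  gen1 : ∀ w ∈ pDual B L P, ∃ u v : 𝓞 K, w - u • x.1 - v • y.1 ∈ L
  gen2 : ∀ w ∈ pDual C M P, ∃ u v : 𝓞 K, w - u • x.2 - v • y.2 ∈ M

theorem exists_glue (hB : TotPos B) (hC : TotPos C) [FiniteDimensional K V]
    [FiniteDimensional K W] (hL : MaxLat B L) (hM : MaxLat C M) (hBs : SqDet B) (hCs : SqDet C)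
    (h2 : (2 : 𝓞 K) ∉ P.asIdeal) (hP1 : P ∈ badPrimes B L) (hP2 : P ∈ badPrimes C M) :
    ∃ x y, Glue B C L M P x y := by
  obtain ⟨t, ht, ht2⟩ := exists_unif P
  obtain ⟨x, hx, hxL⟩ := SetLike.not_le_iff_exists.1 hP1
  obtain ⟨z, hz, hzx⟩ := hL.even hB hBs h2 hx hxL
  obtain ⟨y, hy, hxy, hyL, hs, hgen⟩ := hL.plane hB h2 ht ht2 hx hxL hz hzx
  obtain ⟨x0, hx0, hx0M⟩ := SetLike.not_le_iff_exists.1 hP2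
  obtain ⟨z0, hz0, hzx0⟩ := hM.even hC hCs h2 hx0 hx0M
  obtain ⟨y0, hy0, hxy0, hy0M, hs0, hgen0⟩ := hM.plane hC h2 ht ht2 hx0 hx0M hz0 hzx0
  obtain ⟨a, ha⟩ := exists_residue hB ht hx hx.1
  obtain ⟨b, hb⟩ := exists_residue hB ht hy hy.1
  obtain ⟨a0, ha0⟩ := exists_residue hC ht hx0 hx0.1
  obtain ⟨b0, hb0⟩ := exists_residue hC ht hy0 hy0.1
  have haP := hL.residue_notMem hB ht ht2 hx hxL ha
  obtain ⟨u, v, huv⟩ := exists_quadratic_root h2 (hM.residue_notMem hC ht ht2 hx0 hx0M ha0)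
    (hM.residue_notMem hC ht ht2 hy0 hy0M hb0) a
  have hx' : u • x0 + v • y0 ∈ pDual C M P :=
    Submodule.add_mem _ (Submodule.smul_mem _ _ hx0) (Submodule.smul_mem _ _ hy0)
  set x' := u • x0 + v • y0 with hx'def
  obtain ⟨a', ha'⟩ := exists_residue hC ht hx' hx'.1
  have haa : a' + a ∈ P.asIdeal := by
    obtain ⟨c, hc⟩ := integral_iff.1 hxy0
    have : a' + a = (a0 * (u * u) + b0 * (v * v) + a) + 2 * u * v * c * t := by
      apply RingOfIntegers.coe_injective
      simp only [map_mul, map_add, map_ofNat]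
      have e : C x' x' = u * u * C x0 x0 + 2 * (u * v * C x0 y0) + v * v * C y0 y0 := by
        rw [hx'def, form_add_self hC]
        simp only [form_smul_left, form_smul_right]
        ring
      linear_combination ha' + (t : K) * e - (u : K) * u * ha0 - (v : K) * v * hb0 -
        2 * (u : K) * v * t * hc
    rw [this]
    exact P.asIdeal.add_mem huv (P.asIdeal.mul_mem_left _ ht)
  have hx'M : x' ∉ M := by
    intro h
    obtain ⟨c, hc⟩ := integral_iff.1 (hM.int h x' h)
    have : a' = c * t := by
      apply RingOfIntegers.coe_injective
      simp only [map_mul]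
      linear_combination ha' - (t : K) * hc
    refine haP ((P.asIdeal.add_mem_iff_right ?_).1 haa)
    rw [this]
    exact P.asIdeal.mul_mem_left _ ht
  obtain ⟨z', hz', hzx'⟩ := hM.even hC hCs h2 hx' hx'M
  obtain ⟨y', hy', hxy', hy'M, hs', hgen'⟩ := hM.plane hC h2 ht ht2 hx' hx'M hz' hzx'
  obtain ⟨b', hb'⟩ := exists_residue hC ht hy' hy'.1
  have hbP' := hM.residue_notMem hC ht ht2 hy' hy'M hb'
  obtain ⟨s, hss⟩ := exists_sqrt_mul (P := P) (a := -(a * b)) (b := -(a' * b'))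
    (fun s => by rw [sub_neg_eq_add]; exact hs a b s ha hb)
    (fun s => by rw [sub_neg_eq_add]; exact hs' a' b' s ha' hb')
  obtain ⟨c, i, hi, hci⟩ := exists_inv_mod (mul_notMem haP hbP')
  have hr : (s * c) * (s * c) * b' + b ∈ P.asIdeal := by
    rw [← Ideal.Quotient.eq_zero_iff_mem] at hi haa hss ⊢
    have hci' := congrArg (Ideal.Quotient.mk P.asIdeal) hci
    simp only [map_add, map_mul, map_one, map_sub, map_neg] at hi haa hss hci' ⊢
    rw [hi, add_zero] at hci'
    set q := Ideal.Quotient.mk P.asIdeal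
    have haa' : q a' = - q a := eq_neg_of_add_eq_zero_left haa
    rw [haa'] at hss
    linear_combination q c * q c * q b' * hss -
      q b * (q c * (q a * q b') + 1) * hci'
  set r := s * c with hrdef
  have hrP : r ∉ P.asIdeal := by
    intro h
    refine hL.residue_notMem hB ht ht2 hy hyL hb ((P.asIdeal.add_mem_iff_right ?_).1 hr)
    exact P.asIdeal.mul_mem_right _ (P.asIdeal.mul_mem_right _ h)
  obtain ⟨d, j, hj, hdj⟩ := exists_inv_mod hrP
  refine ⟨(x, x'), (y, r • y'), ⟨hx, hx', hy, Submodule.smul_mem _ _ hy', ?_, ?_, ?_, hgen, ?_⟩⟩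
  · refine integral_of_residue ht ht2 (fun s hs => ?_) haa ?_
    · rw [prodForm_apply, mul_add]
      exact (pDual_form hB hx hx.1 s hs).add (pDual_form hC hx' hx'.1 s hs)
    · simp only [map_add, prodForm_apply]
      linear_combination ha' + ha
  · rw [prodForm_apply]
    refine hxy.add ?_
    rw [form_smul_right]
    exact (RingOfIntegers.isIntegral_coe r).mul hxy'
  · have hry : r • y' ∈ pDual C M P := Submodule.smul_mem _ _ hy'
    refine integral_of_residue ht ht2 (fun s hs => ?_) hr ?_
    · rw [prodForm_apply, mul_add]
      exact (pDual_form hB hy hy.1 s hs).add (pDual_form hC hry hry.1 s hs)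
    · simp only [map_add, map_mul, prodForm_apply, form_smul_left, form_smul_right]
      linear_combination (r : K) * r * hb' + hb
  · intro w hw
    obtain ⟨u, v, h⟩ := hgen' w hw
    refine ⟨u, v * d, ?_⟩
    have : w - u • x' - (v * d) • r • y' = (w - u • x' - v • y') + v • j • y' := by
      have e : v • y' = (v * d) • r • y' + v • j • y' := by
        rw [smul_smul, smul_smul, ← add_smul, mul_assoc, ← mul_add, hdj, mul_one]
      rw [e]; abel
    change w - u • x' - (v * d) • r • y' ∈ M
    rw [this]
    exact M.add_mem h (M.smul_mem _ (hy'.2 j hj))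

theorem Glue.loc_mem (hB : TotPos B) (hC : TotPos C) (hL : MaxLat B L) (hM : MaxLat C M)
    {x y : V × W} (hg : Glue B C L M P x y) {N : Submodule (𝓞 K) (V × W)}
    (hN : N ≤ dualLat (prodForm B C) N) (hLM : L.prod M ≤ N) (hx : x ∈ N) (hy : y ∈ N)
    {z : V × W} (hz : z ∈ dualLat (prodForm B C) N) : z ∈ loc P N := by
  have hz1 : z.1 ∈ dualLat B L := fun l hl => by
    simpa using hz (l, 0) (hLM ⟨hl, M.zero_mem⟩)
  have hz2 : z.2 ∈ dualLat C M := fun l hl => by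
    simpa using hz (0, l) (hLM ⟨L.zero_mem, hl⟩)
  obtain ⟨s, hs, hs1⟩ := hL.dual_le_loc (P := P) hB hz1
  obtain ⟨r, hr, hr2⟩ := hM.dual_le_loc (P := P) hC hz2
  obtain ⟨u, v, huv⟩ := hg.gen1 (r • s • z.1) (Submodule.smul_mem _ _ hs1)
  have hw : r • s • z - u • x - v • y ∈ dualLat (prodForm B C) N :=
    Submodule.sub_mem _ (Submodule.sub_mem _ (Submodule.smul_mem _ _ (Submodule.smul_mem _ _ hz))
      (Submodule.smul_mem _ _ (hN hx))) (Submodule.smul_mem _ _ (hN hy))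
  have hw1 : (r • s • z - u • x - v • y - ((r • s • z.1 - u • x.1 - v • y.1), 0) : V × W) ∈
      dualLat (prodForm B C) N := Submodule.sub_mem _ hw (hN (hLM ⟨huv, M.zero_mem⟩))
  have hw2 : (r • s • z - u • x - v • y - ((r • s • z.1 - u • x.1 - v • y.1), 0) : V × W) =
      (0, r • s • z.2 - u • x.2 - v • y.2) := by
    ext <;> simp
  have hq : r • s • z.2 - u • x.2 - v • y.2 ∈ pDual C M P := by
    refine Submodule.sub_mem _ (Submodule.sub_mem _ ?_ (Submodule.smul_mem _ _ hg.x2))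
      (Submodule.smul_mem _ _ hg.y2)
    rw [smul_comm]
    exact Submodule.smul_mem _ _ hr2
  rw [hw2] at hw1
  set q := r • s • z.2 - u • x.2 - v • y.2
  have hqx : IsIntegral ℤ (C q x.2) := by simpa using hw1 x hx
  have hqy : IsIntegral ℤ (C q y.2) := by simpa using hw1 y hy
  obtain ⟨u', v', h⟩ := hg.gen2 q hq
  have hqM : q ∈ M := by
    refine hM.mem_of_integral hC hq.1 ?_
    have e : C q q = C q (q - u' • x.2 - v' • y.2) + u' * C q x.2 + v' * C q y.2 := by
      simp only [map_sub, form_smul_right]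
      ring
    rw [e]
    exact ((hq.1 _ h).add ((RingOfIntegers.isIntegral_coe u').mul hqx)).add
      ((RingOfIntegers.isIntegral_coe v').mul hqy)
  refine ⟨r * s, mul_notMem hr hs, ?_⟩
  have : (r * s) • z = u • x + v • y + (r • s • z.1 - u • x.1 - v • y.1, q) := by
    rw [mul_smul]
    ext <;> simp [q]
  rw [this]
  exact N.add_mem (N.add_mem (N.smul_mem _ hx) (N.smul_mem _ hy)) (hLM ⟨huv, hqM⟩)

theorem bad_left (hB : TotPos B) (hC : TotPos C) (hL : MaxLat B L) (hM : MaxLat C M)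
    {N : Submodule (𝓞 K) (V × W)} (hN : N ≤ dualLat (prodForm B C) N) (hLM : L.prod M ≤ N)
    (h1 : P ∈ badPrimes B L) (h2 : P ∉ badPrimes C M) : P ∈ badPrimes (prodForm B C) N := by
  obtain ⟨z, hz, hzL⟩ := SetLike.not_le_iff_exists.1 h1
  have hinter : ∀ w, w ∈ dualLat B L → (w, 0) ∈ N → w ∈ L := fun w hw h =>
    hL.mem_of_integral hB hw (by simpa using hN h _ h)
  refine fun hle => hzL (hinter z hz.1 (hle ⟨fun l hl => ?_, fun s hs => ?_⟩))
  · have hl1 : l.1 ∈ dualLat B L := fun m hm => by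
      simpa using hN hl (m, 0) (hLM ⟨hm, M.zero_mem⟩)
    have hl2 : l.2 ∈ dualLat C M := fun m hm => by
      simpa using hN hl (0, m) (hLM ⟨L.zero_mem, hm⟩)
    obtain ⟨s, hs, hsl⟩ := hM.dual_le_loc_of_notMem hC h2 hl2
    have hsl1 : s • l.1 ∈ L := by
      refine hinter _ (Submodule.smul_mem _ _ hl1) ?_
      have : ((s • l.1, 0) : V × W) = s • l - (0, s • l.2) := by ext <;> simp
      rw [this]
      exact N.sub_mem (N.smul_mem _ hl) (hLM ⟨L.zero_mem, hsl⟩)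
    have : IsIntegral ℤ (B z l.1) := by
      refine mem_of_killed (P := P) (N := intSub K) (fun p hp => ?_) ⟨s, hs, ?_⟩
      · rw [Algebra.smul_def]; exact pDual_form hB hz hl1 p hp
      · have := hz.1 _ hsl1
        rw [form_smul_right] at this
        rw [Algebra.smul_def]
        exact this
    simpa using this
  · have : s • ((z, 0) : V × W) = (s • z, 0) := by ext <;> simp
    rw [this]
    exact hLM ⟨hz.2 s hs, M.zero_mem⟩

theorem bad_right (hB : TotPos B) (hC : TotPos C) (hL : MaxLat B L) (hM : MaxLat C M)
    {N : Submodule (𝓞 K) (V × W)} (hN : N ≤ dualLat (prodForm B C) N) (hLM : L.prod M ≤ N)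
    (h1 : P ∉ badPrimes B L) (h2 : P ∈ badPrimes C M) : P ∈ badPrimes (prodForm B C) N := by
  obtain ⟨z, hz, hzM⟩ := SetLike.not_le_iff_exists.1 h2
  have hinter : ∀ w, w ∈ dualLat C M → (0, w) ∈ N → w ∈ M := fun w hw h =>
    hM.mem_of_integral hC hw (by simpa using hN h _ h)
  refine fun hle => hzM (hinter z hz.1 (hle ⟨fun l hl => ?_, fun s hs => ?_⟩))
  · have hl1 : l.1 ∈ dualLat B L := fun m hm => by
      simpa using hN hl (m, 0) (hLM ⟨hm, M.zero_mem⟩)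
    have hl2 : l.2 ∈ dualLat C M := fun m hm => by
      simpa using hN hl (0, m) (hLM ⟨L.zero_mem, hm⟩)
    obtain ⟨s, hs, hsl⟩ := hL.dual_le_loc_of_notMem hB h1 hl1
    have hsl2 : s • l.2 ∈ M := by
      refine hinter _ (Submodule.smul_mem _ _ hl2) ?_
      have : ((0, s • l.2) : V × W) = s • l - (s • l.1, 0) := by ext <;> simp
      rw [this]
      exact N.sub_mem (N.smul_mem _ hl) (hLM ⟨hsl, M.zero_mem⟩)
    have : IsIntegral ℤ (C z l.2) := by
      refine mem_of_killed (P := P) (N := intSub K) (fun p hp => ?_) ⟨s, hs, ?_⟩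
      · rw [Algebra.smul_def]; exact pDual_form hC hz hl2 p hp
      · have := hz.1 _ hsl2
        rw [form_smul_right] at this
        rw [Algebra.smul_def]
        exact this
    simpa using this
  · have : s • ((0, z) : V × W) = (0, s • z) := by ext <;> simp
    rw [this]
    exact hLM ⟨L.zero_mem, hz.2 s hs⟩

theorem notBad_prod (hB : TotPos B) (hC : TotPos C) (hL : MaxLat B L) (hM : MaxLat C M)
    {N : Submodule (𝓞 K) (V × W)} (hLM : L.prod M ≤ N)
    (h1 : P ∉ badPrimes B L) (h2 : P ∉ badPrimes C M) : P ∉ badPrimes (prodForm B C) N := by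
  refine not_not.2 fun z hz => mem_of_killed hz.2 ?_
  have hz1 : z.1 ∈ dualLat B L := fun m hm => by
    simpa using hz.1 (m, 0) (hLM ⟨hm, M.zero_mem⟩)
  have hz2 : z.2 ∈ dualLat C M := fun m hm => by
    simpa using hz.1 (0, m) (hLM ⟨L.zero_mem, hm⟩)
  obtain ⟨s, hs, hsz⟩ := hL.dual_le_loc_of_notMem hB h1 hz1
  obtain ⟨r, hr, hrz⟩ := hM.dual_le_loc_of_notMem hC h2 hz2
  refine ⟨s * r, mul_notMem hs hr, hLM ⟨?_, ?_⟩⟩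
  · change (s * r) • z.1 ∈ L
    rw [mul_comm, mul_smul]; exact L.smul_mem _ hsz
  · change (s * r) • z.2 ∈ M
    rw [mul_smul]; exact M.smul_mem _ hrz

theorem exists_maxLat_prod (hB : TotPos B) (hC : TotPos C) [FiniteDimensional K V]
    [FiniteDimensional K W] (hL : MaxLat B L) (hM : MaxLat C M) (hBs : SqDet B) (hCs : SqDet C) :
    ∃ N, L.prod M ≤ N ∧ MaxLat (prodForm B C) N ∧ ∀ P : HeightOneSpectrum (𝓞 K),
      (2 : 𝓞 K) ∉ P.asIdeal →
      (P ∈ badPrimes (prodForm B C) N ↔ ¬(P ∈ badPrimes B L ↔ P ∈ badPrimes C M)) := by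
  classical
  have hBC := hB.prod hC
  let T := {P : HeightOneSpectrum (𝓞 K) //
    (2 : 𝓞 K) ∉ P.asIdeal ∧ P ∈ badPrimes B L ∧ P ∈ badPrimes C M}
  have : Finite T := ((hL.finite_bad hB).subset fun P hP => hP.2.1).to_subtype
  choose x y hxy using fun P : T => exists_glue hB hC hL hM hBs hCs P.2.1 P.2.2.1 P.2.2.2
  let G : Set (V × W) := Set.range x ∪ Set.range y
  let N : Submodule (𝓞 K) (V × W) := Submodule.span (𝓞 K) (L.prod M ∪ G)
  have hgl : ∀ g ∈ G, ∃ P : T, g.1 ∈ pDual B L P.1 ∧ g.2 ∈ pDual C M P.1 ∧ (g = x P ∨ g = y P) := by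
    rintro g (⟨P, rfl⟩ | ⟨P, rfl⟩)
    · exact ⟨P, (hxy P).x1, (hxy P).x2, Or.inl rfl⟩
    · exact ⟨P, (hxy P).y1, (hxy P).y2, Or.inr rfl⟩
  have hdual : ∀ g ∈ G, ∀ l ∈ L.prod M, IsIntegral ℤ (prodForm B C g l) := fun g hg l hl => by
    obtain ⟨P, h1, h2, -⟩ := hgl g hg
    exact (h1.1 _ hl.1).add (h2.1 _ hl.2)
  have hsymm : ∀ g h, prodForm B C g h = prodForm B C h g := hBC.1
  have hGG : ∀ g ∈ G, ∀ h ∈ G, IsIntegral ℤ (prodForm B C g h) := fun g hg h hh => by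
    obtain ⟨P, g1, g2, hgx⟩ := hgl g hg
    obtain ⟨Q, h1, h2, hhx⟩ := hgl h hh
    by_cases hPQ : P = Q
    · subst hPQ
      rcases hgx with rfl | rfl <;> rcases hhx with rfl | rfl
      · exact (hxy P).xx
      · exact (hxy P).xy
      · rw [hsymm]; exact (hxy P).xy
      · exact (hxy P).yy
    · refine isIntegral_of_two (fun h => hPQ (Subtype.ext h)) (fun s hs => ?_) (fun s hs => ?_)
        (P := P.1) (Q := Q.1)
      · rw [prodForm_apply, mul_add]
        exact (pDual_form hB g1 h1.1 s hs).add (pDual_form hC g2 h2.1 s hs)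
      · rw [hsymm, prodForm_apply, mul_add]
        exact (pDual_form hB h1 g1.1 s hs).add (pDual_form hC h2 g2.1 s hs)
  have hint : N ≤ dualLat (prodForm B C) N := by
    refine integral_span fun g hg h hh => ?_
    rcases hg with hg | hg <;> rcases hh with hh | hh
    · exact (hL.int hg.1 _ hh.1).add (hM.int hg.2 _ hh.2)
    · rw [hsymm]; exact hdual _ hh _ hg
    · exact hdual _ hg _ hh
    · exact hGG _ hg _ hh
  have hLM : L.prod M ≤ N := fun z hz => Submodule.subset_span (Or.inl hz)
  have hlat : IsLat N := by
    refine ⟨?_, fun v => ?_⟩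
    · change (Submodule.span (𝓞 K) (L.prod M ∪ G)).FG
      rw [Submodule.span_union, Submodule.span_eq]
      exact (hL.lat.prod hM.lat).1.sup
        (Submodule.fg_span ((Set.finite_range x).union (Set.finite_range y)))
    · obtain ⟨a, ha, hav⟩ := (hL.lat.prod hM.lat).2 v
      exact ⟨a, ha, hLM hav⟩
  obtain ⟨N', hNN, hN'⟩ := exists_maxLat hBC hlat hint
  refine ⟨N', hLM.trans hNN, hN', fun P h2 => ?_⟩
  by_cases h1 : P ∈ badPrimes B L <;> by_cases h3 : P ∈ badPrimes C M
  · have : P ∉ badPrimes (prodForm B C) N' := not_not.2 fun z hz => mem_of_killed hz.2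
      ((hxy ⟨P, h2, h1, h3⟩).loc_mem hB hC hL hM hN'.int (hLM.trans hNN)
        (hNN (Submodule.subset_span (Or.inr (Or.inl ⟨_, rfl⟩))))
        (hNN (Submodule.subset_span (Or.inr (Or.inr ⟨_, rfl⟩)))) hz.1)
    tauto
  · have := bad_left hB hC hL hM hN'.int (hLM.trans hNN) h1 h3
    tauto
  · have := bad_right hB hC hL hM hN'.int (hLM.trans hNN) h1 h3
    tauto
  · have := notBad_prod hB hC hL hM (hLM.trans hNN) h1 h3
    tauto

end Sum

end TotReal

namespace TotReal

open NumberField Module IsDedekindDomain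
open scoped nonZeroDivisors

set_option linter.unusedSectionVars false

section Witt

variable {K : Type} [Field K] [NumberField K] [IsTotallyReal K]
variable {U : Type} [AddCommGroup U] [Module K U] [Module (𝓞 K) U] [IsScalarTower (𝓞 K) K U]
variable {V : Type} [AddCommGroup V] [Module K V] [Module (𝓞 K) V] [IsScalarTower (𝓞 K) K V]
variable {W : Type} [AddCommGroup W] [Module K W] [Module (𝓞 K) W] [IsScalarTower (𝓞 K) K W]
variable {A : U →ₗ[K] U →ₗ[K] K} {B : V →ₗ[K] V →ₗ[K] K} {C : W →ₗ[K] W →ₗ[K] K}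

/-- Isometry of bilinear spaces. -/
def IsomForm (B : V →ₗ[K] V →ₗ[K] K) (C : W →ₗ[K] W →ₗ[K] K) : Prop :=
  ∃ f : V ≃ₗ[K] W, ∀ x y, C (f x) (f y) = B x y

theorem IsomForm.symm (h : IsomForm B C) : IsomForm C B := by
  obtain ⟨f, hf⟩ := h
  exact ⟨f.symm, fun x y => by rw [← hf, f.apply_symm_apply, f.apply_symm_apply]⟩

theorem IsomForm.trans (h : IsomForm A B) (h' : IsomForm B C) : IsomForm A C := by
  obtain ⟨f, hf⟩ := h
  obtain ⟨g, hg⟩ := h'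
  exact ⟨f.trans g, fun x y => by rw [← hf, ← hg]; rfl⟩

theorem TotPos.eq_zero (hB : TotPos B) {v : V} (h : B v v = 0) : v = 0 :=
  by_contra fun hv => hB.ne_zero hv h

theorem exists_reflection (hB : TotPos B) {x y : V} (h : B x x = B y y) :
    ∃ f : V ≃ₗ[K] V, (∀ v w, B (f v) (f w) = B v w) ∧ f x = y ∧
      ∀ v, B v x = 0 → B v y = 0 → f v = v := by
  by_cases hxy : x = y
  · exact ⟨LinearEquiv.refl K V, fun _ _ => rfl, hxy, fun _ _ _ => rfl⟩
  set u := x - y with hu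
  have hu0 : B u u ≠ 0 := hB.ne_zero (sub_ne_zero.2 hxy)
  let φ : Module.Dual K V := (2 * (B u u)⁻¹) • B u
  have hφ : φ u = 2 := by simp [φ, hu0]
  have hev : ∀ v, Module.reflection hφ v = v - (2 * (B u u)⁻¹ * B u v) • u := fun v => by
    rw [Module.reflection_apply]; rfl
  have huu : B u u = 2 * B u x := by
    simp only [hu, map_sub, LinearMap.sub_apply, hB.1 y x]
    linear_combination -h
  refine ⟨Module.reflection hφ, fun v w => ?_, ?_, fun v h1 h2 => ?_⟩
  · rw [hev, hev]
    simp only [map_sub, LinearMap.sub_apply, map_smul, LinearMap.smul_apply, smul_eq_mul, hB.1 v u]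
    field_simp
    ring
  · have : 2 * (B u u)⁻¹ * B u x = 1 := by
      rw [mul_right_comm, ← huu, mul_inv_cancel₀ hu0]
    rw [hev, this, one_smul, hu, sub_sub_cancel]
  · have : B u v = 0 := by rw [hB.1, hu, map_sub, h1, h2, sub_zero]
    rw [hev, this, mul_zero, zero_smul, sub_zero]

theorem eq_zero_of_frame [FiniteDimensional K W] (hC : TotPos C) {k : ℕ} {g : Fin k → W}
    (hg : OrthFrame C g) (hk : finrank K W = k) {w : W} (h : ∀ i, C w (g i) = 0) : w = 0 := by
  refine hC.eq_zero ?_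
  obtain ⟨x, rfl⟩ := (frameEquiv hC hg hk).surjective w
  nth_rewrite 2 [frameEquiv_apply]
  rw [map_sum]
  exact Finset.sum_eq_zero fun i _ => by rw [map_smul, h, smul_zero]

theorem witt [FiniteDimensional K W] (hB : TotPos B) (hC : TotPos C)
    (h : IsomForm (prodForm A C) (prodForm B C)) : IsomForm A B := by
  obtain ⟨g, hg⟩ := exists_frame hC
  have hBC := hB.prod hC
  have key : ∀ m, ∃ f : (U × W) ≃ₗ[K] (V × W),
      (∀ x y, prodForm B C (f x) (f y) = prodForm A C x y) ∧
      ∀ i : Fin (finrank K W), (i : ℕ) < m → f (0, g i) = (0, g i) := by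
    intro m
    induction m with
    | zero => obtain ⟨f, hf⟩ := h; exact ⟨f, hf, fun i hi => absurd hi (Nat.not_lt_zero _)⟩
    | succ m ih =>
      obtain ⟨f, hf, hfi⟩ := ih
      by_cases hm : m < finrank K W
      · obtain ⟨r, hr, hrx, hrf⟩ := exists_reflection hBC (x := f (0, g ⟨m, hm⟩))
          (y := (0, g ⟨m, hm⟩)) (by rw [hf]; simp)
        refine ⟨f.trans r, fun x y => (hr _ _).trans (hf x y), fun i hi => ?_⟩
        change r (f (0, g i)) = _
        rcases Nat.lt_succ_iff_lt_or_eq.1 hi with hi | hi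
        · have hne : i ≠ ⟨m, hm⟩ := fun h => by simp [h] at hi
          rw [hfi i hi]
          refine hrf _ ?_ ?_
          · rw [← hfi i hi, hf]; simp [hg.1 _ _ hne]
          · simp [hg.1 _ _ hne]
        · have : i = ⟨m, hm⟩ := Fin.ext hi
          rw [this, hrx]
      · exact ⟨f, hf, fun i _ => hfi i (by omega)⟩
  obtain ⟨f, hf, hfi⟩ := key (finrank K W)
  have hfi' : ∀ i, f (0, g i) = (0, g i) := fun i => hfi i i.2
  have h1 : ∀ u, (f (u, 0)).2 = 0 := fun u => eq_zero_of_frame hC hg rfl fun i => by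
    have := hf (u, 0) (0, g i)
    rw [hfi'] at this
    simpa using this
  have h2 : ∀ v, (f.symm (v, 0)).2 = 0 := fun v => eq_zero_of_frame hC hg rfl fun i => by
    have := hf (f.symm (v, 0)) (0, g i)
    rw [hfi', f.apply_symm_apply] at this
    simpa using this.symm
  let e : U →ₗ[K] V := LinearMap.fst K V W ∘ₗ f.toLinearMap ∘ₗ LinearMap.inl K U W
  have he : ∀ u, f (u, 0) = (e u, 0) := fun u => Prod.ext rfl (h1 u)
  refine ⟨LinearEquiv.ofBijective e ⟨?_, fun v => ?_⟩, fun x y => ?_⟩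
  · rw [injective_iff_map_eq_zero]
    intro u hu
    have := he u
    rw [hu] at this
    have := f.injective (this.trans (map_zero f).symm)
    exact congrArg Prod.fst this
  · refine ⟨(f.symm (v, 0)).1, ?_⟩
    have : ((f.symm (v, 0)).1, (0 : W)) = f.symm (v, 0) := Prod.ext rfl (h2 v).symm
    have h3 := he (f.symm (v, 0)).1
    rw [this, f.apply_symm_apply] at h3
    exact (congrArg Prod.fst h3).symm
  · have := hf (x, 0) (y, 0)
    rw [he, he, prodForm_apply, prodForm_apply, map_zero, add_zero, add_zero] at this
    exact this

end Witt

end TotReal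

namespace TotReal

open NumberField Module IsDedekindDomain
open scoped nonZeroDivisors

set_option linter.unusedSectionVars false

/-- A totally imaginary quadratic extension generated by a square root of `-a`. -/
structure CMData (K E : Type) [Field K] [Field E] [Algebra K E] [NumberField K] (a : 𝓞 K) where
  σ : E ≃ₐ[K] E
  tr : E →ₗ[K] K
  θ : E
  tr_spec : ∀ x, algebraMap K E (tr x) = x + σ x
  σθ : σ θ = -θ
  θ_sq : θ * θ = -algebraMap K E a
  pos : ∀ τ : K →+* ℝ, 0 < τ a
  finrank_eq : finrank K E = 2

namespace CMData

variable {K E : Type} [Field K] [NumberField K] [IsTotallyReal K] [Field E] [NumberField E]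
  [Algebra K E] {a : 𝓞 K} (D : CMData K E a)

theorem a_ne_zero (D : CMData K E a) : (a : K) ≠ 0 := fun h => by
  obtain ⟨τ⟩ := (inferInstance : Nonempty (K →+* ℝ))
  have := D.pos τ
  rw [h, map_zero] at this
  exact this.false

/-- The norm to the real subfield. -/
noncomputable def nm (x : E) : K := D.tr (x * D.σ x) / 2

theorem decomp (x : E) : x = algebraMap K E (D.tr x / 2) +
    algebraMap K E (D.tr (x * D.σ D.θ) / (2 * a)) * D.θ := by
  have ha : algebraMap K E a ≠ 0 := (_root_.map_ne_zero _).2 D.a_ne_zero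
  have h1 := D.tr_spec x
  have h2 := D.tr_spec (x * D.σ D.θ)
  rw [map_div₀, map_div₀, h1, h2, map_mul (algebraMap K E), map_ofNat, map_mul D.σ, D.σθ, map_neg,
    D.σθ]
  field_simp
  linear_combination (x - D.σ x) * D.θ_sq

theorem invol (x : E) : D.σ (D.σ x) = x := by
  have h := D.decomp x
  set u := D.tr x / 2
  set v := D.tr (x * D.σ D.θ) / (2 * a)
  rw [h]
  simp only [map_add, map_mul, AlgEquiv.commutes, D.σθ, map_neg, neg_neg]

theorem exists_of_fixed {x : E} (h : D.σ x = x) : ∃ c : K, algebraMap K E c = x :=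
  ⟨D.tr x / 2, by rw [map_div₀, D.tr_spec, h, map_ofNat]; ring⟩

theorem nm_spec (x : E) : algebraMap K E (D.nm x) = x * D.σ x := by
  rw [nm, map_div₀, D.tr_spec, map_mul, D.invol, map_ofNat]
  ring

theorem nm_mul (x y : E) : D.nm (x * y) = D.nm x * D.nm y := by
  apply (algebraMap K E).injective
  rw [map_mul, nm_spec, nm_spec, nm_spec, map_mul]
  ring

theorem tr_mul_σ (x y : E) : D.tr (x * D.σ y) = D.nm (x + y) - D.nm x - D.nm y := by
  apply (algebraMap K E).injective
  rw [map_sub, map_sub, nm_spec, nm_spec, nm_spec, D.tr_spec, map_mul, map_add, D.invol]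
  ring

theorem nm_one : D.nm 1 = 1 := by
  apply (algebraMap K E).injective
  rw [nm_spec, map_one, map_one, one_mul]

theorem nm_pos {x : E} (hx : x ≠ 0) (τ : K →+* ℝ) : 0 < τ (D.nm x) := by
  have h := D.decomp x
  set u := D.tr x / 2
  set v := D.tr (x * D.σ D.θ) / (2 * a)
  have hn : D.nm x = u ^ 2 + a * v ^ 2 := by
    apply (algebraMap K E).injective
    rw [nm_spec, h]
    simp only [map_add, map_mul, AlgEquiv.commutes, D.σθ, map_pow]
    linear_combination -(algebraMap K E v) ^ 2 * D.θ_sq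
  rw [hn, map_add, map_mul, map_pow, map_pow]
  by_cases hu : u = 0
  · have hv : v ≠ 0 := fun hv => hx (by rw [h, hu, hv]; simp)
    have : τ v ≠ 0 := (_root_.map_ne_zero _).2 hv
    have := D.pos τ
    positivity
  · have : τ u ≠ 0 := (_root_.map_ne_zero _).2 hu
    have := D.pos τ
    positivity

theorem isIntegral_σ {x : E} (hx : IsIntegral ℤ x) : IsIntegral ℤ (D.σ x) :=
  hx.map (D.σ.toRingEquiv.toRingHom.toIntAlgHom)

theorem isIntegral_algebraMap {x : K} : IsIntegral ℤ (algebraMap K E x) ↔ IsIntegral ℤ x :=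
  isIntegral_algebraMap_iff (algebraMap K E).injective

theorem isIntegral_tr {x : E} (hx : IsIntegral ℤ x) : IsIntegral ℤ (D.tr x) := by
  rw [← isIntegral_algebraMap (E := E), D.tr_spec]
  exact hx.add (D.isIntegral_σ hx)

theorem isIntegral_nm {x : E} (hx : IsIntegral ℤ x) : IsIntegral ℤ (D.nm x) := by
  rw [← isIntegral_algebraMap (E := E), D.nm_spec]
  exact hx.mul (D.isIntegral_σ hx)

theorem isIntegral_θ (D : CMData K E a) : IsIntegral ℤ D.θ := by
  have : IsIntegral ℤ (D.θ ^ 2) := by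
    rw [sq, D.θ_sq]
    exact (isIntegral_algebraMap.2 (RingOfIntegers.isIntegral_coe a)).neg
  exact this.of_pow two_pos

theorem isIntegral_two_θ_mul {x : E} (h1 : IsIntegral ℤ (D.tr x))
    (h2 : IsIntegral ℤ (D.tr (x * D.θ))) :
    IsIntegral ℤ (2 * D.θ * x) := by
  have : 2 * D.θ * x = D.θ * algebraMap K E (D.tr x) + algebraMap K E (D.tr (x * D.θ)) := by
    rw [D.tr_spec, D.tr_spec, map_mul, D.σθ]
    ring
  rw [this]
  exact (D.isIntegral_θ.mul (isIntegral_algebraMap.2 h1)).add (isIntegral_algebraMap.2 h2)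

/-- The trace form. -/
noncomputable def form : E →ₗ[K] E →ₗ[K] K :=
  (LinearMap.mul K E).compl₁₂ LinearMap.id D.σ.toLinearMap |>.compr₂ D.tr

@[simp]
theorem form_apply (x y : E) : D.form x y = D.tr (x * D.σ y) := rfl

theorem form_self (x : E) : D.form x x = 2 * D.nm x := by
  rw [form_apply, nm]; ring

theorem totPos_form : TotPos D.form := by
  refine ⟨fun x y => ?_, fun x hx τ => ?_⟩
  · apply (algebraMap K E).injective
    rw [form_apply, form_apply, D.tr_spec, D.tr_spec, map_mul, map_mul, D.invol, D.invol]
    ring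
  · rw [form_self, map_mul, map_ofNat]
    have := D.nm_pos hx τ
    positivity

end CMData

theorem TotPos.smul {K V : Type} [Field K] [NumberField K] [IsTotallyReal K] [AddCommGroup V]
    [Module K V] [Module (𝓞 K) V] [IsScalarTower (𝓞 K) K V] {B : V →ₗ[K] V →ₗ[K] K} (hB : TotPos B)
        {c : K}
    (hc : ∀ τ : K →+* ℝ, 0 < τ c) : TotPos (c • B) := by
  refine ⟨fun x y => by simp [hB.1 x y], fun x hx τ => ?_⟩
  have h1 := hc τ
  have h2 := hB.2 x hx τ
  simpa using mul_pos h1 h2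

theorem SqDet.smul_prod {K V : Type} [Field K] [NumberField K] [IsTotallyReal K] [AddCommGroup V]
    [Module K V] [Module (𝓞 K) V] [IsScalarTower (𝓞 K) K V] [FiniteDimensional K V]
    (B : V →ₗ[K] V →ₗ[K] K) (c : K) (h2 : finrank K V = 2) : SqDet (prodForm (c • B) B) := by
  let b := finBasisOfFinrankEq K V h2
  refine SqDet.of_basis (b.prod b) ⟨c * (LinearMap.toMatrix₂ b b B).det, ?_⟩
  have : LinearMap.toMatrix₂ (b.prod b) (b.prod b) (prodForm (c • B) B) =
      Matrix.fromBlocks (c • LinearMap.toMatrix₂ b b B) 0 0 (LinearMap.toMatrix₂ b b B) := by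
    ext i j
    rcases i with i | i <;> rcases j with j | j <;> simp [LinearMap.toMatrix₂_apply]
  rw [this, Matrix.det_fromBlocks_zero₂₁, Matrix.det_smul, Fintype.card_fin]
  ring

end TotReal

namespace TotReal

open NumberField Module IsDedekindDomain
open scoped nonZeroDivisors

set_option linter.unusedSectionVars false

theorem exists_finset_of_finite_codomain {α β : Type*} [Finite β] (f : α → β) :
    ∃ T : Finset α, ∀ a, ∃ t ∈ T, f a = f t := by
  classical
  have hfin : (Set.range f).Finite := Set.toFinite _
  choose g hg using fun b : Set.range f => b.2
  have := hfin.fintype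
  refine ⟨Finset.univ.image g,
      fun a => ⟨g ⟨f a, a, rfl⟩, Finset.mem_image_of_mem _ (Finset.mem_univ _), ?_⟩⟩
  exact (hg ⟨f a, a, rfl⟩).symm

section Narrow

variable {K : Type} [Field K] [NumberField K] [IsTotallyReal K]

/-- Two ideals differ by the scalar `γ`. -/
def IdealRel (c J : Ideal (𝓞 K)) (γ : K) : Prop :=
  ∀ t : K, (∃ y ∈ c, (y : K) = t) ↔ ∃ y ∈ J, γ * y = t

theorem IdealRel.eq {c c' J : Ideal (𝓞 K)} {γ : K} (h : IdealRel c J γ) (h' : IdealRel c' J γ) :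
    c = c' := by
  have key : ∀ {c c' : Ideal (𝓞 K)}, IdealRel c J γ → IdealRel c' J γ → c ≤ c' := by
    intro c c' h h' y hy
    obtain ⟨z, hz, hzy⟩ := (h' y).2 ((h y).1 ⟨y, hy, rfl⟩)
    rwa [← RingOfIntegers.coe_injective hzy]
  exact le_antisymm (key h h') (key h' h)

theorem idealRel_of_span {c J : Ideal (𝓞 K)} {x y : 𝓞 K} (hx : x ≠ 0)
    (h : Ideal.span {x} * c = Ideal.span {y} * J) : IdealRel c J (y / x : K) := by
  have hx' : (x : K) ≠ 0 := RingOfIntegers.coe_ne_zero_iff.2 hx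
  intro t
  constructor
  · rintro ⟨z, hz, rfl⟩
    have : x * z ∈ Ideal.span {y} * J := h ▸ Ideal.mul_mem_mul (Ideal.mem_span_singleton_self x) hz
    obtain ⟨w, hw, hwz⟩ := Ideal.mem_span_singleton_mul.1 this
    refine ⟨w, hw, ?_⟩
    have := congrArg (algebraMap (𝓞 K) K) hwz
    simp only [map_mul] at this
    field_simp
    linear_combination this
  · rintro ⟨z, hz, rfl⟩
    have : y * z ∈ Ideal.span {x} * c := h ▸ Ideal.mul_mem_mul (Ideal.mem_span_singleton_self y) hz
    obtain ⟨w, hw, hwz⟩ := Ideal.mem_span_singleton_mul.1 this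
    refine ⟨w, hw, ?_⟩
    have := congrArg (algebraMap (𝓞 K) K) hwz
    simp only [map_mul] at this
    field_simp
    linear_combination this

variable (K) in
theorem exists_narrow : ∃ 𝒥 : Finset (Ideal (𝓞 K)), (∀ J ∈ 𝒥, J ≠ ⊥) ∧
    ∀ c : Ideal (𝓞 K), c ≠ ⊥ → ∃ J ∈ 𝒥, ∃ γ : K, (∀ τ : K →+* ℝ, 0 < τ γ) ∧ IdealRel c J γ := by
  classical
  choose R hR using ClassGroup.mk0_surjective (R := 𝓞 K)
  have hex : ∀ c : (Ideal (𝓞 K))⁰, ∃ x y : 𝓞 K, x ≠ 0 ∧ y ≠ 0 ∧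
      Ideal.span {x} * (c : Ideal (𝓞 K)) =
          Ideal.span {y} * (R (ClassGroup.mk0 c) : Ideal (𝓞 K)) := by
    intro c
    obtain ⟨x, y, hx, hy, h⟩ := ClassGroup.mk0_eq_mk0_iff.1 (hR (ClassGroup.mk0 c)).symm
    exact ⟨x, y, hx, hy, h⟩
  choose x y hx hy hxy using hex
  let f : (Ideal (𝓞 K))⁰ → ClassGroup (𝓞 K) × ((K →+* ℝ) → Bool) := fun c =>
    (ClassGroup.mk0 c, fun τ => decide (0 < τ (x c * y c)))
  obtain ⟨T, hT⟩ := exists_finset_of_finite_codomain f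
  refine ⟨T.image Subtype.val, fun J hJ => ?_, fun c hc => ?_⟩
  · obtain ⟨t, -, rfl⟩ := Finset.mem_image.1 hJ
    exact nonZeroDivisors.ne_zero t.2
  · obtain ⟨t, ht, hf⟩ := hT ⟨c, mem_nonZeroDivisors_of_ne_zero hc⟩
    set c' : (Ideal (𝓞 K))⁰ := ⟨c, mem_nonZeroDivisors_of_ne_zero hc⟩
    have h1 : ClassGroup.mk0 c' = ClassGroup.mk0 t := congrArg Prod.fst hf
    have h2 : ∀ τ : K →+* ℝ, 0 < τ (x c' * y c') ↔ 0 < τ (x t * y t) := fun τ => by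
      have := congrFun (congrArg Prod.snd hf) τ
      simpa [f] using this
    refine ⟨t, Finset.mem_image_of_mem _ ht, ((y c' * x t : 𝓞 K) / (x c' * y t : 𝓞 K) : K),
      fun τ => ?_, idealRel_of_span (mul_ne_zero (hx _) (hy _)) ?_⟩
    · have n1 : ∀ z : 𝓞 K, z ≠ 0 → τ z ≠ 0 := fun z hz =>
        (_root_.map_ne_zero _).2 (RingOfIntegers.coe_ne_zero_iff.2 hz)
      have hxc := n1 _ (hx c')
      have hyt := n1 _ (hy t)
      have hyc := n1 _ (hy c')
      have hxt := n1 _ (hx t)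
      have h3 := h2 τ
      simp only [map_mul, map_div₀] at h3 ⊢
      have : 0 < (τ (x c') * τ (y c')) * (τ (x t) * τ (y t)) := by
        rcases lt_or_gt_of_ne (mul_ne_zero hxc hyc) with h | h
        · exact mul_pos_of_neg_of_neg h (lt_of_le_of_ne (not_lt.1 fun h' => (h3.2 h').not_gt h)
            (mul_ne_zero hxt hyt))
        · exact mul_pos h (h3.1 h)
      rw [show τ (y c') * τ (x t) / (τ (x c') * τ (y t)) =
        (τ (x c') * τ (y c')) * (τ (x t) * τ (y t)) / (τ (x c') * τ (y t)) ^ 2 by field_simp]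
      positivity
    · have e1 := hxy c'
      have e2 := hxy t
      rw [h1] at e1
      calc Ideal.span {x c' * y t} * c
          = Ideal.span {y t} * (Ideal.span {x c'} * (c' : Ideal (𝓞 K))) := by
            rw [← Ideal.span_singleton_mul_span_singleton]; ring
        _ = Ideal.span {y c'} * (Ideal.span {y t} * (R (ClassGroup.mk0 t) : Ideal (𝓞 K))) := by
            rw [e1]; ring
        _ = Ideal.span {y c' * x t} * (t : Ideal (𝓞 K)) := by
            rw [← e2, ← Ideal.span_singleton_mul_span_singleton]; ring

end Narrow

end TotReal

namespace TotReal

open NumberField Module IsDedekindDomain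
open scoped nonZeroDivisors

set_option linter.unusedSectionVars false

namespace CMData

variable {K E : Type} [Field K] [NumberField K] [IsTotallyReal K] [Field E] [NumberField E]
  [Algebra K E] {a : 𝓞 K} (D : CMData K E a)

/-- The norm on integers. -/
noncomputable def nmO (x : 𝓞 E) : 𝓞 K :=
  ⟨D.nm x, D.isIntegral_nm (RingOfIntegers.isIntegral_coe x)⟩

@[simp]
theorem coe_nmO (x : 𝓞 E) : (D.nmO x : K) = D.nm x := rfl

theorem nmO_mul (x y : 𝓞 E) : D.nmO (x * y) = D.nmO x * D.nmO y := by
  apply RingOfIntegers.coe_injective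
  simp only [coe_nmO, map_mul, nm_mul]

/-- The ideal generated by the norms of the elements of an ideal. -/
noncomputable def nmIdeal (I : Ideal (𝓞 E)) : Ideal (𝓞 K) := Ideal.span (D.nmO '' I)

theorem nmO_mem {I : Ideal (𝓞 E)} {x : 𝓞 E} (hx : x ∈ I) : D.nmO x ∈ D.nmIdeal I :=
  Ideal.subset_span (Set.mem_image_of_mem _ hx)

theorem nmO_ne_zero {x : 𝓞 E} (hx : x ≠ 0) : D.nmO x ≠ 0 := fun h => by
  obtain ⟨τ⟩ := (inferInstance : Nonempty (K →+* ℝ))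
  have := D.nm_pos (RingOfIntegers.coe_ne_zero_iff.2 hx) τ
  rw [← coe_nmO, h] at this
  simp at this

theorem nmIdeal_ne_bot {I : Ideal (𝓞 E)} (hI : I ≠ ⊥) : D.nmIdeal I ≠ ⊥ := by
  obtain ⟨x, hx, hx0⟩ := Submodule.exists_mem_ne_zero_of_ne_bot hI
  exact fun h => D.nmO_ne_zero hx0 (by simpa [h] using D.nmO_mem hx)

theorem nmIdeal_span_mul (w : 𝓞 E) (I : Ideal (𝓞 E)) :
    D.nmIdeal (Ideal.span {w} * I) = Ideal.span {D.nmO w} * D.nmIdeal I := by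
  rw [nmIdeal, nmIdeal, Ideal.span_mul_span']
  congr 1
  ext z
  simp only [Set.mem_image, SetLike.mem_coe, Ideal.mem_span_singleton_mul, Set.singleton_mul]
  constructor
  · rintro ⟨x, ⟨y, hy, rfl⟩, rfl⟩
    exact ⟨_, ⟨y, hy, rfl⟩, (D.nmO_mul w y).symm⟩
  · rintro ⟨_, ⟨y, hy, rfl⟩, rfl⟩
    exact ⟨_, ⟨y, hy, rfl⟩, D.nmO_mul w y⟩

/-- The conjugation on integers. -/
noncomputable def σO : 𝓞 E ≃+* 𝓞 E := RingOfIntegers.mapRingEquiv (D.σ : E ≃+* E)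

@[simp]
theorem coe_σO (x : 𝓞 E) : (D.σO x : E) = D.σ x := rfl

theorem σO_algebraMap (x : 𝓞 K) : D.σO (algebraMap (𝓞 K) (𝓞 E) x) = algebraMap (𝓞 K) (𝓞 E) x := by
  apply RingOfIntegers.coe_injective
  change D.σ (algebraMap K E x) = algebraMap K E x
  exact D.σ.commutes _

theorem algebraMap_nmO (x : 𝓞 E) : algebraMap (𝓞 K) (𝓞 E) (D.nmO x) = x * D.σO x := by
  apply RingOfIntegers.coe_injective
  rw [map_mul]
  exact D.nm_spec _

theorem map_map_σO (I : Ideal (𝓞 K)) :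
    (I.map (algebraMap (𝓞 K) (𝓞 E))).map D.σO = I.map (algebraMap (𝓞 K) (𝓞 E)) := by
  have : (D.σO : 𝓞 E →+* 𝓞 E).comp (algebraMap (𝓞 K) (𝓞 E)) = algebraMap (𝓞 K) (𝓞 E) :=
    RingHom.ext D.σO_algebraMap
  conv_rhs => rw [← this, ← Ideal.map_map]
  rfl

theorem isIntegral_of_quadratic {R S : Type*} [CommRing R] [CommRing S] [Algebra R S] (p q : R)
    {x : S} (h : x * x = algebraMap R S p * x - algebraMap R S q) : IsIntegral R x := by
  nontriviality R
  refine ⟨Polynomial.X ^ 2 - (Polynomial.C p * Polynomial.X - Polynomial.C q), ?_, ?_⟩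
  · refine Polynomial.monic_X_pow_sub (lt_of_le_of_lt (b := ((1 : ℕ) : WithBot ℕ)) ?_ ?_)
    · refine (Polynomial.degree_sub_le _ _).trans (max_le ?_ ?_)
      · exact (Polynomial.degree_C_mul_X_le p)
      · exact Polynomial.degree_C_le.trans (by norm_num)
    · norm_num
  · simp only [Polynomial.eval₂_sub, Polynomial.eval₂_pow, Polynomial.eval₂_X,
      Polynomial.eval₂_mul, Polynomial.eval₂_C]
    linear_combination h

theorem mul_map_σO (I : Ideal (𝓞 E)) :
    I * I.map D.σO = (D.nmIdeal I).map (algebraMap (𝓞 K) (𝓞 E)) := by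
  apply le_antisymm
  · refine Ideal.mul_le.2 fun b hb b₁ hb₁ => ?_
    obtain ⟨b', hb', rfl⟩ := (Ideal.mem_map_of_equiv D.σO b₁).1 hb₁
    by_cases hI : I = ⊥
    · have : b = 0 := by simpa [hI] using hb
      simp [this]
    obtain ⟨s, hs, hs0⟩ := Submodule.exists_mem_ne_zero_of_ne_bot (D.nmIdeal_ne_bot hI)
    obtain ⟨c', hc'⟩ := Ideal.dvd_iff_le.2 ((Ideal.span_singleton_le_iff_mem _).2 hs)
    have hs0' : (algebraMap (𝓞 K) (𝓞 E) s) ≠ 0 :=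
      (map_ne_zero_iff _ (FaithfulSMul.algebraMap_injective _ _)).2 hs0
    have hc0 : c'.map (algebraMap (𝓞 K) (𝓞 E)) ≠ ⊥ := by
      intro h
      have h1 : Ideal.map (algebraMap (𝓞 K) (𝓞 E)) (Ideal.span {s}) = ⊥ := by
        rw [hc', Ideal.map_mul, h, Ideal.mul_bot]
      rw [Ideal.map_span, Set.image_singleton, Ideal.span_singleton_eq_bot] at h1
      exact hs0' h1
    have key : ∀ e ∈ c', algebraMap (𝓞 K) (𝓞 E) e * (b * D.σO b') ∈
        Ideal.span {algebraMap (𝓞 K) (𝓞 E) s} := by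
      intro e he
      have hdiv : ∀ z ∈ D.nmIdeal I, ∃ t : 𝓞 K, e * z = s * t := fun z hz => by
        have : z * e ∈ Ideal.span {s} := hc' ▸ Ideal.mul_mem_mul hz he
        obtain ⟨t, ht⟩ := Ideal.mem_span_singleton'.1 this
        exact ⟨t, by rw [mul_comm, ← ht, mul_comm]⟩
      obtain ⟨t, ht⟩ := hdiv (D.nmO (b + b') - D.nmO b - D.nmO b')
        (Ideal.sub_mem _ (Ideal.sub_mem _ (D.nmO_mem (I.add_mem hb hb')) (D.nmO_mem hb))
          (D.nmO_mem hb'))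
      obtain ⟨t1, ht1⟩ := hdiv _ (D.nmO_mem hb)
      obtain ⟨t2, ht2⟩ := hdiv _ (D.nmO_mem hb')
      have hsE : algebraMap K E s ≠ 0 :=
        (_root_.map_ne_zero _).2 (RingOfIntegers.coe_ne_zero_iff.2 hs0)
      have cK : ∀ {x y : 𝓞 K}, x = y → algebraMap K E x = algebraMap K E y := fun h => by rw [h]
      have ht' := cK ht
      have ht1' := cK ht1
      have ht2' := cK ht2
      have htr := congrArg (algebraMap K E) (D.tr_mul_σ b b')
      rw [D.tr_spec, map_mul, D.invol] at htr
      simp only [map_mul, map_sub, coe_nmO] at ht' ht1' ht2' htr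
      rw [D.nm_spec] at ht1' ht2'
      change _ * (algebraMap K E (D.nm (b + b' : E)) - _ - _) = _ at ht'
      rw [← htr] at ht'
      have hint : IsIntegral ℤ (algebraMap K E e * (b * D.σ b') / algebraMap K E s) := by
        have : IsIntegral (𝓞 K) (algebraMap K E e * (b * D.σ b') / algebraMap K E s) := by
          refine isIntegral_of_quadratic t (t1 * t2) ?_
          change _ = algebraMap K E t * _ - algebraMap K E (algebraMap (𝓞 K) K (t1 * t2))
          rw [map_mul, map_mul]
          change _ = algebraMap K E t * _ - algebraMap K E t1 * algebraMap K E t2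
          field_simp
          linear_combination (algebraMap K E e * (b * D.σ b')) * ht' -
            (algebraMap K E e * (b' * D.σ b')) * ht1' - (algebraMap K E s * algebraMap K E t1) *
                ht2'
        exact isIntegral_trans (R := ℤ) (A := 𝓞 K) _ this
      obtain ⟨r, hr⟩ := integral_iff.1 hint
      refine Ideal.mem_span_singleton'.2 ⟨r, ?_⟩
      apply RingOfIntegers.coe_injective
      rw [map_mul, map_mul, map_mul]
      change (r : E) * algebraMap K E s = algebraMap K E e * (b * D.σ b')
      rw [hr]
      field_simp
    have h2 : Ideal.span {b * D.σO b'} * c'.map (algebraMap (𝓞 K) (𝓞 E)) ≤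
        (D.nmIdeal I).map (algebraMap (𝓞 K) (𝓞 E)) * c'.map (algebraMap (𝓞 K) (𝓞 E)) := by
      rw [← Ideal.map_mul, ← hc', Ideal.map_span, Set.image_singleton, Ideal.map,
        Ideal.span_mul_span', Ideal.span_le]
      rintro _ ⟨_, rfl, _, ⟨e, he, rfl⟩, rfl⟩
      have := key e he
      rwa [mul_comm] at this
    have h3 := (mul_dvd_mul_iff_right hc0).1 (Ideal.dvd_iff_le.2 h2)
    exact Ideal.dvd_iff_le.1 h3 (Ideal.mem_span_singleton_self _)
  · rw [nmIdeal, Ideal.map_span, Ideal.span_le]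
    rintro _ ⟨_, ⟨x, hx, rfl⟩, rfl⟩
    rw [algebraMap_nmO]
    exact Ideal.mul_mem_mul hx (Ideal.mem_map_of_mem _ hx)

/-- An ideal as a lattice. -/
noncomputable def latE (I : Ideal (𝓞 E)) : Submodule (𝓞 K) E :=
  ((I.restrictScalars (𝓞 K)).map (IsScalarTower.toAlgHom (𝓞 K) (𝓞 E) E).toLinearMap)

theorem mem_latE {I : Ideal (𝓞 E)} {x : E} : x ∈ latE (K := K) I ↔ ∃ b ∈ I, (b : E) = x := Iff.rfl

theorem mem_latE_top {x : E} : x ∈ latE (K := K) (⊤ : Ideal (𝓞 E)) ↔ IsIntegral ℤ x := by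
  rw [mem_latE, integral_iff]
  simp

theorem isLat_latE {I : Ideal (𝓞 E)} (hI : I ≠ ⊥) : IsLat (latE (K := K) I) := by
  refine ⟨Submodule.FG.map _ (IsNoetherian.noetherian _), fun v => ?_⟩
  have : IsAlgebraic (𝓞 K) v :=
    (IsFractionRing.isAlgebraic_iff (𝓞 K) K E).2 (Algebra.IsAlgebraic.isAlgebraic v)
  obtain ⟨y, hy, hint⟩ := this.exists_integral_multiple
  obtain ⟨b, hb⟩ := integral_iff.1 (isIntegral_trans (R := ℤ) (A := 𝓞 K) _ hint)
  refine ⟨(Ideal.absNorm I : 𝓞 K) * y, mul_ne_zero (Nat.cast_ne_zero.2 ?_) hy, ?_⟩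
  · exact mt Ideal.absNorm_eq_zero_iff.1 hI
  · refine mem_latE.2 ⟨(Ideal.absNorm I : 𝓞 E) * b,
      I.mul_mem_right _ (Ideal.absNorm_mem I), ?_⟩
    change algebraMap (𝓞 E) E _ = _
    rw [mul_smul, ← hb, map_mul, map_natCast, Algebra.smul_def, map_natCast]

end CMData

end TotReal

namespace TotReal

open NumberField Module IsDedekindDomain
open scoped nonZeroDivisors

set_option linter.unusedSectionVars false

theorem coe_mulO {F : Type} [Field F] (x y : 𝓞 F) : ((x * y : 𝓞 F) : F) = x * y := rfl

theorem coe_addO {F : Type} [Field F] (x y : 𝓞 F) : ((x + y : 𝓞 F) : F) = x + y := rfl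

theorem coe_negO {F : Type} [Field F] (x : 𝓞 F) : ((-x : 𝓞 F) : F) = -x := rfl

namespace CMData

variable {K E : Type} [Field K] [NumberField K] [IsTotallyReal K] [Field E] [NumberField E]
  [Algebra K E] {a : 𝓞 K} (D : CMData K E a)

/-- The quaternary form attached to a scalar. -/
noncomputable def form₂ (γ : K) : (E × E) →ₗ[K] (E × E) →ₗ[K] K := prodForm (γ⁻¹ • D.form) D.form

theorem form₂_apply (γ : K) (x y : E × E) :
    D.form₂ γ x y = γ⁻¹ * D.tr (x.1 * D.σ y.1) + D.tr (x.2 * D.σ y.2) := by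
  simp [form₂]

theorem totPos_form₂ {γ : K} (hγ : ∀ τ : K →+* ℝ, 0 < τ γ) : TotPos (D.form₂ γ) :=
  (D.totPos_form.smul fun τ => by rw [map_inv₀]; exact inv_pos.2 (hγ τ)).prod D.totPos_form

theorem sqDet_form₂ (γ : K) : SqDet (D.form₂ γ) := SqDet.smul_prod _ _ D.finrank_eq

/-- The quaternary lattice attached to an ideal. -/
noncomputable def latE₂ (K : Type) [Field K] {E : Type} [Field E] [Algebra K E]
    (I : Ideal (𝓞 E)) : Submodule (𝓞 K) (E × E) := (latE I).prod (latE ⊤)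

theorem isLat_latE₂ {I : Ideal (𝓞 E)} (hI : I ≠ ⊥) : IsLat (latE₂ K I) :=
  (isLat_latE hI).prod (isLat_latE top_ne_bot)

theorem latE₂_integral {I : Ideal (𝓞 E)} {J : Ideal (𝓞 K)} {γ : K} (hγ : γ ≠ 0)
    (h : IdealRel (D.nmIdeal I) J γ) : latE₂ K I ≤ dualLat (D.form₂ γ) (latE₂ K I) := by
  rintro ⟨x, z⟩ ⟨hx, hz⟩ ⟨y, w⟩ ⟨hy, hw⟩
  rw [form₂_apply]
  refine IsIntegral.add ?_ (D.isIntegral_tr ((mem_latE_top.1 hz).mul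
    (D.isIntegral_σ (mem_latE_top.1 hw))))
  obtain ⟨x, hxI, rfl⟩ := mem_latE.1 hx
  obtain ⟨y, hyI, rfl⟩ := mem_latE.1 hy
  obtain ⟨j, -, hj⟩ := (h (D.nmO (x + y) - D.nmO x - D.nmO y : 𝓞 K)).1
    ⟨_, Ideal.sub_mem _ (Ideal.sub_mem _ (D.nmO_mem (I.add_mem hxI hyI)) (D.nmO_mem hxI))
      (D.nmO_mem hyI), rfl⟩
  have : D.tr ((x : E) * D.σ y) = γ * j := by
    rw [hj, D.tr_mul_σ]
    rfl
  change IsIntegral ℤ (γ⁻¹ * D.tr ((x : E) * D.σ y))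
  rw [this, inv_mul_cancel_left₀ hγ]
  exact RingOfIntegers.isIntegral_coe j

theorem smul_mem_of_mem_dual {I : Ideal (𝓞 E)} {J : Ideal (𝓞 K)} {γ : K} (hγ : γ ≠ 0)
    (h : IdealRel (D.nmIdeal I) J γ) {z : E × E} (hz : z ∈ dualLat (D.form₂ γ) (latE₂ K I))
    {j : 𝓞 K} (hj : j ∈ J) : (2 * a * j) • z ∈ latE₂ K I := by
  have hγE : algebraMap K E γ ≠ 0 := (_root_.map_ne_zero _).2 hγ
  have hsm : ∀ (c : 𝓞 K) (x : E), c • x = algebraMap K E c * x := fun c x => by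
    rw [← algebraMap_smul K c x, Algebra.smul_def]
  constructor
  · have h1 : ∀ y ∈ I, IsIntegral ℤ (2 * D.θ * (algebraMap K E γ⁻¹ * z.1 * D.σ y)) := by
      intro y hy
      have key : ∀ w ∈ I, IsIntegral ℤ (D.tr (algebraMap K E γ⁻¹ * z.1 * D.σ w)) := fun w hw => by
        have := hz ((w : E), 0) ⟨mem_latE.2 ⟨w, hw, rfl⟩, zero_mem _⟩
        rw [form₂_apply] at this
        rw [mul_assoc, ← Algebra.smul_def, map_smul, smul_eq_mul]
        simpa using this
      refine D.isIntegral_two_θ_mul (key y hy) ?_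
      obtain ⟨t, ht⟩ := integral_iff.1 D.isIntegral_θ
      have := (key (t * y) (I.mul_mem_left _ hy)).neg
      rw [← map_neg] at this
      convert this using 2
      rw [coe_mulO, map_mul, ht, D.σθ]
      ring
    have h2 : ∀ c ∈ D.nmIdeal I,
        2 * D.θ * (algebraMap K E γ⁻¹ * z.1) * algebraMap K E c ∈ latE (K := K) I := by
      intro c hc
      induction hc using Submodule.span_induction with
      | mem c hc =>
        obtain ⟨y, hy, rfl⟩ := hc
        obtain ⟨r, hr⟩ := integral_iff.1 (h1 y hy)
        refine mem_latE.2 ⟨r * y, I.mul_mem_left _ hy, ?_⟩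
        rw [coe_mulO, hr, coe_nmO, D.nm_spec]
        ring
      | zero => simp
      | add c c' _ _ hc hc' => rw [coe_addO, map_add, mul_add]; exact add_mem hc hc'
      | smul r c _ hc =>
        have := (latE (K := K) I).smul_mem r hc
        rw [hsm] at this
        convert this using 1
        rw [smul_eq_mul, coe_mulO, map_mul]
        ring
    obtain ⟨c, hc, hcj⟩ := (h (γ * j)).2 ⟨j, hj, rfl⟩
    obtain ⟨r, hr, hr'⟩ := mem_latE.1 (h2 c hc)
    obtain ⟨t, ht⟩ := integral_iff.1 D.isIntegral_θ
    refine mem_latE.2 ⟨-(t * r), neg_mem (I.mul_mem_left _ hr), ?_⟩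
    rw [coe_negO, coe_mulO, ht, hr', hcj]
    change _ = (2 * a * j) • z.1
    rw [hsm]
    simp only [map_mul, map_inv₀, map_ofNat]
    field_simp
    linear_combination -algebraMap K E j * z.1 * D.θ_sq
  · have key : ∀ w : 𝓞 E, IsIntegral ℤ (D.tr (z.2 * D.σ w)) := fun w => by
      have := hz (0, (w : E)) ⟨zero_mem _, mem_latE.2 ⟨w, trivial, rfl⟩⟩
      rw [form₂_apply] at this
      simpa using this
    refine mem_latE_top.2 ?_
    obtain ⟨t, ht⟩ := integral_iff.1 D.isIntegral_θ
    have h1 : IsIntegral ℤ (2 * D.θ * z.2) := by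
      refine D.isIntegral_two_θ_mul (by simpa using key 1) ?_
      have := (key t).neg
      rw [← map_neg, ht, D.σθ] at this
      simpa using this
    have h2 := (D.isIntegral_θ.mul h1).mul
      (isIntegral_algebraMap (E := E).2 (RingOfIntegers.isIntegral_coe j)).neg
    have h3 : (2 * a * j) • z.2 = D.θ * (2 * D.θ * z.2) * -algebraMap K E j := by
      rw [hsm]
      simp only [map_mul, map_ofNat]
      linear_combination 2 * algebraMap K E j * z.2 * D.θ_sq
    change IsIntegral ℤ ((2 * a * j) • z.2)
    rw [h3]
    exact h2

theorem mem_of_mem_badPrimes {I : Ideal (𝓞 E)} {J : Ideal (𝓞 K)} {γ : K} (hγ : γ ≠ 0)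
    (h : IdealRel (D.nmIdeal I) J γ) {N : Submodule (𝓞 K) (E × E)} (hN : latE₂ K I ≤ N)
    {P : HeightOneSpectrum (𝓞 K)} (hP : P ∈ badPrimes (D.form₂ γ) N) {j : 𝓞 K} (hj : j ∈ J) :
    2 * a * j ∈ P.asIdeal := by
  by_contra hn
  refine hP fun x hx => mem_of_killed (mem_pDual.1 hx).2 ⟨_, hn, hN ?_⟩
  exact D.smul_mem_of_mem_dual hγ h (dualLat_anti hN (mem_pDual.1 hx).1) hj

end CMData

end TotReal

namespace TotReal

open NumberField Module IsDedekindDomain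
open scoped nonZeroDivisors

set_option linter.unusedSectionVars false

theorem exists_cmData {K : Type} [Field K] [NumberField K] [IsTotallyReal K] (a : 𝓞 K)
    (ha : ∀ τ : K →+* ℝ, 0 < τ a) :
    ∃ (E : Type) (_ : Field E) (_ : NumberField E) (_ : Algebra K E), Nonempty (CMData K E a) := by
  have : Fact (∀ r : K, r ^ 2 ≠ -(a : K) + 0 * r) := ⟨fun r h => by
    obtain ⟨τ⟩ := (inferInstance : Nonempty (K →+* ℝ))
    have h1 := congrArg τ h
    have h2 := ha τ
    simp only [map_pow, map_neg, zero_mul, add_zero] at h1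
    nlinarith [sq_nonneg (τ r)]⟩
  refine ⟨QuadraticAlgebra K (-(a : K)) 0, inferInstance, NumberField.of_module_finite K _,
      inferInstance, ⟨?_⟩⟩
  refine
    { σ := AlgEquiv.ofRingEquiv (f := RingEquiv.ofBijective
          ({ toFun := star, map_one' := star_one _, map_mul' := fun x y => ?_,
             map_zero' := star_zero _, map_add' := star_add } :
              QuadraticAlgebra K (-(a : K)) 0 →+* QuadraticAlgebra K (-(a : K)) 0)
          star_involutive.bijective) ?_
      tr := (2 : K) • QuadraticAlgebra.reₗ _ _
      θ := ⟨0, 1⟩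
      tr_spec := ?_
      σθ := ?_
      θ_sq := ?_
      pos := ha
      finrank_eq := QuadraticAlgebra.finrank_eq_two _ _ }
  · rw [star_mul, mul_comm]
  · intro r
    change star (⟨r, 0⟩ : QuadraticAlgebra K (-(a : K)) 0) = ⟨r, 0⟩
    apply QuadraticAlgebra.ext <;> simp
  · intro x
    change (⟨2 * x.re, 0⟩ : QuadraticAlgebra K (-(a : K)) 0) = x + star x
    apply QuadraticAlgebra.ext <;> simp
    ring
  · change star (⟨0, 1⟩ : QuadraticAlgebra K (-(a : K)) 0) = _
    apply QuadraticAlgebra.ext <;> simp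
  · change _ = -(⟨a, 0⟩ : QuadraticAlgebra K (-(a : K)) 0)
    apply QuadraticAlgebra.ext <;> simp

end TotReal

namespace TotReal

open NumberField Module IsDedekindDomain
open scoped nonZeroDivisors

set_option linter.unusedSectionVars false

section RelClass

variable (K E : Type) [Field K] [NumberField K] [Field E] [NumberField E] [Algebra K E]

/-- The class group of an extension modulo the classes of the ideals of the base. -/
abbrev RelClassGroup : Type :=
  ClassGroup (𝓞 E) ⧸ (ClassGroup.extendedHom (𝓞 K) (𝓞 E)).range

variable {E}

open Classical in
/-- The class of an ideal in the relative class group. -/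
noncomputable def relCls (I : Ideal (𝓞 E)) : RelClassGroup K E :=
  if h : I = ⊥ then 1 else
    QuotientGroup.mk (ClassGroup.mk0 ⟨I, mem_nonZeroDivisors_of_ne_zero h⟩)

variable {K}

theorem relCls_of_ne {I : Ideal (𝓞 E)} (h : I ≠ ⊥) : relCls K I =
    QuotientGroup.mk (ClassGroup.mk0 ⟨I, mem_nonZeroDivisors_of_ne_zero h⟩) := dif_neg h

theorem relCls_mul {I J : Ideal (𝓞 E)} (hI : I ≠ ⊥) (hJ : J ≠ ⊥) :
    relCls K (I * J) = relCls K I * relCls K J := by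
  have hIJ : I * J ≠ ⊥ := mul_ne_zero hI hJ
  rw [relCls_of_ne hI, relCls_of_ne hJ, relCls_of_ne hIJ, ← QuotientGroup.mk_mul, ← map_mul]
  rfl

theorem map_ne_bot {c : Ideal (𝓞 K)} (hc : c ≠ ⊥) : c.map (algebraMap (𝓞 K) (𝓞 E)) ≠ ⊥ :=
  (Ideal.map_eq_bot_iff_of_injective (FaithfulSMul.algebraMap_injective _ _)).not.2 hc

theorem relCls_map {c : Ideal (𝓞 K)} (hc : c ≠ ⊥) :
    relCls K (c.map (algebraMap (𝓞 K) (𝓞 E))) = 1 := by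
  rw [relCls_of_ne (map_ne_bot hc), QuotientGroup.eq_one_iff]
  exact ⟨ClassGroup.mk0 ⟨c, mem_nonZeroDivisors_of_ne_zero hc⟩, ClassGroup.extendedHom_mk0 _ _ _⟩

theorem span_ne_bot {R : Type*} [CommRing R] {x : R} (hx : x ≠ 0) : Ideal.span {x} ≠ ⊥ := by
  rwa [Ne, Ideal.span_singleton_eq_bot]

theorem relCls_span {x : 𝓞 E} (hx : x ≠ 0) : relCls K (Ideal.span {x}) = 1 := by
  rw [relCls_of_ne (span_ne_bot hx), (ClassGroup.mk0_eq_one_iff _).2 ⟨⟨x, rfl⟩⟩,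
      QuotientGroup.mk_one]

theorem relCls_surjective (q : RelClassGroup K E) : ∃ I : Ideal (𝓞 E), I ≠ ⊥ ∧ relCls K I = q := by
  obtain ⟨x, rfl⟩ := QuotientGroup.mk_surjective q
  obtain ⟨I, rfl⟩ := ClassGroup.mk0_surjective x
  exact ⟨I, nonZeroDivisors.ne_zero I.2, relCls_of_ne (nonZeroDivisors.ne_zero I.2)⟩

theorem exists_of_relCls_eq {I J : Ideal (𝓞 E)} (hI : I ≠ ⊥) (hJ : J ≠ ⊥)
    (h : relCls K I = relCls K J) : ∃ (x y : 𝓞 E) (c : Ideal (𝓞 K)), x ≠ 0 ∧ y ≠ 0 ∧ c ≠ ⊥ ∧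
      Ideal.span {x} * I = Ideal.span {y} * (c.map (algebraMap (𝓞 K) (𝓞 E)) * J) := by
  rw [relCls_of_ne hI, relCls_of_ne hJ, eq_comm, QuotientGroup.eq] at h
  obtain ⟨z, hz⟩ := h
  obtain ⟨c, rfl⟩ := ClassGroup.mk0_surjective z
  have hc : (c : Ideal (𝓞 K)) ≠ ⊥ := nonZeroDivisors.ne_zero c.2
  rw [ClassGroup.extendedHom_mk0, eq_comm, inv_mul_eq_iff_eq_mul, mul_comm, ← map_mul,
    ClassGroup.mk0_eq_mk0_iff] at hz
  obtain ⟨x, y, hx, hy, hxy⟩ := hz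
  exact ⟨x, y, c, hx, hy, hc, hxy⟩

end RelClass

namespace CMData

variable {K E : Type} [Field K] [NumberField K] [IsTotallyReal K] [Field E] [NumberField E]
  [Algebra K E] {a : 𝓞 K} (D : CMData K E a)

theorem map_σO_ne_bot {I : Ideal (𝓞 E)} (hI : I ≠ ⊥) : I.map D.σO ≠ ⊥ :=
  (Ideal.map_eq_bot_iff_of_injective D.σO.injective).not.2 hI

theorem relCls_mul_map_σO {I : Ideal (𝓞 E)} (hI : I ≠ ⊥) :
    relCls K I * relCls K (I.map D.σO) = 1 := by
  rw [← relCls_mul hI (D.map_σO_ne_bot hI), D.mul_map_σO, relCls_map (D.nmIdeal_ne_bot hI)]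

theorem relCls_of_nmIdeal_eq {I I' : Ideal (𝓞 E)} (hI : I ≠ ⊥) (hI' : I' ≠ ⊥)
    (h : D.nmIdeal I = D.nmIdeal I') : ∃ g, relCls K I = g ^ 2 * relCls K I' := by
  have h1 : I * I.map D.σO = I' * I'.map D.σO := by rw [mul_map_σO, mul_map_σO, h]
  set G := I ⊔ I' with hG
  have hG0 : G ≠ ⊥ := fun h0 => hI (le_bot_iff.1 (h0 ▸ le_sup_left))
  have h2 : G * I'.map D.σO = I * G.map D.σO := by
    rw [hG, Ideal.map_sup, Ideal.sup_mul, Ideal.mul_sup, h1, sup_comm]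
  have h3 := congrArg (relCls K) h2
  rw [relCls_mul hG0 (D.map_σO_ne_bot hI'), relCls_mul hI (D.map_σO_ne_bot hG0)] at h3
  have h4 := D.relCls_mul_map_σO hI'
  have h5 := D.relCls_mul_map_σO hG0
  refine ⟨relCls K G * (relCls K I')⁻¹, ?_⟩
  rw [mul_eq_one_iff_inv_eq] at h4 h5
  rw [← h4, ← h5] at h3
  have h6 : relCls K G * (relCls K I')⁻¹ * relCls K G = relCls K I := by
    rw [h3, inv_mul_cancel_right]
  rw [← h6, mul_pow, sq, sq, mul_right_comm, mul_assoc (_ * _), mul_assoc (_⁻¹), inv_mul_cancel,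
      mul_one]

theorem relCls_of_norm {𝔅 𝔅' : Ideal (𝓞 E)} (h𝔅 : 𝔅 ≠ ⊥) (h𝔅' : 𝔅' ≠ ⊥) {J : Ideal (𝓞 K)}
    {γ γ' : K} (h : IdealRel (D.nmIdeal 𝔅) J γ) (h' : IdealRel (D.nmIdeal 𝔅') J γ')
    {z : E} (hz : z ≠ 0) (hγ : γ' = D.nm z * γ) :
    ∃ g, relCls K 𝔅 = g ^ 2 * relCls K 𝔅' := by
  obtain ⟨u, w, hw, rfl⟩ := IsFractionRing.div_surjective (A := 𝓞 E) z
  have hw0 : w ≠ 0 := nonZeroDivisors.ne_zero hw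
  have hu0 : u ≠ 0 := by rintro rfl; simp at hz
  have hwE : (w : E) ≠ 0 := RingOfIntegers.coe_ne_zero_iff.2 hw0
  have key : ∀ {c : Ideal (𝓞 K)} {γ : K} (s : 𝓞 K), IdealRel c J γ →
      IdealRel (Ideal.span {s} * c) J (s * γ) := by
    intro c γ s h t
    constructor
    · rintro ⟨y, hy, rfl⟩
      obtain ⟨y, hyc, rfl⟩ := Ideal.mem_span_singleton_mul.1 hy
      obtain ⟨j, hj, hjy⟩ := (h y).1 ⟨y, hyc, rfl⟩
      exact ⟨j, hj, by rw [coe_mulO, ← hjy, mul_assoc]⟩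
    · rintro ⟨j, hj, rfl⟩
      obtain ⟨y, hy, hyj⟩ := (h _).2 ⟨j, hj, rfl⟩
      exact ⟨s * y, Ideal.mem_span_singleton_mul.2 ⟨y, hy, rfl⟩, by rw [coe_mulO, hyj, mul_assoc]⟩
  have e : D.nm (w : E) * γ' = D.nm (u : E) * γ := by
    rw [hγ, ← mul_assoc, ← D.nm_mul, mul_div_cancel₀ _ hwE]
  have hI : Ideal.span {w} * 𝔅' ≠ ⊥ := mul_ne_zero (span_ne_bot hw0) h𝔅'
  have hI' : Ideal.span {u} * 𝔅 ≠ ⊥ := mul_ne_zero (span_ne_bot hu0) h𝔅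
  have h1 := key (D.nmO u) h
  have h2 := key (D.nmO w) h'
  rw [coe_nmO, ← nmIdeal_span_mul] at h1 h2
  rw [e] at h2
  obtain ⟨g, hg⟩ := D.relCls_of_nmIdeal_eq hI' hI (h1.eq h2)
  rw [relCls_mul (span_ne_bot hw0) h𝔅', relCls_mul (span_ne_bot hu0) h𝔅, relCls_span hu0,
    relCls_span hw0, one_mul, one_mul] at hg
  exact ⟨g, hg⟩

end CMData

end TotReal

namespace TotReal

open NumberField Module IsDedekindDomain
open scoped nonZeroDivisors

set_option linter.unusedSectionVars false

theorem card_powMonoidHom {G : Type*} [CommGroup G] [Finite G] :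
    Nat.card (G ⧸ (powMonoidHom 2 : G →* G).range) = Nat.card (powMonoidHom 2 : G →* G).ker := by
  have h1 := (powMonoidHom 2 : G →* G).range.card_mul_index
  have h2 := (powMonoidHom 2 : G →* G).ker.card_mul_index
  rw [Subgroup.index_ker, mul_comm] at h2
  rw [← h2, Subgroup.index_eq_card] at h1
  exact Nat.eq_of_mul_eq_mul_left Nat.card_pos h1

/-- A parity on a cyclic group separating it modulo squares. -/
theorem exists_parity (G : Type*) [CommGroup G] [IsCyclic G] :
    ∃ p : G → Bool, ∀ x y, p x = p y → ∃ v, x = y * v ^ 2 := by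
  obtain ⟨g, hg⟩ := IsCyclic.exists_generator (α := G)
  choose k hk using fun x => Subgroup.mem_zpowers_iff.1 (hg x)
  refine ⟨fun x => decide (Even (k x)), fun x y h => ?_⟩
  have h' : Even (k x - k y) := Int.even_sub.2 (by simpa using h)
  obtain ⟨m, hm⟩ := h'
  refine ⟨g ^ m, ?_⟩
  rw [← hk x, ← hk y, sq, ← zpow_add, ← zpow_add, ← hm, add_sub_cancel]

section Primes

variable {K : Type} [Field K] [NumberField K]

/-- The product of a finite set of primes. -/
noncomputable def primeProd (T : Finset (HeightOneSpectrum (𝓞 K))) : Ideal (𝓞 K) :=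
  ∏ P ∈ T, P.asIdeal

theorem primeProd_ne_bot (T : Finset (HeightOneSpectrum (𝓞 K))) : primeProd T ≠ ⊥ :=
  Finset.prod_ne_zero_iff.2 fun P _ => P.ne_bot

theorem count_primeProd (T : Finset (HeightOneSpectrum (𝓞 K))) (P : HeightOneSpectrum (𝓞 K))
    [DecidableEq (Ideal (𝓞 K))] [Decidable (P ∈ T)] :
    Multiset.count P.asIdeal (UniqueFactorizationMonoid.normalizedFactors (primeProd T)) =
      if P ∈ T then 1 else 0 := by
  classical
  have h : UniqueFactorizationMonoid.normalizedFactors (primeProd T) =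
      T.val.map HeightOneSpectrum.asIdeal :=
    UniqueFactorizationMonoid.normalizedFactors_prod_of_prime (m :=
        T.val.map HeightOneSpectrum.asIdeal)
      (by
        intro p hp
        obtain ⟨Q, -, rfl⟩ := Multiset.mem_map.1 hp
        exact Q.prime)
  rw [h, Multiset.count_map_eq_count' _ _ fun x y hxy => HeightOneSpectrum.ext hxy]
  rw [Multiset.count_eq_of_nodup T.nodup]
  simp only [Finset.mem_val]
  congr

theorem primeProd_injective {T T' : Finset (HeightOneSpectrum (𝓞 K))} {X Y : Ideal (𝓞 K)}
    (hX : X ≠ ⊥) (hY : Y ≠ ⊥) (h : X ^ 2 * primeProd T = Y ^ 2 * primeProd T') : T = T' := by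
  classical
  have key : ∀ {T T' : Finset (HeightOneSpectrum (𝓞 K))} {X Y : Ideal (𝓞 K)},
      X ≠ ⊥ → Y ≠ ⊥ → X ^ 2 * primeProd T = Y ^ 2 * primeProd T' → T ≤ T' := by
    intro T T' X Y hX hY h P hP
    have h1 := congrArg (fun I => Multiset.count P.asIdeal
      (UniqueFactorizationMonoid.normalizedFactors I)) h
    simp only [UniqueFactorizationMonoid.normalizedFactors_mul (pow_ne_zero 2 hX)
        (primeProd_ne_bot T),
      UniqueFactorizationMonoid.normalizedFactors_mul (pow_ne_zero 2 hY) (primeProd_ne_bot T'),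
      UniqueFactorizationMonoid.normalizedFactors_pow, Multiset.count_add, Multiset.count_nsmul,
      count_primeProd, if_pos hP] at h1
    by_contra hP'
    rw [if_neg hP'] at h1
    omega
  exact le_antisymm (key hX hY h) (key hY hX h.symm)

theorem isCoprime_primeProd {S T : Finset (HeightOneSpectrum (𝓞 K))}
    [DecidableEq (HeightOneSpectrum (𝓞 K))]
    (hT : T ⊆ S) {J : Ideal (𝓞 K)} (hJ : ∀ P ∈ S, ¬ J ≤ P.asIdeal) :
    IsCoprime (primeProd T) (J * primeProd (S \ T)) := by
  refine IsCoprime.prod_left fun P hP => IsCoprime.mul_right ?_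
      (IsCoprime.prod_right fun Q hQ => ?_)
  · have := P.isMaximal
    rw [Ideal.isCoprime_iff_sup_eq]
    exact this.1.2 _ (lt_of_le_of_ne le_sup_left fun h => hJ P (hT hP) (h ▸ le_sup_right))
  · have := P.isMaximal
    have := Q.isMaximal
    refine Ideal.isCoprime_of_isMaximal fun h => (Finset.mem_sdiff.1 hQ).2 ?_
    rwa [← HeightOneSpectrum.ext h]

end Primes

namespace CMData

variable {K E : Type} [Field K] [NumberField K] [IsTotallyReal K] [Field E] [NumberField E]
  [Algebra K E] {a : 𝓞 K} (D : CMData K E a)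

theorem emb_σ (φ : E →+* ℂ) (x : E) : φ (D.σ x) = (starRingEnd ℂ) (φ x) := by
  have hreal : ∀ c : K, (starRingEnd ℂ) (φ (algebraMap K E c)) = φ (algebraMap K E c) := fun c =>
    RingHom.congr_fun (IsTotallyReal.complexEmbedding_isReal (φ.comp (algebraMap K E))) c
  have hθ : (starRingEnd ℂ) (φ D.θ) = -φ D.θ := by
    obtain ⟨τ, hτ⟩ := (embEquiv K).surjective
      ((φ.comp (algebraMap K E)).toRatAlgHom)
    have h1 : φ D.θ * φ D.θ = -((τ a : ℝ) : ℂ) := by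
      rw [← map_mul, D.θ_sq, map_neg, ← embEquiv_apply, hτ]
      rfl
    have h2 := congrArg Complex.re h1
    have h3 := congrArg Complex.im h1
    simp only [Complex.mul_re, Complex.mul_im, Complex.neg_re, Complex.neg_im, Complex.ofReal_re,
      Complex.ofReal_im, neg_zero] at h2 h3
    have h4 := D.pos τ
    have h5 : (φ D.θ).re = 0 := by
      by_contra h5
      have h6 : (φ D.θ).im = 0 := by
        have : (φ D.θ).re * (φ D.θ).im = 0 := by linarith
        exact (mul_eq_zero.1 this).resolve_left h5
      rw [h6] at h2
      nlinarith [mul_self_nonneg (φ D.θ).re]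
    apply Complex.ext <;> simp [h5]
  have h := D.decomp x
  set u := D.tr x / 2
  set v := D.tr (x * D.σ D.θ) / (2 * a)
  rw [h]
  simp only [map_add, map_mul, AlgEquiv.commutes, D.σθ, map_neg, hreal, hθ]

theorem mem_torsion {u : (𝓞 E)ˣ} (h : (u : 𝓞 E) * D.σO u = 1) : u ∈ Units.torsion E := by
  rw [NumberField.Units.mem_torsion]
  intro w
  have h1 := congrArg (fun x : 𝓞 E => w.embedding (x : E)) h
  simp only [map_mul, coe_σO, D.emb_σ, Complex.mul_conj] at h1
  rw [← w.norm_embedding_eq]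
  have h2 : Complex.normSq (w.embedding ((u : 𝓞 E) : E)) = 1 := by
    apply Complex.ofReal_injective
    rw [h1]
    simp
  rw [Complex.normSq_eq_norm_sq] at h2
  exact (pow_eq_one_iff_of_nonneg (norm_nonneg _) two_ne_zero).1 h2

theorem mul_σO_of_mem_torsion {u : (𝓞 E)ˣ} (h : u ∈ Units.torsion E) :
    (u : 𝓞 E) * D.σO u = 1 := by
  rw [NumberField.Units.mem_torsion] at h
  obtain ⟨w⟩ := (inferInstance : Nonempty (InfinitePlace E))
  apply RingOfIntegers.coe_injective
  apply w.embedding.injective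
  rw [map_mul, map_mul]
  change w.embedding _ * w.embedding (D.σ ((u : 𝓞 E) : E)) = _
  rw [D.emb_σ, Complex.mul_conj, Complex.normSq_eq_norm_sq,
    w.norm_embedding_eq, h w]
  simp

/-- The integral square root of `-a`. -/
noncomputable def θO : 𝓞 E := ⟨D.θ, D.isIntegral_θ⟩

theorem θO_sq : D.θO * D.θO = -algebraMap (𝓞 K) (𝓞 E) a :=
  RingOfIntegers.coe_injective D.θ_sq

theorem σO_θO : D.σO D.θO = -D.θO := RingOfIntegers.coe_injective D.σθ

/-- The ambiguous ideals. -/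
noncomputable def amb (T : Finset (HeightOneSpectrum (𝓞 K))) : Ideal (𝓞 E) :=
  (primeProd T).map (algebraMap (𝓞 K) (𝓞 E)) ⊔ Ideal.span {D.θO}

theorem amb_ne_bot (T : Finset (HeightOneSpectrum (𝓞 K))) : D.amb T ≠ ⊥ := fun h =>
  map_ne_bot (E := E) (primeProd_ne_bot T) (le_bot_iff.1 (h ▸ le_sup_left))

theorem map_σO_amb (T : Finset (HeightOneSpectrum (𝓞 K))) : (D.amb T).map D.σO = D.amb T := by
  rw [amb, Ideal.map_sup, map_map_σO, Ideal.map_span, Set.image_singleton, σO_θO,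
    Ideal.span_singleton_neg]

theorem amb_sq [DecidableEq (HeightOneSpectrum (𝓞 K))] {S T : Finset (HeightOneSpectrum (𝓞 K))}
    (hT : T ⊆ S) {J : Ideal (𝓞 K)}
    (hJ : ∀ P ∈ S, ¬ J ≤ P.asIdeal) (ha : Ideal.span {a} = J * primeProd S) :
    D.amb T * D.amb T = (primeProd T).map (algebraMap (𝓞 K) (𝓞 E)) := by
  have h1 := Ideal.isCoprime_iff_sup_eq.1 (isCoprime_primeProd hT hJ)
  have h2 : Ideal.span {D.θO} * Ideal.span {D.θO} =
      (primeProd T).map (algebraMap (𝓞 K) (𝓞 E)) *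
        (J * primeProd (S \ T)).map (algebraMap (𝓞 K) (𝓞 E)) := by
    rw [Ideal.span_singleton_mul_span_singleton, θO_sq, Ideal.span_singleton_neg,
      ← Set.image_singleton, ← Ideal.map_span, ha, ← Ideal.map_mul, mul_left_comm, primeProd,
      primeProd, primeProd, mul_comm (∏ P ∈ T, _), Finset.prod_sdiff hT]
  set A := (primeProd T).map (algebraMap (𝓞 K) (𝓞 E))
  set B := Ideal.span {D.θO}
  have h3 : A ⊔ (J * primeProd (S \ T)).map (algebraMap (𝓞 K) (𝓞 E)) = ⊤ := by
    rw [← Ideal.map_sup, h1, Ideal.map_top]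
  have h4 : D.amb T = A ⊔ B := rfl
  apply le_antisymm
  · rw [h4, Ideal.sup_mul, Ideal.mul_sup, Ideal.mul_sup, h2]
    exact sup_le (sup_le Ideal.mul_le_left Ideal.mul_le_left)
      (sup_le Ideal.mul_le_right Ideal.mul_le_left)
  · calc A = A * (A ⊔ (J * primeProd (S \ T)).map (algebraMap (𝓞 K) (𝓞 E))) := by
          rw [h3, Ideal.mul_top]
      _ = A * A ⊔ B * B := by rw [Ideal.mul_sup, h2]
      _ ≤ D.amb T * D.amb T := by
          rw [h4]
          exact sup_le (Ideal.mul_mono le_sup_left le_sup_left)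
            (Ideal.mul_mono le_sup_right le_sup_right)

/-- A comparison of two ambiguous ideals recording the twist of the comparing element. -/
def Link (T₀ T : Finset (HeightOneSpectrum (𝓞 K))) (u : (𝓞 E)ˣ) : Prop :=
  ∃ (x y : 𝓞 E) (c : Ideal (𝓞 K)), x ≠ 0 ∧ y ≠ 0 ∧ c ≠ ⊥ ∧ Ideal.span {x} * D.amb T =
    Ideal.span {y} * (c.map (algebraMap (𝓞 K) (𝓞 E)) * D.amb T₀) ∧ x * D.σO y * u = y * D.σO x

theorem exists_link {T₀ T : Finset (HeightOneSpectrum (𝓞 K))}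
    (h : relCls K (D.amb T) = relCls K (D.amb T₀)) : ∃ u ∈ Units.torsion E, D.Link T₀ T u := by
  obtain ⟨x, y, c, hx, hy, hc, he⟩ := exists_of_relCls_eq (D.amb_ne_bot T) (D.amb_ne_bot T₀) h
  have he' := congrArg (Ideal.map D.σO) he
  simp only [Ideal.map_mul, Ideal.map_span, Set.image_singleton, map_map_σO, map_σO_amb] at he'
  have h1 : Ideal.span {x * D.σO y} = Ideal.span {y * D.σO x} := by
    have h0 : D.amb T * (c.map (algebraMap (𝓞 K) (𝓞 E)) * D.amb T₀) ≠ 0 :=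
      mul_ne_zero (D.amb_ne_bot T) (mul_ne_zero (map_ne_bot hc) (D.amb_ne_bot T₀))
    apply mul_right_cancel₀ h0
    rw [← Ideal.span_singleton_mul_span_singleton, ← Ideal.span_singleton_mul_span_singleton,
      mul_mul_mul_comm, he, ← he', mul_mul_mul_comm, mul_comm (c.map _ * _)]
  obtain ⟨u, hu⟩ := Ideal.span_singleton_eq_span_singleton.1 h1
  refine ⟨u, D.mem_torsion ?_, x, y, c, hx, hy, hc, he, hu⟩
  have hinv : ∀ z, D.σO (D.σO z) = z := fun z => RingOfIntegers.coe_injective (D.invol z)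
  have hu' := congrArg D.σO hu
  simp only [map_mul, hinv] at hu'
  have h0 : x * D.σO y ≠ 0 := mul_ne_zero hx ((map_ne_zero_iff _ D.σO.injective).2 hy)
  apply mul_left_cancel₀ h0
  rw [← mul_assoc, hu, mul_one, mul_comm y, hu', mul_comm]

theorem eq_of_link [DecidableEq (HeightOneSpectrum (𝓞 K))]
    {S T₀ T T' : Finset (HeightOneSpectrum (𝓞 K))} (hT : T ⊆ S)
    (hT' : T' ⊆ S) {J : Ideal (𝓞 K)}
    (hJ : ∀ P ∈ S, ¬ J ≤ P.asIdeal) (ha : Ideal.span {a} = J * primeProd S) {u u' v : (𝓞 E)ˣ}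
    (hu : D.Link T₀ T u) (hu' : D.Link T₀ T' u') (hv : (v : 𝓞 E) * D.σO v = 1)
        (huv : u = u' * v ^ 2) :
    T = T' := by
  obtain ⟨x, y, c, hx, hy, hc, he, hl⟩ := hu
  obtain ⟨x', y', c', hx', hy', hc', he', hl'⟩ := hu'
  have hσ0 : ∀ {z : 𝓞 E}, z ≠ 0 → D.σO z ≠ 0 := fun hz => (map_ne_zero_iff _ D.σO.injective).2 hz
  have hE : ∀ {z : 𝓞 E}, z ≠ 0 → (z : E) ≠ 0 := fun hz => RingOfIntegers.coe_ne_zero_iff.2 hz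
  have hinv : ∀ z, D.σO (D.σO z) = z := fun z => RingOfIntegers.coe_injective (D.invol z)
  -- the invariant element
  have hfix : x * y' * v * D.σO (y * x') = D.σO (x * y' * v) * (y * x') := by
    have h0 : (u' : 𝓞 E) * v * x' * D.σO y' ≠ 0 := by
      refine mul_ne_zero (mul_ne_zero (mul_ne_zero u'.ne_zero v.ne_zero) hx') (hσ0 hy')
    apply mul_left_cancel₀ h0
    have huv' : (u : 𝓞 E) = u' * v ^ 2 := by rw [huv]; simp
    rw [huv'] at hl
    simp only [map_mul]
    linear_combination (x' * D.σO y' * y' * D.σO x') * hl - (y * D.σO x * x' * D.σO y') * hl'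
      - (u' * y * x' * D.σO y' * x' * D.σO x * D.σO y') * hv
  obtain ⟨t, ht⟩ := D.exists_of_fixed (x := (x * y' * v : 𝓞 E) / (y * x' : 𝓞 E)) (by
    have h1 := congrArg (fun z : 𝓞 E => (z : E)) hfix
    simp only [coe_mulO _ (D.σO _), coe_mulO (D.σO _), coe_σO] at h1
    rw [map_div₀, div_eq_div_iff ((_root_.map_ne_zero _).2 (hE (mul_ne_zero hy hx')))
      (hE (mul_ne_zero hy hx')), ← h1])
  have ht0 : t ≠ 0 := by
    rintro rfl
    rw [map_zero, eq_comm, div_eq_zero_iff] at ht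
    exact ht.elim (hE (mul_ne_zero (mul_ne_zero hx hy') v.ne_zero)) (hE (mul_ne_zero hy hx'))
  obtain ⟨p, q, hq, rfl⟩ := IsFractionRing.div_surjective (A := 𝓞 K) t
  have hq0 : q ≠ 0 := nonZeroDivisors.ne_zero hq
  have hp0 : p ≠ 0 := by rintro rfl; simp at ht0
  have hpq : x * y' * v * algebraMap (𝓞 K) (𝓞 E) q = y * x' * algebraMap (𝓞 K) (𝓞 E) p := by
    apply RingOfIntegers.coe_injective
    rw [map_div₀, div_eq_div_iff ((_root_.map_ne_zero _).2 (RingOfIntegers.coe_ne_zero_iff.2 hq0))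
      (hE (mul_ne_zero hy hx'))] at ht
    exact ht.symm.trans (mul_comm _ _)
  have hs : Ideal.span {x * y'} * (Ideal.span {q}).map (algebraMap (𝓞 K) (𝓞 E)) =
      Ideal.span {y * x'} * (Ideal.span {p}).map (algebraMap (𝓞 K) (𝓞 E)) := by
    rw [Ideal.map_span, Ideal.map_span, Set.image_singleton, Set.image_singleton,
      Ideal.span_singleton_mul_span_singleton, Ideal.span_singleton_mul_span_singleton, ← hpq,
      Ideal.span_singleton_eq_span_singleton]
    exact ⟨v, by ring⟩
  have hm : ∀ (w : 𝓞 K) (c : Ideal (𝓞 K)) (hw : w ≠ 0) (hc : c ≠ ⊥), Ideal.span {w} * c ≠ ⊥ :=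
    fun w c hw hc => mul_ne_zero (span_ne_bot hw) hc
  have hmain : (Ideal.span {p} * c').map (algebraMap (𝓞 K) (𝓞 E)) * D.amb T =
      (Ideal.span {q} * c).map (algebraMap (𝓞 K) (𝓞 E)) * D.amb T' := by
    have h0 : Ideal.span {y * x'} * D.amb T₀ ≠ 0 :=
      mul_ne_zero (span_ne_bot (mul_ne_zero hy hx')) (D.amb_ne_bot T₀)
    apply mul_left_cancel₀ h0
    rw [Ideal.map_mul, Ideal.map_mul]
    simp only [← Ideal.span_singleton_mul_span_singleton] at hs ⊢
    generalize c.map (algebraMap (𝓞 K) (𝓞 E)) = C at *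
    generalize c'.map (algebraMap (𝓞 K) (𝓞 E)) = C' at *
    generalize (Ideal.span {p}).map (algebraMap (𝓞 K) (𝓞 E)) = A at *
    generalize (Ideal.span {q}).map (algebraMap (𝓞 K) (𝓞 E)) = B at *
    calc _ = Ideal.span {y} * Ideal.span {x'} * A * (D.amb T₀ * C' * D.amb T) := by ring
      _ = Ideal.span {x} * D.amb T * (Ideal.span {y'} * (C' * D.amb T₀)) * B := by rw [← hs]; ring
      _ = Ideal.span {y} * (C * D.amb T₀) * (Ideal.span {x'} * D.amb T') * B := by rw [he, he']
      _ = _ := by ring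
  refine primeProd_injective (hm p c' hp0 hc') (hm q c hq0 hc) ?_
  have h2 : ((Ideal.span {p} * c') ^ 2 * primeProd T).map (algebraMap (𝓞 K) (𝓞 E)) =
      ((Ideal.span {q} * c) ^ 2 * primeProd T').map (algebraMap (𝓞 K) (𝓞 E)) := by
    rw [Ideal.map_mul, Ideal.map_mul, ← D.amb_sq hT hJ ha, ← D.amb_sq hT' hJ ha, Ideal.map_pow,
      Ideal.map_pow, ← sq, ← sq, ← mul_pow, hmain, mul_pow]
  rw [← Ideal.comap_map_eq_self_of_faithfullyFlat (B :=
      𝓞 E) ((Ideal.span {p} * c') ^ 2 * primeProd T),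
    h2, Ideal.comap_map_eq_self_of_faithfullyFlat]

theorem two_pow_card_le (D : CMData K E a) {S : Finset (HeightOneSpectrum (𝓞 K))} {J : Ideal (𝓞 K)}
    (hJ : ∀ P ∈ S, ¬ J ≤ P.asIdeal) (ha : Ideal.span {a} = J * primeProd S) :
    2 ^ S.card ≤ 2 * Nat.card (RelClassGroup K E ⧸
      (powMonoidHom 2 : RelClassGroup K E →* RelClassGroup K E).range) := by
  classical
  obtain ⟨par, hpar⟩ := exists_parity (Units.torsion E)
  have := Fintype.ofFinite (powMonoidHom 2 : RelClassGroup K E →* RelClassGroup K E).ker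
  rw [card_powMonoidHom, ← Finset.card_powerset]
  refine (Finset.card_le_mul_card_image (f := fun T => relCls K (D.amb T)) _ 2 ?_).trans ?_
  · intro b hb
    obtain ⟨T₀, hT₀, rfl⟩ := Finset.mem_image.1 hb
    have hex : ∀ T : {T // T ∈ S.powerset.filter fun T => relCls K (D.amb T) = relCls K (D.amb T₀)},
        ∃ u : Units.torsion E, D.Link T₀ T u := by
      rintro ⟨T, hT⟩
      obtain ⟨u, hu, h⟩ := D.exists_link (Finset.mem_filter.1 hT).2
      exact ⟨⟨u, hu⟩, h⟩
    choose u hu using hex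
    rw [← Fintype.card_coe, ← Fintype.card_bool]
    refine Fintype.card_le_of_injective (fun T => par (u T)) fun T T' h => ?_
    obtain ⟨v, hv⟩ := hpar _ _ h
    apply Subtype.ext
    refine D.eq_of_link (Finset.mem_powerset.1 (Finset.mem_filter.1 T.2).1)
      (Finset.mem_powerset.1 (Finset.mem_filter.1 T'.2).1) hJ ha (hu T) (hu T') (v := v)
      (D.mul_σO_of_mem_torsion v.2) (by rw [hv]; rfl)
  · refine Nat.mul_le_mul_left 2 ?_
    rw [← Set.ncard_coe_finset]
    refine (Set.ncard_le_ncard (t := ((powMonoidHom 2 :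
      RelClassGroup K E →* RelClassGroup K E).ker : Set (RelClassGroup K E))) ?_
      (Set.toFinite _)).trans_eq (Nat.card_coe_set_eq _).symm
    intro b hb
    obtain ⟨T, hT, rfl⟩ := Finset.mem_image.1 hb
    rw [SetLike.mem_coe, MonoidHom.mem_ker, powMonoidHom_apply, sq,
      ← relCls_mul (D.amb_ne_bot T) (D.amb_ne_bot T), D.amb_sq (Finset.mem_powerset.1 hT) hJ ha,
      relCls_map (primeProd_ne_bot T)]

end CMData

end TotReal

namespace TotReal

open NumberField Module IsDedekindDomain
open scoped nonZeroDivisors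

set_option linter.unusedSectionVars false

section Rep

variable {K : Type} [Field K] [NumberField K] [IsTotallyReal K]
variable {V : Type} [AddCommGroup V] [Module K V] [Module (𝓞 K) V] [IsScalarTower (𝓞 K) K V]
variable {B : V →ₗ[K] V →ₗ[K] K} {L : Submodule (𝓞 K) V}

theorem exists_rep [FiniteDimensional K V] (hB : TotPos B) {m X : ℕ} (hk : finrank K V = m)
    (hL : IsLat L) (hi : L ≤ dualLat B L) (hd : disc B L ≤ X)
    {S : Finset ((Fin m → K) × Submodule (𝓞 K) (Fin m → K))}
    (hS : ∀ q ∈ latPairs K m X, ∃ p ∈ S, Isom q p) :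
    ∃ p ∈ S, ∃ f : V ≃ₗ[K] (Fin m → K), (∀ x y, diagB p.1 (f x) (f y) = B x y) ∧
      ∀ x, f x ∈ p.2 ↔ x ∈ L := by
  subst hk
  obtain ⟨g, hg⟩ := exists_frame hB
  obtain ⟨p, hp, f, hf, hfL⟩ := hS (frameWt B g, frameLat L g)
    ⟨frameWt_pos hB hg, hL.frame hB hg rfl, integral_frame hB hg rfl hi,
      (disc_frame hB hg rfl L).trans_le hd⟩
  refine ⟨p, hp, (frameEquiv hB hg rfl).symm.trans f, fun x y => ?_, fun x => ?_⟩
  · rw [LinearEquiv.trans_apply, LinearEquiv.trans_apply, hf, ← frameEquiv_form hB hg rfl,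
      LinearEquiv.apply_symm_apply, LinearEquiv.apply_symm_apply]
  · rw [LinearEquiv.trans_apply, hfL]
    change frameEquiv hB hg rfl ((frameEquiv hB hg rfl).symm x) ∈ L ↔ _
    rw [LinearEquiv.apply_symm_apply]

end Rep

section Label

variable (K : Type) [Field K] [NumberField K] [IsTotallyReal K]

/-- The sets of bad primes away from `S₀` of maximal lattices in spaces of dimension `k` and square
determinant. -/
def IsLabel (S₀ : Set (HeightOneSpectrum (𝓞 K))) (k : ℕ) (T : Set (HeightOneSpectrum (𝓞 K))) :
    Prop :=
  ∃ (V : Type) (_ : AddCommGroup V) (_ : Module K V) (_ : Module (𝓞 K) V)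
    (_ : IsScalarTower (𝓞 K) K V) (_ : FiniteDimensional K V) (B : V →ₗ[K] V →ₗ[K] K)
    (L : Submodule (𝓞 K) V), TotPos B ∧ finrank K V = k ∧ SqDet B ∧ MaxLat B L ∧
      badPrimes B L \ S₀ = T

variable {K}

theorem exists_generator (𝒥 : Finset (Ideal (𝓞 K))) (hne : ∀ J ∈ 𝒥, J ≠ ⊥)
    (h𝒥 : ∀ c : Ideal (𝓞 K), c ≠ ⊥ → ∃ J ∈ 𝒥, ∃ γ : K, (∀ τ : K →+* ℝ, 0 < τ γ) ∧ IdealRel c J γ)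
    (I : Ideal (𝓞 K)) (hI : I ≠ ⊥) : ∃ (a : 𝓞 K) (J' : Ideal (𝓞 K)), (∀ τ : K →+* ℝ, 0 < τ a) ∧
      Ideal.span {a} = J' * I ∧ ∃ J ∈ 𝒥, (Ideal.absNorm J : 𝓞 K) ∈ J' := by
  obtain ⟨J, hJ, γ, hγ, h⟩ := h𝒥 I hI
  have hJ0 := hne J hJ
  have hNJ := Ideal.absNorm_mem J
  have hN : Ideal.absNorm J ≠ 0 := Ideal.absNorm_eq_zero_iff.not.2 hJ0
  obtain ⟨a, haI, ha⟩ := (h _).2 ⟨_, hNJ, rfl⟩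
  obtain ⟨J', hJ'⟩ := Ideal.dvd_span_singleton.2 hNJ
  refine ⟨a, J', fun τ => ?_, ?_, J, hJ, ?_⟩
  · rw [ha, map_mul]
    refine mul_pos (hγ τ) ?_
    simpa using Nat.pos_of_ne_zero hN
  · apply mul_left_cancel₀ (show J ≠ 0 from hJ0)
    rw [← mul_assoc, ← hJ', mul_comm]
    ext x
    rw [Ideal.mem_span_singleton_mul, Ideal.mem_span_singleton_mul]
    constructor
    · rintro ⟨y, hy, rfl⟩
      obtain ⟨z, hz, hzy⟩ := (h _).2 ⟨y, hy, rfl⟩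
      refine ⟨z, hz, RingOfIntegers.coe_injective ?_⟩
      change ((_ * _ : 𝓞 K) : K) = ((_ * _ : 𝓞 K) : K)
      rw [coe_mulO, coe_mulO, hzy, ha]
      ring
    · rintro ⟨z, hz, rfl⟩
      obtain ⟨y, hy, hzy⟩ := (h _).1 ⟨z, hz, rfl⟩
      refine ⟨y, hy, RingOfIntegers.coe_injective ?_⟩
      change ((_ * _ : 𝓞 K) : K) = ((_ * _ : 𝓞 K) : K)
      rw [coe_mulO, coe_mulO, ← hzy, ha]
      ring
  · have := Ideal.mem_span_singleton_self (Ideal.absNorm J : 𝓞 K)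
    rw [hJ'] at this
    exact Ideal.mul_le_right this

namespace CMData

variable {E : Type} [Field E] [NumberField E] [Algebra K E] {a : 𝓞 K} (D : CMData K E a)

theorem norm_of_isomForm {γ γ' : K} (hγ : ∀ τ : K →+* ℝ, 0 < τ γ) (hγ' : ∀ τ : K →+* ℝ, 0 < τ γ')
    (h : IsomForm (D.form₂ γ) (D.form₂ γ')) : ∃ z : E, z ≠ 0 ∧ γ' = D.nm z * γ := by
  obtain ⟨τ⟩ := (inferInstance : Nonempty (K →+* ℝ))
  have h0 : γ ≠ 0 := fun h => (hγ τ).ne' (by rw [h, map_zero])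
  have h0' : γ' ≠ 0 := fun h => (hγ' τ).ne' (by rw [h, map_zero])
  obtain ⟨f, hf⟩ := witt (D.totPos_form.smul fun τ => by rw [map_inv₀]; exact inv_pos.2 (hγ' τ))
    D.totPos_form h
  have h1 := hf 1 1
  simp only [LinearMap.smul_apply, form_self, smul_eq_mul, nm_one] at h1
  refine ⟨f 1, (map_ne_zero_iff f f.injective).2 one_ne_zero, ?_⟩
  field_simp at h1
  linear_combination -h1

end CMData

variable (K) in
theorem exists_labels : ∃ (S₀ : Finset (HeightOneSpectrum (𝓞 K))) (c : ℕ),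
    (∀ P : HeightOneSpectrum (𝓞 K), (2 : 𝓞 K) ∈ P.asIdeal → P ∈ S₀) ∧
    ∀ S : Finset (HeightOneSpectrum (𝓞 K)), Disjoint S S₀ →
      ∃ F : Finset (Set (HeightOneSpectrum (𝓞 K))),
        (∀ T ∈ F, IsLabel K S₀ 4 T ∧ T ⊆ S) ∧ 2 ^ S.card ≤ c * F.card := by
  classical
  obtain ⟨𝒥, hne, h𝒥⟩ := exists_narrow K
  let m₀ : 𝓞 K := 2 * ∏ J ∈ 𝒥, (Ideal.absNorm J : 𝓞 K)
  have hm₀ : Ideal.span {m₀} ≠ 0 := span_ne_bot (mul_ne_zero two_ne_zero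
    (Finset.prod_ne_zero_iff.2 fun J hJ => by
      simpa [Ideal.absNorm_eq_zero_iff] using hne J hJ))
  have hfin := Ideal.finite_factors hm₀
  let S₀ := hfin.toFinset
  have hS₀ : ∀ P : HeightOneSpectrum (𝓞 K), P ∈ S₀ ↔ m₀ ∈ P.asIdeal := fun P => by
    simp [S₀, Ideal.dvd_span_singleton]
  have h2S₀ : ∀ P : HeightOneSpectrum (𝓞 K), (2 : 𝓞 K) ∈ P.asIdeal → P ∈ S₀ := fun P hP =>
    (hS₀ P).2 (Ideal.mul_mem_right _ _ hP)
  have hJS₀ : ∀ J ∈ 𝒥, ∀ P : HeightOneSpectrum (𝓞 K), (Ideal.absNorm J : 𝓞 K) ∈ P.asIdeal →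
      P ∈ S₀ := fun J hJ P hP =>
    (hS₀ P).2 (Ideal.mul_mem_left _ _ (Ideal.mem_of_dvd _ (Finset.dvd_prod_of_mem _ hJ) hP))
  obtain ⟨R, -, hR, -⟩ := exists_reps (K := K) 8 (∏ P ∈ S₀, Ideal.absNorm P.asIdeal ^ 2)
  refine ⟨S₀, 2 * (R.card * 𝒥.card), h2S₀, fun S hS => ?_⟩
  obtain ⟨a, J', hapos, ha, J₁, hJ₁, hJ₁'⟩ := exists_generator 𝒥 hne h𝒥 _ (primeProd_ne_bot S)
  have hJ'S : ∀ P : HeightOneSpectrum (𝓞 K), J' ≤ P.asIdeal → P ∈ S₀ := fun P hP =>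
    hJS₀ J₁ hJ₁ P (hP hJ₁')
  obtain ⟨E, _, _, _, ⟨D⟩⟩ := exists_cmData a hapos
  have hcard := D.two_pow_card_le (S := S) (J := J')
    (fun P hP h => Finset.disjoint_left.1 hS hP (hJ'S P h)) ha
  set Q := RelClassGroup K E ⧸ (powMonoidHom 2 : RelClassGroup K E →* RelClassGroup K E).range
  have hq : ∀ q : Q, ∃ 𝔅 : Ideal (𝓞 E), 𝔅 ≠ ⊥ ∧ QuotientGroup.mk (relCls K 𝔅) = q := fun q => by
    obtain ⟨x, rfl⟩ := QuotientGroup.mk_surjective q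
    obtain ⟨𝔅, h, rfl⟩ := relCls_surjective x
    exact ⟨𝔅, h, rfl⟩
  choose 𝔅 h𝔅 h𝔅q using hq
  choose J hJ γ hγ hrel using fun q => h𝒥 _ (D.nmIdeal_ne_bot (h𝔅 q))
  obtain ⟨τ₀⟩ := (inferInstance : Nonempty (K →+* ℝ))
  have hγ0 : ∀ q, γ q ≠ 0 := fun q h => (hγ q τ₀).ne' (by rw [h, map_zero])
  choose N hN hNmax using fun q => exists_maxLat (D.totPos_form₂ (hγ q)) (CMData.isLat_latE₂ (h𝔅 q))
    (D.latE₂_integral (hγ0 q) (hrel q))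
  have hbad : ∀ q, badPrimes (D.form₂ (γ q)) (N q) ⊆ ↑S₀ ∪ ↑S := by
    intro q P hP
    have h1 := D.mem_of_mem_badPrimes (hγ0 q) (hrel q) (hN q) hP (Ideal.absNorm_mem (J q))
    rcases P.isPrime.mem_or_mem h1 with h1 | h1
    · rcases P.isPrime.mem_or_mem h1 with h1 | h1
      · exact Or.inl (h2S₀ P h1)
      · have h3 : J' * primeProd S ≤ P.asIdeal := by
          rw [← ha, Ideal.span_singleton_le_iff_mem]
          exact h1
        rcases P.isPrime.mul_le.1 h3 with h3 | h3
        · exact Or.inl (hJ'S P h3)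
        · obtain ⟨P', hP', h4⟩ := (P.isPrime.prod_le).1 h3
          have : P' = P := HeightOneSpectrum.ext (P'.isMaximal.eq_of_le P.isPrime.ne_top h4)
          exact Or.inr (this ▸ hP')
    · exact Or.inl (hJS₀ _ (hJ q) P h1)
  let lab : Q → Set (HeightOneSpectrum (𝓞 K)) := fun q => badPrimes (D.form₂ (γ q)) (N q) \ S₀
  have := Fintype.ofFinite Q
  have hE4 : finrank K (E × E) = 4 := by rw [finrank_prod, D.finrank_eq]
  refine ⟨Finset.univ.image lab, ?_, ?_⟩
  · intro T hT
    obtain ⟨q, -, rfl⟩ := Finset.mem_image.1 hT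
    refine ⟨⟨E × E, _, _, _, inferInstance, inferInstance, D.form₂ (γ q), N q,
      D.totPos_form₂ (hγ q), hE4, D.sqDet_form₂ _, hNmax q, rfl⟩, ?_⟩
    rintro P ⟨hP, hP'⟩
    exact (hbad q hP).resolve_left hP'
  · refine hcard.trans ?_
    rw [mul_assoc, mul_assoc]
    refine Nat.mul_le_mul_left 2 ?_
    rw [Nat.card_eq_fintype_card, ← Finset.card_univ]
    refine (Finset.card_le_mul_card_image (f := fun q => (J q, lab q)) _ R.card ?_).trans
      (Nat.mul_le_mul_left _ ?_)
    · intro b hb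
      obtain ⟨q₀, -, rfl⟩ := Finset.mem_image.1 hb
      have hex : ∀ q : Q, ∃ p, (J q, lab q) = (J q₀, lab q₀) → p ∈ R ∧
          IsomForm (prodForm (D.form₂ (γ q)) (D.form₂ (γ q₀))) (diagB p.1) := by
        intro q
        by_cases h : (J q, lab q) = (J q₀, lab q₀)
        · obtain ⟨M, -, hM, hMbad⟩ := exists_maxLat_prod (D.totPos_form₂ (hγ q))
            (D.totPos_form₂ (hγ q₀)) (hNmax q) (hNmax q₀) (D.sqDet_form₂ _) (D.sqDet_form₂ _)
          have hT := (D.totPos_form₂ (hγ q)).prod (D.totPos_form₂ (hγ q₀))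
          have hle : badPrimes (prodForm (D.form₂ (γ q)) (D.form₂ (γ q₀))) M ⊆ S₀ := by
            intro P hP
            by_contra hP'
            have h2 : lab q = lab q₀ := (Prod.ext_iff.1 h).2
            have h1 : P ∈ lab q ↔ P ∈ lab q₀ := by rw [h2]
            rw [hMbad P fun h2 => hP' (h2S₀ P h2)] at hP
            refine hP ?_
            simpa only [lab, Set.mem_sdiff, hP', not_false_eq_true, and_true] using h1
          obtain ⟨p, hp, f, hf, -⟩ := exists_rep hT (by rw [finrank_prod, hE4]) hM.lat hM.int
            (hM.disc_le hT hle) hR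
          exact ⟨p, fun _ => ⟨hp, f, hf⟩⟩
        · exact ⟨(0, ⊥), fun h' => absurd h' h⟩
      choose p hp using hex
      refine Finset.card_le_card_of_injOn p (fun q hq => (hp q (Finset.mem_filter.1 hq).2).1) ?_
      intro q hq q' hq' hpq
      have h := (Finset.mem_filter.1 hq).2
      have h' := (Finset.mem_filter.1 hq').2
      have e := (hp q h).2.trans (hpq ▸ (hp q' h').2).symm
      obtain ⟨z, hz, hzγ⟩ := D.norm_of_isomForm (hγ q) (hγ q')
        (witt (D.totPos_form₂ (hγ q')) (D.totPos_form₂ (hγ q₀)) e)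
      have hJ2 : J q' = J q := (Prod.ext_iff.1 h').1.trans (Prod.ext_iff.1 h).1.symm
      have hrel' := hrel q'
      rw [hJ2] at hrel'
      obtain ⟨g, hg⟩ := D.relCls_of_norm (h𝔅 q) (h𝔅 q') (hrel q) hrel' hz hzγ
      rw [← h𝔅q q, ← h𝔅q q', hg, mul_comm, QuotientGroup.mk_mul_of_mem]
      exact ⟨g, rfl⟩
    · rw [← Finset.card_product]
      refine Finset.card_le_card fun x hx => ?_
      obtain ⟨q, hq, rfl⟩ := Finset.mem_image.1 hx
      exact Finset.mem_product.2 ⟨hJ q, Finset.mem_image_of_mem _ hq⟩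

end Label

end TotReal

namespace TotReal

open NumberField Module IsDedekindDomain
open scoped nonZeroDivisors

set_option linter.unusedSectionVars false

section Unary

variable {K : Type} [Field K] [NumberField K] [IsTotallyReal K]
variable {V : Type} [AddCommGroup V] [Module K V] [Module (𝓞 K) V] [IsScalarTower (𝓞 K) K V]
variable {B : V →ₗ[K] V →ₗ[K] K} {L : Submodule (𝓞 K) V}

/-- The unary form of a given determinant. -/
noncomputable def unaryForm (u : K) : K →ₗ[K] K →ₗ[K] K := u • LinearMap.mul K K

theorem unaryForm_apply (u x y : K) : unaryForm u x y = u * (x * y) := rfl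

theorem totPos_unaryForm {u : K} (hu : ∀ τ : K →+* ℝ, 0 < τ u) : TotPos (unaryForm u) := by
  refine ⟨fun x y => by rw [unaryForm_apply, unaryForm_apply, mul_comm x], fun x hx τ => ?_⟩
  rw [unaryForm_apply, map_mul, map_mul]
  have : τ x ≠ 0 := (map_ne_zero τ).2 hx
  exact mul_pos (hu τ) (mul_self_pos.2 this)

theorem isLat_span_singleton {x : K} (hx : x ≠ 0) : IsLat (Submodule.span (𝓞 K) {x}) := by
  refine ⟨Submodule.fg_span_singleton x, fun v => ?_⟩
  obtain ⟨⟨a, b⟩, h⟩ := IsLocalization.surj (nonZeroDivisors (𝓞 K)) (v / x)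
  refine ⟨b, nonZeroDivisors.coe_ne_zero b, Submodule.mem_span_singleton.2 ⟨a, ?_⟩⟩
  rw [Algebra.smul_def, Algebra.smul_def, ← h]
  field_simp

theorem exists_maxLat_unary {u : K} (hu : ∀ τ : K →+* ℝ, 0 < τ u) :
    ∃ M : Submodule (𝓞 K) K, MaxLat (unaryForm u) M := by
  obtain ⟨⟨a, b⟩, h⟩ := IsLocalization.surj (nonZeroDivisors (𝓞 K)) u
  have hb : ((b : 𝓞 K) : K) ≠ 0 := RingOfIntegers.coe_ne_zero_iff.2 (nonZeroDivisors.coe_ne_zero b)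
  obtain ⟨M, -, hM⟩ := exists_maxLat (totPos_unaryForm hu) (isLat_span_singleton hb)
    (integral_span (by
      rintro _ rfl _ rfl
      rw [unaryForm_apply, ← mul_assoc]
      change u * ((b : 𝓞 K) : K) = _ at h
      rw [h]
      exact (RingOfIntegers.isIntegral_coe a).mul (RingOfIntegers.isIntegral_coe _)))
  exact ⟨M, hM⟩

theorem exists_sqDet [FiniteDimensional K V] (hB : TotPos B) :
    ∃ u : K, (∀ τ : K →+* ℝ, 0 < τ u) ∧ SqDet (prodForm B (unaryForm u)) := by
  obtain ⟨g, hg⟩ := exists_frame hB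
  obtain ⟨c, hc⟩ := det_frame hB hg rfl
  refine ⟨∏ i, B (g i) (g i), fun τ => ?_,
    SqDet.of_basis (c.prod (Basis.singleton Unit K)) ⟨∏ i, B (g i) (g i), ?_⟩⟩
  · rw [map_prod]
    exact Finset.prod_pos fun i _ => hB.2 _ (hg.2 i) τ
  · have : LinearMap.toMatrix₂ (c.prod (Basis.singleton Unit K)) (c.prod (Basis.singleton Unit K))
        (prodForm B (unaryForm (∏ i, B (g i) (g i)))) =
        Matrix.fromBlocks (LinearMap.toMatrix₂ c c B) 0 0
          (Matrix.diagonal fun _ => ∏ i, B (g i) (g i)) := by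
      ext i j
      rcases i with i | i <;> rcases j with j | j <;>
        simp [LinearMap.toMatrix₂_apply, unaryForm_apply]
    rw [this, Matrix.det_fromBlocks_zero₂₁, hc]
    simp

end Unary

section Label

open scoped symmDiff

variable {K : Type} [Field K] [NumberField K] [IsTotallyReal K]
  {S₀ : Finset (HeightOneSpectrum (𝓞 K))}

theorem isLabel_empty (S₀ : Set (HeightOneSpectrum (𝓞 K))) : IsLabel K S₀ 1 ∅ := by
  have h1 : ∀ τ : K →+* ℝ, 0 < τ 1 := fun τ => by simp
  obtain ⟨M, hM⟩ := exists_maxLat_unary h1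
  have hT := totPos_unaryForm h1
  refine ⟨K, inferInstance, inferInstance, inferInstance, inferInstance, inferInstance,
    unaryForm 1, M, hT, finrank_self K,
    SqDet.of_basis (Basis.singleton Unit K) ⟨1, ?_⟩, hM, ?_⟩
  · simp [unaryForm_apply]
  · have h1M : (1 : K) ∈ M := by
      obtain ⟨_, h, hN⟩ : ∃ N, Submodule.span (𝓞 K) {(1 : K)} ≤ N ∧ MaxLat (unaryForm 1) N :=
        exists_maxLat hT (isLat_span_singleton one_ne_zero) (integral_span (by
          rintro _ rfl _ rfl
          simpa [unaryForm_apply] using isIntegral_one))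
      refine hM.mem_of_integral hT (fun y hy => ?_)
          (by simpa [unaryForm_apply] using isIntegral_one)
      have h2 : IsIntegral ℤ (y ^ 2) := by simpa [unaryForm_apply, sq] using hM.int hy y hy
      simpa [unaryForm_apply] using h2.of_pow two_pos
    rw [Set.sdiff_eq_empty]
    intro P hP
    refine absurd (fun x hx => ?_) hP
    have hx1 : IsIntegral ℤ x := by simpa [unaryForm_apply] using hx.1 1 h1M
    obtain ⟨a, rfl⟩ := integral_iff.1 hx1
    have := M.smul_mem a h1M
    rwa [Algebra.smul_def, mul_one] at this

theorem IsLabel.add (hS₀ : ∀ P : HeightOneSpectrum (𝓞 K), 2 ∈ P.asIdeal → P ∈ S₀) {k k' : ℕ}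
    {T T' : Set (HeightOneSpectrum (𝓞 K))} (h : IsLabel K S₀ k T) (h' : IsLabel K S₀ k' T') :
    IsLabel K S₀ (k + k') (T ∆ T') := by
  obtain ⟨V, _, _, _, _, _, B, L, hB, hk, hBs, hL, rfl⟩ := h
  obtain ⟨W, _, _, _, _, _, C, M, hC, hk', hCs, hM, rfl⟩ := h'
  obtain ⟨N, -, hN, hbad⟩ := exists_maxLat_prod hB hC hL hM hBs hCs
  refine ⟨V × W, inferInstance, inferInstance, inferInstance, inferInstance, inferInstance,
    prodForm B C, N, hB.prod hC, by rw [finrank_prod, hk, hk'], hBs.prod hCs, hN, ?_⟩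
  ext P
  by_cases hP : P ∈ S₀
  · simp [Set.mem_symmDiff, hP]
  · simp only [Set.mem_symmDiff, Set.mem_sdiff, Finset.mem_coe, hP, not_false_eq_true, and_true]
    rw [hbad P fun h => hP (hS₀ P h)]
    tauto

theorem IsLabel.pad (hS₀ : ∀ P : HeightOneSpectrum (𝓞 K), 2 ∈ P.asIdeal → P ∈ S₀) {k : ℕ}
    {T : Set (HeightOneSpectrum (𝓞 K))} (h : IsLabel K S₀ k T) {m : ℕ} (hkm : k ≤ m) :
    IsLabel K S₀ m T := by
  induction m, hkm using Nat.le_induction with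
  | base => exact h
  | succ m _ ih =>
    have := ih.add hS₀ (isLabel_empty (K := K) S₀)
    rwa [← Set.bot_eq_empty, symmDiff_bot] at this

theorem IsLabel.finite {k : ℕ} {T : Set (HeightOneSpectrum (𝓞 K))}
    (h : IsLabel K S₀ k T) : T.Finite := by
  obtain ⟨V, _, _, _, _, _, B, L, hB, hk, hBs, hL, rfl⟩ := h
  exact (hL.finite_bad hB).subset Set.sdiff_subset

theorem IsLabel.disjoint {k : ℕ} {T : Set (HeightOneSpectrum (𝓞 K))}
    (h : IsLabel K S₀ k T) : Disjoint T S₀ := by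
  obtain ⟨V, _, _, _, _, _, B, L, hB, hk, hBs, hL, rfl⟩ := h
  exact Set.disjoint_sdiff_left

variable (K) in
theorem exists_label_dim : ∃ (S₀ : Finset (HeightOneSpectrum (𝓞 K))) (R : ℕ),
    (∀ P : HeightOneSpectrum (𝓞 K), 2 ∈ P.asIdeal → P ∈ S₀) ∧
    ∀ k T, IsLabel K S₀ k T → IsLabel K S₀ R T := by
  classical
  obtain ⟨S₀, c, hS₀, hF⟩ := exists_labels K
  have hsep : ∀ A : Finset (Set (HeightOneSpectrum (𝓞 K))), (∀ T ∈ A, ∃ k, IsLabel K S₀ k T) →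
      (∀ T ∈ A, ∀ T' ∈ A, ∀ U U', IsLabel K S₀ 4 U → IsLabel K S₀ 4 U' → T ∆ U = T' ∆ U' →
        T = T') → A.card ≤ c := by
    intro A hA hAsep
    have hfin : (⋃ T ∈ A, T).Finite := A.finite_toSet.biUnion fun T hT =>
      let ⟨_, h⟩ := hA T hT
      h.finite
    obtain ⟨F, hF4, hFc⟩ := hF hfin.toFinset (by
      rw [← Finset.disjoint_coe, hfin.coe_toFinset]
      simp only [Set.disjoint_iUnion_left]
      exact fun T hT => let ⟨_, h⟩ := hA T hT
        h.disjoint)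
    have h1 : A.card * F.card ≤ 2 ^ hfin.toFinset.card := by
      rw [← Finset.card_product, ← Finset.card_powerset, ← Finset.card_image_of_injective
        (f := fun s : Finset (HeightOneSpectrum (𝓞 K)) => (s : Set (HeightOneSpectrum (𝓞 K)))) _
            Finset.coe_injective]
      refine Finset.card_le_card_of_injOn (fun p => p.1 ∆ p.2) ?_ ?_
      · rintro ⟨T, U⟩ hp
        obtain ⟨hT, hU⟩ := Finset.mem_product.1 hp
        have hsub : T ∆ U ⊆ hfin.toFinset := by
          refine (Set.symmDiff_subset_union).trans (Set.union_subset ?_ (hF4 U hU).2)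
          rw [hfin.coe_toFinset]
          exact Set.subset_biUnion_of_mem (u := fun T => T) hT
        have hf := hfin.toFinset.finite_toSet.subset hsub
        refine Finset.mem_coe.2 (Finset.mem_image.2 ⟨hf.toFinset, ?_, hf.coe_toFinset⟩)
        rw [Finset.mem_powerset, ← Finset.coe_subset, hf.coe_toFinset]
        exact hsub
      · rintro ⟨T, U⟩ hp ⟨T', U'⟩ hp' h
        obtain ⟨hT, hU⟩ := Finset.mem_product.1 hp
        obtain ⟨hT', hU'⟩ := Finset.mem_product.1 hp'
        have e : T = T' := hAsep T hT T' hT' U U' (hF4 U hU).1 (hF4 U' hU').1 h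
        subst e
        exact Prod.ext rfl (symmDiff_right_injective T h)
    refine Nat.le_of_mul_le_mul_right (h1.trans hFc) (Nat.pos_of_ne_zero fun h => ?_)
    rw [h, mul_zero] at hFc
    exact absurd hFc (not_le.2 (by positivity))
  obtain ⟨U₀, hU₀⟩ : ∃ U, IsLabel K S₀ 4 U := by
    obtain ⟨F, hF4, hFc⟩ := hF ∅ (Finset.disjoint_empty_left _)
    obtain ⟨U, hU⟩ : F.Nonempty := by
      rw [Finset.nonempty_iff_ne_empty]
      rintro rfl
      simp at hFc
    exact ⟨U, (hF4 U hU).1⟩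
  obtain ⟨A, hA, hcov⟩ : ∃ A : Finset (Set (HeightOneSpectrum (𝓞 K))),
      (∀ T ∈ A, ∃ k, IsLabel K S₀ k T) ∧ ∀ k T, IsLabel K S₀ k T → ∃ T' ∈ A, ∃ U U',
        IsLabel K S₀ 4 U ∧ IsLabel K S₀ 4 U' ∧ T ∆ U = T' ∆ U' := by
    by_contra! hno
    have key : ∀ n : ℕ, ∃ A : Finset (Set (HeightOneSpectrum (𝓞 K))), A.card = n ∧
        (∀ T ∈ A, ∃ k, IsLabel K S₀ k T) ∧ (∀ T ∈ A, ∀ T' ∈ A, ∀ U U', IsLabel K S₀ 4 U →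
          IsLabel K S₀ 4 U' → T ∆ U = T' ∆ U' → T = T') := by
      intro n
      induction n with
      | zero => exact ⟨∅, by simp⟩
      | succ n ih =>
        obtain ⟨A, hn, hA, hAsep⟩ := ih
        obtain ⟨k, T, hT, hTno⟩ := hno A hA
        have hTA : T ∉ A := fun h => hTno T h U₀ U₀ hU₀ hU₀ rfl
        refine ⟨insert T A, by rw [Finset.card_insert_of_notMem hTA, hn], ?_, ?_⟩
        · intro T' hT'
          rcases Finset.mem_insert.1 hT' with rfl | hT'
          exacts [⟨k, hT⟩, hA T' hT']
        · intro T₁ h₁ T₂ h₂ U U' hU hU' h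
          rcases Finset.mem_insert.1 h₁ with rfl | h₁' <;>
            rcases Finset.mem_insert.1 h₂ with rfl | h₂'
          · rfl
          · exact absurd h (hTno T₂ h₂' U U' hU hU')
          · exact absurd h.symm (hTno T₁ h₁' U' U hU' hU)
          · exact hAsep T₁ h₁' T₂ h₂' U U' hU hU' h
    obtain ⟨A, hn, hA, hAsep⟩ := key (c + 1)
    exact absurd (hsep A hA hAsep) (by omega)
  choose! dimA hdimA using hA
  refine ⟨S₀, A.sup dimA + 4 + 4, hS₀, fun k T hT => ?_⟩
  obtain ⟨T', hT', U, U', hU, hU', h⟩ := hcov k T hT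
  have h1 := ((hdimA T' hT').pad hS₀ (Finset.le_sup (f := dimA) hT')).add hS₀ hU' |>.add hS₀ hU
  rwa [← h, symmDiff_symmDiff_cancel_right] at h1

variable (K) in
theorem exists_embed : ∃ r X : ℕ, ∀ (n : ℕ) (S : Finset ((Fin (n + r) → K) ×
    Submodule (𝓞 K) (Fin (n + r) → K))), (∀ q ∈ latPairs K (n + r) X, ∃ p ∈ S, Isom q p) →
    ∀ (V : Type) [AddCommGroup V] [Module K V] [Module (𝓞 K) V] [IsScalarTower (𝓞 K) K V]
      [FiniteDimensional K V] (B : V →ₗ[K] V →ₗ[K] K) (L : Submodule (𝓞 K) V), finrank K V = n →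
      TotPos B → IsLat L → L ≤ dualLat B L → ∃ p ∈ S, ∃ f : V →ₗ[K] (Fin (n + r) → K),
        (∀ x y, diagB p.1 (f x) (f y) = B x y) ∧ ∀ x ∈ L, f x ∈ p.2 := by
  obtain ⟨S₀, R, hS₀, hR⟩ := exists_label_dim K
  refine ⟨1 + R, ∏ P ∈ S₀, Ideal.absNorm P.asIdeal ^ 2, ?_⟩
  intro n S hS V _ _ _ _ _ B L hn hB hL hi
  obtain ⟨u, hu, hsq⟩ := exists_sqDet hB
  obtain ⟨M, hM⟩ := exists_maxLat_unary hu
  have hBu := hB.prod (totPos_unaryForm hu)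
  obtain ⟨N, hLN, hN⟩ := exists_maxLat hBu (hL.prod hM.lat) (by
    rintro ⟨x, z⟩ ⟨hx, hz⟩ ⟨y, w⟩ ⟨hy, hw⟩
    exact (hi hx y hy).add (hM.int hz w hw))
  obtain ⟨W, _, _, _, _, _, C, N', hC, hk, hCs, hN', hlab⟩ := hR _ _
    ⟨V × K, inferInstance, inferInstance, inferInstance, inferInstance, inferInstance,
      prodForm B (unaryForm u), N, hBu, rfl, hsq, hN, rfl⟩
  obtain ⟨Λ, hΛN, hΛ, hbad⟩ := exists_maxLat_prod hBu hC hN hN' hsq hCs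
  have hT := hBu.prod hC
  have hsub : badPrimes (prodForm (prodForm B (unaryForm u)) C) Λ ⊆ S₀ := by
    intro P hP
    by_contra hP'
    rw [hbad P fun h => hP' (hS₀ P h)] at hP
    refine hP ?_
    have h1 := Set.ext_iff.1 hlab P
    simpa only [Set.mem_sdiff, hP', not_false_eq_true, and_true, iff_comm] using h1
  obtain ⟨p, hp, f, hf, hfΛ⟩ := exists_rep hT
    (by rw [finrank_prod, finrank_prod, hk, hn, finrank_self, add_assoc]) hΛ.lat hΛ.int
    (hΛ.disc_le hT hsub) hS
  refine ⟨p, hp, f.toLinearMap ∘ₗ LinearMap.inl K (V × K) W ∘ₗ LinearMap.inl K V K,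
    fun x y => ?_, fun x hx => ?_⟩
  · simp only [LinearMap.comp_apply, LinearEquiv.coe_coe, hf, LinearMap.inl_apply, prodForm_apply]
    simp
  · exact (hfΛ _).2 (hΛN ⟨hLN ⟨hx, zero_mem M⟩, zero_mem N'⟩)

end Label

end TotReal

namespace TotReal

open NumberField Module IsDedekindDomain
open scoped nonZeroDivisors

set_option linter.unusedSectionVars false

theorem rpow_le_exp {d k A κ a b : ℝ} (hd : 0 < d) (hk : 1 ≤ k) (hA : 0 ≤ A)
    (ha₁ : d * k / 2 ≤ a) (ha₂ : a ≤ d * (k + A) / 2) (hb : 0 < b)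
    (hlog : Real.log b ≤ Real.log k + κ + A / k) :
    b ^ a ≤ Real.exp (d * k / 2 * (Real.log k + κ) +
      d * A / 2 * (1 + |κ| + A) * (1 + Real.log k)) := by
  have hk0 : 0 < k := by linarith
  have ha : 0 < a := by
    have : 0 < d * k / 2 := by positivity
    linarith
  have hl : 0 ≤ Real.log k := Real.log_nonneg hk
  rw [Real.rpow_def_of_pos hb, Real.exp_le_exp]
  have h1 : Real.log b * a ≤ (Real.log k + κ + A / k) * a := mul_le_mul_of_nonneg_right hlog ha.le
  have h2 : (Real.log k + κ + A / k) * (a - d * k / 2) ≤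
      (Real.log k + |κ| + A) * (d * A / 2) := by
    have e1 : Real.log k + κ + A / k ≤ Real.log k + |κ| + A := by
      have := le_abs_self κ
      have := div_le_self hA hk
      linarith
    refine (mul_le_mul_of_nonneg_right e1 (by linarith)).trans
      (mul_le_mul_of_nonneg_left (by linarith) (by positivity))
  have h3 : A / k * (d * k / 2) = d * A / 2 := by field_simp
  have h4 : 0 ≤ d * A / 2 * (|κ| + A) * Real.log k := by positivity
  nlinarith [h1, h2, h3, h4]

theorem log_succ_le {k : ℝ} (hk : 0 < k) : Real.log (k + 1) ≤ Real.log k + 1 / k := by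
  have h : k + 1 = k * (1 + 1 / k) := by field_simp
  rw [h, Real.log_mul hk.ne' (by positivity)]
  have := Real.log_le_sub_one_of_pos (show 0 < 1 + 1 / k by positivity)
  linarith

theorem bulk_base_log {d k Δ A a : ℝ} (hd : 1 ≤ d) (hk : 1 ≤ k) (hΔ : 0 < Δ) (hA : 0 ≤ A)
    (ha₀ : 0 < a) (ha : a ≤ d * (k + A) / 2) :
    0 < a / (Real.exp 1 * (Real.pi * (k / (k + 1)) * d * ((4 : ℝ) ^ (-(1 / k)) / Δ) ^ (1 / d))) ∧
    Real.log (a / (Real.exp 1 *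
      (Real.pi * (k / (k + 1)) * d * ((4 : ℝ) ^ (-(1 / k)) / Δ) ^ (1 / d)))) ≤
      Real.log k + (Real.log Δ / d - Real.log (2 * Real.pi) - 1) + (A + 3) / k := by
  have hpi := Real.pi_pos
  have hk0 : 0 < k := by linarith
  have hd0 : 0 < d := by linarith
  refine ⟨by positivity, ?_⟩
  have h4 : (0 : ℝ) < 4 ^ (-(1 / k)) := by positivity
  rw [Real.log_div ha₀.ne' (by positivity), Real.log_mul (by positivity) (by positivity),
    Real.log_exp, Real.log_mul (by positivity) (by positivity),
    Real.log_mul (by positivity) (by positivity), Real.log_mul (by positivity) (by positivity),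
    Real.log_div hk0.ne' (by positivity), Real.log_rpow (by positivity),
    Real.log_div h4.ne' hΔ.ne', Real.log_rpow (by norm_num), Real.log_mul (by norm_num) hpi.ne']
  have e1 : Real.log a ≤ Real.log d + Real.log k + A / k - Real.log 2 := by
    have : a ≤ d * k * (1 + A / k) / 2 := ha.trans_eq (by field_simp)
    refine (Real.log_le_log ha₀ this).trans ?_
    rw [Real.log_div (by positivity) two_ne_zero, Real.log_mul (by positivity) (by positivity),
      Real.log_mul hd0.ne' hk0.ne']
    have := Real.log_le_sub_one_of_pos (show 0 < 1 + A / k by positivity)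
    linarith
  have e2 := log_succ_le hk0
  have e3 : 1 / d * (1 / k * Real.log 4) ≤ 2 / k := by
    have h2 : Real.log 4 ≤ 2 := by
      have : (4 : ℝ) = 2 ^ 2 := by norm_num
      rw [this, Real.log_pow]
      have := Real.log_two_lt_d9
      push_cast
      linarith
    have h0 : 0 ≤ Real.log 4 := Real.log_nonneg (by norm_num)
    have : 1 / d ≤ 1 := by rw [div_le_one hd0]; exact hd
    calc 1 / d * (1 / k * Real.log 4) ≤ 1 * (1 / k * 2) := by gcongr
      _ = 2 / k := by ring
  have e4 : (A + 3) / k = A / k + 1 / k + 2 / k := by ring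
  rw [e4]
  have e5 : 1 / d * (-(1 / k) * Real.log 4 - Real.log Δ) =
    -(1 / d * (1 / k * Real.log 4)) - Real.log Δ / d := by ring
  rw [e5]
  linarith

theorem stepConst_le (d : ℕ) (hd : 0 < d) {Δ : ℝ} (hΔ : 0 < Δ) : ∃ C : ℝ, 0 ≤ C ∧ ∀ k : ℕ, 0 < k →
    stepConst d Δ k ≤ Real.exp (d * k / 2 *
      (Real.log k + (Real.log Δ / d - Real.log (2 * Real.pi) - 1)) + C * (1 + Real.log k)) := by
  have hpi := Real.pi_pos
  have hd1 : (1 : ℝ) ≤ d := by exact_mod_cast hd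
  have hd0 : (0 : ℝ) < d := by linarith
  set κ := Real.log Δ / d - Real.log (2 * Real.pi) - 1
  set τ₁ := Real.pi * (4 * Δ) ^ (-(1 / (d : ℝ))) with hτ₁
  have hτ : 0 < τ₁ := by positivity
  set A : ℝ := 8 * d + 4 with hA
  have hA0 : 0 ≤ A := by positivity
  set C₁ := d * A / 2 * (1 + |κ| + A)
  set M : ℝ := (2 * d ^ 2).factorial * (τ₁ ^ (2 * d ^ 2))⁻¹ * Real.exp τ₁ * 2 ^ (2 * d) * 2
  have hM : 0 < M := by positivity
  refine ⟨C₁ + |Real.log M| + 4 * d ^ 2, by positivity, fun k hk => ?_⟩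
  have hk1 : (1 : ℝ) ≤ k := by exact_mod_cast hk
  have hk0 : (0 : ℝ) < k := by linarith
  have hl : 0 ≤ Real.log k := Real.log_nonneg hk1
  set Y := Real.exp (d * k / 2 * (Real.log k + κ) + C₁ * (1 + Real.log k)) with hY
  have hterm : ∀ a : ℝ, d * k / 2 ≤ a → a ≤ d * (k + (8 * d + 1)) / 2 → (a / (Real.exp 1 *
      (Real.pi * (k / (k + 1)) * d * ((4 : ℝ) ^ (-(1 / (k : ℝ))) / Δ) ^ (1 / (d : ℝ))))) ^ a ≤
      Y := by
    intro a h1 h2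
    have ha : 0 < a := lt_of_lt_of_le (by positivity) h1
    obtain ⟨h3, h4⟩ := bulk_base_log hd1 hk1 hΔ (by positivity) ha h2
    refine rpow_le_exp hd0 hk1 hA0 h1 (h2.trans ?_) h3 (h4.trans_eq ?_)
    · gcongr
      linarith
    · rw [show 8 * (d : ℝ) + 1 + 3 = A by rw [hA]; ring]
  have hbulk : bulkConst d Δ k ≤ 2 * Y := by
    rw [two_mul]
    refine add_le_add (hterm _ ?_ ?_) (hterm _ ?_ ?_)
    · rw [le_div_iff₀ hk0]
      nlinarith [mul_pos hd0 hk0, mul_pos hd0 hd0]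
    · rw [div_le_iff₀ hk0]
      nlinarith [mul_pos hd0 hk0, mul_pos hd0 hd0,
          mul_le_mul_of_nonneg_left hk1 (mul_pos hd0 hd0).le]
    · nlinarith
    · nlinarith [mul_pos hd0 hd0]
  have hstep : stepConst d Δ k ≤ M * (k + 1) ^ (2 * d ^ 2) * Y := by
    unfold stepConst
    have e1 : Real.exp (τ₁ / (k + 1)) ≤ Real.exp τ₁ := by
      rw [Real.exp_le_exp]
      exact div_le_self hτ.le (by linarith)
    have e2 : ((τ₁ / (k + 1)) ^ (2 * d ^ 2))⁻¹ = (τ₁ ^ (2 * d ^ 2))⁻¹ * (k + 1) ^ (2 * d ^ 2) := by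
      rw [div_pow]
      field_simp
    calc _ ≤ ((2 * d ^ 2).factorial * ((τ₁ ^ (2 * d ^ 2))⁻¹ * (k + 1) ^ (2 * d ^ 2)) *
          Real.exp τ₁) * (2 ^ (2 * d) * (2 * Y)) := by
          dsimp only
          rw [e2]
          have := bulkConst_nonneg d k hΔ.le
          gcongr
      _ = _ := by simp only [M]; ring
  refine hstep.trans ?_
  have e3 : M ≤ Real.exp (|Real.log M| * (1 + Real.log k)) := by
    rw [← Real.log_le_iff_le_exp hM]
    have := le_abs_self (Real.log M)
    have := mul_nonneg (abs_nonneg (Real.log M)) hl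
    linarith
  have e4 : ((k : ℝ) + 1) ^ (2 * d ^ 2) ≤ Real.exp (4 * d ^ 2 * (1 + Real.log k)) := by
    rw [← Real.log_le_iff_le_exp (by positivity), Real.log_pow]
    have h1 := log_succ_le hk0
    have h2 : 1 / (k : ℝ) ≤ 1 := by rw [div_le_one hk0]; exact hk1
    push_cast
    have : (0 : ℝ) ≤ (d : ℝ) ^ 2 := by positivity
    nlinarith [mul_nonneg this hl]
  calc M * (k + 1) ^ (2 * d ^ 2) * Y ≤ Real.exp (|Real.log M| * (1 + Real.log k)) *
        Real.exp (4 * d ^ 2 * (1 + Real.log k)) * Y := by gcongr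
    _ = _ := by rw [hY, ← Real.exp_add, ← Real.exp_add]; congr 1; ring

theorem sum_mul_log_le (m : ℕ) : ∑ j ∈ Finset.range m, ((j + 1 : ℕ) : ℝ) * Real.log (j + 1 : ℕ) ≤
    (m : ℝ) ^ 2 / 2 * Real.log m - (m : ℝ) ^ 2 / 4 + m * Real.log m + 1 := by
  induction m with
  | zero => simp
  | succ m ih =>
    rw [Finset.sum_range_succ]
    rcases Nat.eq_zero_or_pos m with rfl | hm
    · norm_num
    · have hm0 : (0 : ℝ) < m := by exact_mod_cast hm
      have hl : 0 ≤ Real.log m := Real.log_nonneg (by exact_mod_cast hm)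
      have h1 : Real.log m + 1 / (m + 1) ≤ Real.log (m + 1) := by
        have := Real.one_sub_inv_le_log_of_pos (show (0 : ℝ) < (m + 1) / m by positivity)
        rw [Real.log_div (by positivity) hm0.ne', inv_div] at this
        have e : (1 : ℝ) - m / (m + 1) = 1 / (m + 1) := by field_simp; ring
        linarith
      have h2 := mul_le_mul_of_nonneg_left h1 (show (0 : ℝ) ≤ (m + 1) ^ 2 / 2 by positivity)
      have h3 : ((m : ℝ) + 1) ^ 2 / 2 * (Real.log m + 1 / (m + 1)) =
        (m + 1) ^ 2 / 2 * Real.log m + (m + 1) / 2 := by field_simp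
      push_cast at ih ⊢
      nlinarith

theorem exists_classBound_le (K : Type) [Field K] [NumberField K] [IsTotallyReal K] (X : ℕ) :
    ∃ C : ℝ, 0 ≤ C ∧ ∀ m : ℕ, 0 < m → (m : ℝ) * classBound K m X ≤
      Real.exp (finrank ℚ K / 4 * (m : ℝ) ^ 2 * Real.log m + (m : ℝ) ^ 2 *
        ((2 * Real.log |(discr K : ℝ)| - 2 * finrank ℚ K * Real.log (2 * Real.pi) -
          3 * finrank ℚ K) / 8) + C * (m * (1 + Real.log m))) := by
  set d := finrank ℚ K with hd
  have hd0 : 0 < d := finrank_pos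
  have hd1 : (1 : ℝ) ≤ d := by exact_mod_cast hd0
  have hΔ : 0 < |(discr K : ℝ)| := abs_discr_pos
  obtain ⟨C, hC, hstep⟩ := stepConst_le d hd0 hΔ
  set Δ := |(discr K : ℝ)|
  set κ := Real.log Δ / d - Real.log (2 * Real.pi) - 1 with hκ
  set s := sumConst K
  have hs : 1 ≤ s := one_le_sumConst
  have hls : 0 ≤ Real.log s := Real.log_nonneg hs
  set x := Real.log (X + 1)
  have hx : 0 ≤ x := Real.log_nonneg (by linarith [(Nat.cast_nonneg X : (0 : ℝ) ≤ X)])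
  refine ⟨1 + 2 * d * (Real.log (2 * d) + 1) + (1 / 2 + 2 * d) * x + (C + Real.log s) + d +
    d * |κ|, by
      have : 0 ≤ Real.log (2 * d : ℝ) := Real.log_nonneg (by linarith)
      positivity, fun m hm => ?_⟩
  have hm1 : (1 : ℝ) ≤ m := by exact_mod_cast hm
  have hm0 : (0 : ℝ) < m := by linarith
  have hl : 0 ≤ Real.log m := Real.log_nonneg hm1
  have h1 : (m : ℝ) ≤ Real.exp m := by linarith [Real.add_one_le_exp (m : ℝ)]
  have h2 : ((2 * (d * m)).factorial : ℝ) ≤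
      Real.exp (2 * (d * m) * (Real.log (2 * d) + Real.log m)) := by
    have : ((2 * (d * m)).factorial : ℝ) ≤ ((2 * (d * m) : ℕ) : ℝ) ^ (2 * (d * m)) := by
      exact_mod_cast Nat.factorial_le_pow _
    refine this.trans ?_
    rw [← Real.log_le_iff_le_exp (by positivity), Real.log_pow, ← Real.log_mul (by positivity)
      hm0.ne']
    push_cast
    rw [mul_assoc 2 (d : ℝ) (m : ℝ)]
  have h3 : (X : ℝ) ^ (m / 2 + 2 * d : ℝ) ≤ Real.exp ((1 / 2 + 2 * d) * x * m) := by
    have hX : (0 : ℝ) < X + 1 := by positivity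
    calc (X : ℝ) ^ (m / 2 + 2 * d : ℝ) ≤ (X + 1 : ℝ) ^ (m / 2 + 2 * d : ℝ) :=
          Real.rpow_le_rpow (by positivity) (by linarith) (by positivity)
      _ = Real.exp (x * (m / 2 + 2 * d)) := Real.rpow_def_of_pos hX _
      _ ≤ _ := by
          rw [Real.exp_le_exp]
          nlinarith [mul_nonneg hx (sub_nonneg.2 hm1), mul_nonneg (mul_nonneg hx (sub_nonneg.2 hm1))
            (zero_le_one.trans hd1)]
  have h4 : ∏ j ∈ Finset.range m, (stepConst d Δ (j + 1) * s) ≤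
      Real.exp (d / 2 * ((m : ℝ) ^ 2 / 2 * Real.log m - (m : ℝ) ^ 2 / 4 + m * Real.log m + 1) +
        d / 2 * κ * (m * (m + 1) / 2) + (C + Real.log s) * (m * (1 + Real.log m))) := by
    calc _ ≤ ∏ j ∈ Finset.range m, Real.exp (d / 2 * (((j + 1 : ℕ) : ℝ) * Real.log (j + 1 : ℕ)) +
          d / 2 * κ * (j + 1 : ℕ) + (C + Real.log s) * (1 + Real.log m)) := by
          refine Finset.prod_le_prod (fun j _ => mul_nonneg (stepConst_nonneg _ _ hΔ.le)
            (by linarith)) fun j hj => ?_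
          have hjm : Real.log (j + 1 : ℕ) ≤ Real.log m := Real.log_le_log (by positivity)
            (by exact_mod_cast Finset.mem_range.1 hj)
          refine (mul_le_mul (hstep (j + 1) j.succ_pos) (Real.exp_log (by linarith)).ge
            (by linarith) (Real.exp_pos _).le).trans ?_
          rw [← Real.exp_add, Real.exp_le_exp]
          have := mul_le_mul_of_nonneg_left hjm hC
          have := mul_nonneg hls hl
          linarith
      _ = _ := by
          rw [← Real.exp_sum, Finset.sum_add_distrib, Finset.sum_add_distrib, ← Finset.mul_sum,
            ← Finset.mul_sum]
      _ ≤ _ := by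
          rw [Real.exp_le_exp]
          have e1 : ∑ j ∈ Finset.range m, ((j + 1 : ℕ) : ℝ) = m * (m + 1) / 2 := by
            clear * -
            induction m with
            | zero => simp
            | succ m ih => rw [Finset.sum_range_succ, ih]; push_cast; ring
          rw [e1, Finset.sum_const, Finset.card_range, nsmul_eq_mul]
          have := mul_le_mul_of_nonneg_left (sum_mul_log_le m) (show (0 : ℝ) ≤ d / 2 by positivity)
          linarith
  have h4' : 0 ≤ ∏ j ∈ Finset.range m, (stepConst d Δ (j + 1) * s) :=
    Finset.prod_nonneg fun j _ => mul_nonneg (stepConst_nonneg _ _ hΔ.le) (by linarith)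
  calc (m : ℝ) * classBound K m X ≤ Real.exp m * (Real.exp _ * (Real.exp _ * Real.exp _)) :=
        mul_le_mul h1 (mul_le_mul h2 (mul_le_mul h3 h4 h4' (Real.exp_pos _).le)
          (mul_nonneg (by positivity) h4') (Real.exp_pos _).le)
          (mul_nonneg (by positivity) (mul_nonneg (by positivity) h4')) (Real.exp_pos _).le
    _ ≤ _ := by
        rw [← Real.exp_add, ← Real.exp_add, ← Real.exp_add, Real.exp_le_exp]
        have hκ' : d * κ = Real.log Δ - d * Real.log (2 * Real.pi) - d := by
          rw [hκ]; field_simp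
        have hk := le_abs_self κ
        have hld : 0 ≤ Real.log (2 * d : ℝ) := Real.log_nonneg (by linarith)
        have p1 := mul_nonneg hm0.le hl
        have p2 := mul_nonneg (mul_nonneg hx hm0.le) hl
        have p3 := mul_nonneg (mul_nonneg (mul_nonneg hx hm0.le) hl) (zero_le_one.trans hd1)
        have p4 := mul_nonneg p1 (zero_le_one.trans hd1)
        have p5 := mul_nonneg p4 hld
        have p6 := mul_nonneg p4 (abs_nonneg κ)
        have p7 := mul_le_mul_of_nonneg_left hk (mul_nonneg hm0.le (zero_le_one.trans hd1))
        have p8 := mul_nonneg (mul_nonneg hm0.le (zero_le_one.trans hd1)) (abs_nonneg κ)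
        have p9 := mul_le_mul_of_nonneg_left hm1 (zero_le_one.trans hd1)
        have p10 : (m : ℝ) ^ 2 * (d * κ) =
          (m : ℝ) ^ 2 * (Real.log Δ - d * Real.log (2 * Real.pi) - d) := by rw [hκ']
        linarith

end TotReal

namespace TotReal

open NumberField Module IsDedekindDomain
open scoped nonZeroDivisors TensorProduct

set_option linter.unusedSectionVars false

section Shift

theorem shift_le {α C : ℝ} (β : ℝ) (hα : 0 ≤ α) (hC : 0 ≤ C) (r : ℕ) : ∃ C' : ℝ, 0 < C' ∧
    ∀ n : ℕ, 3 ≤ n → α * ((n + r : ℕ) : ℝ) ^ 2 * Real.log ((n + r : ℕ) : ℝ) +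
      ((n + r : ℕ) : ℝ) ^ 2 * β + C * (((n + r : ℕ) : ℝ) * (1 + Real.log ((n + r : ℕ) : ℝ))) ≤
      α * (n : ℝ) ^ 2 * Real.log n + (n : ℝ) ^ 2 * β + C' * n * Real.log n := by
  set R : ℝ := (r : ℝ) with hR
  have hR0 : 0 ≤ R := Nat.cast_nonneg r
  refine ⟨α * (3 * R + 3 * R ^ 2 + R ^ 3) + |β| * (2 * R + R ^ 2) + C * ((1 + R) * (2 + R)) + 1,
    by positivity, fun n hn => ?_⟩
  have hn3 : (3 : ℝ) ≤ n := by exact_mod_cast hn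
  have hn1 : (1 : ℝ) ≤ n := by linarith
  have hn0 : (0 : ℝ) < n := by linarith
  have hl : 1 ≤ Real.log n := by
    rw [Real.le_log_iff_exp_le hn0]
    linarith [Real.exp_one_lt_d9]
  set l := Real.log n with hl'
  set x : ℝ := (n : ℝ) with hx
  push_cast
  have hlog : Real.log (x + R) ≤ l + R / x := by
    have h1 : x + R = x * (1 + R / x) := by field_simp
    have h2 : 0 ≤ R / x := by positivity
    rw [h1, Real.log_mul hn0.ne' (by positivity)]
    have := Real.log_le_sub_one_of_pos (show 0 < 1 + R / x by positivity)
    linarith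
  have hxl : x ≤ x * l := le_mul_of_one_le_right hn0.le hl
  have h1xl : 1 ≤ x * l := hn1.trans hxl
  have hlxl : l ≤ x * l := le_mul_of_one_le_left (by linarith) hn1
  have e1 : α * (x + R) ^ 2 * Real.log (x + R) ≤
      α * x ^ 2 * l + α * (3 * R + 3 * R ^ 2 + R ^ 3) * (x * l) := by
    have hdiv : R / x ≤ R := div_le_self hR0 hn1
    have k1 : (x + R) ^ 2 * (l + R / x) =
        x ^ 2 * l + (x * R + 2 * x * R * l + 2 * R ^ 2 + R ^ 2 * l + R ^ 2 * (R / x)) := by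
      field_simp; ring
    have k2 : (x + R) ^ 2 * Real.log (x + R) ≤
        x ^ 2 * l + (3 * R + 3 * R ^ 2 + R ^ 3) * (x * l) := by
      refine (mul_le_mul_of_nonneg_left hlog (sq_nonneg _)).trans ?_
      rw [k1]
      have q1 := mul_le_mul_of_nonneg_left hxl hR0
      have q2 := mul_le_mul_of_nonneg_left h1xl (sq_nonneg R)
      have q3 := mul_le_mul_of_nonneg_left hlxl (sq_nonneg R)
      have q4 := mul_le_mul_of_nonneg_left hdiv (sq_nonneg R)
      have q5 := mul_le_mul_of_nonneg_left h1xl (pow_nonneg hR0 3)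
      nlinarith
    have := mul_le_mul_of_nonneg_left k2 hα
    linarith
  have e2 : (x + R) ^ 2 * β ≤ x ^ 2 * β + |β| * (2 * R + R ^ 2) * (x * l) := by
    have k : (2 * x * R + R ^ 2) * β ≤ (2 * x * R + R ^ 2) * |β| :=
      mul_le_mul_of_nonneg_left (le_abs_self β) (by positivity)
    have q1 := mul_le_mul_of_nonneg_left hxl hR0
    have q2 := mul_le_mul_of_nonneg_left h1xl (sq_nonneg R)
    have q3 : (2 * x * R + R ^ 2) * |β| ≤ ((2 * R + R ^ 2) * (x * l)) * |β| :=
      mul_le_mul_of_nonneg_right (by linarith) (abs_nonneg β)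
    linarith
  have e3 : C * ((x + R) * (1 + Real.log (x + R))) ≤ C * ((1 + R) * (2 + R)) * (x * l) := by
    have hdiv : R / x ≤ R := div_le_self hR0 hn1
    have q1 : x + R ≤ (1 + R) * x := by nlinarith
    have q2 : 1 + Real.log (x + R) ≤ (2 + R) * l := by nlinarith
    have q3 : (x + R) * (1 + Real.log (x + R)) ≤ ((1 + R) * x) * ((2 + R) * l) :=
      mul_le_mul q1 q2 (by
        have := Real.log_nonneg (show 1 ≤ x + R by linarith)
        linarith) (by positivity)
    have := mul_le_mul_of_nonneg_left q3 hC
    linarith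
  linarith

theorem main_term_nonneg {α : ℝ} (hα : 0 < α) (β : ℝ) {n : ℕ} (hn : 1 ≤ n)
    (h : Real.exp (|β| / α) ≤ n) : 0 ≤ α * (n : ℝ) ^ 2 * Real.log n + (n : ℝ) ^ 2 * β := by
  have hn0 : (0 : ℝ) < n := by exact_mod_cast hn
  have h1 : |β| / α ≤ Real.log n := (Real.le_log_iff_exp_le hn0).2 h
  rw [div_le_iff₀ hα] at h1
  have h2 := neg_abs_le β
  have h3 : 0 ≤ (n : ℝ) ^ 2 * (Real.log n * α + β) := mul_nonneg (sq_nonneg _) (by linarith)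
  linarith

end Shift

section Lattices

variable {K : Type} [Field K] [NumberField K] [IsTotallyReal K]

theorem exists_smul_eq_tmul {M : Type} [AddCommGroup M] [Module (𝓞 K) M] (v : K ⊗[𝓞 K] M) :
    ∃ a : 𝓞 K, a ≠ 0 ∧ ∃ x : M, a • v = (1 : K) ⊗ₜ[𝓞 K] x := by
  induction v using TensorProduct.induction_on with
  | zero => exact ⟨1, one_ne_zero, 0, by simp⟩
  | tmul k x =>
    obtain ⟨⟨b, a⟩, h⟩ := IsLocalization.surj (nonZeroDivisors (𝓞 K)) k
    refine ⟨a, nonZeroDivisors.coe_ne_zero a, b • x, ?_⟩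
    rw [← TensorProduct.smul_tmul, TensorProduct.smul_tmul', Algebra.smul_def, Algebra.smul_def,
      mul_one, ← h, mul_comm]
  | add v w hv hw =>
    obtain ⟨a, ha, x, hx⟩ := hv
    obtain ⟨b, hb, y, hy⟩ := hw
    refine ⟨a * b, mul_ne_zero ha hb, b • x + a • y, ?_⟩
    rw [TensorProduct.tmul_add, TensorProduct.tmul_smul, TensorProduct.tmul_smul, ← hx, ← hy,
      smul_add, smul_smul, smul_smul, mul_comm b a]

variable {V : Type} [AddCommGroup V] [Module K V] [Module (𝓞 K) V] [IsScalarTower (𝓞 K) K V]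

theorem finrank_baseChange_le [FiniteDimensional K V] (L : Submodule (𝓞 K) V) :
    finrank K (K ⊗[𝓞 K] L) ≤ finrank K V := by
  refine LinearMap.finrank_le_finrank_of_injective (f := LinearMap.liftBaseChange K L.subtype) ?_
  rw [injective_iff_map_eq_zero]
  intro v hv
  obtain ⟨a, ha, x, hx⟩ := exists_smul_eq_tmul v
  have h1 : (x : V) = 0 := by
    have : LinearMap.liftBaseChange K L.subtype (a • v) = 0 := by
      rw [← algebraMap_smul K a v, map_smul, hv, smul_zero]
    rwa [hx, LinearMap.liftBaseChange_tmul, one_smul] at this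
  have h2 : x = 0 := Subtype.ext h1
  rw [h2, TensorProduct.tmul_zero, ← algebraMap_smul K a v] at hx
  exact (smul_eq_zero.1 hx).resolve_left (by simpa using ha)

/-- The bundled lattice given by an integral lattice in a totally positive space. -/
noncomputable def ofLat (B : V →ₗ[K] V →ₗ[K] K) (L : Submodule (𝓞 K) V) (hB : TotPos B)
    (hL : L.FG) (hi : L ≤ dualLat B L) : OKLattice K where
  carrier := L
  finite := Module.Finite.iff_fg.2 hL
  torsionFree := ⟨fun {a x} h => by
    have h' : (a : K) • (x : V) = 0 := by
      have := congrArg Subtype.val h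
      rwa [Submodule.coe_smul, ← algebraMap_smul K a (x : V)] at this
    rcases smul_eq_zero.1 h' with h | h
    · exact Or.inl (by simpa using h)
    · exact Or.inr (Subtype.ext h)⟩
  form := LinearMap.mk₂ (𝓞 K) (fun x y => ⟨B x y, hi x.2 y y.2⟩)
    (fun x y z => RingOfIntegers.ext (LinearMap.map_add₂ B x y z))
    (fun a x y => RingOfIntegers.ext (form_smul_left B a x y))
    (fun x y z => RingOfIntegers.ext (map_add (B (x : V)) (y : V) (z : V)))
    (fun a x y => RingOfIntegers.ext (form_smul_right B a x y))
  symm x y := RingOfIntegers.ext (hB.1 x y)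
  posDef v hv σ := hB.2 v (fun h => hv (Subtype.ext h)) σ

theorem ofLat_form (B : V →ₗ[K] V →ₗ[K] K) (L : Submodule (𝓞 K) V) (hB : TotPos B)
    (hL : L.FG) (hi : L ≤ dualLat B L) (x y : L) :
    ((ofLat B L hB hL hi).form x y : K) = B x y := rfl

theorem rank_ofLat_le [FiniteDimensional K V] (B : V →ₗ[K] V →ₗ[K] K) (L : Submodule (𝓞 K) V)
    (hB : TotPos B) (hL : L.FG) (hi : L ≤ dualLat B L) :
    (ofLat B L hB hL hi).rank ≤ finrank K V := finrank_baseChange_le L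

/-- The space spanned by a bundled lattice. -/
noncomputable def spaceForm (L : OKLattice K) :
    (K ⊗[𝓞 K] L.carrier) →ₗ[K] (K ⊗[𝓞 K] L.carrier) →ₗ[K] K :=
  LinearMap.BilinForm.baseChange K L.form

theorem spaceForm_tmul (L : OKLattice K) (x y : L.carrier) :
    spaceForm L ((1 : K) ⊗ₜ x) ((1 : K) ⊗ₜ y) = (L.form x y : K) := by
  rw [spaceForm, LinearMap.BilinForm.baseChange_tmul, mul_one, Algebra.smul_def, mul_one]

/-- A bundled lattice as a submodule of the space it spans. -/
noncomputable def spaceLat (L : OKLattice K) : Submodule (𝓞 K) (K ⊗[𝓞 K] L.carrier) :=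
  LinearMap.range (TensorProduct.mk (𝓞 K) K L.carrier 1)

theorem isLat_spaceLat (L : OKLattice K) : IsLat (spaceLat L) := by
  refine ⟨Module.Finite.iff_fg.1 (Module.Finite.range _), fun v => ?_⟩
  obtain ⟨a, ha, x, hx⟩ := exists_smul_eq_tmul v
  exact ⟨a, ha, x, hx.symm⟩

theorem spaceLat_le (L : OKLattice K) : spaceLat L ≤ dualLat (spaceForm L) (spaceLat L) := by
  rintro _ ⟨x, rfl⟩ _ ⟨y, rfl⟩
  rw [TensorProduct.mk_apply, TensorProduct.mk_apply, spaceForm_tmul]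
  exact RingOfIntegers.isIntegral_coe _

theorem totPos_spaceForm (L : OKLattice K) : TotPos (spaceForm L) := by
  constructor
  · intro v w
    obtain ⟨a, ha, x, hx⟩ := exists_smul_eq_tmul v
    obtain ⟨b, hb, y, hy⟩ := exists_smul_eq_tmul w
    have hab : (a : K) * b ≠ 0 := mul_ne_zero (by simpa using ha) (by simpa using hb)
    apply mul_left_cancel₀ hab
    have h1 := spaceForm_tmul L x y
    have h2 := spaceForm_tmul L y x
    rw [← hx, ← hy, form_smul_left, form_smul_right] at h1
    rw [← hx, ← hy, form_smul_left, form_smul_right, L.symm, ← h1] at h2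
    rw [mul_assoc, ← h2]; ring
  · intro v hv σ
    obtain ⟨a, ha, x, hx⟩ := exists_smul_eq_tmul v
    have ha' : (a : K) ≠ 0 := by simpa using ha
    have hx0 : x ≠ 0 := by
      rintro rfl
      rw [TensorProduct.tmul_zero, ← algebraMap_smul K a v] at hx
      exact (smul_ne_zero ha' hv) hx
    have h1 := spaceForm_tmul L x x
    rw [← hx, form_smul_left, form_smul_right] at h1
    have h2 := L.posDef x hx0 σ
    rw [show algebraMap (𝓞 K) K (L.form x x) = (L.form x x : K) from rfl, ← h1, map_mul, map_mul,
      ← mul_assoc] at h2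
    exact (mul_pos_iff_of_pos_left (mul_self_pos.2 ((map_ne_zero σ).2 ha'))).1 h2

/-- The orthogonal sum of a finite family of diagonal spaces. -/
noncomputable def sumForm {ι : Type} [Fintype ι] {m : ℕ} (w : ι → Fin m → K) :
    (ι → Fin m → K) →ₗ[K] (ι → Fin m → K) →ₗ[K] K :=
  ∑ i, (diagB (w i)).compl₁₂ (LinearMap.proj i) (LinearMap.proj i)

theorem sumForm_apply {ι : Type} [Fintype ι] {m : ℕ} (w : ι → Fin m → K) (x y : ι → Fin m → K) :
    sumForm w x y = ∑ i, diagB (w i) (x i) (y i) := by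
  simp [sumForm, LinearMap.sum_apply]

theorem totPos_sumForm {ι : Type} [Fintype ι] {m : ℕ} {w : ι → Fin m → K}
    (hw : ∀ i, TotPos (diagB (w i))) : TotPos (sumForm w) := by
  refine ⟨fun x y => ?_, fun x hx σ => ?_⟩
  · rw [sumForm_apply, sumForm_apply]
    exact Finset.sum_congr rfl fun i _ => (hw i).1 _ _
  · rw [sumForm_apply, map_sum]
    obtain ⟨i, hi⟩ := Function.ne_iff.1 hx
    refine Finset.sum_pos' (fun j _ => ?_) ⟨i, Finset.mem_univ i, (hw i).2 _ hi σ⟩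
    by_cases h : x j = 0
    · rw [h]; simp
    · exact ((hw j).2 _ h σ).le

theorem sumForm_single {ι : Type} [Fintype ι] [DecidableEq ι] {m : ℕ} (w : ι → Fin m → K) (i : ι)
    (x y : Fin m → K) : sumForm w (Pi.single i x) (Pi.single i y) = diagB (w i) x y := by
  rw [sumForm_apply, Finset.sum_eq_single i]
  · rw [Pi.single_eq_same, Pi.single_eq_same]
  · intro j _ hj
    rw [Pi.single_eq_of_ne hj, map_zero, LinearMap.zero_apply]
  · intro h
    exact absurd (Finset.mem_univ i) h

end Lattices

section Universal

variable (K : Type) [Field K] [NumberField K] [IsTotallyReal K]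

open Classical in
theorem exists_universal : ∃ r X : ℕ, ∀ n : ℕ, ∃ m : ℕ,
    (∃ L : OKLattice K, L.IsUniversal n ∧ L.rank = m) ∧
      (m : ℝ) ≤ (n + r : ℕ) * classBound K (n + r) X := by
  obtain ⟨r, X, h⟩ := exists_embed K
  refine ⟨r, X, fun n => ?_⟩
  obtain ⟨S, hS, hrep, hcard⟩ := exists_reps (K := K) (n + r) X
  let w : S → Fin (n + r) → K := fun p => p.1.1
  let L : Submodule (𝓞 K) (S → Fin (n + r) → K) := Submodule.pi Set.univ fun p => p.1.2
  have hB : TotPos (sumForm w) := totPos_sumForm fun p => totPos_diagB (hS p.1 p.2).1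
  have hL : L.FG := Submodule.fg_pi fun p => (hS p.1 p.2).2.1.1
  have hi : L ≤ dualLat (sumForm w) L := by
    intro x hx y hy
    rw [sumForm_apply]
    exact IsIntegral.sum _ fun p _ =>
      (hS p.1 p.2).2.2.1 (hx p (Set.mem_univ p)) _ (hy p (Set.mem_univ p))
  refine ⟨(ofLat (sumForm w) L hB hL hi).rank, ⟨_, fun L' hL' => ?_, rfl⟩, ?_⟩
  · obtain ⟨p, hp, f, hf, hfL⟩ := h n S hrep (K ⊗[𝓞 K] L'.carrier) (spaceForm L') (spaceLat L') hL'
      (totPos_spaceForm L') (isLat_spaceLat L') (spaceLat_le L')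
    let g : L'.carrier →ₗ[𝓞 K] (S → Fin (n + r) → K) :=
      (LinearMap.single (𝓞 K) (fun _ : S => Fin (n + r) → K) ⟨p, hp⟩) ∘ₗ
        (f.restrictScalars (𝓞 K)) ∘ₗ TensorProduct.mk (𝓞 K) K L'.carrier 1
    have hg : ∀ x, g x = Pi.single ⟨p, hp⟩ (f ((1 : K) ⊗ₜ x)) := fun x => rfl
    have hgL : ∀ x, g x ∈ L := by
      intro x q _
      by_cases hq : q = ⟨p, hp⟩
      · subst hq
        rw [hg, Pi.single_eq_same]
        exact hfL _ ⟨x, rfl⟩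
      · rw [hg, Pi.single_eq_of_ne hq]
        exact Submodule.zero_mem _
    refine ⟨g.codRestrict L hgL, fun x => RingOfIntegers.ext ?_⟩
    refine (ofLat_form (sumForm w) L hB hL hi _ _).trans ?_
    change sumForm w (g x) (g x) = _
    rw [hg, sumForm_single, hf, spaceForm_tmul]
  · have h1 := rank_ofLat_le (sumForm w) L hB hL hi
    have h2 : finrank K (S → Fin (n + r) → K) = S.card * (n + r) := by
      rw [finrank_pi_fintype]; simp
    rw [h2] at h1
    have h3 : ((ofLat (sumForm w) L hB hL hi).rank : ℝ) ≤ (S.card : ℝ) * (n + r : ℕ) := by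
      exact_mod_cast h1
    refine h3.trans ?_
    rw [mul_comm]
    exact mul_le_mul_of_nonneg_left hcard (Nat.cast_nonneg _)

theorem minUnivRank_bound : ∃ C : ℝ, 0 < C ∧ ∃ N : ℕ, ∀ n : ℕ, N ≤ n →
    Real.log (minUnivRank K n) ≤ (finrank ℚ K : ℝ) / 4 * (n : ℝ) ^ 2 * Real.log n +
      (n : ℝ) ^ 2 * ((2 * Real.log |(discr K : ℝ)| - 2 * (finrank ℚ K : ℝ) * Real.log (2 * Real.pi)
          - 3 * (finrank ℚ K : ℝ)) / 8) + C * n * Real.log n := by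
  obtain ⟨r, X, h⟩ := exists_universal K
  obtain ⟨C, hC, hbd⟩ := exists_classBound_le K X
  have hα : (0 : ℝ) < (finrank ℚ K : ℝ) / 4 := by
    have : (0 : ℝ) < (finrank ℚ K : ℝ) := by exact_mod_cast finrank_pos
    positivity
  set β : ℝ := (2 * Real.log |(discr K : ℝ)| - 2 * (finrank ℚ K : ℝ) * Real.log (2 * Real.pi) -
        3 * (finrank ℚ K : ℝ)) / 8 with hβ
  obtain ⟨C', hC', hsh⟩ := shift_le β hα.le hC r
  refine ⟨C', hC', max 3 ⌈Real.exp (|β| / ((finrank ℚ K : ℝ) / 4))⌉₊, fun n hn => ?_⟩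
  have hn3 : 3 ≤ n := (le_max_left _ _).trans hn
  have hne : Real.exp (|β| / ((finrank ℚ K : ℝ) / 4)) ≤ n :=
    (Nat.le_ceil _).trans (by exact_mod_cast (le_max_right _ _).trans hn)
  rcases Nat.eq_zero_or_pos (minUnivRank K n) with h0 | h0
  · rw [h0, Nat.cast_zero, Real.log_zero]
    have h1 := main_term_nonneg hα β (show 1 ≤ n by omega) hne
    have h2 : 0 ≤ C' * n * Real.log n :=
      mul_nonneg (mul_nonneg hC'.le (Nat.cast_nonneg n)) (Real.log_natCast_nonneg n)
    linarith
  · obtain ⟨m, hm, hle⟩ := h n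
    have h1 : (minUnivRank K n : ℝ) ≤ m := by exact_mod_cast Nat.sInf_le hm
    have h2 := (h1.trans hle).trans (hbd (n + r) (by omega))
    rw [← Real.log_le_iff_le_exp (by exact_mod_cast h0)] at h2
    exact h2.trans (hsh n hn3)

end Universal

theorem isTotallyReal_of_totallyReal {K : Type} [Field K] [NumberField K] (h : TotallyReal K) :
    IsTotallyReal K :=
  ⟨fun _ => InfinitePlace.isReal_iff.2 (ComplexEmbedding.isReal_iff.2
    (RingHom.ext fun x => Complex.conj_eq_iff_im.2 (h _ x)))⟩

end TotReal

theorem stmt2 (K : Type) [Field K] [NumberField K] (htr : TotallyReal K) :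
    ∃ C : ℝ, 0 < C ∧ ∃ N : ℕ, ∀ n : ℕ, N ≤ n →
      Real.log (minUnivRank K n) ≤
        (Module.finrank ℚ K : ℝ) / 4 * (n : ℝ) ^ 2 * Real.log n +
          (n : ℝ) ^ 2 *
            ((2 * Real.log ((NumberField.discr K).natAbs) -
                2 * (Module.finrank ℚ K : ℝ) * Real.log (2 * Real.pi) -
                3 * (Module.finrank ℚ K : ℝ)) / 8) +
          C * n * Real.log n := by
  have := TotReal.isTotallyReal_of_totallyReal htr
  have h : ((discr K).natAbs : ℝ) = |(discr K : ℝ)| := by rw [Nat.cast_natAbs, Int.cast_abs]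
  rw [h]
  exact TotReal.minUnivRank_bound K
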